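/- Let τ(n) denote the number of divisors of n, γ the Euler–Mascheroni constant, and for x ≥ 1 set Δ(x) := Σ_{n≤x} τ(n) − x log x − (2γ − 1)x. Let δ : [2, ∞) → (0, ∞) be a function with δ(X) → 0 and log(1/δ(X))/log X → 0 as X → ∞, and set σ(δ)² := (16/π²) δ (log(1/δ))³. Then for all fixed real numbers α < β: (1/X) · Leb{ x ∈ [X, 2X] : (Δ((x + δ(X))²) − Δ(x²)) / (√x · σ(δ(X))) ∈ (α, β] } → (1/√(2π)) ∫_α^β e^{−t²/2} dt as X → ∞. -/

import Mathlib

open Real Filter Topology MeasureTheory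

/-- The error term in the Dirichlet divisor problem:
`Δ(y) := Σ_{n≤y} τ(n) − y log y − (2γ−1) y`. -/
noncomputable def divisorError (y : ℝ) : ℝ :=
  (∑ n ∈ Finset.Icc 1 ⌊y⌋₊, ((Nat.divisors n).card : ℝ)) -
    y * Real.log y - (2 * Real.eulerMascheroniConstant - 1) * y

namespace DivisorCLT

open Finset
open Complex (I norm_real norm_exp_ofReal_mul_I ofReal_zero ofRealCLM norm_I real_smul ofReal_sum
  ofReal_neg ofReal_exp ofReal_pow ofReal_re abs_re_le_norm)
open Set (indicator indicator_of_mem indicator_of_notMem)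
open Nat (cast_nonneg le_floor floor_le le_floor_iff lt_floor_add_one)
open intervalIntegral (integral_of_le integral_eq_sub_of_hasDerivAt)
open scoped Complex ComplexConjugate

local notation "γ" => eulerMascheroniConstant
local notation:max "τ" n:max => (Finset.card (Nat.divisors n) : ℝ)

noncomputable section

lemma add_one_le_const_mul_rpow {ε : ℝ} (hε : 0 < ε) {p : ℕ} (hp : 2 ≤ p) (a : ℕ) :
    (a + 1 : ℝ) ≤ (1 + 1 / (ε * log 2)) * ((p : ℝ) ^ a) ^ ε := by
  have hl : 0 < log 2 := log_pos (by norm_num)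
  have hp' : (2 : ℝ) ≤ p := mod_cast hp
  have h1 : (1 : ℝ) + a * (ε * log 2) ≤ ((p : ℝ) ^ a) ^ ε := by
    have h2 : ((2 : ℝ) ^ a) ^ ε ≤ ((p : ℝ) ^ a) ^ ε := by gcongr
    refine le_trans ?_ h2
    have h3 : ((2 : ℝ) ^ a) ^ ε = exp (a * (ε * log 2)) := by
      rw [rpow_def_of_pos (by positivity), log_pow]
      ring_nf
    rw [h3]
    linarith [add_one_le_exp (a * (ε * log 2))]
  have hpos : 0 < ε * log 2 := by positivity
  have h4 : (a + 1 : ℝ) ≤ (1 + 1 / (ε * log 2)) * (1 + a * (ε * log 2)) := by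
    have : (1 + 1 / (ε * log 2)) * (1 + a * (ε * log 2))
        = 1 + a + 1 / (ε * log 2) + a * (ε * log 2) := by
      field_simp
      ring
    rw [this]
    have : 0 < 1 / (ε * log 2) := by positivity
    have : 0 ≤ a * (ε * log 2) := by positivity
    linarith
  refine h4.trans ?_
  gcongr

lemma add_one_le_rpow_of_two_le {ε : ℝ} {p : ℕ} (hp : (2 : ℝ) ≤ (p : ℝ) ^ ε)
    (a : ℕ) : (a + 1 : ℝ) ≤ ((p : ℝ) ^ a) ^ ε := by
  have h3 : ((p : ℝ) ^ a) ^ ε = ((p : ℝ) ^ ε) ^ a := by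
    rw [← rpow_natCast, ← rpow_natCast, ← rpow_mul (by positivity),
      ← rpow_mul (by positivity), mul_comm]
  rw [h3]
  calc (a + 1 : ℝ) ≤ 2 ^ a := mod_cast Nat.lt_two_pow_self
    _ ≤ _ := by gcongr

/-- The divisor bound `τ(n) ≪ n^ε`. -/
lemma exists_card_divisors_le {ε : ℝ} (hε : 0 < ε) :
    ∃ C : ℝ, 1 ≤ C ∧ ∀ n : ℕ, 1 ≤ n → τ n ≤ C * (n : ℝ) ^ ε := by
  have hl : 0 < log 2 := log_pos (by norm_num)
  set K : ℝ := 1 + 1 / (ε * log 2) with hK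
  have hK1 : 1 ≤ K := by
    have : 0 < 1 / (ε * log 2) := by positivity
    linarith
  obtain ⟨P, hP⟩ : ∃ P : ℕ, ∀ p : ℕ, P ≤ p → (2 : ℝ) ≤ (p : ℝ) ^ ε := by
    have h := (tendsto_rpow_atTop hε).comp (tendsto_natCast_atTop_atTop (R := ℝ))
    obtain ⟨P, hP⟩ := Filter.eventually_atTop.1 (h.eventually_ge_atTop 2)
    exact ⟨P, hP⟩
  refine ⟨K ^ P, one_le_pow₀ hK1, fun n hn => ?_⟩
  have hn0 : n ≠ 0 := by omega
  have hn' : (n : ℝ) ^ ε = ∏ p ∈ n.primeFactors, ((p : ℝ) ^ n.factorization p) ^ ε := by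
    rw [finsetProd_rpow _ _ (fun i _ => by positivity)]
    congr 1
    conv_lhs => rw [← Nat.prod_factorization_pow_eq_self hn0]
    rw [Finsupp.prod, Nat.support_factorization]
    push_cast
    rfl
  have hcard : τ n = ∏ p ∈ n.primeFactors, ((n.factorization p : ℝ) + 1) := by
    rw [Nat.card_divisors hn0]
    push_cast
    rfl
  rw [hcard, hn']
  calc ∏ p ∈ n.primeFactors, ((n.factorization p : ℝ) + 1)
      ≤ ∏ p ∈ n.primeFactors, ((if p < P then K else 1) * ((p : ℝ) ^ n.factorization p) ^ ε) := by
        refine prod_le_prod (fun i _ => by positivity) fun p hp => ?_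
        have hp2 := (Nat.prime_of_mem_primeFactors hp).two_le
        split_ifs with h
        · exact add_one_le_const_mul_rpow hε hp2 _
        · rw [one_mul]
          exact add_one_le_rpow_of_two_le (hP p (by omega)) _
    _ = (∏ p ∈ n.primeFactors, (if p < P then K else 1)) *
          ∏ p ∈ n.primeFactors, ((p : ℝ) ^ n.factorization p) ^ ε := prod_mul_distrib
    _ ≤ K ^ P * ∏ p ∈ n.primeFactors, ((p : ℝ) ^ n.factorization p) ^ ε := by
        have : (∏ p ∈ n.primeFactors, (if p < P then K else 1)) ≤ K ^ P := by
          rw [prod_ite, prod_const, prod_const_one, mul_one]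
          refine pow_le_pow_right₀ hK1 ?_
          calc _ ≤ (range P).card := card_le_card fun p hp => by
                simp only [mem_filter] at hp
                simpa using hp.2
            _ = P := card_range P
        have h0 : 0 ≤ ∏ p ∈ n.primeFactors, ((p : ℝ) ^ n.factorization p) ^ ε :=
          prod_nonneg fun i _ => by positivity
        gcongr

/-- A smooth even bump, equal to `1` on `[-1, 1]` and supported in `[-2, 2]`. -/
def bump (θ : ℝ) : ℝ := smoothTransition (2 - θ) * smoothTransition (2 + θ)

lemma bump_contDiff : ContDiff ℝ ((⊤ : ℕ∞) : WithTop ℕ∞) bump := by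
  unfold bump
  exact (smoothTransition.contDiff.comp (contDiff_const.sub contDiff_id)).mul
    (smoothTransition.contDiff.comp (contDiff_const.add contDiff_id))

lemma bump_neg (θ : ℝ) : bump (-θ) = bump θ := by
  unfold bump
  rw [sub_neg_eq_add, ← sub_eq_add_neg, mul_comm]

lemma bump_nonneg (θ : ℝ) : 0 ≤ bump θ :=
  mul_nonneg (smoothTransition.nonneg _) (smoothTransition.nonneg _)

lemma bump_le_one (θ : ℝ) : bump θ ≤ 1 :=
  mul_le_one₀ (smoothTransition.le_one _) (smoothTransition.nonneg _) (smoothTransition.le_one _)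

lemma bump_eq_one {θ : ℝ} (h : |θ| ≤ 1) : bump θ = 1 := by
  have := abs_le.1 h
  unfold bump
  rw [smoothTransition.one_of_one_le (by linarith), smoothTransition.one_of_one_le (by linarith),
    mul_one]

lemma bump_eq_zero {θ : ℝ} (h : 2 ≤ |θ|) : bump θ = 0 := by
  unfold bump
  rcases le_abs.1 h with h | h
  · rw [smoothTransition.zero_of_nonpos (by linarith), zero_mul]
  · rw [smoothTransition.zero_of_nonpos (x := 2 + θ) (by linarith), mul_zero]

lemma bump_antitoneOn : AntitoneOn bump (Set.Ici 0) := by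
  intro a ha b hb hab
  simp only [Set.mem_Ici] at ha hb
  unfold bump
  rw [smoothTransition.one_of_one_le (x := 2 + a) (by linarith),
    smoothTransition.one_of_one_le (x := 2 + b) (by linarith), mul_one, mul_one]
  exact smoothTransition.monotone (by linarith)

lemma bump_hasCompactSupport : HasCompactSupport bump :=
  HasCompactSupport.intro (isCompact_Icc (a := (-2:ℝ)) (b := 2)) fun x hx => by
    apply bump_eq_zero
    by_contra! h
    have := abs_lt.1 h
    exact hx ⟨this.1.le, this.2.le⟩

lemma bump_continuous : Continuous bump := bump_contDiff.continuous

/-- `t ↦ bump (log (t / w) / L) / t` is antitone on `[1, ∞)`, provided `log w ≤ L`. -/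
lemma bump_log_div_antitoneOn {w L : ℝ} (hw : 1 ≤ w) (hL : 1 ≤ L) (hwL : log w ≤ L) :
    AntitoneOn (fun t => bump (log (t / w) / L) / t) (Set.Ici 1) := by
  intro a ha b hb hab
  simp only [Set.mem_Ici] at ha hb
  have ha0 : 0 < a := by linarith
  have hw0 : 0 < w := by linarith
  have hlog : log (a / w) / L ≤ log (b / w) / L := by gcongr
  have key : bump (log (b / w) / L) ≤ bump (log (a / w) / L) := by
    rcases le_total 0 (log (a / w) / L) with h | h
    · exact bump_antitoneOn h (h.trans hlog) hlog
    · rw [bump_eq_one (θ := log (a / w) / L)]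
      · exact bump_le_one _
      · rw [abs_of_nonpos h, ← neg_div, div_le_one (by linarith), log_div ha0.ne' hw0.ne']
        have := log_nonneg ha
        linarith
  exact div_le_div₀ (bump_nonneg _) key ha0 hab

lemma integral_bump_log_div {w L A B : ℝ} (hw : 0 < w) (hA : 0 < A) (hAB : A ≤ B) :
    ∫ t in A..B, bump (log (t / w) / L) / t =
      ∫ θ in (log (A / w))..(log (B / w)), bump (θ / L) := by
  have hpos : ∀ t ∈ Set.uIcc A B, 0 < t := fun t ht => by
    rw [Set.uIcc_of_le hAB] at ht; linarith [ht.1]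
  have := intervalIntegral.integral_comp_mul_deriv'' (a := A) (b := B)
    (f := fun t => log (t / w)) (f' := fun t => 1 / t) (g := fun θ => bump (θ / L)) ?_ ?_ ?_ ?_
  · rw [← this]
    apply intervalIntegral.integral_congr
    intro t _
    simp only [Function.comp]
    ring
  · apply ContinuousOn.log
    · fun_prop
    · intro t ht; exact (div_pos (hpos t ht) hw).ne'
  · intro t ht
    have h0 : 0 < t := by rw [min_eq_left hAB] at ht; linarith [ht.1]
    have := (((hasDerivAt_id t).div_const w).log (by simp; exact ⟨h0.ne', hw.ne'⟩))
    refine (this.congr_deriv ?_).hasDerivWithinAt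
    simp; field_simp
  · exact continuousOn_const.div continuousOn_id (fun t ht => (hpos t ht).ne')
  · exact (bump_continuous.comp (continuous_id.div_const L)).continuousOn

lemma integral_bump_half {L M : ℝ} (hL : 0 < L) (hM : 2 * L ≤ M) :
    ∫ θ in (0:ℝ)..M, bump (θ / L) = (∫ θ, bump (θ / L)) / 2 := by
  have hc : Continuous fun θ => bump (θ / L) := bump_continuous.comp (continuous_id.div_const L)
  have h1 : ∫ θ, bump (θ / L) = ∫ θ in (-M)..M, bump (θ / L) := by
    symm
    apply intervalIntegral.integral_eq_integral_of_support_subset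
    intro θ hθ
    by_contra hn
    apply hθ
    apply bump_eq_zero
    rw [abs_div, abs_of_pos hL, le_div_iff₀ hL]
    by_contra! h
    have := abs_lt.1 (h.trans_le hM)
    exact hn ⟨this.1, this.2.le⟩
  have h2 : ∫ θ in (-M)..0, bump (θ / L) = ∫ θ in (0:ℝ)..M, bump (θ / L) := by
    have := intervalIntegral.integral_comp_neg (a := 0) (b := M) (fun θ => bump (θ / L))
    rw [neg_zero] at this
    refine this.symm.trans ?_
    apply intervalIntegral.integral_congr
    intro t _
    simp only [neg_div, bump_neg]
  rw [h1, ← intervalIntegral.integral_add_adjacent_intervals (a := -M) (b := 0)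
    (c := M) (hc.intervalIntegrable _ _) (hc.intervalIntegrable _ _), h2]
  ring

lemma abs_harmonic_sub_log_le {w : ℝ} (hw : 1 ≤ w) :
    |(∑ a ∈ Icc 1 ⌊w⌋₊, 1 / (a : ℝ)) - log w - γ| ≤ 2 / w := by
  set N := ⌊w⌋₊ with hN
  have hN1 : 1 ≤ N := le_floor (by simpa using hw)
  have hN1' : (1:ℝ) ≤ N := mod_cast hN1
  have hNw : (N:ℝ) ≤ w := floor_le (by linarith)
  have hwN : w < N + 1 := lt_floor_add_one w
  have hH : (∑ a ∈ Icc 1 N, 1 / (a : ℝ)) = ((harmonic N : ℚ) : ℝ) := by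
    rw [harmonic_eq_sum_Icc]; push_cast; simp
  have h1 := eulerMascheroniSeq_lt_eulerMascheroniConstant N
  have h2 := eulerMascheroniConstant_lt_eulerMascheroniSeq' N
  rw [eulerMascheroniSeq] at h1
  rw [eulerMascheroniSeq', if_neg (by omega)] at h2
  have h3 : log N ≤ log w := log_le_log (by linarith) hNw
  have h4 : log w ≤ log (N + 1) := log_le_log (by linarith) hwN.le
  have h5 : log (N + 1 : ℝ) - log N ≤ 2 / w := by
    rw [← log_div (by linarith) (by linarith)]
    have := log_le_sub_one_of_pos (x := (N + 1 : ℝ) / N) (by positivity)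
    refine this.trans ?_
    rw [div_sub_one (by linarith), div_le_div_iff₀ (by linarith) (by linarith)]
    linarith
  rw [hH, abs_le]
  constructor <;> linarith

lemma abs_axis_bracket_le {w L : ℝ} (hw : 1 ≤ w) (hL : 1 ≤ L) (hwL : log w ≤ L) {M : ℕ}
    (hM : w * exp (2 * L) ≤ M) :
    |2 * (∑ a ∈ Icc 1 M, bump (log (a / w) / L) / (a : ℝ)) - (∫ θ, bump (θ / L))
      - 2 * log w - 2 * γ| ≤ 8 / w := by
  set N := ⌊w⌋₊ with hN
  set f : ℝ → ℝ := fun t => bump (log (t / w) / L) / t with hf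
  have hw0 : 0 < w := by linarith
  have hN1 : 1 ≤ N := le_floor (by simpa using hw)
  have hN1' : (1:ℝ) ≤ N := mod_cast hN1
  have hNw : (N:ℝ) ≤ w := floor_le (by linarith)
  have hwN : w < N + 1 := lt_floor_add_one w
  have hwM : w ≤ M := by
    refine le_trans ?_ hM
    exact le_mul_of_one_le_right hw0.le (one_le_exp (by linarith))
  have hNM : N ≤ M := mod_cast hNw.trans hwM
  have hanti := bump_log_div_antitoneOn hw hL hwL
  have hint : ∀ a b : ℝ, 1 ≤ a → 1 ≤ b → IntervalIntegrable f volume a b := by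
    intro a b ha hb
    apply AntitoneOn.intervalIntegrable
    apply hanti.mono
    intro t ht
    exact (le_min ha hb).trans ht.1
  have hhalf : ∀ B : ℝ, (M:ℝ) ≤ B → ∫ t in w..B, f t = (∫ θ, bump (θ / L)) / 2 := by
    intro B hB
    rw [hf, integral_bump_log_div hw0 hw0 (hwM.trans hB), div_self hw0.ne', log_one]
    apply integral_bump_half (by linarith)
    rw [le_log_iff_exp_le (div_pos (by linarith [hwM.trans hB]) hw0), le_div_iff₀ hw0, mul_comm]
    exact hM.trans hB
  have hsplit : (∑ a ∈ Icc 1 M, bump (log (a / w) / L) / (a : ℝ)) =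
      (∑ a ∈ Icc 1 N, 1 / (a : ℝ)) + ∑ a ∈ Ico N M, f ((a + 1 : ℕ) : ℝ) := by
    have e1 : Icc 1 M = Ico 1 (M + 1) := rfl
    have e2 : Icc 1 N = Ico 1 (N + 1) := rfl
    rw [e1, e2, ← sum_Ico_consecutive _ (by omega : 1 ≤ N + 1) (by omega : N + 1 ≤ M + 1)]
    congr 1
    · apply sum_congr rfl
      intro a ha
      have ha := mem_Ico.1 ha
      have ha1 : (1:ℝ) ≤ a := mod_cast ha.1
      have haN : (a:ℝ) ≤ N := mod_cast (by omega : a ≤ N)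
      rw [bump_eq_one]
      have hl : log (a / w) ≤ 0 := log_nonpos (by positivity) ((div_le_one hw0).2 (haN.trans hNw))
      rw [abs_div, abs_of_nonpos hl, abs_of_pos (by linarith), div_le_one (by linarith),
        log_div (by positivity) (by positivity)]
      have := log_nonneg ha1
      linarith
    · rw [sum_Ico_add' (fun i : ℕ => f i) N M 1]
  have hup : ∑ a ∈ Ico N M, f ((a + 1 : ℕ) : ℝ) ≤ (∫ θ, bump (θ / L)) / 2 + 2 / w := by
    have h1 := AntitoneOn.sum_le_integral_Ico (f := f) hNM
      (hanti.mono (fun t ht => hN1'.trans ht.1))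
    refine h1.trans ?_
    rw [← intervalIntegral.integral_add_adjacent_intervals (hint N w hN1' hw)
      (hint w M hw (by linarith)), hhalf M le_rfl]
    have h2 : ∫ t in (N:ℝ)..w, f t ≤ ∫ t in (N:ℝ)..w, (1 / N : ℝ) := by
      apply intervalIntegral.integral_mono_on hNw (hint N w hN1' hw) (by simp)
      intro t ht
      have : 0 < t := by linarith [ht.1]
      exact div_le_div₀ zero_le_one (bump_le_one _) (by linarith) ht.1
    rw [intervalIntegral.integral_const, smul_eq_mul] at h2
    have h3 : (w - N) * (1 / N : ℝ) ≤ 2 / w := by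
      rw [mul_one_div, div_le_div_iff₀ (by linarith) (by linarith)]
      nlinarith
    linarith
  have hlow : (∫ θ, bump (θ / L)) / 2 - 1 / w ≤ ∑ a ∈ Ico N M, f ((a + 1 : ℕ) : ℝ) := by
    have h1 := AntitoneOn.integral_le_sum_Ico (f := f) (by omega : N + 1 ≤ M + 1)
      (hanti.mono (fun t ht => by
        have := ht.1
        push_cast at this
        simp only [Set.mem_Ici]; linarith))
    rw [sum_Ico_add' (fun i : ℕ => f i) N M 1]
    refine le_trans ?_ h1
    have h0 := intervalIntegral.integral_add_adjacent_intervals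
      (hint w (N + 1 : ℕ) hw (by push_cast; linarith))
      (hint (N + 1 : ℕ) (M + 1 : ℕ) (by push_cast; linarith) (by push_cast; linarith))
    rw [hhalf (M + 1 : ℕ) (by push_cast; linarith)] at h0
    have h2 : ∫ t in w..((N + 1 : ℕ) : ℝ), f t ≤ ∫ t in w..((N + 1 : ℕ) : ℝ), (1 / w : ℝ) := by
      apply intervalIntegral.integral_mono_on (by push_cast; linarith)
        (hint w _ hw (by push_cast; linarith)) (by simp)
      intro t ht
      exact div_le_div₀ zero_le_one (bump_le_one _) (by linarith) ht.1
    rw [intervalIntegral.integral_const, smul_eq_mul] at h2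
    have h3 : (((N + 1 : ℕ) : ℝ) - w) * (1 / w : ℝ) ≤ 1 / w := by
      apply mul_le_of_le_one_left (by positivity)
      push_cast; linarith
    linarith
  have hharm := abs_le.1 (abs_harmonic_sub_log_le hw)
  rw [hsplit, abs_le]
  have e8 : 8 / w = 4 * (2 / w) := by ring
  have e1 : 1 / w ≤ 2 / w := by gcongr; norm_num
  rw [e8]
  constructor <;> linarith [hharm.1, hharm.2]

section

open scoped FourierTransform ContDiff

/-- Smooth test functions supported in `[1, R]`. -/
structure IsWindow (ψ : ℝ → ℝ) (R : ℝ) : Prop where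
  smooth : ContDiff ℝ ∞ ψ
  eq_zero : ∀ w, w ∉ Set.Icc 1 R → ψ w = 0

/-- The function `2 w ψ(w) / (-2 π i w) ^ j`. -/
def windowDiv (ψ : ℝ → ℝ) (j : ℕ) (w : ℝ) : ℂ :=
  ((2 * w * ψ w : ℝ) : ℂ) / (-2 * π * I * w) ^ j

variable {ψ : ℝ → ℝ} {R : ℝ}

lemma IsWindow.windowDiv_eq_zero (h : IsWindow ψ R) (j : ℕ) {w : ℝ} (hw : w ∉ Set.Icc 1 R) :
    windowDiv ψ j w = 0 := by
  simp [windowDiv, h.eq_zero w hw]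

lemma IsWindow.hasCompactSupport_windowDiv (h : IsWindow ψ R) (j : ℕ) :
    HasCompactSupport (windowDiv ψ j) :=
  HasCompactSupport.intro isCompact_Icc fun _ hw => h.windowDiv_eq_zero j hw

lemma IsWindow.contDiff_windowDiv (h : IsWindow ψ R) (j : ℕ) : ContDiff ℝ ∞ (windowDiv ψ j) := by
  rw [contDiff_iff_contDiffAt]
  intro w
  rcases lt_or_ge w 1 with hw | hw
  · have : windowDiv ψ j =ᶠ[𝓝 w] fun _ => 0 := by
      filter_upwards [Iio_mem_nhds hw] with v hv
      exact h.windowDiv_eq_zero j (fun hv' => absurd hv'.1 (not_le.2 hv))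
    exact contDiffAt_const.congr_of_eventuallyEq this
  · unfold windowDiv
    simp only [div_eq_mul_inv]
    apply ContDiffAt.mul
    · apply ContDiff.contDiffAt
      exact ofRealCLM.contDiff.comp ((contDiff_const.mul contDiff_id).mul h.smooth)
    · apply ContDiffAt.inv
      · apply ContDiff.contDiffAt
        apply ContDiff.pow
        exact contDiff_const.mul ofRealCLM.contDiff
      apply pow_ne_zero
      have : w ≠ 0 := by linarith
      simp [this, pi_ne_zero]

lemma IsWindow.continuous_windowDiv (h : IsWindow ψ R) (j : ℕ) :
    Continuous (windowDiv ψ j) := (h.contDiff_windowDiv j).continuous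

lemma IsWindow.integrable_windowDiv (h : IsWindow ψ R) (j : ℕ) : Integrable (windowDiv ψ j) :=
  (h.continuous_windowDiv j).integrable_of_hasCompactSupport (h.hasCompactSupport_windowDiv j)

lemma IsWindow.integrable (h : IsWindow ψ R) : Integrable ψ :=
  h.smooth.continuous.integrable_of_hasCompactSupport
    (HasCompactSupport.intro isCompact_Icc fun _ hw => h.eq_zero _ hw)

lemma IsWindow.norm_windowDiv_le (h : IsWindow ψ R) {j : ℕ} (hj : 1 ≤ j) (w : ℝ) :
    ‖windowDiv ψ j w‖ ≤ |ψ w| := by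
  by_cases hw : w ∈ Set.Icc 1 R
  · have hw1 : 1 ≤ w := hw.1
    have hpi := pi_gt_three
    rw [windowDiv, norm_div, norm_pow, norm_real, norm_mul, norm_mul, norm_mul]
    simp only [norm_neg, norm_I, norm_real, norm_mul, mul_one, Complex.norm_ofNat,
      norm_eq_abs, abs_of_nonneg (by linarith : (0:ℝ) ≤ w), abs_of_pos pi_pos, abs_two]
    have h1 : 2 * w ≤ 2 * π * w := by nlinarith
    have h2 : 2 * π * w ≤ (2 * π * w) ^ j := le_self_pow₀ (by nlinarith) (by omega)
    rw [div_le_iff₀ (by positivity), mul_comm]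
    exact mul_le_mul_of_nonneg_left (h1.trans h2) (abs_nonneg _)
  · rw [h.windowDiv_eq_zero j hw, norm_zero]
    exact abs_nonneg _

/-- The Fourier transform of `windowDiv`. -/
def windowHat (ψ : ℝ → ℝ) (j : ℕ) : ℝ → ℂ := 𝓕 (windowDiv ψ j)

lemma windowHat_apply (ψ : ℝ → ℝ) (j : ℕ) (s : ℝ) :
    windowHat ψ j s = ∫ w, cexp (((-2 * π * w * s : ℝ) : ℂ) * I) * windowDiv ψ j w := by
  rw [windowHat, fourier_real_eq_integral_exp_smul]
  simp only [smul_eq_mul]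

lemma IsWindow.hasDerivAt_windowHat (h : IsWindow ψ R) (j : ℕ) (s : ℝ) :
    HasDerivAt (windowHat ψ (j + 1)) (windowHat ψ j s) s := by
  have hint : Integrable (fun x => x • windowDiv ψ (j + 1) x) :=
    (continuous_id.smul (h.continuous_windowDiv _)).integrable_of_hasCompactSupport
      (HasCompactSupport.intro isCompact_Icc fun w hw => by
        rw [Pi.smul_apply', h.windowDiv_eq_zero (j + 1) hw, smul_zero])
  have := hasDerivAt_fourier (h.integrable_windowDiv (j + 1)) hint s
  unfold windowHat
  suffices e : windowDiv ψ j = fun x : ℝ => (-2 * π * I * x : ℂ) • windowDiv ψ (j + 1) x by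
    rw [← e] at this
    exact this
  ext w
  by_cases hw : w ∈ Set.Icc 1 R
  · have hw1 : w ≠ 0 := by linarith [hw.1]
    simp only [windowDiv, smul_eq_mul]
    have : (-2 * π * I * w : ℂ) ≠ 0 := by simp [hw1, pi_ne_zero]
    generalize (-2 * π * I * w : ℂ) = z at this
    rw [pow_succ]
    field_simp
  · rw [h.windowDiv_eq_zero j hw, h.windowDiv_eq_zero (j + 1) hw, smul_zero]

lemma IsWindow.norm_windowHat_le (h : IsWindow ψ R) {j : ℕ} (hj : 1 ≤ j) (s : ℝ) :
    ‖windowHat ψ j s‖ ≤ ∫ w, |ψ w| := by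
  rw [windowHat_apply]
  refine (norm_integral_le_integral_norm _).trans ?_
  apply integral_mono_of_nonneg
  · exact .of_forall fun w => norm_nonneg _
  · exact h.integrable.norm
  · refine .of_forall fun w => ?_
    simp only
    rw [norm_mul, norm_exp_ofReal_mul_I, one_mul]
    exact h.norm_windowDiv_le hj w

lemma IsWindow.exists_norm_windowHat_le (h : IsWindow ψ R) (j k : ℕ) :
    ∃ C, 0 ≤ C ∧ ∀ s, |s| ^ k * ‖windowHat ψ j s‖ ≤ C := by
  set f := (h.hasCompactSupport_windowDiv j).toSchwartzMap (h.contDiff_windowDiv j)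
  obtain ⟨C, hC0, hC⟩ := (𝓕 f).decay k 0
  refine ⟨C, hC0.le, fun s => ?_⟩
  have := hC s
  rw [norm_iteratedFDeriv_zero, SchwartzMap.fourier_coe] at this
  exact this

lemma IsWindow.continuous_windowHat (h : IsWindow ψ R) (j : ℕ) : Continuous (windowHat ψ j) := by
  set f := (h.hasCompactSupport_windowDiv j).toSchwartzMap (h.contDiff_windowDiv j)
  have := (𝓕 f).continuous
  rw [SchwartzMap.fourier_coe] at this
  exact this

lemma windowHat_neg (ψ : ℝ → ℝ) (s : ℝ) : windowHat ψ 0 (-s) = conj (windowHat ψ 0 s) := by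
  rw [windowHat_apply, windowHat_apply, ← integral_conj]
  congr 1
  ext w
  simp only [windowDiv, map_mul, pow_zero, div_one, Complex.conj_ofReal, ← Complex.exp_conj,
    Complex.conj_I]
  congr 2
  push_cast
  ring

end

section

variable {ψ : ℝ → ℝ} {R : ℝ}

lemma hasDerivAt_inv_cosh (θ : ℝ) :
    HasDerivAt (fun θ => (cosh θ)⁻¹) (-(tanh θ * (cosh θ)⁻¹)) θ := by
  refine ((hasDerivAt_cosh θ).inv (cosh_pos θ).ne').congr_deriv ?_
  rw [tanh_eq_sinh_div_cosh]
  field_simp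

lemma hasDerivAt_tanh' (θ : ℝ) : HasDerivAt tanh (1 - tanh θ ^ 2) θ := by
  have h := (hasDerivAt_sinh θ).div (hasDerivAt_cosh θ) (cosh_pos θ).ne'
  have e : (sinh / cosh) = tanh := by ext x; simp [tanh_eq_sinh_div_cosh]
  rw [e] at h
  refine h.congr_deriv ?_
  rw [tanh_eq_sinh_div_cosh]
  have := (cosh_pos θ).ne'
  field_simp

lemma continuous_tanh' : Continuous tanh :=
  continuous_iff_continuousAt.2 fun θ => (hasDerivAt_tanh' θ).continuousAt

/-- One integration by parts against `windowHat ψ j (c * sinh θ)`. -/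
lemma IsWindow.integral_mul_windowHat_sinh (h : IsWindow ψ R) (j : ℕ) {c : ℝ} (hc : c ≠ 0)
    {f f' : ℝ → ℝ} (hf : ∀ θ, HasDerivAt f (f' θ) θ) (hf' : Continuous f')
    (hs : HasCompactSupport f) :
    ∫ θ, (f θ : ℂ) * windowHat ψ j (c * sinh θ) =
      -(c : ℂ)⁻¹ * ∫ θ, (((f' θ - tanh θ * f θ) * (cosh θ)⁻¹ : ℝ) : ℂ)
        * windowHat ψ (j + 1) (c * sinh θ) := by
  have hfc : Continuous f := continuous_iff_continuousAt.2 fun θ => (hf θ).continuousAt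
  have hcc : Continuous (fun θ => (cosh θ)⁻¹) :=
    continuous_iff_continuousAt.2 fun θ => (hasDerivAt_inv_cosh θ).continuousAt
  have hf's : HasCompactSupport f' := by
    have : f' = deriv f := by ext θ; exact (hf θ).deriv.symm
    rw [this]; exact hs.deriv
  have hw : ∀ i, Continuous fun θ => windowHat ψ i (c * sinh θ) := fun i =>
    (h.continuous_windowHat i).comp (continuous_const.mul continuous_sinh)
  set u : ℝ → ℂ := fun θ => ((f θ * (cosh θ)⁻¹ : ℝ) : ℂ) with hu
  set u' : ℝ → ℂ := fun θ => (((f' θ - tanh θ * f θ) * (cosh θ)⁻¹ : ℝ) : ℂ) with hu'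
  set v : ℝ → ℂ := fun θ => windowHat ψ (j + 1) (c * sinh θ) with hv
  set v' : ℝ → ℂ := fun θ => ((c * cosh θ : ℝ) : ℂ) * windowHat ψ j (c * sinh θ) with hv'
  have hud : ∀ θ, HasDerivAt u (u' θ) θ := by
    intro θ
    refine (((hf θ).mul (hasDerivAt_inv_cosh θ)).congr_deriv ?_).ofReal_comp
    ring
  have hvd : ∀ θ, HasDerivAt v (v' θ) θ := by
    intro θ
    have h1 := (h.hasDerivAt_windowHat j (c * sinh θ)).scomp θ ((hasDerivAt_sinh θ).const_mul c)
    refine h1.congr_deriv ?_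
    simp [hv']
  have huc : Continuous u := Complex.continuous_ofReal.comp (hfc.mul hcc)
  have hu'c : Continuous u' := Complex.continuous_ofReal.comp
    ((hf'.sub (continuous_tanh'.mul hfc)).mul hcc)
  have hvc : Continuous v := hw _
  have hv'c : Continuous v' := (Complex.continuous_ofReal.comp
    (continuous_const.mul continuous_cosh)).mul (hw _)
  have hus : HasCompactSupport u := hs.mono' (fun θ hθ => by
    apply subset_tsupport
    intro h0
    apply hθ
    simp [hu, h0])
  have hu's : HasCompactSupport u' := by
    have : u' = deriv u := by ext θ; exact (hud θ).deriv.symm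
    rw [this]; exact hus.deriv
  have key := integral_mul_deriv_eq_deriv_mul_of_integrable (u := u) (v := v) (u' := u') (v' := v')
    (fun θ _ => hud θ) (fun θ _ => hvd θ)
    ((huc.mul hv'c).integrable_of_hasCompactSupport hus.mul_right)
    ((hu'c.mul hvc).integrable_of_hasCompactSupport hu's.mul_right)
    ((huc.mul hvc).integrable_of_hasCompactSupport hus.mul_right)
  have e : ∀ θ, (f θ : ℂ) * windowHat ψ j (c * sinh θ) = (c : ℂ)⁻¹ * (u θ * v' θ) := by
    intro θ
    have h1 : (c : ℂ) ≠ 0 := mod_cast hc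
    have h2 : (cosh θ : ℂ) ≠ 0 := mod_cast (cosh_pos θ).ne'
    simp only [hu, hv']
    push_cast
    push_cast at h2
    field_simp
  simp_rw [e]
  rw [integral_const_mul, key]
  ring

lemma one_add_sq_half_le_cosh (θ : ℝ) : 1 + θ ^ 2 / 2 ≤ cosh θ := by
  have h1 : cosh θ = 1 + 2 * sinh (θ / 2) ^ 2 := by
    have := cosh_two_mul (θ / 2)
    rw [cosh_sq] at this
    rw [show θ = 2 * (θ / 2) by ring, this]
    ring_nf
  have h2 : (θ / 2) ^ 2 ≤ sinh (θ / 2) ^ 2 := by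
    rw [sq_le_sq, abs_sinh]
    exact self_le_sinh_iff.2 (abs_nonneg _)
  rw [h1]
  linarith [h2]

lemma continuous_inv_cosh : Continuous fun θ => (cosh θ)⁻¹ :=
  continuous_iff_continuousAt.2 fun θ => (hasDerivAt_inv_cosh θ).continuousAt

lemma integrable_inv_cosh : Integrable (fun θ => (cosh θ)⁻¹) := by
  refine (integrable_inv_one_add_sq.const_mul 2).mono' continuous_inv_cosh.aestronglyMeasurable
    (.of_forall fun θ => ?_)
  have h2 : 1 + θ ^ 2 / 2 ≤ cosh θ := one_add_sq_half_le_cosh θ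
  rw [norm_of_nonneg (by have := cosh_pos θ; positivity)]
  calc (cosh θ)⁻¹ ≤ ((1 + θ ^ 2) / 2)⁻¹ := by apply inv_anti₀ (by positivity); linarith
    _ = 2 * (1 + θ ^ 2)⁻¹ := by rw [inv_div]; rfl

lemma integrable_inv_cosh_pow_three : Integrable (fun θ => ((cosh θ)⁻¹) ^ 3) := by
  refine integrable_inv_cosh.mono' (continuous_inv_cosh.pow 3).aestronglyMeasurable
    (.of_forall fun θ => ?_)
  have := cosh_pos θ
  rw [norm_of_nonneg (by positivity)]
  exact pow_le_of_le_one (by positivity) (inv_le_one_of_one_le₀ (one_le_cosh θ)) (by norm_num)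

/-- Oscillatory integral bound with three integrations by parts. -/
lemma exists_norm_integral_windowHat_sinh_le {M : ℝ} {ψ : ℝ → ℝ} {R : ℝ} (h : IsWindow ψ R)
    {c : ℝ} (hc : 0 < c) {b : ℕ → ℝ → ℝ} (hb : ∀ i θ, HasDerivAt (b i) (b (i + 1) θ) θ)
    (hbM : ∀ i ≤ 3, ∀ θ, |b i θ| ≤ M) (hs : HasCompactSupport (b 0)) :
    ‖∫ θ, (b 0 θ : ℂ) * windowHat ψ 0 (c * sinh θ)‖ ≤
      42 * M * (∫ θ, ((cosh θ)⁻¹) ^ 3) * (∫ w, |ψ w|) / c ^ 3 := by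
  have hbc : ∀ i, Continuous (b i) := fun i =>
    continuous_iff_continuousAt.2 fun θ => (hb i θ).continuousAt
  have hcc := continuous_inv_cosh
  have hT := continuous_tanh'
  have hbs : ∀ i, HasCompactSupport (b i) := by
    intro i
    induction i with
    | zero => exact hs
    | succ i ih =>
      have : b (i + 1) = deriv (b i) := by ext θ; exact (hb i θ).deriv.symm
      rw [this]; exact ih.deriv
  have hbs' : ∀ i, b i =ᶠ[coclosedCompact ℝ] 0 := fun i =>
    hasCompactSupport_iff_eventuallyEq.1 (hbs i)
  set f1 : ℝ → ℝ := fun θ => (b 1 θ - tanh θ * b 0 θ) * (cosh θ)⁻¹ with hf1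
  set f2 : ℝ → ℝ := fun θ => (b 2 θ - 3 * tanh θ * b 1 θ + (3 * tanh θ ^ 2 - 1) * b 0 θ)
    * (cosh θ)⁻¹ ^ 2 with hf2
  set f3 : ℝ → ℝ := fun θ => (b 3 θ - 6 * tanh θ * b 2 θ + (15 * tanh θ ^ 2 - 4) * b 1 θ
    + (9 * tanh θ - 15 * tanh θ ^ 3) * b 0 θ) * (cosh θ)⁻¹ ^ 3 with hf3
  set f1' : ℝ → ℝ := fun θ => (b 2 θ - 2 * tanh θ * b 1 θ + (2 * tanh θ ^ 2 - 1) * b 0 θ)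
    * (cosh θ)⁻¹ with hf1'
  set f2' : ℝ → ℝ := fun θ => (b 3 θ - 5 * tanh θ * b 2 θ + (12 * tanh θ ^ 2 - 4) * b 1 θ
    + (8 * tanh θ - 12 * tanh θ ^ 3) * b 0 θ) * (cosh θ)⁻¹ ^ 2 with hf2'
  have hd1 : ∀ θ, HasDerivAt f1 (f1' θ) θ := by
    intro θ
    refine (((hb 1 θ).sub ((hasDerivAt_tanh' θ).mul (hb 0 θ))).mul
      (hasDerivAt_inv_cosh θ)).congr_deriv ?_
    simp only [hf1', Pi.sub_apply, Pi.mul_apply, zero_add]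
    ring
  have hd2 : ∀ θ, HasDerivAt f2 (f2' θ) θ := by
    intro θ
    refine ((((hb 2 θ).sub (((hasDerivAt_tanh' θ).const_mul 3).mul (hb 1 θ))).add
      (((((hasDerivAt_tanh' θ).pow 2).const_mul 3).sub_const 1).mul (hb 0 θ))).mul
      ((hasDerivAt_inv_cosh θ).pow 2)).congr_deriv ?_
    simp only [hf2', Pi.sub_apply, Pi.mul_apply, Pi.add_apply, Pi.pow_apply, zero_add]
    ring
  have h1 := h.integral_mul_windowHat_sinh 0 hc.ne' (hb 0) (hbc 1) hs
  have h2 := h.integral_mul_windowHat_sinh 1 hc.ne' hd1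
    (by rw [hf1']; have := hbc 2; have := hbc 1; have := hbc 0; fun_prop) (by
      rw [hasCompactSupport_iff_eventuallyEq]
      filter_upwards [hbs' 0, hbs' 1] with θ h0 h1
      simp [hf1, h0, h1])
  have h3 := h.integral_mul_windowHat_sinh 2 hc.ne' hd2
    (by rw [hf2']; have := hbc 3; have := hbc 2; have := hbc 1; have := hbc 0; fun_prop) (by
      rw [hasCompactSupport_iff_eventuallyEq]
      filter_upwards [hbs' 0, hbs' 1, hbs' 2] with θ h0 h1 h2
      simp [hf2, h0, h1, h2])
  have e2 : ∀ θ, (f1' θ - tanh θ * f1 θ) * (cosh θ)⁻¹ = f2 θ := by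
    intro θ; simp only [hf1', hf1, hf2]; ring
  have e3 : ∀ θ, (f2' θ - tanh θ * f2 θ) * (cosh θ)⁻¹ = f3 θ := by
    intro θ; simp only [hf2', hf2, hf3]; ring
  simp only [e2] at h2
  simp only [e3] at h3
  norm_num only at h1 h2 h3
  rw [h1, h2, h3]
  have hM : 0 ≤ M := (abs_nonneg _).trans (hbM 0 (by norm_num) 0)
  have hB : 0 ≤ ∫ w, |ψ w| := integral_nonneg fun _ => abs_nonneg _
  have hbound : ‖∫ θ, (f3 θ : ℂ) * windowHat ψ 3 (c * sinh θ)‖ ≤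
      42 * M * (∫ θ, ((cosh θ)⁻¹) ^ 3) * (∫ w, |ψ w|) := by
    have : 42 * M * (∫ θ, ((cosh θ)⁻¹) ^ 3) * (∫ w, |ψ w|) =
        ∫ θ, (42 * M * (∫ w, |ψ w|)) * ((cosh θ)⁻¹) ^ 3 := by
      rw [integral_const_mul]; ring
    rw [this]
    refine norm_integral_le_of_norm_le (integrable_inv_cosh_pow_three.const_mul _)
      (.of_forall fun θ => ?_)
    rw [norm_mul, norm_real, norm_eq_abs, hf3]
    simp only
    rw [abs_mul, abs_of_nonneg (by have := cosh_pos θ; positivity : 0 ≤ (cosh θ)⁻¹ ^ 3)]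
    have hw := h.norm_windowHat_le (by norm_num : 1 ≤ 3) (c * sinh θ)
    have hTl := (abs_tanh_lt_one θ).le
    have hT2 : tanh θ ^ 2 ≤ 1 := by rw [← sq_abs]; exact pow_le_one₀ (abs_nonneg _) hTl
    have hpoly : |b 3 θ - 6 * tanh θ * b 2 θ + (15 * tanh θ ^ 2 - 4) * b 1 θ
        + (9 * tanh θ - 15 * tanh θ ^ 3) * b 0 θ| ≤ 42 * M := by
      obtain ⟨t1, t2⟩ := abs_lt.1 (abs_tanh_lt_one θ)
      have : |tanh θ ^ 3| ≤ 1 := by rw [abs_pow]; exact pow_le_one₀ (abs_nonneg _) hTl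
      obtain ⟨t3, t4⟩ := abs_le.1 this
      have := sq_nonneg (tanh θ)
      have a {p B : ℝ} (i : ℕ) (hi : i ≤ 3) (h : -B ≤ p ∧ p ≤ B) : |p * b i θ| ≤ B * M := by
        rw [abs_mul]
        exact mul_le_mul (abs_le.2 h) (hbM i hi θ) (abs_nonneg _) (by linarith)
      have := abs_le.1 (a (p := 6 * tanh θ) (B := 6) 2 (by norm_num)
        ⟨by linarith, by linarith⟩)
      have := abs_le.1 (a (p := 15 * tanh θ ^ 2 - 4) (B := 11) 1 (by norm_num)
        ⟨by linarith, by linarith⟩)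
      have := abs_le.1 (a (p := 9 * tanh θ - 15 * tanh θ ^ 3) (B := 24) 0 (by norm_num)
        ⟨by linarith, by linarith⟩)
      have := abs_le.1 (hbM 3 le_rfl θ)
      rw [abs_le]
      constructor <;> linarith
    calc _ ≤ (42 * M * (cosh θ)⁻¹ ^ 3) * ∫ w, |ψ w| := by
          apply mul_le_mul _ hw (norm_nonneg _) (by have := cosh_pos θ; positivity)
          exact mul_le_mul_of_nonneg_right hpoly (by have := cosh_pos θ; positivity)
      _ = _ := by ring
  simp only [norm_mul, norm_neg, norm_inv, norm_real, norm_eq_abs, abs_of_pos hc]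
  rw [le_div_iff₀ (by positivity)]
  refine le_trans (le_of_eq ?_) hbound
  field_simp

end

section

open scoped FourierTransform ContDiff

/-- The integral `∫ bump(θ/L) Φ(h e^{-θ} + m e^{θ}) dθ` with `Φ` the Fourier transform of
`2 w ψ(w)`. -/
def hyperInt (ψ : ℝ → ℝ) (L h m : ℝ) : ℂ :=
  ∫ θ, (bump (θ / L) : ℂ) * windowHat ψ 0 (h * exp (-θ) + m * exp θ)

/-- The Fourier transform in one variable of the truncated hyperbolic weight, in logarithmic
coordinates. -/
def hyperSlice (ψ : ℝ → ℝ) (L h α : ℝ) : ℂ :=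
  ∫ w, windowDiv ψ 0 w * (((bump ((α - log w) / L) : ℝ) : ℂ) *
    cexp (((-2 * π * (h * w ^ 2 * exp (-α)) : ℝ) : ℂ) * I))

/-- The Fourier transform in one variable of the truncated hyperbolic weight. -/
def hyperRow (ψ : ℝ → ℝ) (L h a : ℝ) : ℂ :=
  if 0 < a then hyperSlice ψ L h (log a) / a else 0

/-- The truncated hyperbolic weight `ψ(√(ab)) bump(log(a/b)/(2L))`. -/
def hyperWeight (ψ : ℝ → ℝ) (L a b : ℝ) : ℂ :=
  if 0 < a ∧ 0 < b then ((ψ (√(a * b)) * bump (log (a / b) / (2 * L)) : ℝ) : ℂ) else 0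

variable {ψ : ℝ → ℝ} {R L : ℝ}

lemma hyperInt_comm (L h m : ℝ) : hyperInt ψ L h m = hyperInt ψ L m h := by
  unfold hyperInt
  rw [← integral_neg_eq_self]
  congr 1
  ext θ
  rw [neg_div, bump_neg, neg_neg, add_comm]

lemma norm_hyperSlice_integrand_le (ψ : ℝ → ℝ) (L h α w : ℝ) :
    ‖windowDiv ψ 0 w * (((bump ((α - log w) / L) : ℝ) : ℂ) *
    cexp (((-2 * π * (h * w ^ 2 * exp (-α)) : ℝ) : ℂ) * I))‖ ≤
    ‖windowDiv ψ 0 w‖ := by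
  rw [norm_mul, norm_mul, norm_exp_ofReal_mul_I, mul_one, norm_real, norm_of_nonneg (bump_nonneg _)]
  exact mul_le_of_le_one_right (norm_nonneg _) (bump_le_one _)

lemma IsWindow.measurable_hyperSlice_integrand (hψ : IsWindow ψ R) (L h : ℝ) :
    Measurable fun p : ℝ × ℝ => windowDiv ψ 0 p.2 * (((bump ((p.1 - log p.2) / L) : ℝ) : ℂ) *
      cexp (((-2 * π * (h * p.2 ^ 2 * exp (-p.1)) : ℝ) : ℂ) * I)) := by
  have h1 := (hψ.continuous_windowDiv 0).measurable
  have h2 := bump_continuous.measurable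
  fun_prop

lemma IsWindow.continuous_hyperSlice (hψ : IsWindow ψ R) (L h : ℝ) :
    Continuous (hyperSlice ψ L h) := by
  unfold hyperSlice
  apply continuous_of_dominated (bound := fun w => ‖windowDiv ψ 0 w‖)
  · intro α
    exact ((hψ.measurable_hyperSlice_integrand L h).comp
      (measurable_const.prodMk measurable_id)).aestronglyMeasurable
  · intro α
    exact .of_forall fun w => norm_hyperSlice_integrand_le ψ L h α w
  · exact (hψ.integrable_windowDiv 0).norm
  · refine .of_forall fun w => ?_
    have := bump_continuous
    fun_prop

lemma IsWindow.hyperSlice_integrand_eq_zero (hψ : IsWindow ψ R) (hL : 0 < L) (h : ℝ) {α : ℝ}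
    (hα : α ∉ Set.Icc (-(2 * L)) (2 * L + log R)) (w : ℝ) :
    windowDiv ψ 0 w * (((bump ((α - log w) / L) : ℝ) : ℂ) *
      cexp (((-2 * π * (h * w ^ 2 * exp (-α)) : ℝ) : ℂ) * I)) = 0 := by
  by_cases hw : w ∈ Set.Icc 1 R
  · rw [bump_eq_zero]
    · simp
    · rw [abs_div, abs_of_pos hL, le_div_iff₀ hL]
      have h1 := log_nonneg hw.1
      have h2 : log w ≤ log R := log_le_log (by linarith [hw.1]) hw.2
      by_contra! hlt
      have := abs_lt.1 hlt
      exact hα ⟨by linarith, by linarith⟩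
  · rw [hψ.windowDiv_eq_zero 0 hw, zero_mul]

lemma IsWindow.hyperSlice_eq_zero (hψ : IsWindow ψ R) (hL : 0 < L) (h : ℝ) {α : ℝ}
    (hα : α ∉ Set.Icc (-(2 * L)) (2 * L + log R)) : hyperSlice ψ L h α = 0 := by
  unfold hyperSlice
  simp only [hψ.hyperSlice_integrand_eq_zero hL h hα, integral_zero]

lemma IsWindow.integral_hyperSlice (hψ : IsWindow ψ R) (hL : 0 < L) (h m : ℝ) :
    ∫ α, cexp (((-2 * π * (m * exp α) : ℝ) : ℂ) * I) * hyperSlice ψ L h α = hyperInt ψ L h m := by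
  have hg := (hψ.continuous_windowDiv 0).measurable
  have hb := bump_continuous.measurable
  -- the two phases combined
  have step1 : ∫ α, cexp (((-2 * π * (m * exp α) : ℝ) : ℂ) * I) *
      hyperSlice ψ L h α = ∫ α, ∫ w, windowDiv ψ 0 w * (((bump ((α - log w) / L) : ℝ) : ℂ) *
      cexp (((-2 * π * (h * w ^ 2 * exp (-α) + m * exp α) : ℝ) : ℂ) * I)) := by
    congr 1
    ext α
    rw [hyperSlice, ← integral_const_mul]
    congr 1
    ext w
    rw [mul_add, Complex.ofReal_add, add_mul, Complex.exp_add]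
    ring
  have step2 : ∫ α, ∫ w, windowDiv ψ 0 w * (((bump ((α - log w) / L) : ℝ) : ℂ) *
      cexp (((-2 * π * (h * w ^ 2 * exp (-α) + m * exp α) : ℝ) : ℂ) * I)) =
      ∫ w, ∫ α, windowDiv ψ 0 w * (((bump ((α - log w) / L) : ℝ) : ℂ) *
      cexp (((-2 * π * (h * w ^ 2 * exp (-α) + m * exp α) : ℝ) : ℂ) * I)) := by
    apply integral_integral_swap
    have hbd : Integrable (fun p : ℝ × ℝ =>
        (Set.Icc (-(2 * L)) (2 * L + log R)).indicator (fun _ => (1:ℝ)) p.1 *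
          ‖windowDiv ψ 0 p.2‖) (volume.prod volume) := by
      apply Integrable.mul_prod (f := (Set.Icc (-(2 * L)) (2 * L + log R)).indicator
        (fun _ => (1:ℝ))) (g := fun w => ‖windowDiv ψ 0 w‖)
      · exact (integrable_indicator_iff measurableSet_Icc).2 (by simp)
      · exact (hψ.integrable_windowDiv 0).norm
    refine hbd.mono' ?_ (.of_forall fun p => ?_)
    · apply Measurable.aestronglyMeasurable
      unfold Function.uncurry
      fun_prop
    · simp only [Function.uncurry]
      by_cases hα : p.1 ∈ Set.Icc (-(2 * L)) (2 * L + log R)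
      · rw [indicator_of_mem hα, one_mul, norm_mul, norm_mul, norm_exp_ofReal_mul_I,
          mul_one, norm_real, norm_of_nonneg (bump_nonneg _)]
        exact mul_le_of_le_one_right (norm_nonneg _) (bump_le_one _)
      · have := hψ.hyperSlice_integrand_eq_zero hL 0 hα p.2
        rcases mul_eq_zero.1 this with h0 | h0
        · simp [h0]
        · rcases mul_eq_zero.1 h0 with h0 | h0
          · rw [h0, zero_mul, mul_zero, norm_zero, indicator_of_notMem hα, zero_mul]
          · exact absurd h0 (Complex.exp_ne_zero _)
  have step3 : ∀ w, ∫ α, windowDiv ψ 0 w * (((bump ((α - log w) / L) : ℝ) : ℂ) *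
      cexp (((-2 * π * (h * w ^ 2 * exp (-α) + m * exp α) : ℝ) : ℂ) * I)) =
      ∫ θ, windowDiv ψ 0 w * ((bump (θ / L) : ℂ) *
      cexp (((-2 * π * w * (h * exp (-θ) + m * exp θ) : ℝ) : ℂ) * I)) := by
    intro w
    by_cases hw : w ∈ Set.Icc 1 R
    · have hw0 : 0 < w := by linarith [hw.1]
      rw [← integral_add_right_eq_self _ (log w)]
      congr 1
      ext θ
      rw [add_sub_cancel_right, neg_add, exp_add, exp_add, exp_neg (log w), exp_log hw0]
      congr 5
      field_simp
    · simp [hψ.windowDiv_eq_zero 0 hw]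
  have step4 : ∫ w, ∫ θ, windowDiv ψ 0 w * ((bump (θ / L) : ℂ) *
      cexp (((-2 * π * w * (h * exp (-θ) + m * exp θ) : ℝ) : ℂ) * I)) =
      ∫ θ, ∫ w, windowDiv ψ 0 w * ((bump (θ / L) : ℂ) *
      cexp (((-2 * π * w * (h * exp (-θ) + m * exp θ) : ℝ) : ℂ) * I)) := by
    apply integral_integral_swap
    have hbd : Integrable (fun p : ℝ × ℝ => ‖windowDiv ψ 0 p.1‖ * bump (p.2 / L))
        (volume.prod volume) := by
      apply Integrable.mul_prod (f := fun w => ‖windowDiv ψ 0 w‖) (g := fun θ => bump (θ / L))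
      · exact (hψ.integrable_windowDiv 0).norm
      · apply Integrable.comp_div _ hL.ne'
        exact bump_continuous.integrable_of_hasCompactSupport bump_hasCompactSupport
    refine hbd.mono' ?_ (.of_forall fun p => ?_)
    · apply Measurable.aestronglyMeasurable
      unfold Function.uncurry
      fun_prop
    · simp only [Function.uncurry]
      rw [norm_mul, norm_mul, norm_exp_ofReal_mul_I, mul_one, norm_real,
        norm_of_nonneg (bump_nonneg _)]
  rw [step1, step2]
  simp_rw [step3]
  rw [step4, hyperInt]
  congr 1
  ext θ
  rw [windowHat_apply, ← integral_const_mul]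
  congr 1
  ext w
  ring

lemma IsWindow.hyperRow_eq_zero (hψ : IsWindow ψ R) (hL : 0 < L) (h : ℝ) {a : ℝ}
    (ha : a ∉ Set.Icc (exp (-(2 * L))) (exp (2 * L) * R)) : hyperRow ψ L h a = 0 := by
  unfold hyperRow
  split_ifs with h0
  · by_cases hR : 0 < R
    · rw [hψ.hyperSlice_eq_zero hL, zero_div]
      intro hα
      apply ha
      refine ⟨(le_log_iff_exp_le h0).1 hα.1, ?_⟩
      have := (log_le_iff_le_exp h0).1 hα.2
      rwa [exp_add, exp_log hR] at this
    · have : hyperSlice ψ L h (log a) = 0 := by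
        unfold hyperSlice
        have : ∀ w, windowDiv ψ 0 w = 0 := fun w => hψ.windowDiv_eq_zero 0 (fun hw => by
          linarith [hw.1, hw.2])
        simp [this]
      rw [this, zero_div]
  · rfl

lemma IsWindow.continuous_hyperRow (hψ : IsWindow ψ R) (hL : 0 < L) (h : ℝ) :
    Continuous (hyperRow ψ L h) := by
  rw [continuous_iff_continuousAt]
  intro a
  rcases lt_or_ge a (exp (-(2 * L))) with ha | ha
  · have : hyperRow ψ L h =ᶠ[𝓝 a] fun _ => 0 := by
      filter_upwards [Iio_mem_nhds ha] with b hb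
      exact hψ.hyperRow_eq_zero hL h fun hb' => absurd hb'.1 (not_le.2 hb)
    exact continuousAt_const.congr this.symm
  · have ha0 : 0 < a := (exp_pos _).trans_le ha
    have : hyperRow ψ L h =ᶠ[𝓝 a] fun a => hyperSlice ψ L h (log a) / a := by
      filter_upwards [Ioi_mem_nhds ha0] with b hb
      rw [hyperRow, if_pos (Set.mem_Ioi.1 hb)]
    refine ContinuousAt.congr ?_ this.symm
    apply ContinuousAt.div
    · exact (hψ.continuous_hyperSlice L h).continuousAt.comp (continuousAt_log ha0.ne')
    · exact Complex.continuous_ofReal.continuousAt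
    · exact_mod_cast ha0.ne'

lemma IsWindow.hasCompactSupport_hyperRow (hψ : IsWindow ψ R) (hL : 0 < L) (h : ℝ) :
    HasCompactSupport (hyperRow ψ L h) :=
  HasCompactSupport.intro isCompact_Icc fun _ ha => hψ.hyperRow_eq_zero hL h ha

lemma IsWindow.fourier_hyperRow (hψ : IsWindow ψ R) (hL : 0 < L) (h m : ℝ) :
    𝓕 (hyperRow ψ L h) m = hyperInt ψ L h m := by
  rw [← hψ.integral_hyperSlice hL, fourier_real_eq_integral_exp_smul]
  have hz : ∀ a, a ∉ Set.Ioi (0:ℝ) →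
      cexp (((-2 * π * a * m : ℝ) : ℂ) * I) • hyperRow ψ L h a = 0 := by
    intro a ha
    rw [hyperRow, if_neg (fun h : 0 < a => ha h), smul_zero]
  rw [← setIntegral_eq_integral_of_forall_compl_eq_zero hz]
  have himg : Set.Ioi (0:ℝ) = exp '' Set.univ := by rw [Set.image_univ, range_exp]
  rw [himg, integral_image_eq_integral_abs_deriv_smul MeasurableSet.univ
    (fun x _ => (hasDerivAt_exp x).hasDerivWithinAt) exp_injective.injOn, setIntegral_univ]
  congr 1
  ext α
  rw [hyperRow, if_pos (exp_pos α), log_exp, abs_of_pos (exp_pos α), smul_eq_mul, real_smul]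
  have : (exp α : ℂ) ≠ 0 := mod_cast (exp_pos α).ne'
  rw [show -2 * π * exp α * m = -2 * π * (m * exp α) by ring]
  field_simp

lemma fourier_hyperWeight {a : ℝ} (ha : 0 < a) (L h : ℝ) (hψ : IsWindow ψ R) :
    𝓕 (hyperWeight ψ L a) h = hyperRow ψ L h a := by
  rw [fourier_real_eq_integral_exp_smul, hyperRow, if_pos ha, hyperSlice]
  have hz : ∀ t, t ∉ Set.Ioi (0:ℝ) →
      cexp (((-2 * π * t * h : ℝ) : ℂ) * I) • hyperWeight ψ L a t = 0 := by
    intro t ht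
    rw [hyperWeight, if_neg (fun h => ht h.2), smul_zero]
  rw [← setIntegral_eq_integral_of_forall_compl_eq_zero hz]
  have hz' : ∀ w, w ∉ Set.Ioi (0:ℝ) → windowDiv ψ 0 w * (((bump ((log a - log w) / L) : ℝ) : ℂ) *
    cexp (((-2 * π * (h * w ^ 2 * exp (-(log a))) : ℝ) : ℂ) * I)) = 0 := by
    intro w hw
    rw [hψ.windowDiv_eq_zero 0 (fun h => hw (by simp only [Set.mem_Ioi]; linarith [h.1])), zero_mul]
  rw [← setIntegral_eq_integral_of_forall_compl_eq_zero hz']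
  have hinj : Set.InjOn (fun w => w ^ 2 / a) (Set.Ioi 0) := by
    intro x hx y hy hxy
    simp only [Set.mem_Ioi] at hx hy
    have : x ^ 2 = y ^ 2 := by simpa [div_left_inj' ha.ne'] using hxy
    exact (pow_left_inj₀ hx.le hy.le two_ne_zero).1 this
  have himg : Set.Ioi (0:ℝ) = (fun w => w ^ 2 / a) '' Set.Ioi 0 := by
    ext t
    simp only [Set.mem_Ioi, Set.mem_image]
    constructor
    · intro ht
      refine ⟨√(a * t), by positivity, ?_⟩
      rw [sq_sqrt (by positivity)]
      field_simp
    · rintro ⟨w, hw, rfl⟩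
      positivity
  conv_lhs => rw [himg]
  rw [integral_image_eq_integral_abs_deriv_smul (f' := fun w => 2 * w / a) measurableSet_Ioi
    (fun x _ => ?_) hinj, ← integral_div]
  · apply setIntegral_congr_fun measurableSet_Ioi
    intro w hw
    simp only [Set.mem_Ioi] at hw
    have hw2 : 0 < w ^ 2 / a := by positivity
    simp only
    rw [hyperWeight, if_pos ⟨ha, hw2⟩, exp_neg, exp_log ha,
      mul_div_cancel₀ _ ha.ne', sqrt_sq hw.le, abs_of_pos (by positivity), windowDiv,
      pow_zero, div_one, real_smul, smul_eq_mul]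
    have e1 : log (a / (w ^ 2 / a)) / (2 * L) = (log a - log w) / L := by
      rw [log_div ha.ne' hw2.ne', log_div (by positivity) ha.ne', log_pow]
      push_cast
      rw [show log a - (2 * log w - log a) = 2 * (log a - log w) by ring, mul_div_mul_left _ _
        two_ne_zero]
    rw [e1, show -2 * π * (w ^ 2 / a) * h = -2 * π * (h * w ^ 2 * a⁻¹) by ring]
    push_cast
    ring
  · refine ((((hasDerivAt_id x).pow 2).div_const a).congr_deriv ?_).hasDerivWithinAt
    simp

lemma IsWindow.hyperWeight_eq_zero (hψ : IsWindow ψ R) (L : ℝ) {a : ℝ} (ha : 0 < a) {t : ℝ}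
    (ht : t ∉ Set.Icc (1 / a) (R ^ 2 / a)) : hyperWeight ψ L a t = 0 := by
  unfold hyperWeight
  split_ifs with h0
  · rw [hψ.eq_zero, zero_mul, ofReal_zero]
    intro hm
    apply ht
    have h1 := (one_le_sqrt).1 hm.1
    have h2 := (sqrt_le_left (by linarith [hm.1, hm.2])).1 hm.2
    exact ⟨by rw [div_le_iff₀ ha]; linarith, by rw [le_div_iff₀ ha]; linarith⟩
  · rfl

lemma IsWindow.contDiff_hyperWeight (hψ : IsWindow ψ R) (L : ℝ) {a : ℝ} (ha : 0 < a) :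
    ContDiff ℝ ∞ (hyperWeight ψ L a) := by
  rw [contDiff_iff_contDiffAt]
  intro t
  rcases lt_or_ge t (1 / a) with ht | ht
  · have : hyperWeight ψ L a =ᶠ[𝓝 t] fun _ => 0 := by
      filter_upwards [Iio_mem_nhds ht] with b hb
      exact hψ.hyperWeight_eq_zero L ha fun hb' => absurd hb'.1 (not_le.2 hb)
    exact contDiffAt_const.congr_of_eventuallyEq this
  · have ht0 : 0 < t := lt_of_lt_of_le (by positivity) ht
    have : hyperWeight ψ L a =ᶠ[𝓝 t] fun b =>
        ((ψ (√(a * b)) * bump (log (a / b) / (2 * L)) : ℝ) : ℂ) := by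
      filter_upwards [Ioi_mem_nhds ht0] with b hb
      rw [hyperWeight, if_pos ⟨ha, hb⟩]
    refine ContDiffAt.congr_of_eventuallyEq ?_ this
    refine ofRealCLM.contDiff.contDiffAt.comp t ?_
    apply ContDiffAt.mul
    · exact hψ.smooth.contDiffAt.comp t ((contDiffAt_const.mul contDiffAt_id).sqrt
        (by simp only [id]; positivity))
    · refine bump_contDiff.contDiffAt.comp t (ContDiffAt.div_const (ContDiffAt.log ?_ ?_) _)
      · exact contDiffAt_const.div contDiffAt_id ht0.ne'
      · positivity

lemma IsWindow.hasCompactSupport_hyperWeight (hψ : IsWindow ψ R) (L : ℝ) {a : ℝ} (ha : 0 < a) :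
    HasCompactSupport (hyperWeight ψ L a) :=
  HasCompactSupport.intro isCompact_Icc fun _ h => hψ.hyperWeight_eq_zero L ha h

lemma IsWindow.tsum_hyperWeight (hψ : IsWindow ψ R) (L : ℝ) {a : ℝ} (ha : 0 < a) :
    ∑' b : ℤ, hyperWeight ψ L a b = ∑' h : ℤ, hyperRow ψ L h a := by
  have := SchwartzMap.tsum_eq_tsum_fourier
    ((hψ.hasCompactSupport_hyperWeight L ha).toSchwartzMap (hψ.contDiff_hyperWeight L ha)) 0
  simp only [zero_add, SchwartzMap.fourier_coe] at this
  have e : ((hψ.hasCompactSupport_hyperWeight L ha).toSchwartzMap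
    (hψ.contDiff_hyperWeight L ha) : ℝ → ℂ) = hyperWeight ψ L a := rfl
  simpa [e, fourier_hyperWeight ha L _ hψ] using this

lemma IsWindow.summable_hyperRow (hψ : IsWindow ψ R) (L : ℝ) {a : ℝ} (ha : 0 < a) :
    Summable fun h : ℤ => hyperRow ψ L h a := by
  set f := (hψ.hasCompactSupport_hyperWeight L ha).toSchwartzMap (hψ.contDiff_hyperWeight L ha)
  have h1 := (𝓕 f).isBigO_cocompact_rpow (-2)
  have h2 := summable_of_isBigO (summable_abs_int_rpow one_lt_two)
    (h1.comp_tendsto Int.tendsto_coe_cofinite)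
  refine h2.congr fun h => ?_
  simp only [Function.comp, SchwartzMap.fourier_coe]
  rw [← fourier_hyperWeight ha L _ hψ]
  rfl

lemma IsWindow.tsum_hyperRow (hψ : IsWindow ψ R) (hL : 0 < L) (h : ℝ)
    (hsum : Summable fun m : ℤ => hyperInt ψ L h m) :
    ∑' a : ℤ, hyperRow ψ L h a = ∑' m : ℤ, hyperInt ψ L h m := by
  have hO : hyperRow ψ L h =O[cocompact ℝ] fun x => |x| ^ (-(2:ℝ)) := by
    have h0 := hasCompactSupport_iff_eventuallyEq.1 (hψ.hasCompactSupport_hyperRow hL h)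
    rw [coclosedCompact_eq_cocompact] at h0
    exact h0.trans_isBigO (Asymptotics.isBigO_zero _ _)
  have := tsum_eq_tsum_fourier_of_rpow_decay_of_summable (hψ.continuous_hyperRow hL h)
    one_lt_two hO (by simpa only [hψ.fourier_hyperRow hL] using hsum) 0
  simpa [hψ.fourier_hyperRow hL] using this

end

section

variable {ψ : ℝ → ℝ} {R L : ℝ}

lemma exists_iteratedDeriv_bump_le : ∃ M, 0 ≤ M ∧ ∀ i ≤ 3, ∀ θ, |iteratedDeriv i bump θ| ≤ M := by
  have h : ∀ i : ℕ, ∃ M, ∀ θ, |iteratedDeriv i bump θ| ≤ M := by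
    intro i
    have hc : Continuous (iteratedDeriv i bump) :=
      bump_contDiff.continuous_iteratedDeriv i (mod_cast le_top)
    have hs : HasCompactSupport (iteratedDeriv i bump) := by
      induction i with
      | zero => simpa using bump_hasCompactSupport
      | succ i ih =>
        rw [iteratedDeriv_succ]
        exact (ih (bump_contDiff.continuous_iteratedDeriv i (mod_cast le_top))).deriv
    exact hs.exists_bound_of_continuous hc
  choose M hM using h
  refine ⟨∑ i ∈ range 4, |M i|, sum_nonneg fun _ _ => abs_nonneg _, fun i hi θ => ?_⟩
  refine (hM i θ).trans ((le_abs_self _).trans ?_)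
  exact single_le_sum (f := fun i => |M i|) (fun _ _ => abs_nonneg _) (mem_range.2 (by omega))

lemma exp_half_log_div {h m : ℝ} (hh : 0 < h) (hm : 0 < m) :
    h * exp (-(log (h / m) / 2)) = √(h * m) ∧ m * exp (log (h / m) / 2) = √(h * m) := by
  have e : exp (log (h / m) / 2) = √(h / m) := by
    rw [sqrt_eq_rpow, rpow_def_of_pos (by positivity)]
    ring_nf
  have hs : √(h * m) = √h * √m := sqrt_mul hh.le m
  have hd : √(h / m) = √h / √m := sqrt_div hh.le m
  have h1 : √h * √h = h := mul_self_sqrt hh.le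
  have h2 : √m * √m = m := mul_self_sqrt hm.le
  have h3 : √h ≠ 0 := (sqrt_pos.2 hh).ne'
  have h4 : √m ≠ 0 := (sqrt_pos.2 hm).ne'
  constructor
  · rw [exp_neg, e, hs, hd]
    field_simp
    nlinarith
  · rw [e, hs, hd]
    field_simp
    nlinarith

lemma hyperInt_pos_eq (ψ : ℝ → ℝ) (L : ℝ) {h m : ℝ} (hh : 0 < h) (hm : 0 < m) :
    hyperInt ψ L h m = ∫ θ, ((bump ((θ + log (h / m) / 2) / L) : ℝ) : ℂ) *
      windowHat ψ 0 (2 * √(h * m) * cosh θ) := by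
  obtain ⟨e1, e2⟩ := exp_half_log_div hh hm
  rw [hyperInt, ← integral_add_right_eq_self _ (log (h / m) / 2)]
  congr 1
  ext θ
  congr 2
  rw [neg_add, exp_add, exp_add, cosh_eq]
  calc h * (exp (-θ) * exp (-(log (h / m) / 2))) + m * (exp θ * exp (log (h / m) / 2))
      = (h * exp (-(log (h / m) / 2))) * exp (-θ) + (m * exp (log (h / m) / 2)) * exp θ := by ring
    _ = _ := by rw [e1, e2]; ring

lemma hyperInt_neg_eq (ψ : ℝ → ℝ) (L : ℝ) {h m : ℝ} (hh : 0 < h) (hm : 0 < m) :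
    hyperInt ψ L (-h) m = ∫ θ, ((bump ((θ + log (h / m) / 2) / L) : ℝ) : ℂ) *
      windowHat ψ 0 (2 * √(h * m) * sinh θ) := by
  obtain ⟨e1, e2⟩ := exp_half_log_div hh hm
  rw [hyperInt, ← integral_add_right_eq_self _ (log (h / m) / 2)]
  congr 1
  ext θ
  congr 2
  rw [neg_add, exp_add, exp_add, sinh_eq]
  calc -h * (exp (-θ) * exp (-(log (h / m) / 2))) + m * (exp θ * exp (log (h / m) / 2))
      = -(h * exp (-(log (h / m) / 2))) * exp (-θ) + (m * exp (log (h / m) / 2)) * exp θ := by ring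
    _ = _ := by rw [e1, e2]; ring

lemma hyperInt_neg_neg (ψ : ℝ → ℝ) (L h m : ℝ) :
    hyperInt ψ L (-h) (-m) = conj (hyperInt ψ L h m) := by
  unfold hyperInt
  rw [← integral_conj]
  congr 1
  ext θ
  rw [map_mul, Complex.conj_ofReal, ← windowHat_neg]
  congr 2
  ring

lemma rpow_three_half_eq {x : ℝ} (hx : 0 ≤ x) : (2 * √x) ^ 3 = 8 * x ^ (3 / 2 : ℝ) := by
  rw [mul_pow, sqrt_eq_rpow, ← rpow_natCast (x ^ (1 / 2 : ℝ)), ← rpow_mul hx]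
  norm_num

lemma exists_norm_hyperInt_neg_le : ∃ C, 0 ≤ C ∧ ∀ (ψ : ℝ → ℝ) (R L h m : ℝ), IsWindow ψ R →
    1 ≤ L → 0 < h → 0 < m →
    ‖hyperInt ψ L (-h) m‖ ≤ C * (∫ w, |ψ w|) / (h * m) ^ (3 / 2 : ℝ) := by
  obtain ⟨M, hM0, hM⟩ := exists_iteratedDeriv_bump_le
  have hI : 0 ≤ ∫ θ : ℝ, ((cosh θ)⁻¹) ^ 3 :=
    integral_nonneg fun θ => by have := cosh_pos θ; positivity
  refine ⟨42 * M * (∫ θ, ((cosh θ)⁻¹) ^ 3), by positivity, ?_⟩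
  intro ψ R L h m hψ hL hh hm
  have hB : 0 ≤ ∫ w, |ψ w| := integral_nonneg fun _ => abs_nonneg _
  have hL0 : 0 < L := by linarith
  rw [hyperInt_neg_eq ψ L hh hm]
  set t := log (h / m) / 2 with ht
  have key := exists_norm_integral_windowHat_sinh_le (M := M) hψ (c := 2 * √(h * m)) (by positivity)
    (b := fun i θ => iteratedDeriv i bump ((θ + t) / L) * (1 / L) ^ i) ?_ ?_ ?_
  · simp only [iteratedDeriv_zero, pow_zero, mul_one] at key
    refine key.trans ?_
    rw [rpow_three_half_eq (by positivity)]
    gcongr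
    have : 0 < (h * m) ^ (3 / 2 : ℝ) := by positivity
    linarith
  · intro i θ
    have h1 : HasDerivAt (iteratedDeriv i bump) (iteratedDeriv (i + 1) bump ((θ + t) / L))
        ((θ + t) / L) := by
      rw [iteratedDeriv_succ]
      apply DifferentiableAt.hasDerivAt
      exact (bump_contDiff.differentiable_iteratedDeriv i
        (mod_cast WithTop.coe_lt_top _)).differentiableAt
    have h2 : HasDerivAt (fun θ => (θ + t) / L) (1 / L) θ :=
      ((hasDerivAt_id θ).add_const t).div_const L
    refine ((h1.comp θ h2).mul_const _).congr_deriv ?_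
    ring
  · intro i hi θ
    rw [abs_mul, abs_of_nonneg (by positivity : 0 ≤ (1 / L) ^ i)]
    refine (mul_le_of_le_one_right (abs_nonneg _) (pow_le_one₀ (by positivity) ?_)).trans
      (hM i hi _)
    rw [div_le_one hL0]; exact hL
  · simp only [iteratedDeriv_zero, pow_zero, mul_one]
    refine HasCompactSupport.intro (isCompact_Icc (a := -(2 * L) - t) (b := 2 * L - t))
      fun θ hθ => bump_eq_zero ?_
    rw [abs_div, abs_of_pos hL0, le_div_iff₀ hL0]
    by_contra! hlt
    have := abs_lt.1 hlt
    exact hθ ⟨by linarith, by linarith⟩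

lemma IsWindow.exists_norm_windowHat_cosh_le (hψ : IsWindow ψ R) : ∃ C, 0 ≤ C ∧
    ∀ x θ, 0 < x → ‖windowHat ψ 0 (2 * √x * cosh θ)‖ ≤ C / x ^ (3 / 2 : ℝ) * ((cosh θ)⁻¹) ^ 3 := by
  obtain ⟨C, hC0, hC⟩ := hψ.exists_norm_windowHat_le 0 3
  refine ⟨C, hC0, fun x θ hx => ?_⟩
  have h1 := hC (2 * √x * cosh θ)
  have hc := cosh_pos θ
  have hx' : 0 < x ^ (3 / 2 : ℝ) := by positivity
  rw [abs_of_pos (by positivity), mul_pow, rpow_three_half_eq hx.le] at h1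
  rw [inv_pow, ← div_eq_mul_inv, div_div, le_div_iff₀ (by positivity)]
  have : 0 ≤ x ^ (3 / 2 : ℝ) * cosh θ ^ 3 * ‖windowHat ψ 0 (2 * √x * cosh θ)‖ := by positivity
  linarith

lemma IsWindow.exists_norm_hyperInt_pos_le (hψ : IsWindow ψ R) : ∃ C, 0 ≤ C ∧ ∀ L h m : ℝ,
    0 < h → 0 < m → ‖hyperInt ψ L h m‖ ≤ C / (h * m) ^ (3 / 2 : ℝ) := by
  obtain ⟨C, hC0, hC⟩ := hψ.exists_norm_windowHat_cosh_le
  have hI : 0 ≤ ∫ θ : ℝ, ((cosh θ)⁻¹) ^ 3 :=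
    integral_nonneg fun θ => by have := cosh_pos θ; positivity
  refine ⟨C * ∫ θ, ((cosh θ)⁻¹) ^ 3, by positivity, fun L h m hh hm => ?_⟩
  rw [hyperInt_pos_eq ψ L hh hm, mul_div_right_comm, ← integral_const_mul]
  refine norm_integral_le_of_norm_le (integrable_inv_cosh_pow_three.const_mul _)
    (.of_forall fun θ => ?_)
  rw [norm_mul, norm_real, norm_of_nonneg (bump_nonneg _)]
  exact (mul_le_of_le_one_left (norm_nonneg _) (bump_le_one _)).trans (hC _ θ (by positivity))

lemma IsWindow.exists_norm_hyperInt_axis_le (hψ : IsWindow ψ R) (hL : 0 < L) :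
    ∃ C, 0 ≤ C ∧ ∀ h : ℝ, 1 ≤ |h| → ‖hyperInt ψ L h 0‖ ≤ C / |h| ^ (3 / 2 : ℝ) := by
  obtain ⟨C, hC0, hC⟩ := hψ.exists_norm_windowHat_le 0 3
  have hint : Integrable fun θ => bump (θ / L) :=
    (bump_continuous.integrable_of_hasCompactSupport bump_hasCompactSupport).comp_div hL.ne'
  have hI : 0 ≤ ∫ θ, bump (θ / L) := integral_nonneg fun θ => bump_nonneg _
  refine ⟨C * exp (6 * L) * ∫ θ, bump (θ / L), by positivity, fun h hh => ?_⟩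
  rw [hyperInt, mul_div_right_comm, ← integral_const_mul]
  refine norm_integral_le_of_norm_le (hint.const_mul _) (.of_forall fun θ => ?_)
  rw [norm_mul, norm_real, norm_of_nonneg (bump_nonneg _), zero_mul, add_zero, mul_comm]
  rcases le_or_gt 2 |θ / L| with h2 | h2
  · rw [bump_eq_zero h2, mul_zero, mul_zero]
  · apply mul_le_mul_of_nonneg_right _ (bump_nonneg _)
    have hθ : -θ ≥ -(2 * L) := by
      rw [abs_div, abs_of_pos hL, div_lt_iff₀ hL] at h2
      linarith [le_abs_self θ]
    have h1 := hC (h * exp (-θ))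
    rw [abs_mul, abs_of_pos (exp_pos _), mul_pow, ← exp_nat_mul] at h1
    have h3 : exp (-(6 * L)) ≤ exp ((3 : ℕ) * -θ) := by apply exp_le_exp.2; push_cast; linarith
    have h4 : |h| ^ (3 / 2 : ℝ) ≤ |h| ^ 3 := by
      rw [← rpow_natCast]
      exact rpow_le_rpow_of_exponent_le hh (by norm_num)
    have h5 : |h| ^ (3 / 2 : ℝ) * exp (-(6 * L)) * ‖windowHat ψ 0 (h * exp (-θ))‖ ≤ C := by
      refine le_trans ?_ h1
      gcongr
    have h6 : 0 < |h| ^ (3 / 2 : ℝ) := by positivity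
    rw [le_div_iff₀ h6]
    rw [exp_neg] at h5
    have h7 := exp_pos (6 * L)
    rw [mul_assoc, mul_comm, mul_assoc, inv_mul_le_iff₀ h7] at h5
    linarith

/-- The summable majorant on `ℤ` used for double Poisson sums. -/
def intWeight (n : ℤ) : ℝ := if n = 0 then 1 else 1 / |(n : ℝ)| ^ (3 / 2 : ℝ)

lemma intWeight_nonneg (n : ℤ) : 0 ≤ intWeight n := by unfold intWeight; split_ifs <;> positivity

lemma summable_intWeight : Summable intWeight := by
  have h := summable_abs_int_rpow (b := 3 / 2) (by norm_num)
  refine (summable_congr_cofinite ?_).2 h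
  filter_upwards [(Set.finite_singleton (0:ℤ)).compl_mem_cofinite] with n hn
  rw [intWeight, if_neg (fun h : n = 0 => hn h), rpow_neg (abs_nonneg _), one_div]

lemma IsWindow.exists_norm_hyperInt_le (hψ : IsWindow ψ R) (hL : 1 ≤ L) :
    ∃ C, ∀ h m : ℤ, ‖hyperInt ψ L h m‖ ≤ C * (intWeight h * intWeight m) := by
  obtain ⟨C1, hC1, h1⟩ := exists_norm_hyperInt_neg_le
  obtain ⟨C2, hC2, h2⟩ := hψ.exists_norm_hyperInt_pos_le
  obtain ⟨C3, hC3, h3⟩ := hψ.exists_norm_hyperInt_axis_le (by linarith : 0 < L)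
  have hB : 0 ≤ ∫ w, |ψ w| := integral_nonneg fun _ => abs_nonneg _
  set C4 := ‖hyperInt ψ L 0 0‖
  set C := C1 * (∫ w, |ψ w|) + C2 + C3 + C4 with hC
  have hn : 0 ≤ C1 * (∫ w, |ψ w|) := by positivity
  have hC4 : 0 ≤ C4 := norm_nonneg _
  have hne : ∀ n : ℤ, n ≠ 0 → (1:ℝ) ≤ |(n : ℝ)| := fun n hn => by exact_mod_cast Int.one_le_abs hn
  refine ⟨C, fun h m => ?_⟩
  by_cases hh : h = 0
  · by_cases hm : m = 0
    · subst hh hm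
      simp only [intWeight, if_true, Int.cast_zero]
      change C4 ≤ _
      linarith
    · subst hh
      simp only [intWeight, if_true, if_neg hm, Int.cast_zero]
      rw [hyperInt_comm, one_mul, mul_one_div]
      refine (h3 m (hne m hm)).trans ?_
      gcongr
      linarith
  · by_cases hm : m = 0
    · subst hm
      simp only [intWeight, if_true, if_neg hh, Int.cast_zero]
      rw [mul_one, mul_one_div]
      refine (h3 h (hne h hh)).trans ?_
      gcongr
      linarith
    · simp only [intWeight, if_neg hh, if_neg hm]
      have hh1 := hne h hh
      have hm1 := hne m hm
      rw [div_mul_div_comm, one_mul, ← mul_rpow (abs_nonneg _) (abs_nonneg _), mul_one_div]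
      have pos : 0 < (|(h:ℝ)| * |(m:ℝ)|) ^ (3 / 2 : ℝ) := by positivity
      have same : ‖hyperInt ψ L |(h:ℝ)| |(m:ℝ)|‖ ≤ C / (|(h:ℝ)| * |(m:ℝ)|) ^ (3 / 2 : ℝ) :=
        (h2 L _ _ (by linarith) (by linarith)).trans (by gcongr; linarith)
      have mixed : ‖hyperInt ψ L (-|(h:ℝ)|) |(m:ℝ)|‖ ≤ C / (|(h:ℝ)| * |(m:ℝ)|) ^ (3 / 2 : ℝ) :=
        (h1 ψ R L _ _ hψ hL (by linarith) (by linarith)).trans (by gcongr; linarith)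
      rcases abs_cases (h:ℝ) with ⟨e1, _⟩ | ⟨e1, _⟩ <;> rcases abs_cases (m:ℝ) with ⟨e2, _⟩ | ⟨e2, _⟩
      · rw [e1, e2] at same ⊢; exact same
      · rw [← Complex.norm_conj, ← hyperInt_neg_neg]
        rw [e1, e2] at mixed ⊢; exact mixed
      · rw [e1, e2] at mixed ⊢; rwa [neg_neg] at mixed
      · rw [← Complex.norm_conj, ← hyperInt_neg_neg]
        rw [e1, e2] at same ⊢; exact same

lemma IsWindow.summable_hyperInt (hψ : IsWindow ψ R) (hL : 1 ≤ L) :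
    Summable fun p : ℤ × ℤ => hyperInt ψ L p.1 p.2 := by
  obtain ⟨C, hC⟩ := hψ.exists_norm_hyperInt_le hL
  refine Summable.of_norm_bounded (g := fun p : ℤ × ℤ => C * (intWeight p.1 * intWeight p.2)) ?_
    fun p => hC p.1 p.2
  exact (summable_intWeight.mul_of_nonneg summable_intWeight intWeight_nonneg
    intWeight_nonneg).mul_left C

end

section

variable {ψ : ℝ → ℝ} {R L : ℝ}

lemma tsum_int_eq_zero_add {f : ℤ → ℂ} (hf : Summable f) :
    ∑' n : ℤ, f n = f 0 + ∑' n : ℕ, (f (n + 1) + f (-(n + 1))) := by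
  have h1 : Summable fun n : ℕ => f (n + 1) :=
    hf.comp_injective (i := fun n : ℕ => ((n : ℤ) + 1)) (fun a b h => by simpa using h)
  have h2 : Summable fun n : ℕ => f (-((n : ℤ) + 1)) :=
    hf.comp_injective (i := fun n : ℕ => -((n : ℤ) + 1)) (fun a b h => by simpa using h)
  have h0 : Summable fun n : ℕ => f n :=
    hf.comp_injective (i := fun n : ℕ => (n : ℤ)) (fun a b h => by simpa using h)
  rw [tsum_of_nat_of_neg_add_one h0 h2, h0.tsum_eq_zero_add, h1.tsum_add h2]
  push_cast
  ring

/-- Splitting a symmetric double sum over `ℤ × ℤ` along the axes. -/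
lemma tsum_tsum_int_symm {T : ℤ → ℤ → ℂ} (hT : Summable fun p : ℤ × ℤ => T p.1 p.2)
    (hs : ∀ a b, T a b = T b a) :
    ∑' h, ∑' m, T h m = 2 * (∑' m, T 0 m) - T 0 0 +
      ∑' p : ℕ × ℕ, (T (p.1 + 1) (p.2 + 1) + T (p.1 + 1) (-(p.2 + 1)) +
        (T (-(p.1 + 1)) (p.2 + 1) + T (-(p.1 + 1)) (-(p.2 + 1)))) := by
  have hrow : ∀ h, Summable fun m => T h m := fun h => hT.prod_factor h
  have hU : Summable fun h => ∑' m, T h m := hT.prod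
  have hcol : Summable fun h => T h 0 := by simpa only [hs] using hrow 0
  have inj1 : Function.Injective fun n : ℕ => ((n : ℤ) + 1) := fun a b h => by simpa using h
  have inj2 : Function.Injective fun n : ℕ => -((n : ℤ) + 1) := fun a b h => by simpa using h
  have q1 : Summable fun p : ℕ × ℕ => T (p.1 + 1) (p.2 + 1) :=
    hT.comp_injective (i := fun p : ℕ × ℕ => (((p.1 : ℤ) + 1), ((p.2 : ℤ) + 1))) fun x y h => by
      obtain ⟨h1, h2⟩ := Prod.mk.inj h
      exact Prod.ext (by omega) (by omega)
  have q2 : Summable fun p : ℕ × ℕ => T (p.1 + 1) (-(p.2 + 1)) :=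
    hT.comp_injective (i := fun p : ℕ × ℕ => (((p.1 : ℤ) + 1), -((p.2 : ℤ) + 1))) fun x y h => by
      obtain ⟨h1, h2⟩ := Prod.mk.inj h
      exact Prod.ext (by omega) (by omega)
  have q3 : Summable fun p : ℕ × ℕ => T (-(p.1 + 1)) (p.2 + 1) :=
    hT.comp_injective (i := fun p : ℕ × ℕ => (-((p.1 : ℤ) + 1), ((p.2 : ℤ) + 1))) fun x y h => by
      obtain ⟨h1, h2⟩ := Prod.mk.inj h
      exact Prod.ext (by omega) (by omega)
  have q4 : Summable fun p : ℕ × ℕ => T (-(p.1 + 1)) (-(p.2 + 1)) :=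
    hT.comp_injective (i := fun p : ℕ × ℕ => (-((p.1 : ℤ) + 1), -((p.2 : ℤ) + 1))) fun x y h => by
      obtain ⟨h1, h2⟩ := Prod.mk.inj h
      exact Prod.ext (by omega) (by omega)
  have qq : Summable fun p : ℕ × ℕ => (T (p.1 + 1) (p.2 + 1) + T (p.1 + 1) (-(p.2 + 1)) +
        (T (-(p.1 + 1)) (p.2 + 1) + T (-(p.1 + 1)) (-(p.2 + 1)))) := (q1.add q2).add (q3.add q4)
  have hc0 : ∑' m, T 0 m = T 0 0 + ∑' n : ℕ, (T (n + 1) 0 + T (-(n + 1)) 0) := by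
    rw [← tsum_int_eq_zero_add hcol]
    exact tsum_congr fun m => hs 0 m
  have hcs : Summable fun n : ℕ => T (n + 1) 0 + T (-(n + 1)) 0 :=
    (hcol.comp_injective (i := fun k : ℕ => (k : ℤ) + 1) inj1).add
      (hcol.comp_injective (i := fun k : ℕ => -((k : ℤ) + 1)) inj2)
  rw [tsum_int_eq_zero_add hU, qq.tsum_prod, two_mul]
  have : ∀ n : ℕ, (∑' m, T (n + 1) m + ∑' m, T (-(n + 1)) m) =
      (T (n + 1) 0 + T (-(n + 1)) 0) + ∑' k : ℕ, (T (n + 1) (k + 1) + T (n + 1) (-(k + 1)) +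
        (T (-(n + 1)) (k + 1) + T (-(n + 1)) (-(k + 1)))) := by
    intro n
    have e1 : ∀ h : ℤ, Summable fun k : ℕ => T h (k + 1) + T h (-(k + 1)) := fun h =>
      (((hrow h).comp_injective (i := fun k : ℕ => (k : ℤ) + 1) inj1)).add
        ((hrow h).comp_injective (i := fun k : ℕ => -((k : ℤ) + 1)) inj2)
    rw [tsum_int_eq_zero_add (hrow _), tsum_int_eq_zero_add (hrow _),
      (e1 (n + 1)).tsum_add (e1 (-(n + 1)))]
    ring
  simp_rw [this]
  rw [hcs.tsum_add qq.prod]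
  linear_combination -hc0

lemma card_divisors_eq_card_divisorsAntidiagonal (n : ℕ) :
    n.divisors.card = (Nat.divisorsAntidiagonal n).card := by
  rw [← Nat.image_fst_divisorsAntidiagonal, card_image_of_injOn]
  rintro ⟨a, b⟩ h1 ⟨a', b'⟩ h2 (rfl : a = a')
  simp only [mem_coe, Nat.mem_divisorsAntidiagonal] at h1 h2
  have ha : 0 < a := Nat.pos_of_ne_zero fun h => h1.2 (by rw [← h1.1, h, zero_mul])
  exact Prod.ext rfl (Nat.eq_of_mul_eq_mul_left ha (h1.1.trans h2.1.symm))

lemma sum_card_divisors_mul {M : ℕ} (f : ℕ → ℂ) (hf : ∀ n, M < n → f n = 0) :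
    ∑ n ∈ Icc 1 M, (n.divisors.card : ℂ) * f n = ∑ a ∈ Icc 1 M, ∑ b ∈ Icc 1 M, f (a * b) := by
  rw [← sum_product' (Icc 1 M) (Icc 1 M) (fun a b => f (a * b))]
  have h1 : ∑ p ∈ Icc 1 M ×ˢ Icc 1 M, f (p.1 * p.2) =
      ∑ p ∈ (Icc 1 M ×ˢ Icc 1 M).filter (fun p => p.1 * p.2 ∈ Icc 1 M), f (p.1 * p.2) := by
    symm
    apply sum_filter_of_ne
    intro p hp hne
    simp only [mem_product, mem_Icc] at hp ⊢
    refine ⟨Nat.mul_pos hp.1.1 hp.2.1, ?_⟩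
    by_contra! hlt
    exact hne (hf _ hlt)
  rw [h1, ← sum_fiberwise_of_maps_to (g := fun p : ℕ × ℕ => p.1 * p.2)
    (t := Icc 1 M) (fun p hp => (mem_filter.1 hp).2)]
  apply sum_congr rfl
  intro n hn
  rw [sum_congr rfl (g := fun _ => f n) (fun p hp => by rw [(mem_filter.1 hp).2]),
    sum_const, nsmul_eq_mul]
  congr 2
  rw [mem_Icc] at hn
  rw [card_divisors_eq_card_divisorsAntidiagonal]
  · congr 1
    ext p
    simp only [Nat.mem_divisorsAntidiagonal, mem_filter, mem_product, mem_Icc]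
    constructor
    · rintro ⟨rfl, h0⟩
      have h1 : 0 < p.1 := Nat.pos_of_ne_zero fun h => h0 (by simp [h])
      have h2 : 0 < p.2 := Nat.pos_of_ne_zero fun h => h0 (by simp [h])
      exact ⟨⟨⟨⟨h1, (Nat.le_mul_of_pos_right _ h2).trans hn.2⟩, h2,
        (Nat.le_mul_of_pos_left _ h1).trans hn.2⟩, hn⟩, rfl⟩
    · rintro ⟨-, h⟩
      exact ⟨h, by omega⟩

end

section

variable {ψ : ℝ → ℝ} {R L : ℝ}

lemma tsum_int_eq_sum_Icc {f : ℤ → ℂ} {M : ℕ} (h0 : ∀ n ≤ 0, f n = 0)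
    (hM : ∀ n : ℤ, (M : ℤ) < n → f n = 0) :
    ∑' n, f n = ∑ n ∈ Icc 1 M, f (n : ℕ) := by
  rw [tsum_eq_sum (s := (Icc 1 M).map ⟨fun n : ℕ => (n : ℤ), Nat.cast_injective⟩), sum_map]
  · rfl
  · intro b hb
    by_contra hne
    have h1 : 0 < b := by
      by_contra! h
      exact hne (h0 b h)
    have h2 : b ≤ M := by
      by_contra! h
      exact hne (hM b h)
    lift b to ℕ using h1.le
    exact hb (mem_map.2 ⟨b, mem_Icc.2 ⟨by omega, by omega⟩, rfl⟩)

lemma IsWindow.hyperWeight_eq (hψ : IsWindow ψ R) (hR : 1 ≤ R) (hL : 1 ≤ L) (hRL : log R ≤ L)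
    {a b : ℝ} (ha : 1 ≤ a) (hb : 1 ≤ b) : hyperWeight ψ L a b = ψ (√(a * b)) := by
  rw [hyperWeight, if_pos ⟨by linarith, by linarith⟩]
  by_cases h : √(a * b) ∈ Set.Icc 1 R
  · have h1 : a * b ≤ R ^ 2 := (sqrt_le_left (by linarith)).1 h.2
    rw [bump_eq_one, mul_one]
    have h2 : log (a * b) ≤ 2 * L := by
      calc log (a * b) ≤ log (R ^ 2) := log_le_log (by nlinarith) h1
        _ ≤ 2 * L := by rw [log_pow]; push_cast; linarith
    rw [log_mul (by linarith) (by linarith)] at h2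
    have ha' := log_nonneg ha
    have hb' := log_nonneg hb
    rw [log_div (by linarith) (by linarith), abs_div, abs_of_pos (by linarith : (0:ℝ) < 2 * L),
      div_le_one (by linarith), abs_le]
    constructor <;> linarith
  · rw [hψ.eq_zero _ h, zero_mul]

lemma IsWindow.eq_zero_of_lt (hψ : IsWindow ψ R) (hR : 1 ≤ R) {x : ℝ} (h : R ^ 2 < x) : ψ (√x) = 0 :=
  hψ.eq_zero _ fun h' => absurd ((sqrt_le_left (by linarith)).1 h'.2) (not_le.2 h)

lemma IsWindow.sum_card_divisors_eq_tsum (hψ : IsWindow ψ R) (hR : 1 ≤ R) (hL : 1 ≤ L)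
    (hRL : log R ≤ L) {M : ℕ} (hM : exp (2 * L) * R ≤ M) :
    ∑ n ∈ Icc 1 M, (n.divisors.card : ℂ) * ψ (√n) = ∑' h : ℤ, ∑' m : ℤ, hyperInt ψ L h m := by
  have hL0 : 0 < L := by linarith
  have hRM : R ^ 2 ≤ M := by
    refine le_trans ?_ hM
    have : R ≤ exp (2 * L) := by rw [← log_le_iff_le_exp (by linarith)]; linarith
    nlinarith
  have hbig : ∀ n : ℤ, (M : ℤ) < n → ∀ h, hyperRow ψ L h n = 0 := by
    intro n hn h
    apply hψ.hyperRow_eq_zero hL0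
    intro h'
    have : (M : ℝ) < n := mod_cast hn
    linarith [h'.2]
  have hneg : ∀ n : ℤ, n ≤ 0 → ∀ h, hyperRow ψ L h n = 0 := by
    intro n hn h
    have : (n : ℝ) ≤ 0 := mod_cast hn
    rw [hyperRow, if_neg (not_lt.2 this)]
  rw [sum_card_divisors_mul (fun n => (ψ (√n) : ℂ))]
  · have h1 : ∀ a ∈ Icc 1 M, ∑ b ∈ Icc 1 M, ((ψ (√((a * b : ℕ) : ℝ)) : ℝ) : ℂ) =
        ∑' h : ℤ, hyperRow ψ L h (a : ℝ) := by
      intro a ha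
      have ha1 : (1 : ℝ) ≤ a := mod_cast (mem_Icc.1 ha).1
      rw [← hψ.tsum_hyperWeight L (by linarith), tsum_int_eq_sum_Icc (M := M)]
      · refine sum_congr rfl fun b hb => ?_
        have hb1 : (1 : ℝ) ≤ b := mod_cast (mem_Icc.1 hb).1
        push_cast
        rw [hψ.hyperWeight_eq hR hL hRL ha1 hb1]
      · intro n hn
        have : (n : ℝ) ≤ 0 := mod_cast hn
        rw [hyperWeight, if_neg (fun h => absurd h.2 (not_lt.2 this))]
      · intro n hn
        have h3 : (M : ℝ) < n := mod_cast hn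
        have h4 : (0:ℝ) ≤ M := by positivity
        rw [hψ.hyperWeight_eq hR hL hRL ha1 (by nlinarith), hψ.eq_zero_of_lt hR, ofReal_zero]
        nlinarith
    rw [sum_congr rfl h1, ← Summable.tsum_finsetSum]
    · refine tsum_congr fun h => ?_
      rw [← hψ.tsum_hyperRow hL0 h ((hψ.summable_hyperInt hL).prod_factor h),
        tsum_int_eq_sum_Icc (M := M) (fun n hn => hneg n hn h) (fun n hn => hbig n hn h)]
      simp
    · intro a ha
      refine hψ.summable_hyperRow L ?_
      exact_mod_cast (mem_Icc.1 ha).1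
  · intro n hn
    rw [hψ.eq_zero_of_lt hR, ofReal_zero]
    exact hRM.trans_lt (mod_cast hn)

lemma IsWindow.tsum_hyperInt_zero (hψ : IsWindow ψ R) (hL : 1 ≤ L) {M : ℕ}
    (hM : exp (2 * L) * R ≤ M) :
    ∑' m : ℤ, hyperInt ψ L 0 m = ∫ w, windowDiv ψ 0 w *
      ((∑ a ∈ Icc 1 M, bump (log (a / w) / L) / (a : ℝ) : ℝ) : ℂ) := by
  have hL0 : 0 < L := by linarith
  have h0 := hψ.tsum_hyperRow hL0 ((0 : ℤ) : ℝ) ((hψ.summable_hyperInt hL).prod_factor 0)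
  rw [Int.cast_zero] at h0
  rw [← h0, tsum_int_eq_sum_Icc (M := M)]
  · simp only [ofReal_sum, mul_sum]
    rw [integral_finsetSum]
    · refine sum_congr rfl fun a ha => ?_
      have ha1 : (0 : ℝ) < a := mod_cast (mem_Icc.1 ha).1
      rw [Int.cast_natCast, hyperRow, if_pos ha1, hyperSlice, ← integral_div]
      congr 1
      ext w
      by_cases hw : w ∈ Set.Icc 1 R
      · rw [log_div (by linarith) (by linarith [hw.1])]
        push_cast
        simp
        ring
      · rw [hψ.windowDiv_eq_zero 0 hw]
        simp
    · intro a ha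
      refine (hψ.integrable_windowDiv 0).mul_bdd (c := 1 / a)
        (Measurable.aestronglyMeasurable ?_) (.of_forall fun w => ?_)
      · have := bump_continuous.measurable
        fun_prop
      · rw [norm_real, norm_eq_abs, abs_div, abs_of_nonneg (bump_nonneg _), Nat.abs_cast]
        gcongr
        exact bump_le_one _
  · intro n hn
    have : (n : ℝ) ≤ 0 := mod_cast hn
    rw [hyperRow, if_neg (not_lt.2 this)]
  · intro n hn
    apply hψ.hyperRow_eq_zero hL0
    intro h'
    have : (M : ℝ) < n := mod_cast hn
    linarith [h'.2]

lemma IsWindow.norm_axis_sub_le (hψ : IsWindow ψ R) (hL : 1 ≤ L) (hRL : log R ≤ L) :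
    ‖2 * (∑' m : ℤ, hyperInt ψ L 0 m) - hyperInt ψ L 0 0 -
      ((∫ w, 2 * w * ψ w * (2 * log w + 2 * γ) : ℝ) : ℂ)‖ ≤
      16 * ∫ w, |ψ w| := by
  have hL0 : 0 < L := by linarith
  obtain ⟨M, hM⟩ := exists_nat_ge (exp (2 * L) * R)
  have hi : ∀ f : ℝ → ℝ, Measurable f → (∃ C, ∀ w ∈ Set.Icc 1 R, |f w| ≤ C) →
      Integrable fun w => windowDiv ψ 0 w * (f w : ℂ) := by
    rintro f hf ⟨C, hC⟩
    have : (fun w => windowDiv ψ 0 w * (f w : ℂ)) = fun w => windowDiv ψ 0 w *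
        (((Set.Icc 1 R).indicator f w : ℝ) : ℂ) := by
      ext w
      by_cases hw : w ∈ Set.Icc 1 R
      · rw [indicator_of_mem hw]
      · rw [hψ.windowDiv_eq_zero 0 hw, zero_mul, zero_mul]
    rw [this]
    refine (hψ.integrable_windowDiv 0).mul_bdd (c := |C|)
      (Complex.measurable_ofReal.comp (hf.indicator measurableSet_Icc)).aestronglyMeasurable
      (.of_forall fun w => ?_)
    rw [norm_real, norm_eq_abs]
    by_cases hw : w ∈ Set.Icc 1 R
    · rw [indicator_of_mem hw]
      exact (hC w hw).trans (le_abs_self C)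
    · rw [indicator_of_notMem hw]
      simp
  set S : ℝ → ℝ := fun w => ∑ a ∈ Icc 1 M, bump (log (a / w) / L) / (a : ℝ) with hS
  set B : ℝ := ∫ θ, bump (θ / L) with hB
  have iS : Integrable fun w => windowDiv ψ 0 w * (S w : ℂ) := by
    refine hi S ?_ ⟨∑ a ∈ Icc 1 M, 1 / (a : ℝ), fun w _ => ?_⟩
    · have := bump_continuous.measurable
      fun_prop
    · refine (abs_sum_le_sum_abs _ _).trans (sum_le_sum fun a ha => ?_)
      rw [abs_div, abs_of_nonneg (bump_nonneg _), Nat.abs_cast]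
      gcongr
      exact bump_le_one _
  have il : Integrable fun w => windowDiv ψ 0 w * ((2 * log w + 2 * γ : ℝ) : ℂ) := by
    refine hi _ (by fun_prop) ⟨2 * log R + |2 * γ|, fun w hw => ?_⟩
    refine (abs_add_le _ _).trans ?_
    rw [abs_of_nonneg (by linarith [log_nonneg hw.1])]
    gcongr
    · linarith [hw.1]
    · exact hw.2
  have e1 := hψ.tsum_hyperInt_zero hL hM
  have e2 : hyperInt ψ L 0 0 = (B : ℂ) * ∫ w, windowDiv ψ 0 w := by
    rw [hyperInt]
    simp only [zero_mul, add_zero]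
    rw [integral_mul_const, integral_complex_ofReal, windowHat_apply]
    simp [hB]
  have e3 : ((∫ w, 2 * w * ψ w * (2 * log w + 2 * γ) : ℝ) : ℂ) =
      ∫ w, windowDiv ψ 0 w * ((2 * log w + 2 * γ : ℝ) : ℂ) := by
    rw [← integral_complex_ofReal]
    congr 1
    ext w
    simp [windowDiv]
  rw [e1, e2, e3, ← integral_const_mul, ← integral_const_mul, ← integral_sub (iS.const_mul 2)
    ((hψ.integrable_windowDiv 0).const_mul _), ← integral_sub _ il]
  · rw [← integral_const_mul]
    refine norm_integral_le_of_norm_le (hψ.integrable.abs.const_mul 16) (.of_forall fun w => ?_)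
    by_cases hw : w ∈ Set.Icc 1 R
    · have hw0 : 0 < w := by linarith [hw.1]
      have hb := abs_axis_bracket_le (w := w) hw.1 hL ((log_le_log hw0 hw.2).trans hRL) (M := M)
        (by rw [mul_comm]; exact le_trans (by gcongr; exact hw.2) hM)
      have : 2 * (windowDiv ψ 0 w * (S w : ℂ)) - B * windowDiv ψ 0 w -
          windowDiv ψ 0 w * ((2 * log w + 2 * γ : ℝ) : ℂ) =
          ((2 * w * ψ w * (2 * S w - B - 2 * log w - 2 * γ) : ℝ) : ℂ) := by
        rw [windowDiv]
        push_cast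
        ring
      rw [this, norm_real, norm_eq_abs, abs_mul, abs_mul, abs_of_pos (by linarith)]
      calc 2 * w * |ψ w| * _ ≤ 2 * w * |ψ w| * (8 / w) := by gcongr
        _ = 16 * |ψ w| := by field_simp; ring
    · rw [hψ.windowDiv_eq_zero 0 hw]
      simp
  · exact (iS.const_mul 2).sub ((hψ.integrable_windowDiv 0).const_mul _)

end

section

variable {ψ : ℝ → ℝ} {R L : ℝ}

lemma card_fiber_succ_mul (n : ℕ) :
    Nat.card ((fun p : ℕ × ℕ => (p.1 + 1) * (p.2 + 1)) ⁻¹' {n}) = n.divisors.card := by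
  rw [card_divisors_eq_card_divisorsAntidiagonal, ← Fintype.card_coe, ← Nat.card_eq_fintype_card]
  refine Nat.card_congr ⟨fun p => ⟨(p.1.1 + 1, p.1.2 + 1), ?_⟩,
    fun p => ⟨(p.1.1 - 1, p.1.2 - 1), ?_⟩, fun p => ?_, fun p => ?_⟩
  · have : (p.1.1 + 1) * (p.1.2 + 1) = n := p.2
    rw [Nat.mem_divisorsAntidiagonal]
    exact ⟨this, by rw [← this]; positivity⟩
  · have h1 := Nat.left_ne_zero_of_mem_divisorsAntidiagonal p.2
    have h2 := Nat.right_ne_zero_of_mem_divisorsAntidiagonal p.2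
    have h3 := (Nat.mem_divisorsAntidiagonal.1 p.2).1
    change (p.1.1 - 1 + 1) * (p.1.2 - 1 + 1) = n
    rwa [Nat.sub_add_cancel (Nat.pos_of_ne_zero h1), Nat.sub_add_cancel (Nat.pos_of_ne_zero h2)]
  · simp
  · have h1 := Nat.left_ne_zero_of_mem_divisorsAntidiagonal p.2
    have h2 := Nat.right_ne_zero_of_mem_divisorsAntidiagonal p.2
    refine Subtype.ext (Prod.ext ?_ ?_)
    · exact Nat.sub_add_cancel (Nat.pos_of_ne_zero h1)
    · exact Nat.sub_add_cancel (Nat.pos_of_ne_zero h2)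

lemma hasSum_card_divisors_mul {f : ℕ → ℂ}
    (hf : Summable fun p : ℕ × ℕ => f ((p.1 + 1) * (p.2 + 1))) :
    HasSum (fun n => (n.divisors.card : ℂ) * f n) (∑' p : ℕ × ℕ, f ((p.1 + 1) * (p.2 + 1))) := by
  have := hf.hasSum.tsum_fiberwise (fun p : ℕ × ℕ => (p.1 + 1) * (p.2 + 1))
  have e : (fun n => (n.divisors.card : ℂ) * f n) = fun c =>
      ∑' (b : ((fun p : ℕ × ℕ => (p.1 + 1) * (p.2 + 1)) ⁻¹' {c})),
        f ((b.1.1 + 1) * (b.1.2 + 1)) := by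
    ext n
    rw [← card_fiber_succ_mul, ← nsmul_eq_mul, ← tsum_const]
    exact tsum_congr fun b => (congrArg f b.2).symm
  rw [e]
  exact this

/-- The kernel `∫ Φ(2 √x cosh θ) dθ` with `Φ` the Fourier transform of `2 w ψ(w)`. -/
def hyperKernel (ψ : ℝ → ℝ) (x : ℝ) : ℂ := ∫ θ, windowHat ψ 0 (2 * √x * cosh θ)

lemma IsWindow.tendsto_hyperInt (hψ : IsWindow ψ R) {h m : ℝ} (hh : 0 < h) (hm : 0 < m) :
    Tendsto (fun L => hyperInt ψ L h m) atTop (𝓝 (hyperKernel ψ (h * m))) := by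
  obtain ⟨C, hC, hb⟩ := hψ.exists_norm_windowHat_cosh_le
  simp only [hyperInt_pos_eq ψ _ hh hm]
  apply tendsto_integral_filter_of_dominated_convergence
    (fun θ => C / (h * m) ^ (3 / 2 : ℝ) * ((cosh θ)⁻¹) ^ 3)
  · refine .of_forall fun L => Continuous.aestronglyMeasurable ?_
    have := bump_continuous
    have := hψ.continuous_windowHat 0
    fun_prop
  · refine .of_forall fun L => .of_forall fun θ => ?_
    rw [norm_mul, norm_real, norm_of_nonneg (bump_nonneg _)]
    exact (mul_le_of_le_one_left (norm_nonneg _) (bump_le_one _)).trans (hb _ _ (by positivity))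
  · exact integrable_inv_cosh_pow_three.const_mul _
  · refine .of_forall fun θ => ?_
    refine tendsto_const_nhds.congr' ?_
    have : Tendsto (fun L => (θ + log (h / m) / 2) / L) atTop (𝓝 0) :=
      tendsto_const_nhds.div_atTop tendsto_id
    filter_upwards [(this.abs).eventually (Iic_mem_nhds (by norm_num : |(0:ℝ)| < 1))] with L hL
    rw [bump_eq_one hL, Complex.ofReal_one, one_mul]

lemma summable_succ_mul_rpow :
    Summable fun p : ℕ × ℕ => 1 / ((p.1 + 1 : ℝ) * (p.2 + 1)) ^ (3 / 2 : ℝ) := by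
  have h1 : Summable fun n : ℕ => 1 / (n + 1 : ℝ) ^ (3 / 2 : ℝ) := by
    have := (summable_nat_add_iff 1).2 (summable_one_div_nat_rpow.2 (by norm_num : (1:ℝ) < 3 / 2))
    simpa using this
  refine (h1.mul_of_nonneg h1 (fun n => by positivity) (fun n => by positivity)).congr fun p => ?_
  rw [mul_rpow (by positivity) (by positivity), one_div_mul_one_div]

lemma IsWindow.exists_norm_hyperKernel_le (hψ : IsWindow ψ R) : ∃ C, 0 ≤ C ∧ ∀ h m : ℝ, 0 < h →
    0 < m → ‖hyperKernel ψ (h * m)‖ ≤ C / (h * m) ^ (3 / 2 : ℝ) := by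
  obtain ⟨C, hC, hb⟩ := hψ.exists_norm_hyperInt_pos_le
  exact ⟨C, hC, fun h m hh hm => le_of_tendsto (hψ.tendsto_hyperInt hh hm).norm
    (.of_forall fun L => hb L h m hh hm)⟩

lemma IsWindow.summable_hyperKernel (hψ : IsWindow ψ R) :
    Summable fun p : ℕ × ℕ => hyperKernel ψ ((p.1 + 1 : ℝ) * (p.2 + 1)) := by
  obtain ⟨C, hC, hb⟩ := hψ.exists_norm_hyperKernel_le
  refine Summable.of_norm_bounded (summable_succ_mul_rpow.mul_left C) fun p => ?_
  rw [mul_one_div]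
  exact hb _ _ (by positivity) (by positivity)

lemma IsWindow.tsum_hyperKernel_add_conj (hψ : IsWindow ψ R) :
    ∑' p : ℕ × ℕ, (hyperKernel ψ ((p.1 + 1) * (p.2 + 1)) +
      conj (hyperKernel ψ ((p.1 + 1) * (p.2 + 1)))) =
      ((∑' n : ℕ, τ n * (2 * (hyperKernel ψ n).re) : ℝ) : ℂ) := by
  have e : ∀ p : ℕ × ℕ, hyperKernel ψ ((p.1 + 1) * (p.2 + 1)) +
      conj (hyperKernel ψ ((p.1 + 1) * (p.2 + 1))) =
      (fun n : ℕ => ((2 * (hyperKernel ψ n).re : ℝ) : ℂ)) ((p.1 + 1) * (p.2 + 1)) := fun p => by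
    simp only [Complex.add_conj, Nat.cast_mul, Nat.cast_add, Nat.cast_one]
  have h := hψ.summable_hyperKernel
  have hs := h.add (Complex.hasSum_conj'.2 h.hasSum |>.summable)
  have := (hasSum_card_divisors_mul (f := fun n : ℕ => ((2 * (hyperKernel ψ n).re : ℝ) : ℂ))
    (hs.congr e)).tsum_eq
  rw [tsum_congr e]
  refine this.symm.trans ?_
  push_cast
  rfl

/-- A smoothed Voronoi summation formula for the divisor function, up to a bounded error. -/
theorem exists_norm_voronoi_le : ∃ C, 0 ≤ C ∧ ∀ (ψ : ℝ → ℝ) (R : ℝ), IsWindow ψ R → 1 ≤ R →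
    ∀ M : ℕ, R ^ 2 ≤ M →
    |∑ n ∈ Icc 1 M, τ n * ψ (√n) -
      (∫ w, 2 * w * ψ w * (2 * log w + 2 * γ)) -
      ∑' n : ℕ, τ n * (2 * (hyperKernel ψ n).re)| ≤ C * ∫ w, |ψ w| := by
  obtain ⟨C₀, hC₀, hneg⟩ := exists_norm_hyperInt_neg_le
  set Z : ℝ := ∑' p : ℕ × ℕ, 1 / ((p.1 + 1 : ℝ) * (p.2 + 1)) ^ (3 / 2 : ℝ) with hZ
  have hZ0 : 0 ≤ Z := tsum_nonneg fun p => by positivity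
  refine ⟨16 + 2 * C₀ * Z, by positivity, fun ψ R hψ hR M hM => ?_⟩
  set I := ∫ w, |ψ w| with hI
  set A : ℂ := ∑ n ∈ Icc 1 M, (n.divisors.card : ℂ) * ψ (√n) with hA
  set B : ℝ := ∫ w, 2 * w * ψ w * (2 * log w + 2 * γ) with hB
  set P : ℝ → ℂ := fun L => ∑' p : ℕ × ℕ, (hyperInt ψ L (p.1 + 1) (p.2 + 1) +
    conj (hyperInt ψ L (p.1 + 1) (p.2 + 1))) with hP
  obtain ⟨C₁, hC₁, hpos⟩ := hψ.exists_norm_hyperInt_pos_le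
  have hsum1 : ∀ L, Summable fun p : ℕ × ℕ => hyperInt ψ L (p.1 + 1 : ℝ) (p.2 + 1) := fun L => by
    refine Summable.of_norm_bounded (summable_succ_mul_rpow.mul_left C₁) fun p => ?_
    rw [mul_one_div]
    exact hpos _ _ _ (by positivity) (by positivity)
  have key : ∀ L, 1 ≤ L → log R ≤ L → ‖A - B - P L‖ ≤ (16 + 2 * C₀ * Z) * I := by
    intro L hL hRL
    obtain ⟨M', hM'⟩ := exists_nat_ge (exp (2 * L) * R)
    have hA' : A = ∑ n ∈ Icc 1 (max M M'), (n.divisors.card : ℂ) * ψ (√n) := by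
      refine sum_subset (Icc_subset_Icc_right (le_max_left _ _)) fun n hn hn' => ?_
      have h1 : M < n := by
        simp only [mem_Icc] at hn hn'
        omega
      rw [hψ.eq_zero_of_lt hR (hM.trans_lt (mod_cast h1)), ofReal_zero, mul_zero]
    have hA2 : A = ∑' h : ℤ, ∑' m : ℤ, hyperInt ψ L h m := by
      rw [hA']
      exact hψ.sum_card_divisors_eq_tsum hR hL hRL (hM'.trans (mod_cast le_max_right _ _))
    have hsp := tsum_tsum_int_symm (T := fun a b => hyperInt ψ L a b) (hψ.summable_hyperInt hL)
      fun a b => hyperInt_comm L a b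
    have hax := hψ.norm_axis_sub_le hL hRL
    push_cast at hsp
    have hN : ∀ p : ℕ × ℕ, ‖hyperInt ψ L (-(p.1 + 1 : ℝ)) (p.2 + 1)‖ ≤
        C₀ * I * (1 / ((p.1 + 1 : ℝ) * (p.2 + 1)) ^ (3 / 2 : ℝ)) := fun p => by
      rw [mul_one_div]
      exact hneg ψ R L _ _ hψ hL (by positivity) (by positivity)
    have hsymm : ∀ p : ℕ × ℕ, hyperInt ψ L (p.1 + 1 : ℝ) (-(p.2 + 1)) =
        conj (hyperInt ψ L (-(p.1 + 1 : ℝ)) (p.2 + 1)) := fun p => by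
      rw [← hyperInt_neg_neg, neg_neg]
    have hsumN := Summable.of_norm_bounded (summable_succ_mul_rpow.mul_left (C₀ * I)) hN
    have hsplit : ∑' p : ℕ × ℕ, (hyperInt ψ L (p.1 + 1) (p.2 + 1) +
        hyperInt ψ L (p.1 + 1) (-(p.2 + 1)) + (hyperInt ψ L (-(p.1 + 1)) (p.2 + 1) +
        hyperInt ψ L (-(p.1 + 1)) (-(p.2 + 1)))) = P L + ∑' p : ℕ × ℕ,
        (conj (hyperInt ψ L (-(p.1 + 1 : ℝ)) (p.2 + 1)) +
          hyperInt ψ L (-(p.1 + 1 : ℝ)) (p.2 + 1)) := by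
      rw [hP, ← Summable.tsum_add]
      · refine tsum_congr fun p => ?_
        rw [hsymm, hyperInt_neg_neg]
        ring
      · exact (hsum1 L).add (Complex.hasSum_conj'.2 (hsum1 L).hasSum |>.summable)
      · exact (Complex.hasSum_conj'.2 hsumN.hasSum |>.summable).add hsumN
    have hmix : ‖∑' p : ℕ × ℕ, (conj (hyperInt ψ L (-(p.1 + 1 : ℝ)) (p.2 + 1)) +
          hyperInt ψ L (-(p.1 + 1 : ℝ)) (p.2 + 1))‖ ≤ 2 * C₀ * I * Z := by
      rw [hZ, ← tsum_mul_left]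
      refine tsum_of_norm_bounded (summable_succ_mul_rpow.mul_left (2 * C₀ * I)).hasSum
        fun p => (norm_add_le _ _).trans ?_
      rw [RCLike.norm_conj]
      linarith [hN p]
    rw [hA2, hsp, hsplit]
    calc _ = ‖(2 * (∑' m : ℤ, hyperInt ψ L 0 m) - hyperInt ψ L 0 0 - B) + _‖ := by
          congr 1
          ring
      _ ≤ _ := norm_add_le _ _
      _ ≤ 16 * I + 2 * C₀ * I * Z := add_le_add hax hmix
      _ = _ := by ring
  have hlim : Tendsto P atTop (𝓝 (∑' p : ℕ × ℕ, (hyperKernel ψ ((p.1 + 1) * (p.2 + 1)) +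
      conj (hyperKernel ψ ((p.1 + 1) * (p.2 + 1)))))) := by
    refine tendsto_tsum_of_dominated_convergence (summable_succ_mul_rpow.mul_left (2 * C₁))
      (fun p => ?_) (.of_forall fun L p => ?_)
    · have := hψ.tendsto_hyperInt (h := (p.1:ℝ) + 1) (m := p.2 + 1) (by positivity) (by positivity)
      exact this.add ((Complex.continuous_conj.tendsto _).comp this)
    · refine (norm_add_le _ _).trans ?_
      rw [RCLike.norm_conj]
      have := hpos L (p.1 + 1 : ℝ) (p.2 + 1) (by positivity) (by positivity)
      rw [mul_one_div, mul_div_assoc]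
      linarith
  have hbound : ‖A - B - ∑' p : ℕ × ℕ, (hyperKernel ψ ((p.1 + 1) * (p.2 + 1)) +
      conj (hyperKernel ψ ((p.1 + 1) * (p.2 + 1))))‖ ≤ (16 + 2 * C₀ * Z) * I := by
    refine le_of_tendsto (hlim.const_sub (A - B)).norm ?_
    filter_upwards [eventually_ge_atTop 1, eventually_ge_atTop (log R)] with L h1 h2
    exact key L h1 h2
  rw [hψ.tsum_hyperKernel_add_conj] at hbound
  rw [← norm_eq_abs, ← norm_real]
  push_cast at hbound ⊢
  exact hbound

end

section

variable {ψ : ℝ → ℝ} {R L : ℝ}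

lemma IsWindow.integrable_mul_windowHat_cosh (hψ : IsWindow ψ R) (j : ℕ) {c : ℝ} (hc : 0 < c)
    {f : ℝ → ℝ} (hf : Continuous f) {A : ℝ} (hA : ∀ θ, |f θ| ≤ A * cosh θ) :
    Integrable fun θ => (f θ : ℂ) * windowHat ψ j (c * cosh θ) := by
  obtain ⟨C, hC, hb⟩ := hψ.exists_norm_windowHat_le j 2
  refine (integrable_inv_cosh.const_mul (A * (C / c ^ 2))).mono'
    (Continuous.aestronglyMeasurable ?_) (.of_forall fun θ => ?_)
  · have := hψ.continuous_windowHat j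
    fun_prop
  · have h0 := cosh_pos θ
    have h1 := hb (c * cosh θ)
    rw [abs_of_pos (by positivity)] at h1
    rw [norm_mul, norm_real, norm_eq_abs]
    have hA0 : 0 ≤ A := by
      have := (abs_nonneg _).trans (hA θ)
      by_contra! h
      nlinarith
    calc |f θ| * ‖windowHat ψ j (c * cosh θ)‖ ≤ (A * cosh θ) * (C / (c * cosh θ) ^ 2) := by
          gcongr
          · exact hA θ
          · rw [le_div_iff₀ (by positivity)]
            linarith
      _ = _ := by field_simp

/-- Replacing `dθ` by `cosh (θ / 2) dθ` in the hyperbolic kernel costs little. -/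
lemma exists_norm_integral_windowHat_cosh_sub_le : ∃ C, 0 ≤ C ∧ ∀ (ψ : ℝ → ℝ) (R c B : ℝ),
    IsWindow ψ R → 0 < c → (∀ s, c ≤ s → ‖windowHat ψ 1 s‖ ≤ B) →
    ‖(∫ θ, windowHat ψ 0 (c * cosh θ)) - ∫ θ, (cosh (θ / 2) : ℂ) * windowHat ψ 0 (c * cosh θ)‖ ≤
      C * B / c := by
  have hhalf : Integrable fun θ => (cosh (θ / 2))⁻¹ := integrable_inv_cosh.comp_div (by norm_num)
  refine ⟨∫ θ, (cosh (θ / 2))⁻¹, integral_nonneg fun θ => by have := cosh_pos (θ / 2); positivity,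
    fun ψ R c B hψ hc hB => ?_⟩
  set r : ℝ → ℝ := fun θ => tanh (θ / 4) * (cosh (θ / 2))⁻¹ with hr
  set r' : ℝ → ℝ := fun θ => (1 - tanh (θ / 4) ^ 2) * (1 / 4) * (cosh (θ / 2))⁻¹ +
    tanh (θ / 4) * (-(tanh (θ / 2) * (cosh (θ / 2))⁻¹) * (1 / 2)) with hr'
  have hd : ∀ θ, HasDerivAt r (r' θ) θ := fun θ => by
    have h1 : HasDerivAt (fun θ => (cosh (θ / 2))⁻¹)
        (-(tanh (θ / 2) * (cosh (θ / 2))⁻¹) * (1 / 2)) θ :=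
      HasDerivAt.comp (h₂ := fun θ => (cosh θ)⁻¹) θ (hasDerivAt_inv_cosh (θ / 2))
        ((hasDerivAt_id θ).div_const 2)
    exact ((hasDerivAt_tanh' (θ / 4)).comp θ ((hasDerivAt_id θ).div_const 4)).mul h1
  have hv : ∀ θ, HasDerivAt (fun θ => windowHat ψ 1 (c * cosh θ))
      (windowHat ψ 0 (c * cosh θ) * ((c * sinh θ : ℝ) : ℂ)) θ := fun θ => by
    have := (hψ.hasDerivAt_windowHat 0 (c * cosh θ)).scomp θ ((hasDerivAt_cosh θ).const_mul c)
    refine this.congr_deriv ?_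
    rw [real_smul, mul_comm]
  have ht : ∀ θ : ℝ, |tanh θ| ≤ 1 := fun θ => abs_le.2 ⟨(neg_one_lt_tanh θ).le, (tanh_lt_one θ).le⟩
  have hrb : ∀ θ, |r θ| ≤ (cosh (θ / 2))⁻¹ := fun θ => by
    have := cosh_pos (θ / 2)
    rw [hr, abs_mul, abs_of_pos (by positivity : 0 < (cosh (θ / 2))⁻¹)]
    exact mul_le_of_le_one_left (by positivity) (ht _)
  have hrb' : ∀ θ, |r' θ| ≤ (cosh (θ / 2))⁻¹ := fun θ => by
    have := cosh_pos (θ / 2)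
    have e : r' θ = ((1 - tanh (θ / 4) ^ 2) * (1 / 4) - tanh (θ / 4) * tanh (θ / 2) * (1 / 2)) *
        (cosh (θ / 2))⁻¹ := by rw [hr']; ring
    rw [e, abs_mul, abs_of_pos (by positivity : 0 < (cosh (θ / 2))⁻¹)]
    refine mul_le_of_le_one_left (by positivity) ?_
    have h1 := abs_le.1 (ht (θ / 4))
    have h3 : |tanh (θ / 4) * tanh (θ / 2)| ≤ 1 := by
      rw [abs_mul]
      exact mul_le_one₀ (ht _) (abs_nonneg _) (ht _)
    have h4 := abs_le.1 h3
    rw [abs_le]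
    constructor <;> nlinarith
  have hcr : Continuous r := continuous_iff_continuousAt.2 fun θ => (hd θ).continuousAt
  have hcr' : Continuous r' := by
    have := continuous_tanh'
    have := continuous_inv_cosh
    have h2 : Continuous fun θ => (cosh (θ / 2))⁻¹ := this.comp (continuous_id.div_const 2)
    fun_prop
  have hle1 : ∀ θ : ℝ, (cosh (θ / 2))⁻¹ ≤ cosh θ := fun θ =>
    (inv_le_one_of_one_le₀ (one_le_cosh _)).trans (one_le_cosh θ)
  have hid : ∀ θ, r θ * (c * sinh θ) = 2 * c * (cosh (θ / 2) - 1) := fun θ => by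
    have e1 : sinh θ = 2 * sinh (θ / 2) * cosh (θ / 2) := by rw [← sinh_two_mul]; ring_nf
    have e2 : sinh (θ / 2) = 2 * sinh (θ / 4) * cosh (θ / 4) := by rw [← sinh_two_mul]; ring_nf
    have e3 : cosh (θ / 2) = 1 + 2 * sinh (θ / 4) ^ 2 := by
      have := cosh_two_mul (θ / 4)
      rw [cosh_sq] at this
      rw [show θ / 2 = 2 * (θ / 4) by ring, this]
      ring
    have := cosh_pos (θ / 4)
    have := cosh_pos (θ / 2)
    rw [hr]
    simp only []
    rw [e1, tanh_eq_sinh_div_cosh, e2]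
    field_simp
    rw [e3]
    ring
  have hhc : ∀ θ : ℝ, cosh (θ / 2) ≤ cosh θ := fun θ => by
    rw [cosh_le_cosh, abs_div, abs_two]
    linarith [abs_nonneg θ]
  have i1 := hψ.integrable_mul_windowHat_cosh 1 hc hcr (A := 1) fun θ => by
    rw [one_mul]; exact (hrb θ).trans (hle1 θ)
  have i2 := hψ.integrable_mul_windowHat_cosh 1 hc hcr' (A := 1) fun θ => by
    rw [one_mul]; exact (hrb' θ).trans (hle1 θ)
  have j1 := hψ.integrable_mul_windowHat_cosh 0 hc (f := fun _ => 1) continuous_const (A := 1)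
    fun θ => by rw [one_mul, abs_one]; exact one_le_cosh θ
  have j2 := hψ.integrable_mul_windowHat_cosh 0 hc (f := fun θ => cosh (θ / 2)) (by fun_prop)
    (A := 1) fun θ => by rw [one_mul, abs_of_pos (cosh_pos _)]; exact hhc θ
  have e3 : ∀ θ, (r θ : ℂ) * (windowHat ψ 0 (c * cosh θ) * ((c * sinh θ : ℝ) : ℂ)) =
      2 * c * ((cosh (θ / 2) : ℂ) * windowHat ψ 0 (c * cosh θ) -
        ((1 : ℝ) : ℂ) * windowHat ψ 0 (c * cosh θ)) := fun θ => by
    have := congrArg (Complex.ofReal) (hid θ)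
    push_cast at this ⊢
    linear_combination windowHat ψ 0 (c * cosh θ) * this
  have i3 : Integrable fun θ =>
      (r θ : ℂ) * (windowHat ψ 0 (c * cosh θ) * ((c * sinh θ : ℝ) : ℂ)) := by
    simp_rw [e3]
    exact (j2.sub j1).const_mul _
  have hparts := integral_mul_deriv_eq_deriv_mul_of_integrable (u := fun θ => (r θ : ℂ))
    (u' := fun θ => (r' θ : ℂ)) (fun θ _ => (hd θ).ofReal_comp) (fun θ _ => hv θ) i3 i2 i1
  simp_rw [e3] at hparts
  rw [integral_const_mul, integral_sub j2 j1] at hparts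
  simp only [Complex.ofReal_one, one_mul] at hparts
  have hfin : (∫ θ, windowHat ψ 0 (c * cosh θ)) -
      ∫ θ, (cosh (θ / 2) : ℂ) * windowHat ψ 0 (c * cosh θ) =
      (2 * c : ℂ)⁻¹ * ∫ θ, (r' θ : ℂ) * windowHat ψ 1 (c * cosh θ) := by
    have hc' : (2 * c : ℂ) ≠ 0 := by simpa using hc.ne'
    rw [eq_inv_mul_iff_mul_eq₀ hc']
    linear_combination -hparts
  have hB0 : 0 ≤ B := (norm_nonneg _).trans (hB c le_rfl)
  rw [hfin, norm_mul]
  have hn : ‖(2 * c : ℂ)⁻¹‖ = 1 / (2 * c) := by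
    rw [norm_inv, norm_mul, norm_real, norm_of_nonneg hc.le]
    simp
  have hI : ‖∫ θ, (r' θ : ℂ) * windowHat ψ 1 (c * cosh θ)‖ ≤ (∫ θ, (cosh (θ / 2))⁻¹) * B := by
    rw [← integral_mul_const]
    refine norm_integral_le_of_norm_le (hhalf.mul_const B) (.of_forall fun θ => ?_)
    rw [norm_mul, norm_real, norm_eq_abs]
    have := cosh_pos (θ / 2)
    exact mul_le_mul (hrb' θ) (hB _ (le_mul_of_one_le_right hc.le (one_le_cosh θ))) (norm_nonneg _)
      (by positivity)
  rw [hn]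
  have h0 := (norm_nonneg _).trans hI
  calc 1 / (2 * c) * _ ≤ 1 / c * ((∫ θ, (cosh (θ / 2))⁻¹) * B) := by
        gcongr
        linarith
    _ = _ := by ring

end

section

variable {ψ : ℝ → ℝ} {R L : ℝ}

lemma integral_mul_cosh_half (F : ℝ → ℂ) :
    ∫ θ, (cosh (θ / 2) : ℂ) * F (cosh θ) = ∫ y, F (1 + y ^ 2 / 2) := by
  have hd : ∀ θ ∈ Set.univ, HasDerivWithinAt (fun θ => 2 * sinh (θ / 2)) (cosh (θ / 2))
      Set.univ θ := fun θ _ => by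
    have := (((hasDerivAt_sinh (θ / 2)).comp θ ((hasDerivAt_id θ).div_const 2)).const_mul 2)
    refine (this.congr_deriv ?_).hasDerivWithinAt
    ring
  have hinj : Set.InjOn (fun θ => 2 * sinh (θ / 2)) Set.univ := fun a _ b _ h => by
    have : sinh (a / 2) = sinh (b / 2) := by simpa using h
    have := sinh_injective this
    linarith
  have himg : (fun θ => 2 * sinh (θ / 2)) '' Set.univ = Set.univ := by
    rw [Set.image_univ]
    refine Set.range_eq_univ.2 fun y => ?_
    obtain ⟨t, ht⟩ := sinh_surjective (y / 2)
    exact ⟨2 * t, by simp only [mul_div_cancel_left₀ t (two_ne_zero' ℝ), ht]; ring⟩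
  have := integral_image_eq_integral_abs_deriv_smul MeasurableSet.univ hd hinj
    (fun y => F (1 + y ^ 2 / 2))
  rw [himg, setIntegral_univ, setIntegral_univ] at this
  rw [this]
  refine integral_congr_ae (.of_forall fun θ => ?_)
  have e : cosh θ = 1 + (2 * sinh (θ / 2)) ^ 2 / 2 := by
    have := cosh_two_mul (θ / 2)
    rw [cosh_sq] at this
    rw [show θ = 2 * (θ / 2) by ring, this]
    ring_nf
  simp only []
  rw [abs_of_pos (cosh_pos _), ← e, real_smul, Complex.ofReal_cosh]

lemma one_div_I_mul_cpow_half {t : ℝ} (ht : 0 < t) :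
    (1 / (I * t)) ^ (1 / 2 : ℂ) = cexp (-(π / 4 : ℝ) * I) / (√t : ℂ) := by
  have h1 : (1 / (I * t) : ℂ) = ((1 / t : ℝ) : ℂ) * cexp (((-(π / 2) : ℝ) : ℂ) * I) := by
    have : cexp (((-(π / 2) : ℝ) : ℂ) * I) = -I := by
      rw [Complex.exp_mul_I, ← Complex.ofReal_cos, ← Complex.ofReal_sin, cos_neg, sin_neg,
        cos_pi_div_two, sin_pi_div_two]
      simp
    have ht' : (t : ℂ) ≠ 0 := mod_cast ht.ne'
    rw [this, div_eq_iff (mul_ne_zero Complex.I_ne_zero ht')]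
    push_cast
    field_simp
    simp
  have h2 : (1 / (I * t) : ℂ) ≠ 0 := by
    have ht' : (t : ℂ) ≠ 0 := mod_cast ht.ne'
    exact one_div_ne_zero (mul_ne_zero Complex.I_ne_zero ht')
  have hlog : Complex.log (1 / (I * t)) = ((-log t : ℝ) : ℂ) + ((-(π / 2) : ℝ) : ℂ) * I := by
    have e : (1 / (I * t) : ℂ) = cexp (((-log t : ℝ) : ℂ) + ((-(π / 2) : ℝ) : ℂ) * I) := by
      rw [Complex.exp_add, ← ofReal_exp, exp_neg, exp_log ht, h1, one_div]
    rw [e, Complex.log_exp]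
    · simp
      linarith [pi_pos]
    · simp
      linarith [pi_pos]
  rw [Complex.cpow_def_of_ne_zero h2, hlog]
  have hs : (√t : ℂ) = cexp ((log t / 2 : ℝ) : ℂ) := by
    rw [← ofReal_exp, ← log_sqrt ht.le, exp_log (sqrt_pos.2 ht)]
  rw [hs, ← Complex.exp_sub]
  congr 1
  push_cast
  ring

/-- Fresnel-type evaluation of the main part of the hyperbolic kernel. -/
lemma IsWindow.integral_cosh_half_mul_windowHat (hψ : IsWindow ψ R) {c : ℝ} (hc : 0 < c) :
    ∫ θ, (cosh (θ / 2) : ℂ) * windowHat ψ 0 (c * cosh θ) = cexp (-(π / 4 : ℝ) * I) / (√c : ℂ) *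
        ∫ w, ((2 * √w * ψ w : ℝ) : ℂ) * cexp (((-2 * π * w * c : ℝ) : ℂ) * I) := by
  rw [integral_mul_cosh_half (fun y => windowHat ψ 0 (c * y))]
  set G : ℝ → ℝ → ℂ := fun ε y => cexp (-((π * ε : ℝ) : ℂ) * (y : ℂ) ^ 2) *
    windowHat ψ 0 (c * (1 + y ^ 2 / 2)) with hG
  obtain ⟨C, hC, hb⟩ := hψ.exists_norm_windowHat_le 0 1
  have hint : Integrable fun y => windowHat ψ 0 (c * (1 + y ^ 2 / 2)) := by
    refine (integrable_inv_one_add_sq.const_mul (2 * C / c)).mono'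
      (Continuous.aestronglyMeasurable ?_) (.of_forall fun y => ?_)
    · have := hψ.continuous_windowHat 0
      fun_prop
    · have := hb (c * (1 + y ^ 2 / 2))
      rw [pow_one, abs_of_pos (by positivity)] at this
      calc _ ≤ C / (c * (1 + y ^ 2 / 2)) := by
            rw [le_div_iff₀ (by positivity)]; linarith
        _ ≤ C / (c * ((1 + y ^ 2) / 2)) := by
            gcongr
            nlinarith [sq_nonneg y]
        _ = _ := by field_simp
  have hnexp : ∀ z : ℂ, z.re ≤ 0 → ‖cexp z‖ ≤ 1 := fun z hz => by
    rw [Complex.norm_exp]; exact exp_le_one_iff.2 hz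
  have lim1 : Tendsto (fun ε => ∫ y, G ε y) (𝓝[>] 0)
      (𝓝 (∫ y, windowHat ψ 0 (c * (1 + y ^ 2 / 2)))) := by
    apply tendsto_integral_filter_of_dominated_convergence
      (fun y => ‖windowHat ψ 0 (c * (1 + y ^ 2 / 2))‖)
    · refine .of_forall fun ε => Continuous.aestronglyMeasurable ?_
      have := hψ.continuous_windowHat 0
      fun_prop
    · filter_upwards [self_mem_nhdsWithin] with ε hε
      refine .of_forall fun y => ?_
      rw [hG, norm_mul]
      refine mul_le_of_le_one_left (norm_nonneg _) (hnexp _ ?_)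
      have : 0 < ε := hε
      rw [← ofReal_neg, ← ofReal_pow, ← Complex.ofReal_mul, ofReal_re]
      have : 0 ≤ π * ε * y ^ 2 := by positivity
      linarith
    · exact hint.norm
    · refine .of_forall fun y => ?_
      have h : Continuous fun ε => G ε y := by fun_prop
      have := (h.tendsto 0).mono_left (nhdsWithin_le_nhds (s := Set.Ioi 0))
      simpa [hG] using this
  set H : ℝ → ℝ → ℂ := fun ε w => windowDiv ψ 0 w * cexp (((-2 * π * w * c : ℝ) : ℂ) * I) *
    (1 / ((ε : ℂ) + I * (c * w : ℝ))) ^ (1 / 2 : ℂ) with hH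
  have hG_eq : ∀ ε, 0 < ε → ∫ y, G ε y = ∫ w, H ε w := by
    intro ε hε
    have hgauss := (integrable_exp_neg_mul_sq (by positivity : 0 < π * ε))
    have e1 : ∀ y, G ε y = ∫ w, windowDiv ψ 0 w * cexp (((-2 * π * w * c : ℝ) : ℂ) * I) *
        cexp (-(π * ((ε : ℂ) + I * (c * w : ℝ))) * (y : ℂ) ^ 2) := by
      intro y
      rw [hG]
      simp only []
      rw [windowHat_apply, ← integral_const_mul]
      congr 1
      ext w
      have : cexp (-((π * ε : ℝ) : ℂ) * (y : ℂ) ^ 2) *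
          cexp (((-2 * π * w * (c * (1 + y ^ 2 / 2)) : ℝ) : ℂ) * I) =
          cexp (((-2 * π * w * c : ℝ) : ℂ) * I) *
          cexp (-(π * ((ε : ℂ) + I * (c * w : ℝ))) * (y : ℂ) ^ 2) := by
        rw [← Complex.exp_add, ← Complex.exp_add]
        congr 1
        push_cast
        ring
      linear_combination windowDiv ψ 0 w * this
    simp_rw [e1]
    rw [integral_integral_swap]
    · congr 1
      ext w
      rw [integral_const_mul, integral_gaussian_complex]
      · rw [hH]
        congr 2
        have : (π : ℂ) ≠ 0 := mod_cast pi_ne_zero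
        rw [← div_div, div_self this]
      · simp
        positivity
    · have hprod := hgauss.mul_prod (hψ.integrable_windowDiv 0).norm
      refine hprod.mono' ?_ (.of_forall fun p => ?_)
      · refine Continuous.aestronglyMeasurable ?_
        have := hψ.continuous_windowDiv 0
        simp only [Function.uncurry_def]
        fun_prop
      · rw [Function.uncurry_def]
        simp only [norm_mul, norm_exp_ofReal_mul_I, mul_one]
        rw [Complex.norm_exp, mul_comm]
        refine mul_le_mul_of_nonneg_right (exp_le_exp.2 (le_of_eq ?_)) (norm_nonneg _)
        rw [← ofReal_pow, Complex.re_mul_ofReal]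
        simp
  have lim2 : Tendsto (fun ε => ∫ w, H ε w) (𝓝[>] 0) (𝓝 (∫ w, H 0 w)) := by
    apply tendsto_integral_filter_of_dominated_convergence (fun w => ‖windowDiv ψ 0 w‖ * (1 / √c))
    · refine .of_forall fun ε => Measurable.aestronglyMeasurable ?_
      have := (hψ.continuous_windowDiv 0).measurable
      fun_prop
    · filter_upwards [self_mem_nhdsWithin] with ε hε
      refine .of_forall fun w => ?_
      have hε' : 0 < ε := hε
      by_cases hw : w ∈ Set.Icc 1 R
      · rw [hH, norm_mul, norm_mul, norm_exp_ofReal_mul_I, mul_one]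
        refine mul_le_mul_of_nonneg_left ?_ (norm_nonneg _)
        rw [show (1 / 2 : ℂ) = ((1 / 2 : ℝ) : ℂ) by push_cast; rfl, Complex.norm_cpow_real,
          norm_div, norm_one, show 1 / √c = (1 / c) ^ (1 / 2 : ℝ) by
            rw [one_div, one_div, inv_rpow hc.le, sqrt_eq_rpow]]
        apply rpow_le_rpow (by positivity) _ (by norm_num)
        apply one_div_le_one_div_of_le hc
        have h1 := Complex.abs_im_le_norm ((ε : ℂ) + I * (c * w : ℝ))
        have h2 : ((ε : ℂ) + I * (c * w : ℝ)).im = c * w := by simp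
        rw [h2] at h1
        exact (le_mul_of_one_le_right hc.le hw.1).trans ((le_abs_self _).trans h1)
      · rw [hH]
        simp [hψ.windowDiv_eq_zero 0 hw]
    · exact (hψ.integrable_windowDiv 0).norm.mul_const _
    · refine .of_forall fun w => ?_
      by_cases hw : w ∈ Set.Icc 1 R
      · refine (ContinuousAt.tendsto ?_).mono_left nhdsWithin_le_nhds
        rw [hH]
        refine ContinuousAt.mul continuousAt_const ?_
        have hcw : 0 < c * w := mul_pos hc (by linarith [hw.1])
        have hne : ((0 : ℝ) : ℂ) + I * (c * w : ℝ) ≠ 0 := fun h => by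
          have := congrArg Complex.im h
          simp at this
          rcases this with h | h <;> nlinarith [hw.1]
        refine ContinuousAt.cpow ?_ continuousAt_const ?_
        · exact ContinuousAt.div continuousAt_const (by fun_prop) hne
        · rw [Complex.mem_slitPlane_iff]
          right
          rw [one_div, Complex.inv_im]
          have : (((0 : ℝ) : ℂ) + I * (c * w : ℝ)).im ≠ 0 := by
            simp only [ofReal_zero, zero_add, Complex.mul_im, Complex.I_re,
              ofReal_re, Complex.I_im, Complex.ofReal_im]
            linarith
          exact div_ne_zero (neg_ne_zero.2 this) (Complex.normSq_pos.2 hne).ne'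
      · rw [hH]
        simp only [hψ.windowDiv_eq_zero 0 hw, zero_mul]
        exact tendsto_const_nhds
  have heq := tendsto_nhds_unique (lim1.congr' (by
    filter_upwards [self_mem_nhdsWithin] with ε hε using hG_eq ε hε)) lim2
  rw [heq, ← integral_const_mul]
  congr 1
  ext w
  by_cases hw : w ∈ Set.Icc 1 R
  · have hw0 : 0 < w := by linarith [hw.1]
    rw [hH]
    simp only [ofReal_zero, zero_add]
    rw [one_div_I_mul_cpow_half (mul_pos hc hw0), sqrt_mul hc.le, windowDiv, pow_zero, div_one]
    have h1 : (√w : ℂ) ≠ 0 := mod_cast (sqrt_pos.2 hw0).ne'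
    have h2 : (√c : ℂ) ≠ 0 := mod_cast (sqrt_pos.2 hc).ne'
    have h3 : (w : ℂ) = (√w : ℂ) * √w := by rw [← Complex.ofReal_mul, mul_self_sqrt hw0.le]
    push_cast
    rw [h3]
    field_simp
  · rw [hH]
    simp [hψ.windowDiv_eq_zero 0 hw, hψ.eq_zero w hw]

end

section

open scoped FourierTransform ContDiff

variable {ψ : ℝ → ℝ} {R L : ℝ}

/-- The main part of the Voronoi dual term at frequency `2 √n`. -/
def dualTerm (ψ : ℝ → ℝ) (n : ℕ) : ℂ := cexp (-(π / 4 : ℝ) * I) / (√(2 * √n) : ℂ) *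
    ∫ w, ((2 * √w * ψ w : ℝ) : ℂ) * cexp (((-2 * π * w * (2 * √n) : ℝ) : ℂ) * I)

lemma IsWindow.summable_card_divisors_mul_hyperKernel (hψ : IsWindow ψ R) :
    Summable fun n : ℕ => τ n * (2 * (hyperKernel ψ n).re) := by
  have h := hψ.summable_hyperKernel
  set f : ℕ → ℂ := fun n => hyperKernel ψ n with hf
  have hs : Summable fun p : ℕ × ℕ => f ((p.1 + 1) * (p.2 + 1)) := by
    refine h.congr fun p => ?_
    simp only [hf, Nat.cast_mul, Nat.cast_add, Nat.cast_one]
  have h2 := (hasSum_card_divisors_mul (f := f) hs).summable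
  have h3 : Summable fun n : ℕ => ((n.divisors.card : ℂ) * f n).re :=
    (Complex.hasSum_re h2.hasSum).summable
  refine (h3.mul_left 2).congr fun n => ?_
  rw [← Complex.ofReal_natCast, Complex.re_ofReal_mul]
  ring

/-- A smoothed Voronoi summation formula for the divisor function with elementary dual terms. -/
theorem exists_voronoi_dualTerm_le : ∃ C, 0 ≤ C ∧ ∀ (ψ : ℝ → ℝ) (R B : ℝ), IsWindow ψ R → 1 ≤ R →
    (∀ s, 0 < s → ‖windowHat ψ 1 s‖ ≤ B / s ^ (3 / 2 : ℝ)) → ∀ M : ℕ, R ^ 2 ≤ M →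
    Summable (fun n : ℕ => τ n * (2 * (dualTerm ψ n).re)) ∧
    |∑ n ∈ Icc 1 M, τ n * ψ (√n) -
      (∫ w, 2 * w * ψ w * (2 * log w + 2 * γ)) -
      ∑' n : ℕ, τ n * (2 * (dualTerm ψ n).re)| ≤ C * ((∫ w, |ψ w|) + B) := by
  obtain ⟨C₁, hC₁, hv⟩ := exists_norm_voronoi_le
  obtain ⟨C₂, hC₂, hk⟩ := exists_norm_integral_windowHat_cosh_sub_le
  obtain ⟨C₃, hC₃, hτ⟩ := exists_card_divisors_le (ε := 1 / 8) (by norm_num)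
  have hsum : Summable fun n : ℕ => 1 / (n : ℝ) ^ (9 / 8 : ℝ) :=
    summable_one_div_nat_rpow.2 (by norm_num)
  set Z := ∑' n : ℕ, 1 / (n : ℝ) ^ (9 / 8 : ℝ) with hZ
  have hZ0 : 0 ≤ Z := tsum_nonneg fun n => by positivity
  refine ⟨C₁ + 2 * C₃ * C₂ * Z, by have := zero_le_one.trans hC₃; positivity, fun ψ R B hψ hR hB M hM => ?_⟩
  have hB0 : 0 ≤ B := by
    have := (norm_nonneg _).trans (hB 1 one_pos)
    simpa using this
  have hI0 : 0 ≤ ∫ w, |ψ w| := integral_nonneg fun w => abs_nonneg _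
  have hdiff : ∀ n : ℕ, ‖τ n * (2 * (hyperKernel ψ n).re) - τ n * (2 * (dualTerm ψ n).re)‖ ≤
      2 * C₃ * C₂ * B * (1 / (n : ℝ) ^ (9 / 8 : ℝ)) := by
    intro n
    rcases Nat.eq_zero_or_pos n with rfl | hn
    · simp
    have hn' : (0 : ℝ) < n := mod_cast hn
    have hc : 0 < 2 * √n := by positivity
    have h1 := hk ψ R (2 * √n) (B / (2 * √n) ^ (3 / 2 : ℝ)) hψ hc fun s hs => by
      refine (hB s (hc.trans_le hs)).trans ?_
      gcongr
    rw [hψ.integral_cosh_half_mul_windowHat hc] at h1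
    have h2 : |(hyperKernel ψ n).re - (dualTerm ψ n).re| ≤
        C₂ * (B / (2 * √n) ^ (3 / 2 : ℝ)) / (2 * √n) := by
      rw [← Complex.sub_re]
      exact (abs_re_le_norm _).trans h1
    have h3 : C₂ * (B / (2 * √n) ^ (3 / 2 : ℝ)) / (2 * √n) ≤ C₂ * B / (n : ℝ) ^ (5 / 4 : ℝ) := by
      have e : (2 * √(n:ℝ)) ^ (3 / 2 : ℝ) * (2 * √n) = (2 * √n) ^ (5 / 2 : ℝ) := by
        rw [← rpow_add_one hc.ne']; norm_num
      have e2 : (n : ℝ) ^ (5 / 4 : ℝ) = (√n) ^ (5 / 2 : ℝ) := by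
        rw [sqrt_eq_rpow, ← rpow_mul hn'.le]; norm_num
      rw [mul_div_assoc', div_div, e, e2]
      gcongr
      linarith [sqrt_nonneg (n:ℝ)]
    rw [← mul_sub, ← mul_sub, norm_mul, norm_mul, norm_eq_abs, norm_eq_abs, Nat.abs_cast,
      norm_eq_abs, abs_two]
    calc _ ≤ (C₃ * (n : ℝ) ^ (1 / 8 : ℝ)) * (2 * (C₂ * B / (n : ℝ) ^ (5 / 4 : ℝ))) := by
          gcongr
          · exact hτ n hn
          · exact h2.trans h3
      _ = 2 * C₃ * C₂ * B * ((n : ℝ) ^ (1 / 8 : ℝ) / (n : ℝ) ^ (5 / 4 : ℝ)) := by ring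
      _ = _ := by
          rw [← rpow_sub hn', one_div ((n:ℝ) ^ _), ← rpow_neg hn'.le]
          norm_num
  have hsd := Summable.of_norm_bounded (hsum.mul_left (2 * C₃ * C₂ * B)) hdiff
  have hsk := hψ.summable_card_divisors_mul_hyperKernel
  have hsm : Summable fun n : ℕ => τ n * (2 * (dualTerm ψ n).re) := by
    refine (hsk.sub hsd).congr fun n => ?_
    ring
  refine ⟨hsm, ?_⟩
  have hd : |∑' n : ℕ, τ n * (2 * (hyperKernel ψ n).re) - ∑' n : ℕ, τ n * (2 * (dualTerm ψ n).re)| ≤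
      2 * C₃ * C₂ * B * Z := by
    rw [← hsk.tsum_sub hsm, hZ, ← tsum_mul_left]
    exact tsum_of_norm_bounded (hsum.mul_left (2 * C₃ * C₂ * B)).hasSum hdiff
  have := hv ψ R hψ hR M hM
  calc _ ≤ C₁ * (∫ w, |ψ w|) + 2 * C₃ * C₂ * B * Z := by
        refine le_trans ?_ (add_le_add this hd)
        refine le_trans (le_of_eq ?_) (abs_add_le _ _)
        congr 1
        ring
    _ ≤ _ := by nlinarith [mul_nonneg (mul_nonneg (mul_nonneg (zero_le_one.trans hC₃) hC₂) hZ0) hI0, mul_nonneg hC₁ hB0]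

lemma IsWindow.norm_windowHat_one_le_of_deriv (hψ : IsWindow ψ R) {A D : ℝ}
    (hA : ∫ w, |ψ w| ≤ A) (hD : ∫ w, |deriv (deriv ψ) w| ≤ D) {s : ℝ} (hs : 0 < s) :
    ‖windowHat ψ 1 s‖ ≤ A ^ (1 / 4 : ℝ) * D ^ (3 / 4 : ℝ) / s ^ (3 / 2 : ℝ) := by
  have hA0 : 0 ≤ A := (integral_nonneg fun w => abs_nonneg _).trans hA
  have hD0 : 0 ≤ D := (integral_nonneg fun w => abs_nonneg _).trans hD
  have h1 : ‖windowHat ψ 1 s‖ ≤ A := (hψ.norm_windowHat_le le_rfl s).trans hA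
  have h2 : ‖windowHat ψ 1 s‖ ≤ D / s ^ 2 := by
    have hz : ∀ w ∉ Set.Icc 1 R, ψ w = 0 := hψ.eq_zero
    have hdiv : windowDiv ψ 1 = fun w => (I / π) * (ψ w : ℂ) := by
      funext w
      by_cases hw : w ∈ Set.Icc 1 R
      · have hw0 : (w : ℂ) ≠ 0 := by
          have : (0:ℝ) < w := lt_of_lt_of_le one_pos hw.1
          exact_mod_cast this.ne'
        have hp : (π : ℂ) ≠ 0 := mod_cast pi_ne_zero
        simp only [windowDiv]
        field_simp
        push_cast
        linear_combination (-(2 * (w:ℂ) * ψ w) ) * Complex.I_sq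
      · simp [windowDiv, hz w hw]
    have hsm : ContDiff ℝ ∞ (windowDiv ψ 1) := hψ.contDiff_windowDiv 1
    have hcs : HasCompactSupport (windowDiv ψ 1) := hψ.hasCompactSupport_windowDiv 1
    have hsm1 : ContDiff ℝ ∞ (deriv (windowDiv ψ 1)) := (contDiff_infty_iff_deriv.1 hsm).2
    have hsm2 : ContDiff ℝ ∞ (deriv (deriv (windowDiv ψ 1))) := (contDiff_infty_iff_deriv.1 hsm1).2
    have hi0 := hsm.continuous.integrable_of_hasCompactSupport hcs (μ := volume)
    have hi1 := hsm1.continuous.integrable_of_hasCompactSupport hcs.deriv (μ := volume)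
    have hi2 := hsm2.continuous.integrable_of_hasCompactSupport hcs.deriv.deriv (μ := volume)
    have f1 := fourier_deriv hi0 (hsm.differentiable (by simp)) hi1
    have f2 := fourier_deriv hi1 (hsm1.differentiable (by simp)) hi2
    have f3 := congrFun f2 s
    simp only [f1, smul_eq_mul] at f3
    have hψ1 : ContDiff ℝ ∞ (deriv ψ) := (contDiff_infty_iff_deriv.1 hψ.smooth).2
    have hdd : ∀ w, ‖deriv (deriv (windowDiv ψ 1)) w‖ = 1 / π * |deriv (deriv ψ) w| := by
      intro w
      have g1 : deriv (windowDiv ψ 1) = fun w => (I / π) * ((deriv ψ w : ℝ) : ℂ) := by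
        funext v
        rw [hdiv]
        exact (((hψ.smooth.differentiable (by simp)) v).hasDerivAt.ofReal_comp.const_mul _).deriv
      have g2 : deriv (deriv (windowDiv ψ 1)) w = (I / π) * ((deriv (deriv ψ) w : ℝ) : ℂ) := by
        rw [g1]
        exact (((hψ1.differentiable (by simp)) w).hasDerivAt.ofReal_comp.const_mul _).deriv
      rw [g2, norm_mul, norm_div, norm_I, norm_real, norm_real,
        norm_eq_abs, norm_eq_abs, abs_of_pos pi_pos]
    have f4 : ‖𝓕 (deriv (deriv (windowDiv ψ 1))) s‖ ≤ 1 / π * D := by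
      refine (VectorFourier.norm_fourierIntegral_le_integral_norm _ _ _ _ _).trans ?_
      simp only [hdd]
      rw [integral_const_mul]
      gcongr
    have f8 : ‖(2 * π * I * s : ℂ)‖ = 2 * π * s := by
      rw [norm_mul, norm_mul, norm_mul, norm_I, norm_real,
      norm_real, norm_eq_abs, norm_eq_abs, abs_of_pos pi_pos, abs_of_pos hs]
      simp
    rw [f3, norm_mul (2 * π * I * s : ℂ), norm_mul (2 * π * I * s : ℂ), f8] at f4
    rw [le_div_iff₀ (by positivity)]
    have f5 : ‖windowHat ψ 1 s‖ * s ^ 2 * (4 * π ^ 2) ≤ 1 / π * D := by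
      refine le_trans (le_of_eq ?_) f4
      rw [windowHat]; ring
    have f6 : 1 / π ≤ 1 := by rw [div_le_one pi_pos]; linarith [pi_gt_three]
    have f7 : 1 ≤ 4 * π ^ 2 := by nlinarith [pi_gt_three]
    calc _ ≤ ‖windowHat ψ 1 s‖ * s ^ 2 * (4 * π ^ 2) := le_mul_of_one_le_right (by positivity) f7
      _ ≤ 1 / π * D := f5
      _ ≤ D := mul_le_of_le_one_left hD0 f6
  set N := ‖windowHat ψ 1 s‖ with hN
  have hN0 : 0 ≤ N := norm_nonneg _
  calc N = N ^ (1 / 4 : ℝ) * N ^ (3 / 4 : ℝ) := by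
        rw [← rpow_add_of_nonneg hN0 (by norm_num) (by norm_num)]; norm_num
    _ ≤ A ^ (1 / 4 : ℝ) * (D / s ^ 2) ^ (3 / 4 : ℝ) := by gcongr
    _ = _ := by
        rw [div_rpow hD0 (by positivity), ← rpow_natCast s 2, ← rpow_mul hs.le]
        norm_num
        ring

end

section

open scoped FourierTransform ContDiff

/-- The derivative of the standard smooth transition function, a bump supported in `[0, 1]`. -/
def mollifier : ℝ → ℝ := deriv smoothTransition

lemma hasDerivAt_smoothTransition (w : ℝ) : HasDerivAt smoothTransition (mollifier w) w :=
  (smoothTransition.contDiff (n := 1).differentiable one_ne_zero w).hasDerivAt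

lemma contDiff_mollifier : ContDiff ℝ ∞ mollifier :=
  (contDiff_infty_iff_deriv.1 smoothTransition.contDiff).2

lemma mollifier_nonneg (w : ℝ) : 0 ≤ mollifier w := smoothTransition.monotone.deriv_nonneg

lemma mollifier_eq_zero {w : ℝ} (hw : w ∉ Set.Ioo (0 : ℝ) 1) : mollifier w = 0 := by
  rcases le_or_gt w 0 with h | h
  · refine IsLocalMin.deriv_eq_zero (.of_forall fun v => ?_)
    rw [smoothTransition.zero_of_nonpos h]
    exact smoothTransition.nonneg v
  · have h1 : 1 ≤ w := by
      by_contra h'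
      exact hw ⟨h, not_le.1 h'⟩
    refine IsLocalMax.deriv_eq_zero (.of_forall fun v => ?_)
    rw [smoothTransition.one_of_one_le h1]
    exact smoothTransition.le_one v

lemma hasCompactSupport_mollifier : HasCompactSupport mollifier :=
  HasCompactSupport.intro (isCompact_Icc (a := (0 : ℝ)) (b := 1)) fun _ hw =>
    mollifier_eq_zero fun h => hw (Set.Ioo_subset_Icc_self h)

lemma integrable_mollifier : Integrable mollifier :=
  contDiff_mollifier.continuous.integrable_of_hasCompactSupport hasCompactSupport_mollifier

lemma hasDerivAt_mollifier (w : ℝ) : HasDerivAt mollifier (deriv mollifier w) w :=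
  (contDiff_mollifier.differentiable (by simp) w).hasDerivAt

lemma continuous_deriv_mollifier : Continuous (deriv mollifier) :=
  (contDiff_infty_iff_deriv.1 contDiff_mollifier).2.continuous

lemma integrable_deriv_mollifier : Integrable (deriv mollifier) :=
  continuous_deriv_mollifier.integrable_of_hasCompactSupport hasCompactSupport_mollifier.deriv

/-- A smooth approximation, at scale `u`, to the indicator function of `(0, δ]`. -/
def edge (u δ w : ℝ) : ℝ := smoothTransition (w / u) - smoothTransition ((w - δ) / u)

variable {u δ x : ℝ}

lemma contDiff_edge (u δ : ℝ) : ContDiff ℝ ∞ (edge u δ) := by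
  unfold edge
  exact (smoothTransition.contDiff.comp (contDiff_id.div_const u)).sub
    (smoothTransition.contDiff.comp ((contDiff_id.sub contDiff_const).div_const u))

lemma edge_eq_zero_of_nonpos (hu : 0 < u) (hδ : 0 ≤ δ) {w : ℝ} (hw : w ≤ 0) : edge u δ w = 0 := by
  rw [edge, smoothTransition.zero_of_nonpos (div_nonpos_of_nonpos_of_nonneg hw hu.le),
    smoothTransition.zero_of_nonpos (div_nonpos_of_nonpos_of_nonneg (by linarith) hu.le), sub_zero]

lemma edge_eq_zero_of_ge (hu : 0 < u) (hδ : 0 ≤ δ) {w : ℝ} (hw : δ + u ≤ w) : edge u δ w = 0 := by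
  rw [edge, smoothTransition.one_of_one_le, smoothTransition.one_of_one_le, sub_self] <;>
  · rw [le_div_iff₀ hu]; linarith

lemma edge_eq_one (hu : 0 < u) {w : ℝ} (h1 : u ≤ w) (h2 : w ≤ δ) : edge u δ w = 1 := by
  rw [edge, smoothTransition.one_of_one_le (by rwa [le_div_iff₀ hu, one_mul]),
    smoothTransition.zero_of_nonpos (div_nonpos_of_nonpos_of_nonneg (by linarith) hu.le), sub_zero]

lemma edge_nonneg (hu : 0 < u) (hδ : 0 ≤ δ) (w : ℝ) : 0 ≤ edge u δ w := by
  refine sub_nonneg.2 (smoothTransition.monotone ?_)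
  gcongr
  linarith

lemma edge_le_one (u δ w : ℝ) : edge u δ w ≤ 1 := by
  have := smoothTransition.nonneg ((w - δ) / u)
  have := smoothTransition.le_one (w / u)
  rw [edge]; linarith

/-- The derivative of `edge`. -/
def edgeDeriv (u δ w : ℝ) : ℝ := (mollifier (w / u) - mollifier ((w - δ) / u)) / u

/-- The second derivative of `edge`. -/
def edgeDerivTwo (u δ w : ℝ) : ℝ :=
  (deriv mollifier (w / u) - deriv mollifier ((w - δ) / u)) / u ^ 2

lemma hasDerivAt_edge (u δ w : ℝ) : HasDerivAt (edge u δ) (edgeDeriv u δ w) w := by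
  have h1 := (hasDerivAt_smoothTransition (w / u)).comp w ((hasDerivAt_id w).div_const u)
  have h2 := (hasDerivAt_smoothTransition ((w - δ) / u)).comp w
    (((hasDerivAt_id w).sub_const δ).div_const u)
  refine (h1.sub h2).congr_deriv ?_
  rw [edgeDeriv]; ring

lemma hasDerivAt_edgeDeriv (u δ w : ℝ) : HasDerivAt (edgeDeriv u δ) (edgeDerivTwo u δ w) w := by
  have h1 := (hasDerivAt_mollifier (w / u)).comp w ((hasDerivAt_id w).div_const u)
  have h2 := (hasDerivAt_mollifier ((w - δ) / u)).comp w
    (((hasDerivAt_id w).sub_const δ).div_const u)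
  refine ((h1.sub h2).div_const u).congr_deriv ?_
  rw [edgeDerivTwo]; ring

lemma integral_abs_comp_sub_div_le {f : ℝ → ℝ} (hf : Integrable f) (hu : 0 < u) (δ x : ℝ) :
    Integrable (fun w => (f ((w - x) / u) - f ((w - x - δ) / u))) ∧
    ∫ w, |f ((w - x) / u) - f ((w - x - δ) / u)| ≤ 2 * u * ∫ w, |f w| := by
  have i1 : Integrable fun w => f (w / u) := hf.comp_div hu.ne'
  have i2 : Integrable fun w => f ((w - x) / u) := i1.comp_sub_right x
  have i3 : Integrable fun w => f ((w - x - δ) / u) := by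
    simpa only [sub_sub] using i1.comp_sub_right (x + δ)
  have j (c : ℝ) : ∫ w, |f ((w - c) / u)| = u * ∫ w, |f w| := by
    rw [integral_sub_right_eq_self (fun w => |f (w / u)|) c,
      Measure.integral_comp_div (fun w => |f w|) u, abs_of_pos hu, smul_eq_mul]
  refine ⟨i2.sub i3, ?_⟩
  calc _ ≤ ∫ w, (|f ((w - x) / u)| + |f ((w - x - δ) / u)|) :=
        integral_mono (i2.sub i3).abs (i2.abs.add i3.abs) fun w => abs_sub _ _
    _ = 2 * u * ∫ w, |f w| := by
        rw [integral_add i2.abs i3.abs, j x]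
        simp only [sub_sub]
        rw [j (x + δ)]; ring

/-- The smooth weight detecting `x < w ≤ x + δ`, with the factor making the dual side explicit. -/
def divisorWindow (u δ x w : ℝ) : ℝ := √(x / w) * edge u δ (w - x)

lemma divisorWindow_eq_zero (hu : 0 < u) (hδ : 0 ≤ δ) {w : ℝ}
    (hw : w ∉ Set.Icc x (x + δ + u)) : divisorWindow u δ x w = 0 := by
  rw [divisorWindow]
  rcases le_or_gt x w with h | h
  · have : ¬ w ≤ x + δ + u := fun h' => hw ⟨h, h'⟩
    rw [edge_eq_zero_of_ge hu hδ (by linarith), mul_zero]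
  · rw [edge_eq_zero_of_nonpos hu hδ (by linarith), mul_zero]

lemma abs_divisorWindow_le (hu : 0 < u) (hδ : 0 ≤ δ) (hx : 1 ≤ x) (w : ℝ) :
    |divisorWindow u δ x w| ≤ indicator (Set.Icc x (x + δ + u)) 1 w := by
  by_cases hw : w ∈ Set.Icc x (x + δ + u)
  · rw [indicator_of_mem hw, Pi.one_apply, divisorWindow, abs_mul,
      abs_of_nonneg (edge_nonneg hu hδ _), abs_of_nonneg (sqrt_nonneg _)]
    refine mul_le_one₀ ?_ (edge_nonneg hu hδ _) (edge_le_one _ _ _)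
    rw [sqrt_le_iff, one_pow, div_le_one (by linarith [hw.1])]
    exact ⟨zero_le_one, hw.1⟩
  · rw [divisorWindow_eq_zero hu hδ hw, indicator_of_notMem hw, abs_zero]

lemma isWindow_divisorWindow (hu : 0 < u) (hδ : 0 ≤ δ) (hx : 1 ≤ x) :
    IsWindow (divisorWindow u δ x) (x + δ + u) where
  eq_zero w hw := divisorWindow_eq_zero hu hδ fun h => hw ⟨hx.trans h.1, h.2⟩
  smooth := by
    rw [contDiff_iff_contDiffAt]
    intro w
    rcases lt_or_ge w 1 with h | h
    · have : divisorWindow u δ x =ᶠ[𝓝 w] fun _ => 0 := by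
        filter_upwards [Iio_mem_nhds h] with v hv
        exact divisorWindow_eq_zero hu hδ fun h' => absurd (hx.trans h'.1) (not_le.2 hv)
      exact contDiffAt_const.congr_of_eventuallyEq this
    · unfold divisorWindow
      refine ContDiffAt.mul ?_ ((contDiff_edge u δ).comp (contDiff_id.sub contDiff_const)).contDiffAt
      refine ContDiffAt.sqrt (contDiffAt_const.div contDiffAt_id (ne_of_gt (by simpa using by linarith))) ?_
      positivity

lemma integral_abs_divisorWindow_le (hu : 0 < u) (hδ : 0 ≤ δ) (hx : 1 ≤ x) :
    ∫ w, |divisorWindow u δ x w| ≤ δ + u := by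
  have hw := isWindow_divisorWindow hu hδ hx
  calc _ ≤ ∫ w, indicator (Set.Icc x (x + δ + u)) (1 : ℝ → ℝ) w := by
        refine integral_mono hw.integrable.abs ?_ (abs_divisorWindow_le hu hδ hx)
        exact (integrable_indicator_iff measurableSet_Icc).2
          (integrableOn_const (C := (1 : ℝ)) isCompact_Icc.measure_lt_top.ne)
    _ = _ := by
        rw [integral_indicator_one measurableSet_Icc]
        simp [measureReal_def]
        rw [ENNReal.toReal_ofReal (by linarith)]; ring

lemma hasDerivAt_mul_rpow_edge {C p w : ℝ} (hw : 0 < w) {f : ℝ → ℝ} {f' : ℝ}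
    (hf : HasDerivAt f f' (w - x)) :
    HasDerivAt (fun w => C * w ^ p * f (w - x)) (C * p * w ^ (p - 1) * f (w - x) + C * w ^ p * f')
      w := by
  have h1 := (hasDerivAt_rpow_const (p := p) (Or.inl hw.ne')).const_mul C
  have h2 := hf.comp w ((hasDerivAt_id w).sub_const x)
  refine (h1.mul h2).congr_deriv ?_
  simp only [id, mul_one, Function.comp]; ring

lemma abs_deriv_deriv_divisorWindow_le (hu : 0 < u) (hδ : 0 ≤ δ) (hx : 1 ≤ x) (w : ℝ) :
    |deriv (deriv (divisorWindow u δ x)) w| ≤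
      |edgeDerivTwo u δ (w - x)| + |edgeDeriv u δ (w - x)| +
        indicator (Set.Icc x (x + δ + u)) 1 w := by
  have hind : 0 ≤ indicator (Set.Icc x (x + δ + u)) (1 : ℝ → ℝ) w :=
    Set.indicator_nonneg (fun _ _ => zero_le_one) w
  rcases lt_or_ge w x with h | h
  · have e : divisorWindow u δ x =ᶠ[𝓝 w] fun _ => 0 := by
      filter_upwards [Iio_mem_nhds h] with v hv
      exact divisorWindow_eq_zero hu hδ fun h' => absurd h'.1 (not_le.2 hv)
    rw [e.deriv.deriv_eq]
    simp only [deriv_const', deriv_const, abs_zero]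
    positivity
  have hw : 0 < w := by linarith
  have e1 : ∀ v, 0 < v → divisorWindow u δ x v = √x * v ^ (-1 / 2 : ℝ) * edge u δ (v - x) := by
    intro v hv
    rw [divisorWindow, sqrt_div (by linarith), sqrt_eq_rpow v, div_eq_mul_inv, ← rpow_neg hv.le]
    norm_num
  have e2 : ∀ v, 0 < v → deriv (divisorWindow u δ x) v =
      √x * (-1 / 2) * v ^ (-1 / 2 - 1 : ℝ) * edge u δ (v - x) +
        √x * v ^ (-1 / 2 : ℝ) * edgeDeriv u δ (v - x) := by
    intro v hv
    have : divisorWindow u δ x =ᶠ[𝓝 v] fun v => √x * v ^ (-1 / 2 : ℝ) * edge u δ (v - x) := by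
      filter_upwards [Ioi_mem_nhds hv] with t ht using e1 t ht
    rw [this.deriv_eq]
    exact (hasDerivAt_mul_rpow_edge hv (hasDerivAt_edge u δ (v - x))).deriv
  have e3 : deriv (divisorWindow u δ x) =ᶠ[𝓝 w] fun v =>
      √x * (-1 / 2) * v ^ (-1 / 2 - 1 : ℝ) * edge u δ (v - x) +
        √x * v ^ (-1 / 2 : ℝ) * edgeDeriv u δ (v - x) := by
    filter_upwards [Ioi_mem_nhds hw] with t ht using e2 t ht
  have e4 := ((hasDerivAt_mul_rpow_edge (C := √x * (-1 / 2)) (p := -1 / 2 - 1) hw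
    (hasDerivAt_edge u δ (w - x))).fun_add (hasDerivAt_mul_rpow_edge (C := √x) (p := -1 / 2) hw
    (hasDerivAt_edgeDeriv u δ (w - x)))).deriv
  rw [e3.deriv_eq, e4]
  have hb : ∀ p : ℝ, p ≤ -1 / 2 → √x * w ^ p ≤ 1 := by
    intro p hp
    calc √x * w ^ p ≤ √w * w ^ (-1 / 2 : ℝ) := by
          gcongr
          linarith
      _ = 1 := by rw [sqrt_eq_rpow, ← rpow_add hw]; norm_num
  have hb0 : ∀ p : ℝ, 0 ≤ √x * w ^ p := fun p => by positivity
  have b0 := hb (-1 / 2) le_rfl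
  have b1 := hb (-1 / 2 - 1) (by norm_num)
  have b2 := hb (-1 / 2 - 1 - 1) (by norm_num)
  have hedge : edge u δ (w - x) ≤ indicator (Set.Icc x (x + δ + u)) (1 : ℝ → ℝ) w := by
    by_cases hw' : w ∈ Set.Icc x (x + δ + u)
    · rw [indicator_of_mem hw']
      exact edge_le_one _ _ _
    · have : ¬ w ≤ x + δ + u := fun h' => hw' ⟨h, h'⟩
      rw [edge_eq_zero_of_ge hu hδ (by linarith)]
      exact hind
  have he0 := edge_nonneg (u := u) (δ := δ) hu hδ (w - x)
  calc _ = |(√x * w ^ (-1 / 2 : ℝ)) * edgeDerivTwo u δ (w - x) -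
        (√x * w ^ (-1 / 2 - 1 : ℝ)) * edgeDeriv u δ (w - x) +
        3 / 4 * (√x * w ^ (-1 / 2 - 1 - 1 : ℝ)) * edge u δ (w - x)| := by congr 1; ring
    _ ≤ |(√x * w ^ (-1 / 2 : ℝ)) * edgeDerivTwo u δ (w - x)| +
        |(√x * w ^ (-1 / 2 - 1 : ℝ)) * edgeDeriv u δ (w - x)| +
        |3 / 4 * (√x * w ^ (-1 / 2 - 1 - 1 : ℝ)) * edge u δ (w - x)| :=
        (abs_add_le _ _).trans (add_le_add_left (abs_sub _ _) _)
    _ ≤ _ := by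
        rw [abs_mul _ (edgeDerivTwo _ _ _), abs_mul _ (edgeDeriv _ _ _), abs_mul _ (edge _ _ _),
          abs_of_nonneg (hb0 _), abs_of_nonneg (hb0 _),
          abs_of_nonneg he0, abs_of_nonneg (mul_nonneg (by norm_num) (hb0 _))]
        refine add_le_add (add_le_add (mul_le_of_le_one_left (abs_nonneg _) b0)
          (mul_le_of_le_one_left (abs_nonneg _) b1)) (le_trans ?_ hedge)
        refine mul_le_of_le_one_left he0 ?_
        linarith [hb0 (-1 / 2 - 1 - 1)]

lemma exists_integral_abs_deriv_deriv_divisorWindow_le : ∃ C, 0 ≤ C ∧ ∀ u δ x : ℝ, 0 < u → u ≤ 1 →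
    0 ≤ δ → δ ≤ 1 → 1 ≤ x → ∫ w, |deriv (deriv (divisorWindow u δ x)) w| ≤ C / u := by
  have hA0 : 0 ≤ ∫ w, |deriv mollifier w| := integral_nonneg fun w => abs_nonneg _
  have hB0 : 0 ≤ ∫ w, |mollifier w| := integral_nonneg fun w => abs_nonneg _
  refine ⟨2 * (∫ w, |deriv mollifier w|) + 2 * (∫ w, |mollifier w|) + 2, by positivity,
    fun u δ x hu hu1 hδ hδ1 hx => ?_⟩
  obtain ⟨i1, b1⟩ := integral_abs_comp_sub_div_le integrable_deriv_mollifier hu δ x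
  obtain ⟨i2, b2⟩ := integral_abs_comp_sub_div_le integrable_mollifier hu δ x
  have j1 : Integrable fun w => |edgeDerivTwo u δ (w - x)| := (i1.div_const (u ^ 2)).abs
  have j2 : Integrable fun w => |edgeDeriv u δ (w - x)| := (i2.div_const u).abs
  have j3 : Integrable (indicator (Set.Icc x (x + δ + u)) (1 : ℝ → ℝ)) :=
    (integrable_indicator_iff measurableSet_Icc).2
      (integrableOn_const (C := (1 : ℝ)) isCompact_Icc.measure_lt_top.ne)
  have k1 : ∫ w, |edgeDerivTwo u δ (w - x)| ≤ 2 * (∫ w, |deriv mollifier w|) / u := by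
    simp only [edgeDerivTwo, abs_div, integral_div]
    rw [abs_of_pos (by positivity : 0 < u ^ 2), div_le_div_iff₀ (by positivity) hu]
    calc _ ≤ 2 * u * (∫ w, |deriv mollifier w|) * u := by gcongr
      _ = _ := by ring
  have k2 : ∫ w, |edgeDeriv u δ (w - x)| ≤ 2 * (∫ w, |mollifier w|) := by
    simp only [edgeDeriv, abs_div, integral_div]
    rw [abs_of_pos hu, div_le_iff₀ hu]
    calc _ ≤ 2 * u * (∫ w, |mollifier w|) := by gcongr
      _ = _ := by ring
  have k3 : ∫ w, indicator (Set.Icc x (x + δ + u)) (1 : ℝ → ℝ) w ≤ 2 := by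
    rw [integral_indicator_one measurableSet_Icc, measureReal_def, volume_Icc,
      ENNReal.toReal_ofReal (by linarith)]
    linarith
  have hle : ∀ t : ℝ, 0 ≤ t → t ≤ t / u := fun t ht => by
    rw [le_div_iff₀ hu]; exact mul_le_of_le_one_right ht hu1
  calc _ ≤ ∫ w, (|edgeDerivTwo u δ (w - x)| + |edgeDeriv u δ (w - x)| +
        indicator (Set.Icc x (x + δ + u)) 1 w) :=
        integral_mono_of_nonneg (.of_forall fun _ => abs_nonneg _) ((j1.add j2).add j3)
          (.of_forall fun w => abs_deriv_deriv_divisorWindow_le hu hδ hx w)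
    _ ≤ 2 * (∫ w, |deriv mollifier w|) / u + 2 * (∫ w, |mollifier w|) + 2 := by
        have e := integral_add (j1.add j2) j3
        simp only [Pi.add_apply] at e
        rw [e, integral_add j1 j2]
        gcongr
    _ ≤ _ := by
        rw [add_div, add_div]
        have := hle _ (mul_nonneg zero_le_two hB0)
        have := hle 2 zero_le_two
        linarith

/-- The decay required by the Voronoi formula, at the smoothing scale `u`. -/
lemma exists_norm_windowHat_divisorWindow_le : ∃ C, 0 ≤ C ∧ ∀ u δ x : ℝ, 0 < u → u ≤ 1 →
    0 ≤ δ → δ ≤ 1 → 1 ≤ x → ∀ s, 0 < s →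
      ‖windowHat (divisorWindow u δ x) 1 s‖ ≤ C * u ^ (-3 / 4 : ℝ) / s ^ (3 / 2 : ℝ) := by
  obtain ⟨D, hD, h⟩ := exists_integral_abs_deriv_deriv_divisorWindow_le
  refine ⟨(2 : ℝ) ^ (1 / 4 : ℝ) * D ^ (3 / 4 : ℝ), by positivity,
    fun u δ x hu hu1 hδ hδ1 hx s hs => ?_⟩
  refine ((isWindow_divisorWindow hu hδ hx).norm_windowHat_one_le_of_deriv
    ((integral_abs_divisorWindow_le hu hδ hx).trans (by linarith : δ + u ≤ 2))
    (h u δ x hu hu1 hδ hδ1 hx) hs).trans (le_of_eq ?_)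
  rw [div_rpow hD hu.le, neg_div, rpow_neg hu.le]
  ring

end

section

open scoped FourierTransform ContDiff

/-- The additive character `t ↦ exp (2 π i t)`. -/
def unitExp (t : ℝ) : ℂ := cexp (((2 * π * t : ℝ) : ℂ) * I)

lemma norm_unitExp (t : ℝ) : ‖unitExp t‖ = 1 := norm_exp_ofReal_mul_I _

lemma unitExp_add (s t : ℝ) : unitExp (s + t) = unitExp s * unitExp t := by
  rw [unitExp, unitExp, unitExp, ← Complex.exp_add]
  congr 1; push_cast; ring

lemma unitExp_zero : unitExp 0 = 1 := by simp [unitExp]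

lemma unitExp_neg (t : ℝ) : unitExp (-t) = conj (unitExp t) := by
  rw [unitExp, unitExp, ← Complex.exp_conj, map_mul, Complex.conj_I, Complex.conj_ofReal]
  congr 1; push_cast; ring

lemma continuous_unitExp : Continuous unitExp := by unfold unitExp; fun_prop

lemma norm_unitExp_sub_one_le (t : ℝ) : ‖unitExp t - 1‖ ≤ 2 * π * |t| := by
  have := norm_exp_I_mul_ofReal_sub_one_le (x := 2 * π * t)
  rw [unitExp, mul_comm]
  simpa [abs_mul, abs_of_pos pi_pos] using this

lemma fourier_eq_integral_unitExp (f : ℝ → ℂ) (ξ : ℝ) : 𝓕 f ξ = ∫ w, unitExp (-(w * ξ)) * f w := by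
  rw [fourier_real_eq_integral_exp_smul]
  refine integral_congr_ae (.of_forall fun w => ?_)
  simp only [unitExp, smul_eq_mul]
  congr 2; push_cast; ring

/-- The Fourier transform of `mollifier`. -/
def mollifierHat (ξ : ℝ) : ℂ := ∫ w, unitExp (-(w * ξ)) * (mollifier w : ℂ)

lemma integral_mollifier : ∫ w, mollifier w = 1 := by
  have h : ∀ a b, IntervalIntegrable mollifier volume a b := fun a b =>
    contDiff_mollifier.continuous.intervalIntegrable a b
  have h1 : ∫ w in (0:ℝ)..1, mollifier w = 1 := by
    rw [integral_eq_sub_of_hasDerivAt (fun w _ => hasDerivAt_smoothTransition w) (h 0 1)]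
    simp
  rw [← h1, integral_of_le zero_le_one]
  refine (setIntegral_eq_integral_of_forall_compl_eq_zero fun w hw => ?_).symm
  exact mollifier_eq_zero fun h' => hw (Set.Ioo_subset_Ioc_self h')

lemma integrable_unitExp_mul_mollifier (ξ : ℝ) :
    Integrable fun w => unitExp (-(w * ξ)) * (mollifier w : ℂ) := by
  refine Continuous.integrable_of_hasCompactSupport ?_ ?_
  · exact (continuous_unitExp.comp (by fun_prop)).mul
      (Complex.continuous_ofReal.comp contDiff_mollifier.continuous)
  · exact (hasCompactSupport_mollifier.comp_left (g := ((↑) : ℝ → ℂ)) ofReal_zero).mul_left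

lemma norm_mollifierHat_le_one (ξ : ℝ) : ‖mollifierHat ξ‖ ≤ 1 := by
  refine (norm_integral_le_integral_norm _).trans (le_of_eq ?_)
  rw [← integral_mollifier]
  refine integral_congr_ae (.of_forall fun w => ?_)
  simp only
  rw [norm_mul, norm_unitExp, one_mul, norm_real, norm_of_nonneg (mollifier_nonneg w)]

lemma norm_mollifierHat_sub_one_le (ξ : ℝ) : ‖mollifierHat ξ - 1‖ ≤ 2 * π * |ξ| := by
  have e : mollifierHat ξ - 1 = ∫ w, (unitExp (-(w * ξ)) - 1) * (mollifier w : ℂ) := by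
    have h1 : (1 : ℂ) = ∫ w, (mollifier w : ℂ) := by
      rw [integral_complex_ofReal, integral_mollifier, Complex.ofReal_one]
    have hm : Integrable fun w => (mollifier w : ℂ) := integrable_mollifier.ofReal
    calc mollifierHat ξ - 1 = mollifierHat ξ - ∫ w, (mollifier w : ℂ) := by rw [← h1]
      _ = ∫ w, (unitExp (-(w * ξ)) * (mollifier w : ℂ) - (mollifier w : ℂ)) :=
        (integral_sub (integrable_unitExp_mul_mollifier ξ) hm).symm
      _ = _ := by simp only [sub_mul, one_mul]
  rw [e]
  calc _ ≤ ∫ w, 2 * π * |ξ| * mollifier w := by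
        refine norm_integral_le_of_norm_le (integrable_mollifier.const_mul _)
          (.of_forall fun w => ?_)
        rw [norm_mul, norm_real, norm_of_nonneg (mollifier_nonneg w)]
        by_cases hw : w ∈ Set.Ioo (0:ℝ) 1
        · refine mul_le_mul_of_nonneg_right ?_ (mollifier_nonneg w)
          refine (norm_unitExp_sub_one_le _).trans ?_
          rw [abs_neg, abs_mul, abs_of_pos hw.1]
          have : w * |ξ| ≤ |ξ| := mul_le_of_le_one_left (abs_nonneg _) hw.2.le
          gcongr
        · simp [mollifier_eq_zero hw]
    _ = _ := by rw [integral_const_mul, integral_mollifier, mul_one]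

lemma exists_norm_mollifierHat_le (k : ℕ) : ∃ C, 0 ≤ C ∧ ∀ ξ, |ξ| ^ k * ‖mollifierHat ξ‖ ≤ C := by
  have hs : ContDiff ℝ ∞ fun w => (mollifier w : ℂ) := ofRealCLM.contDiff.comp contDiff_mollifier
  have hc : HasCompactSupport fun w => (mollifier w : ℂ) :=
    hasCompactSupport_mollifier.comp_left (g := ((↑) : ℝ → ℂ)) ofReal_zero
  obtain ⟨C, hC0, hC⟩ := (𝓕 (hc.toSchwartzMap hs)).decay k 0
  refine ⟨C, hC0.le, fun s => ?_⟩
  have := hC s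
  rw [norm_iteratedFDeriv_zero, SchwartzMap.fourier_coe] at this
  rw [mollifierHat, ← fourier_eq_integral_unitExp]
  exact this

variable {u δ x : ℝ}

lemma fourier_edgeDeriv (hu : 0 < u) (δ ξ : ℝ) :
    𝓕 (fun w => (edgeDeriv u δ w : ℂ)) ξ = mollifierHat (u * ξ) * (1 - unitExp (-(δ * ξ))) := by
  have h1 : ∫ w, unitExp (-(w * ξ)) * (mollifier (w / u) : ℂ) = u * mollifierHat (u * ξ) := by
    have := Measure.integral_comp_div (fun t => unitExp (-(t * (u * ξ))) * (mollifier t : ℂ)) u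
    rw [abs_of_pos hu, real_smul] at this
    rw [mollifierHat, ← this]
    refine integral_congr_ae (.of_forall fun w => ?_)
    simp only
    congr 3
    field_simp
  have h2 : ∫ w, unitExp (-(w * ξ)) * (mollifier ((w - δ) / u) : ℂ) =
      unitExp (-(δ * ξ)) * (u * mollifierHat (u * ξ)) := by
    rw [← h1, ← integral_const_mul, ← integral_sub_right_eq_self
      (fun w => unitExp (-(δ * ξ)) * (unitExp (-(w * ξ)) * (mollifier (w / u) : ℂ))) δ]
    refine integral_congr_ae (.of_forall fun w => ?_)
    simp only
    rw [← mul_assoc, ← unitExp_add]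
    congr 2; ring
  have i1 : Integrable fun w => unitExp (-(w * ξ)) * (mollifier (w / u) : ℂ) := by
    have := (integrable_unitExp_mul_mollifier (u * ξ)).comp_div hu.ne'
    refine this.congr (.of_forall fun w => ?_)
    simp only
    congr 3
    field_simp
  have i2 : Integrable fun w => unitExp (-(w * ξ)) * (mollifier ((w - δ) / u) : ℂ) := by
    have := (i1.comp_sub_right δ).const_mul (unitExp (-(δ * ξ)))
    refine this.congr (.of_forall fun w => ?_)
    simp only
    rw [← mul_assoc, ← unitExp_add]
    congr 2; ring
  have hu' : (u : ℂ) ≠ 0 := mod_cast hu.ne'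
  rw [fourier_eq_integral_unitExp]
  calc _ = ∫ w, (unitExp (-(w * ξ)) * (mollifier (w / u) : ℂ) -
        unitExp (-(w * ξ)) * (mollifier ((w - δ) / u) : ℂ)) / u := by
        refine integral_congr_ae (.of_forall fun w => ?_)
        simp only [edgeDeriv]
        push_cast; ring
    _ = _ := by
        rw [integral_div, integral_sub i1 i2, h1, h2]
        field_simp

lemma hasCompactSupport_edge (hu : 0 < u) (hδ : 0 ≤ δ) : HasCompactSupport (edge u δ) :=
  HasCompactSupport.intro (isCompact_Icc (a := (0 : ℝ)) (b := δ + u)) fun w hw => by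
    rcases le_or_gt w 0 with h | h
    · exact edge_eq_zero_of_nonpos hu hδ h
    · exact edge_eq_zero_of_ge hu hδ (le_of_lt (not_le.1 fun h' => hw ⟨h.le, h'⟩))

lemma fourier_edge (hu : 0 < u) (hδ : 0 ≤ δ) {ξ : ℝ} (hξ : ξ ≠ 0) :
    𝓕 (fun w => (edge u δ w : ℂ)) ξ =
      mollifierHat (u * ξ) * (1 - unitExp (-(δ * ξ))) / (2 * π * I * ξ) := by
  have hs : ContDiff ℝ ∞ fun w => (edge u δ w : ℂ) := ofRealCLM.contDiff.comp (contDiff_edge u δ)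
  have hc : HasCompactSupport fun w => (edge u δ w : ℂ) :=
    (hasCompactSupport_edge hu hδ).comp_left (g := ((↑) : ℝ → ℂ)) ofReal_zero
  have hd : deriv (fun w => (edge u δ w : ℂ)) = fun w => (edgeDeriv u δ w : ℂ) :=
    funext fun w => ((hasDerivAt_edge u δ w).ofReal_comp).deriv
  have h := congrFun (fourier_deriv (hs.continuous.integrable_of_hasCompactSupport hc)
    (hs.differentiable (by simp)) ((contDiff_infty_iff_deriv.1 hs).2.continuous.integrable_of_hasCompactSupport hc.deriv)) ξ
  rw [hd, fourier_edgeDeriv hu, smul_eq_mul] at h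
  have hπ : (π : ℂ) ≠ 0 := mod_cast pi_ne_zero
  have hξ' : (ξ : ℂ) ≠ 0 := mod_cast hξ
  rw [h]
  field_simp

lemma integral_sqrt_mul_divisorWindow (hu : 0 < u) (hδ : 0 ≤ δ) (hx : 1 ≤ x) {ξ : ℝ} (hξ : ξ ≠ 0) :
    ∫ w, ((2 * √w * divisorWindow u δ x w : ℝ) : ℂ) * cexp (((-2 * π * w * ξ : ℝ) : ℂ) * I) =
      2 * √x * (unitExp (-(x * ξ)) *
        (mollifierHat (u * ξ) * (1 - unitExp (-(δ * ξ))) / (2 * π * I * ξ))) := by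
  rw [← fourier_edge hu hδ hξ, fourier_eq_integral_unitExp, ← integral_const_mul,
    ← integral_const_mul, ← integral_sub_right_eq_self
      (fun w => 2 * √x * (unitExp (-(x * ξ)) * (unitExp (-(w * ξ)) * (edge u δ w : ℂ)))) x]
  refine integral_congr_ae (.of_forall fun w => ?_)
  simp only
  rw [← mul_assoc (unitExp _), ← unitExp_add]
  have h1 : 2 * √w * divisorWindow u δ x w = 2 * √x * edge u δ (w - x) := by
    rw [divisorWindow]
    rcases le_or_gt w x with h | h
    · rw [edge_eq_zero_of_nonpos hu hδ (by linarith)]; simp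
    · have hw : 0 < w := by linarith
      have h2 : √x = √w * √(x / w) := by rw [← sqrt_mul hw.le, mul_div_cancel₀ _ hw.ne']
      rw [h2]; ring
  have h2 : cexp (((-2 * π * w * ξ : ℝ) : ℂ) * I) = unitExp (-(x * ξ) + -((w - x) * ξ)) := by
    rw [unitExp]; congr 3; ring
  rw [h1, h2]
  push_cast; ring

/-- The Fourier coefficients of the error term over short intervals. -/
def voronoiCoeff (δ : ℝ) (n : ℕ) : ℂ :=
  (n.divisors.card : ℂ) * (cexp (-(π / 4 : ℝ) * I) / (√(2 * √n) : ℂ) *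
    (2 * ((1 - unitExp (-(δ * (2 * √n)))) / (2 * π * I * (2 * √n : ℝ)))))

lemma dualTerm_divisorWindow (hu : 0 < u) (hδ : 0 ≤ δ) (hx : 1 ≤ x) (n : ℕ) :
    τ n * (2 * (dualTerm (divisorWindow u δ x) n).re) =
      √x * (2 * (voronoiCoeff δ n * mollifierHat (u * (2 * √n)) *
        unitExp (-(x * (2 * √n)))).re) := by
  rcases Nat.eq_zero_or_pos n with rfl | hn
  · simp [voronoiCoeff]
  have hn' : (0:ℝ) < n := mod_cast hn
  rw [dualTerm, integral_sqrt_mul_divisorWindow hu hδ hx (by positivity)]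
  have h : ∀ z w : ℂ, (n.divisors.card : ℂ) * z = √x * w → τ n * (2 * z.re) = √x * (2 * w.re) := by
    intro z w h
    have := congrArg Complex.re h
    rw [← Complex.ofReal_natCast, Complex.re_ofReal_mul, Complex.re_ofReal_mul] at this
    linarith
  apply h
  rw [voronoiCoeff]
  ring

lemma norm_voronoiCoeff (δ : ℝ) {n : ℕ} (hn : 1 ≤ n) :
    ‖voronoiCoeff δ n‖ ^ 2 = τ n ^ 2 * (n : ℝ) ^ (-3 / 2 : ℝ) *
      sin (2 * π * √n * δ) ^ 2 / (2 * π ^ 2) := by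
  have hn' : (0:ℝ) < n := mod_cast hn
  have h1 : ‖1 - unitExp (-(δ * (2 * √n)))‖ ^ 2 = 4 * sin (2 * π * √n * δ) ^ 2 := by
    have hc : unitExp (-(δ * (2 * √n))) =
        (cos (2 * (2 * π * √n * δ)) : ℂ) - (sin (2 * (2 * π * √n * δ)) : ℂ) * I := by
      rw [unitExp, Complex.exp_mul_I, ← Complex.ofReal_cos, ← Complex.ofReal_sin,
        show 2 * π * -(δ * (2 * √(n:ℝ))) = -(2 * (2 * π * √n * δ)) by ring, cos_neg, sin_neg]
      push_cast; ring
    rw [hc, ← Complex.normSq_eq_norm_sq, Complex.normSq_apply]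
    simp only [Complex.sub_re, Complex.one_re, ofReal_re, Complex.mul_re, Complex.I_re,
      mul_zero, Complex.ofReal_im, Complex.I_im, mul_one, sub_self, sub_zero, Complex.sub_im,
      Complex.one_im, Complex.mul_im, add_zero, zero_sub]
    rw [sin_two_mul, cos_two_mul']
    linear_combination (sin (2 * π * √n * δ) ^ 2 + cos (2 * π * √n * δ) ^ 2 - 1) *
      sin_sq_add_cos_sq (2 * π * √n * δ)
  have h2 : ‖cexp (-(π / 4 : ℝ) * I)‖ = 1 := by rw [← ofReal_neg]; exact norm_exp_ofReal_mul_I _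
  rw [voronoiCoeff]
  simp only [norm_mul, norm_div, mul_pow, div_pow, h1, h2, norm_real, Complex.norm_natCast,
    norm_I, Complex.norm_ofNat, norm_eq_abs, sq_abs, one_pow]
  have e : (n : ℝ) ^ (-3 / 2 : ℝ) = 1 / (√n * (√n) ^ 2) := by
    rw [sq_sqrt hn'.le, sqrt_eq_rpow, ← rpow_add_one hn'.ne', one_div, ← rpow_neg hn'.le]
    norm_num
  rw [e, sq_sqrt (by positivity : (0:ℝ) ≤ 2 * √n)]
  have : 0 < √(n:ℝ) := by positivity
  field_simp
  ring

end

section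

variable {u δ x : ℝ}

lemma abs_divisorWindow_sub_indicator_le (hu : 0 < u) (huδ : u ≤ δ) (hx : 1 ≤ x) (w : ℝ) :
    |divisorWindow u δ x w - indicator (Set.Ioc x (x + δ)) 1 w| ≤
      indicator (Set.Ioc x (x + u)) 1 w + indicator (Set.Ioc (x + δ) (x + δ + u)) 1 w +
        δ / x * indicator (Set.Ioc x (x + δ)) 1 w := by
  have hδ : 0 ≤ δ := hu.le.trans huδ
  have h0 : ∀ s : Set ℝ, 0 ≤ indicator s (1 : ℝ → ℝ) w := fun s =>
    Set.indicator_nonneg (fun _ _ => zero_le_one) w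
  have h1 := abs_divisorWindow_le hu hδ hx w
  have hnn : 0 ≤ divisorWindow u δ x w := mul_nonneg (sqrt_nonneg _) (edge_nonneg hu hδ _)
  rcases le_or_gt w x with hwx | hwx
  · have : divisorWindow u δ x w = 0 := by
      rw [divisorWindow, edge_eq_zero_of_nonpos hu hδ (by linarith), mul_zero]
    rw [this, indicator_of_notMem (s := Set.Ioc x (x + δ)) (fun h => absurd h.1 (not_lt.2 hwx))]
    simp only [sub_zero, abs_zero, mul_zero, add_zero]
    exact add_nonneg (h0 _) (h0 _)
  rcases le_or_gt w (x + δ) with hwδ | hwδ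
  · have hm : w ∈ Set.Ioc x (x + δ) := ⟨hwx, hwδ⟩
    rw [indicator_of_mem hm, Pi.one_apply, mul_one]
    have hle : divisorWindow u δ x w ≤ 1 :=
      (le_abs_self _).trans (h1.trans (Set.indicator_le_self' (fun _ _ => zero_le_one) w))
    rw [abs_sub_comm, abs_of_nonneg (by linarith)]
    rcases le_or_gt w (x + u) with hwu | hwu
    · rw [indicator_of_mem (s := Set.Ioc x (x + u)) ⟨hwx, hwu⟩, Pi.one_apply]
      have := h0 (Set.Ioc (x + δ) (x + δ + u))
      have : 0 ≤ δ / x := by positivity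
      linarith
    · have e : edge u δ (w - x) = 1 := edge_eq_one hu (by linarith) (by linarith)
      have h2 : 1 - δ / x ≤ √(x / w) := by
        have hw0 : 0 < w := by linarith
        have a1 : x / w ≤ √(x / w) := by
          refine le_sqrt_of_sq_le ?_
          rw [sq]
          exact mul_le_of_le_one_left (by positivity) ((div_le_one hw0).2 hwx.le)
        refine le_trans ?_ a1
        rw [le_div_iff₀ hw0]
        have hx0 : 0 < x := by linarith
        have : (1 - δ / x) * w * x ≤ x * x := by
          have : (1 - δ / x) * w * x = (x - δ) * w := by field_simp
          rw [this]
          rcases le_or_gt (x - δ) 0 with h | h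
          · nlinarith
          · nlinarith
        exact le_of_mul_le_mul_right this hx0
      rw [divisorWindow, e, mul_one]
      have := h0 (Set.Ioc (x + δ) (x + δ + u))
      have := h0 (Set.Ioc x (x + u))
      linarith
  · rw [indicator_of_notMem (s := Set.Ioc x (x + δ)) (fun h => absurd h.2 (not_le.2 hwδ)),
      sub_zero, mul_zero, add_zero]
    refine le_add_of_nonneg_of_le (h0 _) ?_
    rcases le_or_gt w (x + δ + u) with h | h
    · rw [indicator_of_mem (s := Set.Ioc (x + δ) (x + δ + u)) ⟨hwδ, h⟩]
      exact h1.trans (Set.indicator_le_self' (fun _ _ => zero_le_one) w)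
    · refine h1.trans (le_of_eq_of_le ?_ (h0 _))
      exact indicator_of_notMem (fun h' => absurd h'.2 (not_le.2 h)) _

lemma card_filter_sqrt_le {a b : ℝ} (ha : 0 ≤ a) (hab : a ≤ b) (M : ℕ) :
    (((Icc 1 M).filter fun n : ℕ => √n ∈ Set.Ioc a b).card : ℝ) ≤ b ^ 2 - a ^ 2 + 1 := by
  have hb : 0 ≤ b := ha.trans hab
  have hsub : ((Icc 1 M).filter fun n : ℕ => √n ∈ Set.Ioc a b) ⊆ Ioc ⌊a ^ 2⌋₊ ⌊b ^ 2⌋₊ := by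
    intro n hn
    rw [mem_filter] at hn
    obtain ⟨-, h1, h2⟩ := hn
    rw [mem_Ioc, Nat.floor_lt (by positivity), le_floor_iff (by positivity)]
    exact ⟨(lt_sqrt ha).1 h1, (sqrt_le_left hb).1 h2⟩
  have h1 := card_le_card hsub
  rw [Nat.card_Ioc] at h1
  have h2 : ⌊a ^ 2⌋₊ ≤ ⌊b ^ 2⌋₊ := Nat.floor_mono (by gcongr)
  calc _ ≤ ((⌊b ^ 2⌋₊ - ⌊a ^ 2⌋₊ : ℕ) : ℝ) := mod_cast h1
    _ ≤ _ := by
        rw [Nat.cast_sub h2]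
        have := floor_le (sq_nonneg b)
        have := (lt_floor_add_one (a ^ 2)).le
        linarith

lemma exists_sum_card_divisors_indicator_le : ∃ C, 0 ≤ C ∧ ∀ (a b X : ℝ) (M : ℕ), 1 ≤ X → 0 ≤ a →
    a ≤ b → b ≤ 4 * X → ∑ n ∈ Icc 1 M, τ n *
      indicator (Set.Ioc a b) 1 (√n) ≤ C * X ^ (1 / 32 : ℝ) * (b ^ 2 - a ^ 2 + 1) := by
  obtain ⟨C, hC, hτ⟩ := exists_card_divisors_le (ε := 1 / 64) (by norm_num)
  refine ⟨C * 4 ^ (1 / 32 : ℝ), by positivity, fun a b X M hX ha hab hb => ?_⟩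
  have hb0 : 0 ≤ b := ha.trans hab
  have key : ∀ n ∈ Icc 1 M, τ n * indicator (Set.Ioc a b) 1 (√n) ≤
      if √n ∈ Set.Ioc a b then C * 4 ^ (1 / 32 : ℝ) * X ^ (1 / 32 : ℝ) else 0 := by
    intro n hn
    have hn1 := (mem_Icc.1 hn).1
    split_ifs with h
    · rw [indicator_of_mem h, Pi.one_apply, mul_one]
      refine (hτ n hn1).trans ?_
      have : (n : ℝ) ≤ (4 * X) ^ 2 := by
        refine ((sqrt_le_left hb0).1 h.2).trans ?_
        gcongr
      calc C * (n : ℝ) ^ (1 / 64 : ℝ) ≤ C * ((4 * X) ^ 2) ^ (1 / 64 : ℝ) := by gcongr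
        _ = _ := by
          rw [← rpow_natCast, ← rpow_mul (by positivity), mul_rpow (by norm_num) (by linarith)]
          norm_num
          ring
    · rw [indicator_of_notMem h, mul_zero]
  refine (sum_le_sum key).trans ?_
  rw [← sum_filter, sum_const, nsmul_eq_mul, mul_comm]
  gcongr
  exact card_filter_sqrt_le ha hab M

lemma sum_card_divisors_indicator {a b : ℝ} (ha : 0 ≤ a) (hab : a ≤ b) {M : ℕ} (hM : b ^ 2 ≤ M) :
    ∑ n ∈ Icc 1 M, τ n * indicator (Set.Ioc a b) 1 (√n) = (∑ n ∈ Icc 1 ⌊b ^ 2⌋₊, τ n) -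
        ∑ n ∈ Icc 1 ⌊a ^ 2⌋₊, τ n := by
  have hb : 0 ≤ b := ha.trans hab
  have key : ∀ c : ℝ, 0 ≤ c → c ^ 2 ≤ M → ∑ n ∈ Icc 1 ⌊c ^ 2⌋₊, τ n =
      ∑ n ∈ Icc 1 M, if √n ≤ c then τ n else 0 := by
    intro c hc hcM
    rw [← sum_filter]
    congr 1
    ext n
    rw [mem_filter, mem_Icc, mem_Icc, le_floor_iff (by positivity), sqrt_le_left hc]
    constructor
    · rintro ⟨h1, h2⟩
      exact ⟨⟨h1, by exact_mod_cast h2.trans hcM⟩, h2⟩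
    · rintro ⟨⟨h1, -⟩, h2⟩
      exact ⟨h1, h2⟩
  rw [key b hb hM, key a ha (le_trans (by gcongr) hM), ← sum_sub_distrib]
  refine sum_congr rfl fun n _ => ?_
  rcases le_or_gt (√(n:ℝ)) a with h | h
  · rw [indicator_of_notMem (fun h' => absurd h'.1 (not_lt.2 h)), if_pos (h.trans hab),
      if_pos h]; simp
  · rw [if_neg (not_le.2 h)]
    rcases le_or_gt (√(n:ℝ)) b with h' | h'
    · rw [indicator_of_mem (s := Set.Ioc a b) ⟨h, h'⟩, if_pos h']; simp
    · rw [indicator_of_notMem (fun h'' => absurd h''.2 (not_le.2 h')), if_neg (not_le.2 h')]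
      simp

lemma hasDerivAt_divisor_main {w : ℝ} (hw : 0 < w) :
    HasDerivAt (fun w => w ^ 2 * log (w ^ 2) + (2 * γ - 1) * w ^ 2)
      (2 * w * (2 * log w + 2 * γ)) w := by
  have h1 : HasDerivAt (fun w => w ^ 2) (2 * w) w := by simpa using hasDerivAt_pow 2 w
  have h2 := (h1.mul (h1.log (by positivity))).add (h1.const_mul (2 * γ - 1))
  refine h2.congr_deriv ?_
  rw [log_pow]
  field_simp
  push_cast
  ring

lemma integral_divisor_main (hx : 1 ≤ x) (hδ : 0 ≤ δ) :
    ∫ w in x..(x + δ), 2 * w * (2 * log w + 2 * γ) =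
      ((x + δ) ^ 2 * log ((x + δ) ^ 2) + (2 * γ - 1) * (x + δ) ^ 2) -
        (x ^ 2 * log (x ^ 2) + (2 * γ - 1) * x ^ 2) := by
  refine integral_eq_sub_of_hasDerivAt (fun w hw => hasDerivAt_divisor_main ?_) ?_
  · rw [Set.uIcc_of_le (by linarith)] at hw
    linarith [hw.1]
  · refine ContinuousOn.intervalIntegrable fun w hw => ?_
    rw [Set.uIcc_of_le (by linarith)] at hw
    have : w ≠ 0 := by linarith [hw.1]
    exact ContinuousAt.continuousWithinAt (by fun_prop (disch := assumption))

end

section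

variable {u δ x : ℝ}

/-- The summand of the truncated dual sum for `(Δ((x + δ)²) - Δ(x²)) / √x`. -/
def dualSummand (u δ x : ℝ) (n : ℕ) : ℝ :=
  2 * (voronoiCoeff δ n * mollifierHat (u * (2 * √n)) * unitExp (-(x * (2 * √n)))).re

lemma exists_abs_dualSummand_le : ∃ C, 0 ≤ C ∧ ∀ (X δ x : ℝ) (n : ℕ), 1 ≤ X → X ^ (7 / 4 : ℝ) ≤ n →
    |dualSummand (X ^ (-9 / 16 : ℝ)) δ x n| ≤ C * X ^ (-1 / 32 : ℝ) * (1 / (n : ℝ) ^ (5 / 4 : ℝ)) := by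
  obtain ⟨C, hC, hτ⟩ := exists_card_divisors_le (ε := 1 / 4) (by norm_num)
  obtain ⟨D, hD, hρ⟩ := exists_norm_mollifierHat_le 14
  refine ⟨2 * C * D, by positivity, fun X δ x n hX hn => ?_⟩
  have hX0 : 0 < X := by linarith
  have hn1 : (1 : ℝ) ≤ n := (one_le_rpow hX (by norm_num)).trans hn
  have hn0 : (0 : ℝ) < n := by linarith
  have hn1' : 1 ≤ n := mod_cast hn1
  have hc : ‖voronoiCoeff δ n‖ ≤ n.divisors.card := by
    refine le_of_sq_le_sq ?_ (cast_nonneg _)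
    rw [norm_voronoiCoeff δ hn1']
    have h1 : (n : ℝ) ^ (-3 / 2 : ℝ) ≤ 1 := rpow_le_one_of_one_le_of_nonpos hn1 (by norm_num)
    have h2 : sin (2 * π * √n * δ) ^ 2 ≤ 1 := sin_sq_le_one _
    rw [div_le_iff₀ (by positivity)]
    have h3 : (1:ℝ) ≤ 2 * π ^ 2 := by nlinarith [pi_gt_three]
    calc _ ≤ τ n ^ 2 * 1 * 1 := by gcongr
      _ ≤ _ := by
        rw [mul_one]
        exact mul_le_mul_of_nonneg_left h3 (by positivity)
  have hu : (n : ℝ) ^ (5 / 28 : ℝ) ≤ |X ^ (-9 / 16 : ℝ) * (2 * √n)| := by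
    have h1 : (n : ℝ) ^ (-9 / 28 : ℝ) ≤ X ^ (-9 / 16 : ℝ) := by
      calc (n : ℝ) ^ (-9 / 28 : ℝ) ≤ (X ^ (7 / 4 : ℝ)) ^ (-9 / 28 : ℝ) :=
            rpow_le_rpow_of_nonpos (by positivity) hn (by norm_num)
        _ = _ := by rw [← rpow_mul hX0.le]; norm_num
    rw [abs_of_nonneg (by positivity)]
    calc (n : ℝ) ^ (5 / 28 : ℝ) = (n : ℝ) ^ (-9 / 28 : ℝ) * √n := by
          rw [sqrt_eq_rpow, ← rpow_add hn0]; norm_num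
      _ ≤ _ := by
          gcongr
          linarith [sqrt_nonneg (n:ℝ)]
  have hm : ‖mollifierHat (X ^ (-9 / 16 : ℝ) * (2 * √n))‖ ≤ D / (n : ℝ) ^ (5 / 2 : ℝ) := by
    rw [le_div_iff₀ (by positivity), mul_comm]
    refine le_trans ?_ (hρ (X ^ (-9 / 16 : ℝ) * (2 * √n)))
    have : (n : ℝ) ^ (5 / 2 : ℝ) = ((n : ℝ) ^ (5 / 28 : ℝ)) ^ 14 := by
      rw [← rpow_natCast, ← rpow_mul hn0.le]; norm_num
    rw [this]
    gcongr
  rw [dualSummand, abs_mul, abs_two]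
  calc _ ≤ 2 * ‖voronoiCoeff δ n * mollifierHat (X ^ (-9 / 16 : ℝ) * (2 * √n)) *
        unitExp (-(x * (2 * √n)))‖ := by gcongr; exact abs_re_le_norm _
    _ ≤ 2 * ((C * (n : ℝ) ^ (1 / 4 : ℝ)) * (D / (n : ℝ) ^ (5 / 2 : ℝ))) := by
        rw [norm_mul, norm_unitExp, mul_one, norm_mul]
        gcongr
        exact hc.trans (hτ n hn1')
    _ = 2 * C * D * (n : ℝ) ^ (-1 : ℝ) * (1 / (n : ℝ) ^ (5 / 4 : ℝ)) := by
        have h1 : (n : ℝ) ^ (-1 : ℝ) * (n : ℝ) ^ (-(5 / 4) : ℝ) =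
            (n : ℝ) ^ (1 / 4 : ℝ) * (n : ℝ) ^ (-(5 / 2) : ℝ) := by
          rw [← rpow_add hn0, ← rpow_add hn0]; norm_num
        rw [one_div ((n : ℝ) ^ (5 / 4 : ℝ)), ← rpow_neg hn0.le, div_eq_mul_inv D, ← rpow_neg hn0.le]
        linear_combination -2 * C * D * h1
    _ ≤ _ := by
        have : (n : ℝ) ^ (-1 : ℝ) ≤ X ^ (-1 / 32 : ℝ) := by
          calc (n : ℝ) ^ (-1 : ℝ) ≤ (X ^ (7 / 4 : ℝ)) ^ (-1 : ℝ) :=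
                rpow_le_rpow_of_nonpos (by positivity) hn (by norm_num)
            _ = X ^ (-7 / 4 : ℝ) := by rw [← rpow_mul hX0.le]; norm_num
            _ ≤ _ := rpow_le_rpow_of_exponent_le hX (by norm_num)
        have hC0 : 0 ≤ C := by linarith
        gcongr

lemma exists_tsum_dualSummand_sub_le : ∃ C, 0 ≤ C ∧ ∀ (X δ x : ℝ), 1 ≤ X →
    Summable (dualSummand (X ^ (-9 / 16 : ℝ)) δ x) →
    |∑' n, dualSummand (X ^ (-9 / 16 : ℝ)) δ x n -
      ∑ n ∈ Icc 1 ⌊X ^ (7 / 4 : ℝ)⌋₊, dualSummand (X ^ (-9 / 16 : ℝ)) δ x n| ≤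
        C * X ^ (-1 / 32 : ℝ) := by
  obtain ⟨C, hC, h⟩ := exists_abs_dualSummand_le
  have hsum : Summable fun n : ℕ => 1 / (n : ℝ) ^ (5 / 4 : ℝ) :=
    summable_one_div_nat_rpow.2 (by norm_num)
  refine ⟨C * ∑' n : ℕ, 1 / (n : ℝ) ^ (5 / 4 : ℝ),
    mul_nonneg hC (tsum_nonneg fun n => by positivity), fun X δ x hX hs => ?_⟩
  set f := dualSummand (X ^ (-9 / 16 : ℝ)) δ x with hf
  set s := Icc 1 ⌊X ^ (7 / 4 : ℝ)⌋₊
  have e1 : ∑ n ∈ s, f n = ∑' n, if n ∈ s then f n else 0 := by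
    rw [tsum_eq_sum (s := s) (fun n hn => by rw [if_neg hn])]
    exact sum_congr rfl fun n hn => by rw [if_pos hn]
  have hs2 : Summable fun n => if n ∈ s then f n else 0 :=
    summable_of_ne_finset_zero (s := s) fun n hn => by rw [if_neg hn]
  rw [e1, ← hs.tsum_sub hs2]
  have := tsum_of_norm_bounded ((hsum.mul_left (C * X ^ (-1 / 32 : ℝ))).hasSum)
    (f := fun n => f n - if n ∈ s then f n else 0) fun n => ?_
  · rw [tsum_mul_left] at this
    refine this.trans (le_of_eq ?_)
    ring
  · by_cases hn : n ∈ s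
    · rw [if_pos hn, sub_self, norm_zero]; positivity
    · rw [if_neg hn, sub_zero]
      rcases Nat.eq_zero_or_pos n with rfl | hn0
      · rw [hf, dualSummand, voronoiCoeff]
        simp
      · refine h X δ x n hX ?_
        have : ¬ n ≤ ⌊X ^ (7 / 4 : ℝ)⌋₊ := fun h' => hn (mem_Icc.2 ⟨hn0, h'⟩)
        exact (Nat.lt_of_floor_lt (not_le.1 this)).le

lemma exists_abs_sum_divisorWindow_sub_le : ∃ C, 0 ≤ C ∧ ∀ (X δ x : ℝ) (M : ℕ), 1 ≤ X →
    X ^ (-9 / 16 : ℝ) ≤ δ → δ ≤ 1 → x ∈ Set.Icc X (2 * X) → (x + δ) ^ 2 ≤ M →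
    |∑ n ∈ Icc 1 M, τ n *
        divisorWindow (X ^ (-9 / 16 : ℝ)) δ x (√n) -
      ((∑ n ∈ Icc 1 ⌊(x + δ) ^ 2⌋₊, τ n) - ∑ n ∈ Icc 1 ⌊x ^ 2⌋₊, τ n)| ≤ C * X ^ (15 / 32 : ℝ) := by
  obtain ⟨C, hC, h⟩ := exists_sum_card_divisors_indicator_le
  refine ⟨C * 21, by positivity, fun X δ x M hX hδ hδ1 hx hM => ?_⟩
  set u := X ^ (-9 / 16 : ℝ) with hu_def
  have hX0 : 0 < X := by linarith
  have hu : 0 < u := by positivity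
  have hu1 : u ≤ 1 := hδ.trans hδ1
  have hδ0 : 0 < δ := hu.trans_le hδ
  have hx1 : 1 ≤ x := hX.trans hx.1
  have hXu : X * u = X ^ (7 / 16 : ℝ) := by rw [hu_def, mul_comm, ← rpow_add_one hX0.ne']; norm_num
  have hXu1 : 1 ≤ X * u := by rw [hXu]; exact one_le_rpow hX (by norm_num)
  rw [← sum_card_divisors_indicator (by linarith) (by linarith) hM, ← sum_sub_distrib]
  have b1 := h x (x + u) X M hX (by linarith) (by linarith) (by linarith [hx.2])
  have b2 := h (x + δ) (x + δ + u) X M hX (by linarith) (by linarith) (by linarith [hx.2])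
  have b3 := h x (x + δ) X M hX (by linarith) (by linarith) (by linarith [hx.2])
  have hP : 0 ≤ C * X ^ (1 / 32 : ℝ) := by positivity
  have c1 : (x + u) ^ 2 - x ^ 2 + 1 ≤ 6 * (X * u) := by nlinarith [hx.2]
  have c2 : (x + δ + u) ^ 2 - (x + δ) ^ 2 + 1 ≤ 8 * (X * u) := by nlinarith [hx.2]
  have c3 : δ / x * ((x + δ) ^ 2 - x ^ 2 + 1) ≤ 4 * (X * u) := by
    have : δ / x * ((x + δ) ^ 2 - x ^ 2 + 1) ≤ 4 := by
      rw [div_mul_eq_mul_div, div_le_iff₀ (by linarith)]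
      have : 0 ≤ (x + δ) ^ 2 - x ^ 2 + 1 := by nlinarith
      have := mul_le_of_le_one_left this hδ1
      nlinarith
    linarith
  calc _ ≤ ∑ n ∈ Icc 1 M, (τ n *
          indicator (Set.Ioc x (x + u)) 1 (√n) + τ n *
          indicator (Set.Ioc (x + δ) (x + δ + u)) 1 (√n) + δ / x *
          (τ n * indicator (Set.Ioc x (x + δ)) 1 (√n))) := by
        refine (abs_sum_le_sum_abs _ _).trans (sum_le_sum fun n _ => ?_)
        rw [← mul_sub, abs_mul, Nat.abs_cast]
        refine (mul_le_mul_of_nonneg_left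
          (abs_divisorWindow_sub_indicator_le hu hδ hx1 (√n)) (cast_nonneg _)).trans
          (le_of_eq ?_)
        ring
    _ ≤ C * X ^ (1 / 32 : ℝ) * (6 * (X * u)) + C * X ^ (1 / 32 : ℝ) * (8 * (X * u)) +
          C * X ^ (1 / 32 : ℝ) * (4 * (X * u)) := by
        rw [sum_add_distrib, sum_add_distrib, ← mul_sum]
        refine add_le_add (add_le_add (b1.trans ?_) (b2.trans ?_)) ?_
        · gcongr
        · gcongr
        · refine (mul_le_mul_of_nonneg_left b3 (by positivity)).trans ?_
          rw [mul_left_comm]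
          gcongr
    _ ≤ C * 21 * (X ^ (1 / 32 : ℝ) * (X * u)) := by
        have : 0 ≤ C * X ^ (1 / 32 : ℝ) * (X * u) := by positivity
        linarith
    _ = _ := by rw [hXu, ← rpow_add hX0]; norm_num

lemma exists_abs_integral_divisorWindow_sub_le : ∃ C, 0 ≤ C ∧ ∀ (X δ x : ℝ), 1 ≤ X →
    X ^ (-9 / 16 : ℝ) ≤ δ → δ ≤ 1 → x ∈ Set.Icc X (2 * X) →
    |(∫ w, 2 * w * divisorWindow (X ^ (-9 / 16 : ℝ)) δ x w *
        (2 * log w + 2 * γ)) -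
      ∫ w in x..(x + δ), 2 * w * (2 * log w + 2 * γ)| ≤ C * X ^ (15 / 32 : ℝ) := by
  refine ⟨6336, by norm_num, fun X δ x hX hδ hδ1 hx => ?_⟩
  set u := X ^ (-9 / 16 : ℝ) with hu_def
  have hX0 : 0 < X := by linarith
  have hu : 0 < u := by positivity
  have hu1 : u ≤ 1 := hδ.trans hδ1
  have hδ0 : 0 < δ := hu.trans_le hδ
  have hx1 : 1 ≤ x := hX.trans hx.1
  set K := 2112 * (X * X ^ (1 / 32 : ℝ)) with hK
  have hK0 : 0 ≤ K := by positivity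
  set m : ℝ → ℝ := fun w => 2 * w * (2 * log w + 2 * γ) with hm
  have hγ0 : 0 < γ := lt_trans (by norm_num) one_half_lt_eulerMascheroniConstant
  have hγ1 : γ < 1 := lt_trans eulerMascheroniConstant_lt_two_thirds (by norm_num)
  have hmK : ∀ w ∈ Set.Icc x (x + δ + u), |m w| ≤ K := by
    intro w hw
    have hw1 : 1 ≤ w := hx1.trans hw.1
    have hw4 : w ≤ 4 * X := by linarith [hw.2, hx.2]
    have hlog0 : 0 ≤ log w := log_nonneg hw1
    have hX32 : 1 ≤ X ^ (1 / 32 : ℝ) := one_le_rpow hX (by norm_num)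
    have hlog : log w ≤ 32 * (4 * X ^ (1 / 32 : ℝ)) := by
      calc log w ≤ w ^ (1 / 32 : ℝ) / (1 / 32) := log_le_rpow_div (by linarith) (by norm_num)
        _ = 32 * w ^ (1 / 32 : ℝ) := by ring
        _ ≤ 32 * (4 * X) ^ (1 / 32 : ℝ) := by gcongr
        _ ≤ _ := by
            rw [mul_rpow (by norm_num) hX0.le]
            gcongr
            exact rpow_le_self_of_one_le (by norm_num) (by norm_num)
    rw [hm, abs_of_nonneg (by positivity)]
    calc 2 * w * (2 * log w + 2 * γ) ≤
        2 * (4 * X) * (2 * (32 * (4 * X ^ (1 / 32 : ℝ))) + 2 * 1) := by gcongr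
      _ ≤ 2 * (4 * X) * (264 * X ^ (1 / 32 : ℝ)) := by gcongr; linarith
      _ = _ := by rw [hK]; ring
  have hψ := isWindow_divisorWindow (u := u) (δ := δ) (x := x) hu hδ0.le hx1
  have hmm : Measurable m := by
    rw [hm]
    have := measurable_log
    fun_prop
  have i1 : Integrable fun w => divisorWindow u δ x w * m w := by
    refine (hψ.integrable.abs.const_mul K).mono'
      (hψ.smooth.continuous.measurable.mul hmm).aestronglyMeasurable
      (.of_forall fun w => ?_)
    rw [norm_mul, norm_eq_abs, norm_eq_abs, mul_comm]
    by_cases hw : w ∈ Set.Icc x (x + δ + u)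
    · exact mul_le_mul_of_nonneg_right (hmK w hw) (abs_nonneg _)
    · rw [divisorWindow_eq_zero hu hδ0.le hw]; simp
  have hone : ∀ a b : ℝ, Integrable (indicator (Set.Ioc a b) (1 : ℝ → ℝ)) := fun a b =>
    (integrable_indicator_iff measurableSet_Ioc).2 (integrableOn_const (C := (1 : ℝ)) (by simp))
  have hint : ∀ a b : ℝ, a ≤ b → ∫ w, indicator (Set.Ioc a b) (1 : ℝ → ℝ) w = b - a := by
    intro a b hab
    rw [integral_indicator_one measurableSet_Ioc, measureReal_def, volume_Ioc,
      ENNReal.toReal_ofReal (by linarith)]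
  have i2 : Integrable fun w => indicator (Set.Ioc x (x + δ)) 1 w * m w := by
    refine ((hone x (x + δ)).const_mul K).mono'
      ((measurable_one.indicator measurableSet_Ioc).mul hmm).aestronglyMeasurable
      (.of_forall fun w => ?_)
    by_cases hw : w ∈ Set.Ioc x (x + δ)
    · rw [indicator_of_mem hw, Pi.one_apply, one_mul, mul_one]
      exact hmK w ⟨hw.1.le, hw.2.trans (by linarith)⟩
    · rw [indicator_of_notMem hw]; simp
  have e1 : ∫ w in x..(x + δ), m w = ∫ w, indicator (Set.Ioc x (x + δ)) 1 w * m w := by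
    rw [integral_of_le (by linarith), ← integral_indicator measurableSet_Ioc]
    refine integral_congr_ae (.of_forall fun w => ?_)
    by_cases hw : w ∈ Set.Ioc x (x + δ)
    · simp [indicator_of_mem hw]
    · simp [indicator_of_notMem hw]
  have e2 : ∫ w, 2 * w * divisorWindow u δ x w * (2 * log w + 2 * γ) =
      ∫ w, divisorWindow u δ x w * m w := by
    refine integral_congr_ae (.of_forall fun w => ?_)
    simp only [hm]; ring
  have e3 := integral_add (hone x (x + u)) (hone (x + δ) (x + δ + u))
  have e4 := integral_add ((hone x (x + u)).add (hone (x + δ) (x + δ + u)))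
    ((hone x (x + δ)).const_mul (δ / x))
  simp only [Pi.add_apply] at e3 e4
  have hG : ∫ w, (indicator (Set.Ioc x (x + u)) 1 w + indicator (Set.Ioc (x + δ) (x + δ + u)) 1 w +
        δ / x * indicator (Set.Ioc x (x + δ)) 1 w) ≤ 3 * u := by
    rw [e4, e3, integral_const_mul, hint _ _ (by linarith), hint _ _ (by linarith),
      hint _ _ (by linarith)]
    have h1 : δ / x * (x + δ - x) ≤ 1 / X := by
      rw [add_sub_cancel_left, div_mul_eq_mul_div]
      exact div_le_div₀ zero_le_one (by nlinarith) hX0 hx.1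
    have h2 : 1 / X ≤ u := by
      rw [one_div, ← rpow_neg_one]
      exact rpow_le_rpow_of_exponent_le hX (by norm_num)
    linarith
  have iG := ((hone x (x + u)).add (hone (x + δ) (x + δ + u))).add
    ((hone x (x + δ)).const_mul (δ / x))
  rw [e1, e2, ← integral_sub i1 i2]
  calc _ ≤ ∫ w, K * (indicator (Set.Ioc x (x + u)) 1 w +
      indicator (Set.Ioc (x + δ) (x + δ + u)) 1 w + δ / x * indicator (Set.Ioc x (x + δ)) 1 w) := by
        rw [← norm_eq_abs]
        refine norm_integral_le_of_norm_le (iG.const_mul K) (.of_forall fun w => ?_)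
        rw [← sub_mul, norm_mul, mul_comm, norm_eq_abs, norm_eq_abs]
        by_cases hw : w ∈ Set.Icc x (x + δ + u)
        · exact mul_le_mul (hmK w hw) (abs_divisorWindow_sub_indicator_le hu hδ hx1 w)
            (abs_nonneg _) hK0
        · rw [divisorWindow_eq_zero hu hδ0.le hw, indicator_of_notMem fun h =>
            hw ⟨h.1.le, h.2.trans (by linarith)⟩]
          simp only [sub_self, abs_zero, mul_zero]
          have h0 : ∀ s : Set ℝ, 0 ≤ indicator s (1 : ℝ → ℝ) w := fun s =>
            Set.indicator_nonneg (fun _ _ => zero_le_one) w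
          have := h0 (Set.Ioc x (x + u))
          have := h0 (Set.Ioc (x + δ) (x + δ + u))
          positivity
    _ ≤ K * (3 * u) := by
        rw [integral_const_mul]
        gcongr
    _ = 6336 * (u * X * X ^ (1 / 32 : ℝ)) := by rw [hK]; ring
    _ = _ := by rw [hu_def, ← rpow_add_one hX0.ne', ← rpow_add hX0]; norm_num

/-- Over short intervals the error term in the divisor problem is a short trigonometric sum. -/
theorem exists_abs_divisorError_sub_le : ∃ C, 0 ≤ C ∧ ∀ (X δ x : ℝ), 1 ≤ X →
    X ^ (-9 / 16 : ℝ) ≤ δ → δ ≤ 1 → x ∈ Set.Icc X (2 * X) →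
    |(divisorError ((x + δ) ^ 2) - divisorError (x ^ 2)) / √x -
      ∑ n ∈ Icc 1 ⌊X ^ (7 / 4 : ℝ)⌋₊, dualSummand (X ^ (-9 / 16 : ℝ)) δ x n| ≤
        C * X ^ (-1 / 32 : ℝ) := by
  obtain ⟨C₁, hC₁, h1⟩ := exists_voronoi_dualTerm_le
  obtain ⟨C₂, hC₂, h2⟩ := exists_norm_windowHat_divisorWindow_le
  obtain ⟨C₃, hC₃, h3⟩ := exists_tsum_dualSummand_sub_le
  obtain ⟨C₄, hC₄, h4⟩ := exists_abs_sum_divisorWindow_sub_le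
  obtain ⟨C₅, hC₅, h5⟩ := exists_abs_integral_divisorWindow_sub_le
  refine ⟨C₁ * (2 + C₂) + C₃ + C₄ + C₅, by positivity, fun X δ x hX hδ hδ1 hx => ?_⟩
  have hX0 : 0 < X := by linarith
  have hx1 : 1 ≤ x := hX.trans hx.1
  have hx0 : 0 < x := by linarith
  have hu : 0 < X ^ (-9 / 16 : ℝ) := by positivity
  have hδ0 : 0 < δ := hu.trans_le hδ
  obtain ⟨M, hM⟩ := exists_nat_ge ((x + δ + X ^ (-9 / 16 : ℝ)) ^ 2)
  have hw := isWindow_divisorWindow (x := x) hu hδ0.le hx1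
  obtain ⟨hs, hv⟩ := h1 _ _ (C₂ * (X ^ (-9 / 16 : ℝ)) ^ (-3 / 4 : ℝ)) hw (by linarith)
    (fun s hs => h2 _ δ x hu (hδ.trans hδ1) hδ0.le hδ1 hx1 s hs) M hM
  have hterm : ∀ n : ℕ, τ n * (2 * (dualTerm (divisorWindow (X ^ (-9 / 16 : ℝ)) δ x) n).re) =
      √x * dualSummand (X ^ (-9 / 16 : ℝ)) δ x n := fun n =>
    dualTerm_divisorWindow hu hδ0.le hx1 n
  simp only [hterm] at hs hv
  have hsx : 0 < √x := by positivity
  have hs2 : Summable (dualSummand (X ^ (-9 / 16 : ℝ)) δ x) := (summable_mul_left_iff hsx.ne').1 hs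
  rw [tsum_mul_left] at hv
  have k3 := h3 X δ x hX hs2
  have k4 := h4 X δ x M hX hδ hδ1 hx ((pow_le_pow_left₀ (by linarith) (by linarith) 2).trans hM)
  have k5 := h5 X δ x hX hδ hδ1 hx
  rw [integral_divisor_main hx1 hδ0.le] at k5
  have kv : C₁ * ((∫ w, |divisorWindow (X ^ (-9 / 16 : ℝ)) δ x w|) +
      C₂ * (X ^ (-9 / 16 : ℝ)) ^ (-3 / 4 : ℝ)) ≤ C₁ * (2 + C₂) * X ^ (15 / 32 : ℝ) := by
    have a1 := integral_abs_divisorWindow_le (x := x) hu hδ0.le hx1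
    have a2 : (X ^ (-9 / 16 : ℝ)) ^ (-3 / 4 : ℝ) ≤ X ^ (15 / 32 : ℝ) := by
      rw [← rpow_mul hX0.le]
      exact rpow_le_rpow_of_exponent_le hX (by norm_num)
    have a3 : 1 ≤ X ^ (15 / 32 : ℝ) := one_le_rpow hX (by norm_num)
    rw [mul_assoc]
    refine mul_le_mul_of_nonneg_left ?_ hC₁
    have := mul_le_mul_of_nonneg_left a2 hC₂
    have := hδ.trans hδ1
    linarith
  have kx : X ^ (15 / 32 : ℝ) / √x ≤ X ^ (-1 / 32 : ℝ) := by
    rw [div_le_iff₀ hsx]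
    calc X ^ (15 / 32 : ℝ) = X ^ (-1 / 32 : ℝ) * √X := by
          rw [sqrt_eq_rpow, ← rpow_add hX0]; norm_num
      _ ≤ _ := by gcongr; exact hx.1
  set T := ∑' n, dualSummand (X ^ (-9 / 16 : ℝ)) δ x n
  set S := ∑ n ∈ Icc 1 ⌊X ^ (7 / 4 : ℝ)⌋₊, dualSummand (X ^ (-9 / 16 : ℝ)) δ x n
  have hE : |divisorError ((x + δ) ^ 2) - divisorError (x ^ 2) - √x * T| ≤
      (C₁ * (2 + C₂) + C₄ + C₅) * X ^ (15 / 32 : ℝ) := by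
    have hv2 := hv.trans kv
    rw [abs_le] at hv2 k4 k5 ⊢
    simp only [divisorError]
    constructor <;> linarith [hv2.1, hv2.2, k4.1, k4.2, k5.1, k5.2]
  calc _ = |(divisorError ((x + δ) ^ 2) - divisorError (x ^ 2) - √x * T) / √x + (T - S)| := by
        congr 1; field_simp; ring
    _ ≤ |(divisorError ((x + δ) ^ 2) - divisorError (x ^ 2) - √x * T) / √x| + |T - S| :=
        abs_add_le _ _
    _ ≤ (C₁ * (2 + C₂) + C₄ + C₅) * X ^ (-1 / 32 : ℝ) + C₃ * X ^ (-1 / 32 : ℝ) := by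
        refine add_le_add ?_ k3
        rw [abs_div, abs_of_pos hsx]
        calc _ ≤ (C₁ * (2 + C₂) + C₄ + C₅) * X ^ (15 / 32 : ℝ) / √x := by gcongr
          _ ≤ _ := by rw [mul_div_assoc]; gcongr
    _ = _ := by ring

end

/-- The indicator of the squares. -/
def squareIndicator : ArithmeticFunction ℝ :=
  ⟨fun n => if n ≠ 0 ∧ IsSquare n then 1 else 0, by simp⟩

/-- The constant arithmetic function `1`, with real values. -/
abbrev realZeta : ArithmeticFunction ℝ :=
  ((ArithmeticFunction.zeta : ArithmeticFunction ℕ) : ArithmeticFunction ℝ)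

/-- The square of the divisor function. -/
def divisorSq : ArithmeticFunction ℝ :=
  (realZeta * realZeta).pmul (realZeta * realZeta)

lemma zeta_mul_zeta_apply (n : ℕ) : (realZeta * realZeta) n = n.divisors.card := by
  rw [ArithmeticFunction.coe_zeta_mul_apply, cast_card]
  refine sum_congr rfl fun i hi => ?_
  have : i ≠ 0 := (Nat.pos_of_mem_divisors hi).ne'
  simp [this]

lemma divisorSq_apply (n : ℕ) : divisorSq n = τ n ^ 2 := by
  rw [divisorSq, ArithmeticFunction.pmul_apply, zeta_mul_zeta_apply, sq]

lemma isSquare_mul_iff_of_coprime {m n : ℕ} (h : m.Coprime n) :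
    IsSquare (m * n) ↔ IsSquare m ∧ IsSquare n := by
  refine ⟨fun ⟨r, hr⟩ => ?_, fun ⟨h1, h2⟩ => h1.mul h2⟩
  rw [← sq] at hr
  have key : ∀ {a b : ℕ}, a.Coprime b → a * b = r ^ 2 → IsSquare a := by
    intro a b hab e
    obtain ⟨d, hd⟩ := exists_eq_pow_of_mul_eq_pow (Nat.isUnit_iff.2 hab) e
    exact ⟨d, by rw [hd, sq]⟩
  exact ⟨key h hr, key h.symm (by rw [mul_comm, hr])⟩

lemma isMultiplicative_squareIndicator : squareIndicator.IsMultiplicative := by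
  refine ArithmeticFunction.IsMultiplicative.iff_ne_zero.2 ⟨by simp [squareIndicator], ?_⟩
  intro m n hm hn h
  simp only [squareIndicator, ArithmeticFunction.coe_mk, isSquare_mul_iff_of_coprime h]
  by_cases h1 : IsSquare m <;> by_cases h2 : IsSquare n <;> simp [h1, h2, hm, hn]

lemma mul_apply_prime_pow (f g : ArithmeticFunction ℝ) {p : ℕ} (hp : p.Prime) (k : ℕ) :
    (f * g) (p ^ k) = ∑ i ∈ range (k + 1), f (p ^ i) * g (p ^ (k - i)) := by
  rw [ArithmeticFunction.mul_apply, Nat.sum_divisorsAntidiagonal (fun a b => f a * g b),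
    Nat.sum_divisors_prime_pow hp]
  refine sum_congr rfl fun i hi => ?_
  rw [Nat.pow_div (by simpa [Nat.lt_succ_iff] using hi) hp.pos]

lemma sum_range_add_one_mul (k m : ℕ) : ∑ i ∈ range m, (i + 1 : ℝ) * (k - i + 1) =
    m * (m + 1) * (3 * k - 2 * m + 5) / 6 := by
  induction m with
  | zero => simp
  | succ m ih => rw [sum_range_succ, ih]; push_cast; ring

lemma sum_range_even_sq : ∀ k : ℕ, ∑ j ∈ range (k + 1),
    (if Even (k - j) then (j + 1 : ℝ) ^ 2 else 0) = (k + 1 : ℝ) * (k + 2) * (k + 3) / 6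
  | 0 => by norm_num
  | 1 => by norm_num [sum_range_succ]
  | k + 2 => by
    rw [sum_range_succ, sum_range_succ]
    have : ∀ j ∈ range (k + 1), (if Even (k + 2 - j) then (j + 1 : ℝ) ^ 2 else 0) =
        if Even (k - j) then (j + 1 : ℝ) ^ 2 else 0 := by
      intro j hj
      have hj' : j ≤ k := by simpa [Nat.lt_succ_iff] using hj
      rw [show k + 2 - j = k - j + 2 by omega]
      simp [Nat.even_add]
    rw [sum_congr rfl this, sum_range_even_sq k]
    have h1 : k + 2 - (k + 1) = 1 := by omega
    rw [h1]
    simp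
    ring

lemma squareIndicator_mul_divisorSq : squareIndicator * divisorSq =
    realZeta * (realZeta * (realZeta * realZeta)) := by
  have hz : realZeta.IsMultiplicative := ArithmeticFunction.isMultiplicative_zeta.natCast
  have hzz := hz.mul hz
  rw [← mul_assoc, divisorSq, ArithmeticFunction.IsMultiplicative.eq_iff_eq_on_prime_powers _
    (isMultiplicative_squareIndicator.mul (hzz.pmul hzz)) _ (hzz.mul hzz)]
  intro p k hp
  rw [mul_apply_prime_pow _ _ hp, mul_apply_prime_pow _ _ hp]
  have hτ : ∀ j : ℕ, τ (p ^ j) = j + 1 := fun j => by rw [Nat.divisors_prime_pow hp]; simp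
  simp only [zeta_mul_zeta_apply, hτ]
  have e1 : ∑ i ∈ range (k + 1), (i + 1 : ℝ) * (((k - i : ℕ) : ℝ) + 1) =
      (k + 1) * (k + 2) * (k + 3) / 6 := by
    calc _ = ∑ i ∈ range (k + 1), (i + 1 : ℝ) * (k - i + 1) := by
          refine sum_congr rfl fun i hi => ?_
          rw [Nat.cast_sub (by simpa [Nat.lt_succ_iff] using hi)]
      _ = _ := by rw [sum_range_add_one_mul]; push_cast; ring
  rw [e1, ← sum_range_even_sq k, ← sum_flip]
  refine sum_congr rfl fun j hj => ?_
  have hj' : j ≤ k := by simpa [Nat.lt_succ_iff] using hj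
  rw [Nat.sub_sub_self hj', ArithmeticFunction.pmul_apply, zeta_mul_zeta_apply, hτ, ← sq]
  have : IsSquare (p ^ (k - j)) ↔ Even (k - j) := by
    refine ⟨fun ⟨r, hr⟩ => ?_, fun h => h.isSquare_pow p⟩
    obtain ⟨i, -, rfl⟩ := (Nat.dvd_prime_pow hp).1 (Dvd.intro _ hr.symm)
    rw [← pow_add] at hr
    exact ⟨i, Nat.pow_right_injective hp.two_le hr⟩
  simp only [squareIndicator, ArithmeticFunction.coe_mk, this, ne_eq, pow_eq_zero_iff', hp.ne_zero,
    false_and, not_false_eq_true, true_and]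
  split_ifs <;> simp

/-- The summatory function of an arithmetic function. -/
def sumUpTo (f : ArithmeticFunction ℝ) (y : ℝ) : ℝ := ∑ n ∈ Ioc 0 ⌊y⌋₊, f n

lemma sumUpTo_mul (f g : ArithmeticFunction ℝ) (y : ℝ) :
    sumUpTo (f * g) y = ∑ n ∈ Ioc 0 ⌊y⌋₊, f n * sumUpTo g (y / n) := by
  rw [sumUpTo, ArithmeticFunction.sum_Ioc_mul_eq_sum_sum]
  refine sum_congr rfl fun n _ => ?_
  rw [sumUpTo, Nat.floor_div_natCast]

lemma sumUpTo_zeta_mul (g : ArithmeticFunction ℝ) (y : ℝ) :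
    sumUpTo (realZeta * g) y = ∑ n ∈ Ioc 0 ⌊y⌋₊, sumUpTo g (y / n) := by
  rw [sumUpTo_mul]
  refine sum_congr rfl fun n hn => ?_
  have : n ≠ 0 := (mem_Ioc.1 hn).1.ne'
  simp [this]

lemma sumUpTo_zeta (y : ℝ) : sumUpTo realZeta y = ⌊y⌋₊ := by
  rw [sumUpTo, sum_congr rfl (g := fun _ => (1 : ℝ))]
  · simp
  · intro n hn
    have : n ≠ 0 := (mem_Ioc.1 hn).1.ne'
    simp [this]

lemma abs_sum_log_pow_sub_le (k : ℕ) {y : ℝ} (hy : 1 ≤ y) :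
    |∑ n ∈ Ioc 0 ⌊y⌋₊, (1 / (n : ℝ)) * log (y / n) ^ k -
      log y ^ (k + 1) / (k + 1)| ≤ (1 + log y) ^ k := by
  set N := ⌊y⌋₊ with hN
  have hN1 : 1 ≤ N := le_floor (by simpa using hy)
  have hNy : (N : ℝ) ≤ y := floor_le (by linarith)
  have hN1' : (1 : ℝ) ≤ N := mod_cast hN1
  have hyN : y < N + 1 := lt_floor_add_one y
  have hy0 : 0 < y := by linarith
  have hlog : 0 ≤ log y := log_nonneg hy
  set f : ℝ → ℝ := fun t => (1 / t) * log (y / t) ^ k with hf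
  have hanti : AntitoneOn f (Set.Icc ((1 : ℕ) : ℝ) N) := by
    intro a ha b hb hab
    have ha1 : (1 : ℝ) ≤ a := by simpa using ha.1
    have hb1 : (1 : ℝ) ≤ b := by simpa using hb.1
    have hby : 1 ≤ y / b := by rw [le_div_iff₀ (by linarith)]; linarith [hb.2]
    have : 0 ≤ log (y / b) := log_nonneg hby
    simp only [hf]
    gcongr
  have hint : ∫ t in ((1 : ℕ) : ℝ)..N, f t =
      log y ^ (k + 1) / (k + 1) - log (y / N) ^ (k + 1) / (k + 1) := by
    have hd : ∀ t ∈ Set.uIcc ((1 : ℕ) : ℝ) N,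
        HasDerivAt (fun t => -(log (y / t) ^ (k + 1) / (k + 1))) (f t) t := by
      intro t ht
      rw [Set.uIcc_of_le (mod_cast hN1)] at ht
      have ht1 : (1 : ℝ) ≤ t := by simpa using ht.1
      have ht0 : t ≠ 0 := by positivity
      have h1 : HasDerivAt (fun t => log (y / t)) (-(1 / t)) t := by
        have := (((hasDerivAt_inv ht0).const_mul y).log (by positivity))
        refine (this.congr_deriv ?_).congr_of_eventuallyEq (.of_forall fun s => ?_)
        · field_simp
        · simp [div_eq_mul_inv]
      refine (((h1.fun_pow (k + 1)).div_const (k + 1 : ℝ)).fun_neg).congr_deriv ?_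
      have : (k : ℝ) + 1 ≠ 0 := by positivity
      simp only [hf, Nat.add_sub_cancel]
      push_cast
      field_simp
    rw [integral_eq_sub_of_hasDerivAt hd ?_]
    · simp; ring
    · refine AntitoneOn.intervalIntegrable ?_
      rwa [Set.uIcc_of_le (mod_cast hN1)]
  have hl : 0 ≤ log (y / N) := log_nonneg (by rw [le_div_iff₀ (by linarith)]; linarith)
  have hl2 : log (y / N) ≤ 1 := by
    have : y / N ≤ 2 := by rw [div_le_iff₀ (by linarith)]; linarith
    linarith [log_le_log (by positivity) this, log_two_lt_d9]
  have hl3 : log (y / N) ≤ log y := log_le_log (by positivity) (div_le_self hy0.le hN1')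
  have htail : log (y / N) ^ (k + 1) / (k + 1) ≤ (1 + log y) ^ k := by
    rw [div_le_iff₀ (by positivity), pow_succ]
    calc log (y / N) ^ k * log (y / N) ≤ (1 + log y) ^ k * 1 := by gcongr; linarith
      _ ≤ _ := by gcongr; linarith [(cast_nonneg k : (0 : ℝ) ≤ k)]
  have htail0 : 0 ≤ log (y / N) ^ (k + 1) / (k + 1) := by positivity
  have hup := AntitoneOn.sum_le_integral_Ico hN1 hanti
  have hlo := AntitoneOn.integral_le_sum_Ico hN1 hanti
  rw [hint] at hup hlo
  have hf1 : f 1 ≤ (1 + log y) ^ k := by simp only [hf, div_one, one_mul]; gcongr; linarith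
  have hfN : 0 ≤ f N := by simp only [hf]; positivity
  have s1 : ∑ n ∈ Ioc 0 N, (1 / (n : ℝ)) * log (y / n) ^ k =
      ∑ n ∈ Ico (1 : ℕ) N, f (n : ℝ) + f N := by
    rw [← sum_Ico_succ_top hN1 (fun n : ℕ => f (n : ℝ))]
    rfl
  have s2 : ∑ n ∈ Ioc 0 N, (1 / (n : ℝ)) * log (y / n) ^ k =
      f 1 + ∑ n ∈ Ico (1 : ℕ) N, f ((n + 1 : ℕ) : ℝ) := by
    have e : ∑ n ∈ Ioc 0 N, (1 / (n : ℝ)) * log (y / n) ^ k =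
      ∑ n ∈ Ico (1 : ℕ) (N + 1), f (n : ℝ) := rfl
    rw [e, sum_eq_sum_Ico_succ_bot (by omega), sum_Ico_add' (fun n : ℕ => f (n : ℝ)) 1 N 1]
    simp
  rw [abs_le]
  constructor
  · rw [s1]; linarith
  · rw [s2]; linarith

/-- `g` has summatory function `c y (log y)^(k+1) + O(y (1 + log y)^k)`. -/
def HasLogMean (g : ArithmeticFunction ℝ) (c : ℝ) (k : ℕ) : Prop := ∃ C, 0 ≤ C ∧ ∀ y : ℝ, 1 ≤ y →
    |sumUpTo g y - c * (y * log y ^ (k + 1))| ≤ C * (y * (1 + log y) ^ k)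

lemma sum_one_div_le {y : ℝ} (hy : 1 ≤ y) : ∑ n ∈ Ioc 0 ⌊y⌋₊, 1 / (n : ℝ) ≤ 1 + log y := by
  have := abs_le.1 (abs_sum_log_pow_sub_le 0 hy)
  simp at this
  simp only [one_div]
  linarith [this.2]

lemma hasLogMean_zeta_mul_zeta : HasLogMean (realZeta * realZeta) 1 0 := by
  refine ⟨2, by norm_num, fun y hy => ?_⟩
  have h0 := abs_le.1 (abs_sum_log_pow_sub_le 0 hy)
  have hy0 : 0 < y := by linarith
  simp only [pow_zero, mul_one, zero_add, pow_one, Nat.cast_zero, div_one] at h0 ⊢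
  rw [sumUpTo_zeta_mul]
  simp only [sumUpTo_zeta, one_mul]
  have h1 : ∑ n ∈ Ioc 0 ⌊y⌋₊, (⌊y / n⌋₊ : ℝ) ≤ y * ∑ n ∈ Ioc 0 ⌊y⌋₊, 1 / (n : ℝ) := by
    rw [mul_sum]
    refine sum_le_sum fun n hn => ?_
    rw [mul_one_div]
    exact floor_le (by positivity)
  have h2 : y * ∑ n ∈ Ioc 0 ⌊y⌋₊, 1 / (n : ℝ) - ⌊y⌋₊ ≤ ∑ n ∈ Ioc 0 ⌊y⌋₊, (⌊y / n⌋₊ : ℝ) := by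
    have : (⌊y⌋₊ : ℝ) = ∑ n ∈ Ioc 0 ⌊y⌋₊, (1 : ℝ) := by simp
    conv_lhs => rw [this, mul_sum, ← sum_sub_distrib]
    refine sum_le_sum fun n hn => ?_
    rw [mul_one_div]
    linarith [lt_floor_add_one (y / n)]
  have h3 : (⌊y⌋₊ : ℝ) ≤ y := floor_le hy0.le
  rw [abs_le]
  constructor <;> nlinarith [h0.1, h0.2]

lemma HasLogMean.zeta_mul {g : ArithmeticFunction ℝ} {c : ℝ} {k : ℕ} (h : HasLogMean g c k) :
    HasLogMean (realZeta * g) (c / (k + 2)) (k + 1) := by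
  obtain ⟨C, hC, h⟩ := h
  refine ⟨C + |c|, by positivity, fun y hy => ?_⟩
  have hy0 : 0 < y := by linarith
  have hlog : 0 ≤ log y := log_nonneg hy
  have hn1 : ∀ n ∈ Ioc 0 ⌊y⌋₊, (1 : ℝ) ≤ n ∧ 1 ≤ y / n := fun n hn => by
    obtain ⟨h1, h2⟩ := mem_Ioc.1 hn
    have h1' : (1 : ℝ) ≤ n := mod_cast h1
    refine ⟨h1', ?_⟩
    rw [le_div_iff₀ (by linarith), one_mul]
    exact (le_floor_iff hy0.le).1 h2
  have a1 : |sumUpTo (realZeta * g) y - ∑ n ∈ Ioc 0 ⌊y⌋₊, c * (y / n * log (y / n) ^ (k + 1))| ≤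
      C * (y * (1 + log y) ^ (k + 1)) := by
    rw [sumUpTo_zeta_mul, ← sum_sub_distrib]
    calc _ ≤ ∑ n ∈ Ioc 0 ⌊y⌋₊, C * (y * (1 + log y) ^ k) * (1 / n) := by
          refine (abs_sum_le_sum_abs _ _).trans (sum_le_sum fun n hn => ?_)
          obtain ⟨h1, h2⟩ := hn1 n hn
          refine (h _ h2).trans ?_
          rw [mul_assoc C, mul_right_comm y, mul_one_div]
          have : log (y / n) ≤ log y := log_le_log (by positivity) (div_le_self hy0.le h1)
          have := log_nonneg h2
          gcongr
      _ ≤ C * (y * (1 + log y) ^ k) * (1 + log y) := by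
          rw [← mul_sum]
          gcongr
          exact sum_one_div_le hy
      _ = _ := by ring
  have a2 := mul_le_mul_of_nonneg_left (abs_sum_log_pow_sub_le (k + 1) hy)
    (by positivity : 0 ≤ |c| * y)
  have e : ∑ n ∈ Ioc 0 ⌊y⌋₊, c * (y / n * log (y / n) ^ (k + 1)) =
      c * y * ∑ n ∈ Ioc 0 ⌊y⌋₊, (1 / (n : ℝ)) * log (y / n) ^ (k + 1) := by
    rw [mul_sum]
    exact sum_congr rfl fun n _ => by ring
  rw [e] at a1
  rw [← abs_of_pos hy0, ← abs_mul, abs_of_pos hy0, ← abs_mul] at a2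
  push_cast at a2
  calc _ = |(sumUpTo (realZeta * g) y - c * y * ∑ n ∈ Ioc 0 ⌊y⌋₊,
        (1 / (n : ℝ)) * log (y / n) ^ (k + 1)) + c * y * (∑ n ∈ Ioc 0 ⌊y⌋₊,
        (1 / (n : ℝ)) * log (y / n) ^ (k + 1) - log y ^ (k + 1 + 1) / (k + 1 + 1))| := by
        congr 1
        have : (k : ℝ) + 2 ≠ 0 := by positivity
        field_simp
        ring
    _ ≤ _ := (abs_add_le _ _).trans (add_le_add a1 a2)
    _ = _ := by rw [abs_mul, abs_of_pos hy0]; ring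

lemma hasLogMean_squareIndicator_mul : HasLogMean (squareIndicator * divisorSq) (1 / 6) 2 := by
  rw [squareIndicator_mul_divisorSq]
  have := hasLogMean_zeta_mul_zeta.zeta_mul.zeta_mul
  norm_num at this ⊢
  exact this

lemma sumUpTo_eq_zero (f : ArithmeticFunction ℝ) {y : ℝ} (hy : y < 1) : sumUpTo f y = 0 := by
  rw [sumUpTo, Nat.floor_eq_zero.2 hy]; simp

lemma sumUpTo_squareIndicator_mul (g : ArithmeticFunction ℝ) {y : ℝ} (hy : 0 ≤ y) :
    sumUpTo (squareIndicator * g) y = ∑ d ∈ Ioc 0 ⌊√y⌋₊, sumUpTo g (y / (d : ℝ) ^ 2) := by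
  rw [sumUpTo_mul]
  have h1 : ∀ n ∈ Ioc 0 ⌊y⌋₊, squareIndicator n * sumUpTo g (y / n) =
      if IsSquare n then sumUpTo g (y / n) else 0 := fun n hn => by
    have : n ≠ 0 := (mem_Ioc.1 hn).1.ne'
    simp [squareIndicator, this]
  rw [sum_congr rfl h1, ← sum_filter]
  symm
  refine sum_nbij (fun d => d ^ 2) ?_ ?_ ?_ ?_
  · intro d hd
    obtain ⟨h1, h2⟩ := mem_Ioc.1 hd
    have h3 : (d : ℝ) ≤ √y := (le_floor_iff (sqrt_nonneg y)).1 h2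
    have h4 : (d : ℝ) ^ 2 ≤ y := (le_sqrt (by positivity) hy).1 h3
    refine mem_filter.2 ⟨mem_Ioc.2 ⟨by positivity, le_floor ?_⟩, ⟨d, sq d⟩⟩
    exact_mod_cast h4
  · intro a _ b _ hab
    exact Nat.pow_left_injective (n := 2) (by norm_num) hab
  · intro n hn
    obtain ⟨h1, r, rfl⟩ := mem_filter.1 (mem_coe.1 hn)
    obtain ⟨h2, h3⟩ := mem_Ioc.1 h1
    refine ⟨r, mem_coe.2 (mem_Ioc.2 ⟨Nat.pos_of_mul_pos_left h2, le_floor ?_⟩), sq r⟩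
    refine (le_sqrt (by positivity) hy).2 ?_
    have := (le_floor_iff hy).1 h3
    push_cast at this
    rwa [sq]
  · intro d _
    push_cast
    rfl

lemma sum_one_div_sq_le (N : ℕ) : ∑ d ∈ Ioc 0 N, 1 / (d : ℝ) ^ 2 ≤ π ^ 2 / 6 :=
  sum_le_hasSum _ (fun i _ => by positivity) hasSum_zeta_two

lemma le_sum_one_div_sq {N : ℕ} (hN : N ≠ 0) :
    π ^ 2 / 6 - 1 / N ≤ ∑ d ∈ Ioc 0 N, 1 / (d : ℝ) ^ 2 := by
  have h := hasSum_zeta_two.tendsto_sum_nat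
  have : π ^ 2 / 6 ≤ ∑ d ∈ Ioc 0 N, 1 / (d : ℝ) ^ 2 + 1 / N := by
    refine le_of_tendsto h ((eventually_ge_atTop (N + 1)).mono fun M hM => ?_)
    obtain ⟨K, rfl⟩ : ∃ K, M = K + 1 := ⟨M - 1, by omega⟩
    have e : ∑ i ∈ range (K + 1), 1 / (i : ℝ) ^ 2 = ∑ d ∈ Ioc 0 K, 1 / (d : ℝ) ^ 2 := by
      rw [sum_range_eq_add_Ico _ (by omega)]
      simp only [Nat.cast_zero, ne_eq, OfNat.ofNat_ne_zero, not_false_eq_true, zero_pow, div_zero,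
        zero_add]
      rfl
    rw [e, ← sum_Ioc_consecutive _ (Nat.zero_le N) (by omega : N ≤ K)]
    have := sum_Ioc_inv_sq_le_sub (α := ℝ) hN (by omega : N ≤ K)
    simp only [one_div] at this ⊢
    have : 0 ≤ (K : ℝ)⁻¹ := by positivity
    linarith
  linarith

lemma exists_sum_log_div_sq_le : ∃ K, 0 ≤ K ∧ ∀ N : ℕ, ∑ d ∈ Ioc 0 N, log d / (d : ℝ) ^ 2 ≤ K := by
  have hs : Summable fun n : ℕ => 2 * (1 / (n : ℝ) ^ (3 / 2 : ℝ)) :=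
    (summable_one_div_nat_rpow.2 (by norm_num)).mul_left 2
  refine ⟨∑' n : ℕ, 2 * (1 / (n : ℝ) ^ (3 / 2 : ℝ)), tsum_nonneg fun n => by positivity, fun N => ?_⟩
  refine le_trans (sum_le_sum fun d hd => ?_) (hs.sum_le_tsum _ fun n _ => by positivity)
  have hd0 : (0 : ℝ) < d := mod_cast (mem_Ioc.1 hd).1
  have h1 : log d ≤ 2 * (d : ℝ) ^ (1 / 2 : ℝ) := by
    have := log_le_rpow_div hd0.le (ε := 1 / 2) (by norm_num)
    linarith
  have h2 : (d : ℝ) ^ 2 = (d : ℝ) ^ (1 / 2 : ℝ) * (d : ℝ) ^ (3 / 2 : ℝ) := by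
    rw [← rpow_add hd0]; norm_num
  rw [div_le_iff₀ (by positivity), h2]
  refine h1.trans (le_of_eq ?_)
  field_simp

lemma exists_abs_sum_log_cube_sub_le : ∃ C, 0 ≤ C ∧ ∀ y : ℝ, 1 ≤ y →
    |∑ d ∈ Ioc 0 ⌊√y⌋₊, log (y / (d : ℝ) ^ 2) ^ 3 / (d : ℝ) ^ 2 - π ^ 2 / 6 * log y ^ 3| ≤
      C * (1 + log y) ^ 2 := by
  obtain ⟨K, hK, h⟩ := exists_sum_log_div_sq_le
  refine ⟨6 * K + 4, by positivity, fun y hy => ?_⟩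
  have hy0 : 0 < y := by linarith
  have hlog : 0 ≤ log y := log_nonneg hy
  set D := ⌊√y⌋₊
  have hs1 : 1 ≤ √y := one_le_sqrt.2 hy
  have hD : D ≠ 0 := by
    have : 1 ≤ D := le_floor (by simpa using hs1)
    omega
  have hD1 : (1 : ℝ) ≤ D := mod_cast Nat.one_le_iff_ne_zero.2 hD
  have hDy : √y < D + 1 := lt_floor_add_one _
  have hly : log y ≤ 4 * D := by
    have h1 : log y = 2 * log (√y) := by rw [log_sqrt hy0.le]; ring
    have := log_le_sub_one_of_pos (by positivity : 0 < √y)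
    linarith
  have hterm : ∀ d ∈ Ioc 0 D, log (y / (d : ℝ) ^ 2) ^ 3 / (d : ℝ) ^ 2 ≤
      log y ^ 3 * (1 / (d : ℝ) ^ 2) ∧ log y ^ 3 * (1 / (d : ℝ) ^ 2) -
      6 * log y ^ 2 * (log d / (d : ℝ) ^ 2) ≤ log (y / (d : ℝ) ^ 2) ^ 3 / (d : ℝ) ^ 2 := by
    intro d hd
    obtain ⟨h1, h2⟩ := mem_Ioc.1 hd
    have hd1 : (1 : ℝ) ≤ d := mod_cast h1
    have h3 : (d : ℝ) ^ 2 ≤ y :=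
      (le_sqrt (by positivity) hy0.le).1 ((le_floor_iff (sqrt_nonneg y)).1 h2)
    have h4 : 0 ≤ log (y / (d : ℝ) ^ 2) := log_nonneg (by rw [le_div_iff₀ (by positivity)]; linarith)
    have h5 : log (y / (d : ℝ) ^ 2) = log y - 2 * log d := by
      rw [log_div hy0.ne' (by positivity), log_pow]; norm_num
    have h6 : 0 ≤ log d := log_nonneg hd1
    rw [h5] at h4 ⊢
    constructor
    · rw [mul_one_div]
      gcongr
      linarith
    · have : log y ^ 3 * (1 / (d : ℝ) ^ 2) - 6 * log y ^ 2 * (log d / (d : ℝ) ^ 2) =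
        (log y ^ 3 - 6 * log y ^ 2 * log d) / (d : ℝ) ^ 2 := by ring
      rw [this]
      gcongr
      nlinarith [mul_nonneg (sq_nonneg (log d)) (by linarith : 0 ≤ 3 * log y - 2 * log d)]
  have hup := sum_le_sum fun d hd => (hterm d hd).1
  have hlo := sum_le_sum fun d hd => (hterm d hd).2
  rw [sum_sub_distrib, ← mul_sum, ← mul_sum] at hlo
  rw [← mul_sum] at hup
  have b1 := mul_le_mul_of_nonneg_left (sum_one_div_sq_le D) (by positivity : 0 ≤ log y ^ 3)
  have b2 := mul_le_mul_of_nonneg_left (le_sum_one_div_sq hD) (by positivity : 0 ≤ log y ^ 3)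
  have b3 := mul_le_mul_of_nonneg_left (h D) (by positivity : 0 ≤ 6 * log y ^ 2)
  have b4 : log y ^ 3 * (1 / D) ≤ 4 * log y ^ 2 := by
    rw [mul_one_div, div_le_iff₀ (by linarith)]
    nlinarith [mul_le_mul_of_nonneg_left hly (sq_nonneg (log y))]
  have b5 : log y ^ 2 ≤ (1 + log y) ^ 2 := by gcongr; linarith
  have b6 := mul_le_mul_of_nonneg_left b5 (by positivity : 0 ≤ 6 * K + 4)
  rw [abs_le]
  constructor
  · nlinarith
  · have : 0 ≤ (6 * K + 4) * (1 + log y) ^ 2 := by positivity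
    linarith

/-- The mean square of the divisor function. -/
theorem hasLogMean_divisorSq : HasLogMean divisorSq (1 / π ^ 2) 2 := by
  obtain ⟨C₁, hC₁, h1⟩ := hasLogMean_squareIndicator_mul
  obtain ⟨C₂, hC₂, h2⟩ := exists_abs_sum_log_cube_sub_le
  set c := 1 / π ^ 2 with hc
  have hc0 : 0 < c := by positivity
  have hcπ : c * (π ^ 2 / 6) = 1 / 6 := by rw [hc]; field_simp
  set E : ℝ → ℝ := fun y => sumUpTo divisorSq y - c * (y * log y ^ (2 + 1)) with hE
  set C₀ := C₁ + c * C₂ with hC₀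
  have hC₀0 : 0 ≤ C₀ := by positivity
  refine ⟨3 * C₀, by positivity, ?_⟩
  suffices H : ∀ N : ℕ, ∀ y : ℝ, 1 ≤ y → y < 2 ^ N → |E y| ≤ 3 * C₀ * (y * (1 + log y) ^ 2) by
    intro y hy
    obtain ⟨N, hN⟩ := pow_unbounded_of_one_lt y (one_lt_two : (1 : ℝ) < 2)
    exact H N y hy hN
  intro N
  induction N with
  | zero => intro y h h'; norm_num at h'; linarith
  | succ N ih =>
    intro y hy hyN
    have hy0 : 0 < y := by linarith
    have hlog : 0 ≤ log y := log_nonneg hy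
    set D := ⌊√y⌋₊
    have hD : 1 ≤ D := le_floor (by simpa using one_le_sqrt.2 hy)
    have a1 := h1 y hy
    rw [sumUpTo_squareIndicator_mul _ hy0.le] at a1
    have a2 := mul_le_mul_of_nonneg_left (h2 y hy) (by positivity : 0 ≤ c * y)
    rw [← abs_of_pos (by positivity : 0 < c * y), ← abs_mul, abs_of_pos (by positivity : 0 < c * y),
      mul_sub, mul_sum] at a2
    have hsplit : ∑ d ∈ Ioc 0 D, E (y / (d : ℝ) ^ 2) =
        E y + ∑ d ∈ Ioc 1 D, E (y / (d : ℝ) ^ 2) := by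
      rw [← sum_Ioc_consecutive _ (Nat.zero_le 1) hD]
      simp
    have hsum : ∑ d ∈ Ioc 0 D, E (y / (d : ℝ) ^ 2) =
        ∑ d ∈ Ioc 0 D, sumUpTo divisorSq (y / (d : ℝ) ^ 2) -
        ∑ d ∈ Ioc 0 D, c * y * (log (y / (d : ℝ) ^ 2) ^ 3 / (d : ℝ) ^ 2) := by
      rw [← sum_sub_distrib]
      refine sum_congr rfl fun d _ => ?_
      simp only [hE]; ring
    have htot : |∑ d ∈ Ioc 0 D, E (y / (d : ℝ) ^ 2)| ≤ C₀ * (y * (1 + log y) ^ 2) := by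
      have : ∑ d ∈ Ioc 0 D, E (y / (d : ℝ) ^ 2) =
          (∑ d ∈ Ioc 0 D, sumUpTo divisorSq (y / (d : ℝ) ^ 2) - 1 / 6 * (y * log y ^ (2 + 1))) -
          (∑ d ∈ Ioc 0 D, c * y * (log (y / (d : ℝ) ^ 2) ^ 3 / (d : ℝ) ^ 2) -
            c * y * (π ^ 2 / 6 * log y ^ 3)) := by
        rw [hsum]
        linear_combination -(y * log y ^ 3) * hcπ
      rw [this]
      refine (abs_sub _ _).trans ((add_le_add a1 a2).trans (le_of_eq ?_))
      rw [hC₀]; ring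
    have hrest : |∑ d ∈ Ioc 1 D, E (y / (d : ℝ) ^ 2)| ≤
        3 * C₀ * (y * (1 + log y) ^ 2) * (0.65) := by
      have hz : ∑ d ∈ Ioc 1 D, 1 / (d : ℝ) ^ 2 ≤ 0.65 := by
        have := sum_one_div_sq_le D
        rw [← sum_Ioc_consecutive _ (Nat.zero_le 1) hD] at this
        simp only [Nat.Ioc_succ_singleton, zero_add, sum_singleton, Nat.cast_one, one_pow,
          div_one] at this
        nlinarith [pi_lt_d4, pi_gt_three]
      refine le_trans ?_ (mul_le_mul_of_nonneg_left hz (by positivity))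
      rw [mul_sum]
      refine (abs_sum_le_sum_abs _ _).trans (sum_le_sum fun d hd => ?_)
      obtain ⟨k1, k2⟩ := mem_Ioc.1 hd
      have hd2 : (2 : ℝ) ≤ d := mod_cast k1
      have h3 : (d : ℝ) ^ 2 ≤ y :=
        (le_sqrt (by positivity) hy0.le).1 ((le_floor_iff (sqrt_nonneg y)).1 k2)
      have h4 : 1 ≤ y / (d : ℝ) ^ 2 := by rw [le_div_iff₀ (by positivity)]; linarith
      have h5 : y / (d : ℝ) ^ 2 < 2 ^ N := by
        rw [div_lt_iff₀ (by positivity)]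
        have : (0 : ℝ) < 2 ^ N := by positivity
        rw [pow_succ] at hyN
        have h4' : (4 : ℝ) ≤ (d : ℝ) ^ 2 := by nlinarith
        nlinarith [mul_le_mul_of_nonneg_left h4' this.le]
      have h6 : y / (d : ℝ) ^ 2 ≤ y := div_le_self hy0.le (by nlinarith)
      refine (ih _ h4 h5).trans ?_
      have h7 := log_nonneg h4
      calc 3 * C₀ * (y / (d : ℝ) ^ 2 * (1 + log (y / (d : ℝ) ^ 2)) ^ 2) ≤
            3 * C₀ * (y / (d : ℝ) ^ 2 * (1 + log y) ^ 2) := by gcongr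
        _ = _ := by ring
    have : E y = ∑ d ∈ Ioc 0 D, E (y / (d : ℝ) ^ 2) -
        ∑ d ∈ Ioc 1 D, E (y / (d : ℝ) ^ 2) := by rw [hsplit]; ring
    rw [this]
    refine (abs_sub _ _).trans ((add_le_add htot hrest).trans ?_)
    have : 0 ≤ C₀ * (y * (1 + log y) ^ 2) := by positivity
    linarith

lemma hasDerivAt_laplace_sin_sq {t : ℝ} (ht : 0 < t) (x : ℝ) :
    HasDerivAt (fun x => t * exp (-(t * x)) * (-(1 / (2 * t)) +
      (t * cos (4 * π * x) - 4 * π * sin (4 * π * x)) / (2 * (t ^ 2 + (4 * π) ^ 2))))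
      (sin (2 * π * x) ^ 2 * (t * exp (-(t * x)))) x := by
  have h0 : t ^ 2 + (4 * π) ^ 2 ≠ 0 := by positivity
  have hb : HasDerivAt (fun x => 4 * π * x) (4 * π) x := by
    simpa using (hasDerivAt_id x).const_mul (4 * π)
  have he : HasDerivAt (fun x => t * exp (-(t * x))) (t * (exp (-(t * x)) * -t)) x := by
    have : HasDerivAt (fun x => -(t * x)) (-t) x := by
      simpa using ((hasDerivAt_id x).const_mul t).fun_neg
    exact this.exp.const_mul t
  have hcs := (((hb.cos.const_mul t).fun_sub (hb.sin.const_mul (4 * π))).div_const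
    (2 * (t ^ 2 + (4 * π) ^ 2))).const_add (-(1 / (2 * t)))
  refine (he.fun_mul hcs).congr_deriv ?_
  have h1 : sin (2 * π * x) ^ 2 = 1 / 2 - cos (4 * π * x) / 2 := by
    rw [sin_sq_eq_half_sub]; congr 3; ring
  rw [h1]
  field_simp
  ring

lemma tendsto_laplace_sin_sq {t : ℝ} (ht : 0 < t) :
    Tendsto (fun x => t * exp (-(t * x)) * (-(1 / (2 * t)) +
      (t * cos (4 * π * x) - 4 * π * sin (4 * π * x)) / (2 * (t ^ 2 + (4 * π) ^ 2))))
      atTop (𝓝 0) := by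
  refine Tendsto.zero_mul_isBoundedUnder_le (f := fun x => t * exp (-(t * x))) ?_ ?_
  · have : Tendsto (fun x => -(t * x)) atTop atBot :=
      tendsto_neg_atTop_atBot.comp (tendsto_id.const_mul_atTop ht)
    simpa using (tendsto_exp_atBot.comp this).const_mul t
  · refine isBoundedUnder_of ⟨1 / (2 * t) + (t + 4 * π) / (2 * (t ^ 2 + (4 * π) ^ 2)), fun x => ?_⟩
    simp only [Function.comp, norm_eq_abs]
    refine (abs_add_le _ _).trans (add_le_add ?_ ?_)
    · rw [abs_neg, abs_of_pos (by positivity)]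
    · rw [abs_div, abs_of_pos (by positivity : 0 < 2 * (t ^ 2 + (4 * π) ^ 2))]
      gcongr
      refine (abs_sub _ _).trans (add_le_add ?_ ?_)
      · rw [abs_mul, abs_of_pos ht]; nlinarith [abs_cos_le_one (4 * π * x)]
      · rw [abs_mul, abs_of_pos (by positivity : 0 < 4 * π)]
        nlinarith [abs_sin_le_one (4 * π * x), pi_pos]

lemma integral_laplace_sin_sq {t : ℝ} (ht : 0 < t) :
    IntegrableOn (fun x => sin (2 * π * x) ^ 2 * (t * exp (-(t * x)))) (Set.Ioi 0) ∧
    ∫ x in Set.Ioi (0 : ℝ), sin (2 * π * x) ^ 2 * (t * exp (-(t * x))) =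
      2 * π * (4 * π)⁻¹ * (1 + ((4 * π)⁻¹ * t) ^ 2)⁻¹ := by
  have h1 : ∀ x ∈ Set.Ioi (0 : ℝ), 0 ≤ sin (2 * π * x) ^ 2 * (t * exp (-(t * x))) :=
    fun x _ => by positivity
  refine ⟨integrableOn_Ioi_deriv_of_nonneg
    (hasDerivAt_laplace_sin_sq ht 0).continuousAt.continuousWithinAt
    (fun x _ => hasDerivAt_laplace_sin_sq ht x) h1 (tendsto_laplace_sin_sq ht), ?_⟩
  rw [integral_Ioi_of_hasDerivAt_of_nonneg
    (hasDerivAt_laplace_sin_sq ht 0).continuousAt.continuousWithinAt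
    (fun x _ => hasDerivAt_laplace_sin_sq ht x) h1 (tendsto_laplace_sin_sq ht)]
  simp only [mul_zero, neg_zero, exp_zero, cos_zero, sin_zero]
  field_simp
  ring

lemma integral_sin_sq_div_sq :
    Integrable (fun x => sin (2 * π * x) ^ 2 / x ^ 2) (volume.restrict (Set.Ioi 0)) ∧
    ∫ x in Set.Ioi (0 : ℝ), sin (2 * π * x) ^ 2 / x ^ 2 = π ^ 2 := by
  set μ := volume.restrict (Set.Ioi (0 : ℝ)) with hμ
  have hmem : ∀ᵐ t ∂μ, 0 < t := ae_restrict_mem measurableSet_Ioi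
  have hint2 : Integrable (fun t => 2 * π * (4 * π)⁻¹ * (1 + ((4 * π)⁻¹ * t) ^ 2)⁻¹) μ :=
    ((integrable_inv_one_add_sq.comp_mul_left' (by positivity)).const_mul _).integrableOn
  have hI : Integrable (Function.uncurry fun t x : ℝ =>
      sin (2 * π * x) ^ 2 * (t * exp (-(t * x)))) (μ.prod μ) := by
    refine (integrable_prod_iff ?_).2 ⟨?_, ?_⟩
    · refine Continuous.aestronglyMeasurable ?_
      unfold Function.uncurry
      fun_prop
    · filter_upwards [hmem] with t ht using (integral_laplace_sin_sq ht).1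
    · refine hint2.congr ?_
      filter_upwards [hmem] with t ht
      rw [← (integral_laplace_sin_sq ht).2]
      refine integral_congr_ae ?_
      filter_upwards with x
      simp only [Function.uncurry]
      rw [norm_of_nonneg (by positivity)]
  have hval : ∀ x : ℝ, 0 < x → ∫ t, sin (2 * π * x) ^ 2 * (t * exp (-(t * x))) ∂μ =
      sin (2 * π * x) ^ 2 / x ^ 2 := fun x hx => by
    rw [integral_const_mul]
    have := integral_rpow_mul_exp_neg_mul_Ioi (a := 2) (r := x) (by norm_num) hx
    rw [show (2 : ℝ) - 1 = 1 by norm_num, Real.Gamma_two] at this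
    simp only [rpow_one, rpow_two] at this
    rw [hμ, show (∫ t in Set.Ioi (0 : ℝ), t * exp (-(t * x))) = (1 / x) ^ 2 * 1 by
      rw [← this]; simp only [mul_comm x]]
    field_simp
  refine ⟨?_, ?_⟩
  · refine hI.swap.integral_prod_left.congr ?_
    filter_upwards [hmem] with x hx
    exact hval x hx
  · calc ∫ x, sin (2 * π * x) ^ 2 / x ^ 2 ∂μ
        = ∫ x, ∫ t, sin (2 * π * x) ^ 2 * (t * exp (-(t * x))) ∂μ ∂μ := by
          refine integral_congr_ae ?_
          filter_upwards [hmem] with x hx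
          exact (hval x hx).symm
      _ = ∫ t, ∫ x, sin (2 * π * x) ^ 2 * (t * exp (-(t * x))) ∂μ ∂μ :=
          (integral_integral_swap hI).symm
      _ = ∫ t, 2 * π * (4 * π)⁻¹ * (1 + ((4 * π)⁻¹ * t) ^ 2)⁻¹ ∂μ := by
          refine integral_congr_ae ?_
          filter_upwards [hmem] with t ht
          exact (integral_laplace_sin_sq ht).2
      _ = π ^ 2 := by
          rw [integral_const_mul, hμ,
            integral_comp_mul_left_Ioi (fun t => (1 + t ^ 2)⁻¹) 0 (by positivity),
            integral_Ioi_inv_one_add_sq]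
          simp
          field_simp

lemma sum_mul_sub_eq_integral {H H' : ℝ → ℝ} (hH : ∀ w, 0 < w → HasDerivAt H (H' w) w)
    (hc : ContinuousOn H' (Set.Ioi 0)) (s : Finset ℕ) (a v : ℕ → ℝ) {W : ℝ}
    (hv : ∀ n ∈ s, 0 < v n ∧ v n ≤ W) :
    ∑ n ∈ s, a n * (H W - H (v n)) = ∫ w in Set.Ioc 0 W, H' w * ∑ n ∈ s with v n ≤ w, a n := by
  have h1 : ∀ w, H' w * ∑ n ∈ s with v n ≤ w, a n =
      ∑ n ∈ s, (Set.Ici (v n)).indicator (fun w => a n * H' w) w := fun w => by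
    rw [sum_filter, mul_sum]
    refine sum_congr rfl fun n _ => ?_
    by_cases h : v n ≤ w
    · rw [if_pos h, indicator_of_mem (Set.mem_Ici.2 h), mul_comm]
    · rw [if_neg h, indicator_of_notMem (fun h' => h (Set.mem_Ici.1 h')), mul_zero]
  have hci : ∀ n ∈ s, IntegrableOn (fun w => a n * H' w) (Set.Icc (v n) W) := fun n hn =>
    (ContinuousOn.mul continuousOn_const
      (hc.mono fun w hw => (hv n hn).1.trans_le hw.1)).integrableOn_Icc
  have hset : ∀ n ∈ s, Set.Ioc 0 W ∩ Set.Ici (v n) = Set.Icc (v n) W := fun n hn => by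
    ext w
    simp only [Set.mem_inter_iff, Set.mem_Ioc, Set.mem_Ici, Set.mem_Icc]
    exact ⟨fun h => ⟨h.2, h.1.2⟩, fun h => ⟨⟨(hv n hn).1.trans_le h.1, h.2⟩, h.1⟩⟩
  simp only [h1]
  rw [integral_finsetSum]
  · refine sum_congr rfl fun n hn => ?_
    rw [setIntegral_indicator measurableSet_Ici, hset n hn, integral_Icc_eq_integral_Ioc,
      integral_const_mul, ← integral_of_le (hv n hn).2,
      integral_eq_sub_of_hasDerivAt]
    · intro w hw
      rw [Set.uIcc_of_le (hv n hn).2] at hw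
      exact hH w ((hv n hn).1.trans_le hw.1)
    · refine ContinuousOn.intervalIntegrable ?_
      rw [Set.uIcc_of_le (hv n hn).2]
      exact hc.mono fun w hw => (hv n hn).1.trans_le hw.1
  · intro n hn
    rw [integrable_indicator_iff measurableSet_Ici, IntegrableOn,
      Measure.restrict_restrict measurableSet_Ici, Set.inter_comm, hset n hn]
    exact hci n hn

lemma divisorSq_nonneg (n : ℕ) : 0 ≤ divisorSq n := by rw [divisorSq_apply]; positivity

lemma sumUpTo_divisorSq_nonneg (y : ℝ) : 0 ≤ sumUpTo divisorSq y :=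
  sum_nonneg fun n _ => divisorSq_nonneg n

lemma exists_sumUpTo_divisorSq_le :
    ∃ C, 0 ≤ C ∧ ∀ y, 1 ≤ y → sumUpTo divisorSq y ≤ C * (y * (1 + log y) ^ 3) := by
  obtain ⟨C, hC, h⟩ := hasLogMean_divisorSq
  refine ⟨1 / π ^ 2 + C, by positivity, fun y hy => ?_⟩
  have h1 := (abs_le.1 (h y hy)).2
  have h0 := log_nonneg hy
  have h2 : log y ^ (2 + 1) ≤ (1 + log y) ^ 3 := by
    have : log y ≤ 1 + log y := by linarith
    exact pow_le_pow_left₀ h0 this 3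
  have h3 : (1 + log y) ^ 2 ≤ (1 + log y) ^ 3 := pow_le_pow_right₀ (by linarith) (by norm_num)
  have h4 : 1 / π ^ 2 * (y * log y ^ (2 + 1)) ≤ 1 / π ^ 2 * (y * (1 + log y) ^ 3) := by gcongr
  have h5 : C * (y * (1 + log y) ^ 2) ≤ C * (y * (1 + log y) ^ 3) := by gcongr
  linarith

/-- The summatory function of `τ²`, in the scale in which `δ √n` is of order one. -/
def scaledSum (δ w : ℝ) : ℝ :=
  δ ^ 2 / log (1 / δ) ^ 3 * sumUpTo divisorSq (w ^ 2 / δ ^ 2)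

lemma one_le_log_one_div {δ : ℝ} (h0 : 0 < δ) (h1 : δ ≤ exp (-1)) : 1 ≤ log (1 / δ) := by
  rw [one_div, log_inv]
  have := log_le_log h0 h1
  rw [log_exp] at this
  linarith

lemma scaledSum_nonneg {δ : ℝ} (h0 : 0 < δ) (h1 : δ ≤ exp (-1)) (w : ℝ) : 0 ≤ scaledSum δ w := by
  have := one_le_log_one_div h0 h1
  have := sumUpTo_divisorSq_nonneg (w ^ 2 / δ ^ 2)
  unfold scaledSum
  positivity

lemma log_sq_div_sq {δ w : ℝ} (h0 : 0 < δ) (hw : 0 < w) :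
    log (w ^ 2 / δ ^ 2) = 2 * log w + 2 * log (1 / δ) := by
  rw [log_div (by positivity) (by positivity), log_pow, log_pow, one_div, log_inv]
  push_cast
  ring

lemma exists_scaledSum_le : ∃ C, 0 ≤ C ∧ ∀ δ w W : ℝ, 0 < δ → δ ≤ exp (-1) → 0 < w → w ≤ W →
    1 ≤ W → scaledSum δ w ≤ C * (w ^ 2 * (3 + 2 * log W) ^ 3) := by
  obtain ⟨C, hC, h⟩ := exists_sumUpTo_divisorSq_le
  refine ⟨C, hC, fun δ w W h0 h1 hw hwW hW => ?_⟩
  have hL := one_le_log_one_div h0 h1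
  have hlW := log_nonneg hW
  by_cases hy : 1 ≤ w ^ 2 / δ ^ 2
  · have h2 : log (w ^ 2 / δ ^ 2) ≤ 2 * log W + 2 * log (1 / δ) := by
      rw [log_sq_div_sq h0 hw]
      have := log_le_log hw hwW
      linarith
    have h3 : (1 + log (w ^ 2 / δ ^ 2)) ≤ log (1 / δ) * (3 + 2 * log W) := by nlinarith
    have h4 := log_nonneg hy
    calc scaledSum δ w ≤ δ ^ 2 / log (1 / δ) ^ 3 *
          (C * (w ^ 2 / δ ^ 2 * (log (1 / δ) * (3 + 2 * log W)) ^ 3)) := by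
          unfold scaledSum
          refine mul_le_mul_of_nonneg_left ((h _ hy).trans ?_) (by positivity)
          gcongr
      _ = _ := by field_simp
  · rw [scaledSum, sumUpTo_eq_zero _ (not_le.1 hy), mul_zero]
    positivity

lemma tendsto_log_one_div : Tendsto (fun δ => log (1 / δ)) (𝓝[>] 0) atTop := by
  simp only [one_div]
  exact tendsto_log_atTop.comp tendsto_inv_nhdsGT_zero

lemma tendsto_scaledSum {w : ℝ} (hw : 0 < w) :
    Tendsto (fun δ => scaledSum δ w) (𝓝[>] 0) (𝓝 (8 / π ^ 2 * w ^ 2)) := by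
  obtain ⟨C, hC, h⟩ := hasLogMean_divisorSq
  have hL := tendsto_log_one_div
  have hq : ∀ c : ℝ, Tendsto (fun δ => c / log (1 / δ)) (𝓝[>] 0) (𝓝 0) := fun c =>
    hL.const_div_atTop c
  have hmain : Tendsto (fun δ => 1 / π ^ 2 * (w ^ 2 * (2 * log w / log (1 / δ) + 2) ^ 3))
      (𝓝[>] 0) (𝓝 (8 / π ^ 2 * w ^ 2)) := by
    have := ((((hq (2 * log w)).add_const 2).pow 3).const_mul (w ^ 2)).const_mul (1 / π ^ 2)
    convert this using 2
    ring
  have herr : Tendsto (fun δ => C * (w ^ 2 * ((1 + 2 * log w) / log (1 / δ) + 2) ^ 2) *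
      (1 / log (1 / δ))) (𝓝[>] 0) (𝓝 0) := by
    have := (((((hq (1 + 2 * log w)).add_const 2).pow 2).const_mul (w ^ 2)).const_mul C).mul (hq 1)
    simpa using this
  have hdiff : Tendsto (fun δ => scaledSum δ w -
      1 / π ^ 2 * (w ^ 2 * (2 * log w / log (1 / δ) + 2) ^ 3)) (𝓝[>] 0) (𝓝 0) := by
    refine squeeze_zero_norm' ?_ herr
    have e1 : ∀ᶠ δ : ℝ in 𝓝[>] 0, δ < min w 1 :=
      (eventually_lt_nhds (lt_min hw one_pos)).filter_mono nhdsWithin_le_nhds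
    filter_upwards [e1, self_mem_nhdsWithin, hL.eventually_ge_atTop 1] with δ h1 h2 h3
    have hδ : (0 : ℝ) < δ := h2
    have hL0 : 0 < log (1 / δ) := by linarith
    have hy : 1 ≤ w ^ 2 / δ ^ 2 := by
      rw [le_div_iff₀ (by positivity), one_mul]
      exact pow_le_pow_left₀ hδ.le (h1.le.trans (min_le_left _ _)) 2
    have h4 := h _ hy
    rw [log_sq_div_sq hδ hw] at h4
    have hk : 0 < δ ^ 2 / log (1 / δ) ^ 3 := by positivity
    rw [norm_eq_abs]
    have e : scaledSum δ w - 1 / π ^ 2 * (w ^ 2 * (2 * log w / log (1 / δ) + 2) ^ 3) =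
        δ ^ 2 / log (1 / δ) ^ 3 * (sumUpTo divisorSq (w ^ 2 / δ ^ 2) -
          1 / π ^ 2 * (w ^ 2 / δ ^ 2 * (2 * log w + 2 * log (1 / δ)) ^ (2 + 1))) := by
      unfold scaledSum
      field_simp
      ring
    rw [e, abs_mul, abs_of_pos hk]
    refine (mul_le_mul_of_nonneg_left h4 hk.le).trans (le_of_eq ?_)
    field_simp
    ring
  simpa using hdiff.add hmain

/-- The function `sin² (2πw) / w³`. -/
def sinKernel (w : ℝ) : ℝ := sin (2 * π * w) ^ 2 / w ^ 3

/-- The derivative of `sinKernel`. -/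
def sinKernelDeriv (w : ℝ) : ℝ :=
  4 * π * (sin (2 * π * w) * cos (2 * π * w)) / w ^ 3 - 3 * sin (2 * π * w) ^ 2 / w ^ 4

lemma hasDerivAt_sin_sq (w : ℝ) : HasDerivAt (fun w => sin (2 * π * w) ^ 2)
    (4 * π * (sin (2 * π * w) * cos (2 * π * w))) w := by
  have hb : HasDerivAt (fun x => 2 * π * x) (2 * π) w := by
    simpa using (hasDerivAt_id w).const_mul (2 * π)
  refine (hb.sin.fun_pow 2).congr_deriv ?_
  push_cast
  ring

lemma hasDerivAt_sinKernel {w : ℝ} (hw : 0 < w) : HasDerivAt sinKernel (sinKernelDeriv w) w := by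
  refine ((hasDerivAt_sin_sq w).fun_div (hasDerivAt_pow 3 w) (by positivity)).congr_deriv ?_
  unfold sinKernelDeriv
  field_simp
  ring

lemma continuousOn_sinKernelDeriv : ContinuousOn sinKernelDeriv (Set.Ioi 0) := by
  unfold sinKernelDeriv
  refine ContinuousOn.sub (ContinuousOn.div (by fun_prop) (by fun_prop) ?_)
    (ContinuousOn.div (by fun_prop) (by fun_prop) ?_)
  · intro w hw; have : 0 < w := hw; positivity
  · intro w hw; have : 0 < w := hw; positivity

lemma abs_sin_le_two_pi_mul {w : ℝ} (hw : 0 < w) : |sin (2 * π * w)| ≤ 2 * π * w :=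
  (abs_sin_le_abs).trans (le_of_eq (abs_of_pos (by positivity)))

lemma sinKernel_nonneg {w : ℝ} (hw : 0 < w) : 0 ≤ sinKernel w := by unfold sinKernel; positivity

lemma abs_sinKernelDeriv_le {w : ℝ} (hw : 0 < w) : |sinKernelDeriv w| ≤ 20 * π ^ 2 / w ^ 2 := by
  have h1 := abs_sin_le_two_pi_mul hw
  have h2 : sin (2 * π * w) ^ 2 ≤ (2 * π * w) ^ 2 := by
    rw [← sq_abs (sin _)]; exact pow_le_pow_left₀ (abs_nonneg _) h1 2
  unfold sinKernelDeriv
  refine (abs_sub _ _).trans ?_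
  rw [abs_div, abs_div, abs_of_pos (by positivity : 0 < w ^ 3),
    abs_of_pos (by positivity : 0 < w ^ 4), abs_mul (4 * π), abs_mul (sin _),
    abs_of_pos (by positivity : 0 < 4 * π), abs_of_nonneg (by positivity : 0 ≤ 3 * sin (2 * π * w) ^ 2)]
  have h3 : |sin (2 * π * w)| * |cos (2 * π * w)| ≤ 2 * π * w * 1 :=
    mul_le_mul h1 (abs_cos_le_one _) (abs_nonneg _) (by positivity)
  calc 4 * π * (|sin (2 * π * w)| * |cos (2 * π * w)|) / w ^ 3 + 3 * sin (2 * π * w) ^ 2 / w ^ 4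
      ≤ 4 * π * (2 * π * w * 1) / w ^ 3 + 3 * (2 * π * w) ^ 2 / w ^ 4 := by gcongr
    _ = _ := by field_simp; ring

lemma measurable_sumUpTo (f : ArithmeticFunction ℝ) : Measurable (sumUpTo f) :=
  (measurable_from_nat (f := fun k : ℕ => ∑ n ∈ Ioc 0 k, f n)).comp Nat.measurable_floor

lemma measurable_scaledSum (δ : ℝ) : Measurable (scaledSum δ) :=
  ((measurable_sumUpTo divisorSq).comp (by fun_prop)).const_mul _

lemma filter_mul_sqrt_le {δ w : ℝ} (h0 : 0 < δ) (hw : 0 ≤ w) (M : ℕ) :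
    (Ioc 0 M).filter (fun n : ℕ => δ * √n ≤ w) = Ioc 0 (min M ⌊w ^ 2 / δ ^ 2⌋₊) := by
  ext n
  simp only [mem_filter, mem_Ioc, le_min_iff, and_assoc]
  refine and_congr_right fun _ => and_congr_right fun _ => ?_
  rw [le_floor_iff (by positivity), ← le_div_iff₀' h0, sqrt_le_left (by positivity), div_pow]

lemma scaled_sum_sinKernel_eq {δ W : ℝ} (h0 : 0 < δ) (hW : 0 < W) : δ ^ 2 / log (1 / δ) ^ 3 *
      ∑ n ∈ Ioc 0 ⌊W ^ 2 / δ ^ 2⌋₊, divisorSq n * sinKernel (δ * √n) =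
    sinKernel W * scaledSum δ W - ∫ w in Set.Ioc 0 W, sinKernelDeriv w * scaledSum δ w := by
  have hv : ∀ n ∈ Ioc 0 ⌊W ^ 2 / δ ^ 2⌋₊, 0 < δ * √n ∧ δ * √n ≤ W := by
    intro n hn
    have h1 := hn
    rw [← min_self ⌊W ^ 2 / δ ^ 2⌋₊, ← filter_mul_sqrt_le h0 hW.le] at h1
    have : (0 : ℝ) < n := mod_cast (mem_Ioc.1 hn).1
    exact ⟨by positivity, (mem_filter.1 h1).2⟩
  have h := sum_mul_sub_eq_integral (fun w hw => hasDerivAt_sinKernel hw)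
    continuousOn_sinKernelDeriv _ (fun n => divisorSq n) (fun n : ℕ => δ * √n) hv
  have h2 : ∫ w in Set.Ioc 0 W, sinKernelDeriv w * scaledSum δ w =
      δ ^ 2 / log (1 / δ) ^ 3 * ∫ w in Set.Ioc 0 W, sinKernelDeriv w *
        ∑ n ∈ Ioc (0 : ℕ) ⌊W ^ 2 / δ ^ 2⌋₊ with (fun n : ℕ => δ * √n) n ≤ w, divisorSq n := by
    rw [← integral_const_mul]
    refine setIntegral_congr_fun measurableSet_Ioc fun w hw => ?_
    beta_reduce
    have h3 : ⌊w ^ 2 / δ ^ 2⌋₊ ≤ ⌊W ^ 2 / δ ^ 2⌋₊ := by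
      refine Nat.floor_le_floor ?_
      have := hw.1; have := hw.2
      gcongr
    rw [filter_mul_sqrt_le h0 hw.1.le, min_eq_right h3, scaledSum, sumUpTo]
    ring
  rw [h2, ← h, scaledSum, sumUpTo]
  simp only [mul_sub, sum_sub_distrib, ← sum_mul]
  ring

lemma integral_sinKernel_by_parts {W : ℝ} (hW : 0 < W) :
    8 / π ^ 2 * (sinKernel W * W ^ 2 - ∫ w in Set.Ioc 0 W, sinKernelDeriv w * w ^ 2) =
      16 / π ^ 2 * ∫ w in Set.Ioc 0 W, sin (2 * π * w) ^ 2 / w ^ 2 := by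
  have hi1 : IntegrableOn (fun w => sin (2 * π * w) ^ 2 / w ^ 2) (Set.Ioc 0 W) :=
    IntegrableOn.mono_set (t := Set.Ioi 0) integral_sin_sq_div_sq.1 Set.Ioc_subset_Ioi_self
  have hi2 : IntegrableOn (fun w => sinKernelDeriv w * w ^ 2) (Set.Ioc 0 W) := by
    have hcm : ContinuousOn (fun w => sinKernelDeriv w * w ^ 2) (Set.Ioc 0 W) :=
      (continuousOn_sinKernelDeriv.mono Set.Ioc_subset_Ioi_self).mul (by fun_prop)
    refine Integrable.of_bound (μ := volume.restrict (Set.Ioc 0 W))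
      (hcm.aestronglyMeasurable measurableSet_Ioc) (20 * π ^ 2) ?_
    · filter_upwards [ae_restrict_mem measurableSet_Ioc] with w hw
      have hw0 : 0 < w := hw.1
      rw [norm_mul, norm_eq_abs, norm_eq_abs, abs_of_pos (by positivity : 0 < w ^ 2)]
      calc |sinKernelDeriv w| * w ^ 2 ≤ 20 * π ^ 2 / w ^ 2 * w ^ 2 := by
            gcongr; exact abs_sinKernelDeriv_le hw0
        _ = _ := by field_simp
  have hcont : Continuous fun w => sin (2 * π * w) ^ 2 / w := by
    have : (fun w => sin (2 * π * w) ^ 2 / w) =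
        fun w => 2 * π * sin (2 * π * w) * sinc (2 * π * w) := by
      ext w
      rcases eq_or_ne w 0 with rfl | hw
      · simp
      · rw [sinc_of_ne_zero (by positivity)]; field_simp
    rw [this]
    have := continuous_sinc
    fun_prop
  have hi3 : Integrable (fun w => 2 * (sin (2 * π * w) ^ 2 / w ^ 2) + sinKernelDeriv w * w ^ 2)
      (volume.restrict (Set.Ioc 0 W)) := (hi1.const_mul 2).add hi2
  have hftc := intervalIntegral.integral_eq_sub_of_hasDerivAt_of_le hW.le hcont.continuousOn
    (f' := fun w => 2 * (sin (2 * π * w) ^ 2 / w ^ 2) + sinKernelDeriv w * w ^ 2) (fun w hw => by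
      have hw0 : 0 < w := hw.1
      refine ((hasDerivAt_sin_sq w).fun_div (hasDerivAt_id w) hw0.ne').congr_deriv ?_
      unfold sinKernelDeriv
      simp only [id]
      field_simp
      ring) ((intervalIntegrable_iff_integrableOn_Ioc_of_le hW.le).2 hi3)
  rw [integral_of_le hW.le, integral_add (hi1.const_mul 2) hi2, integral_const_mul] at hftc
  have e : sinKernel W * W ^ 2 = sin (2 * π * W) ^ 2 / W := by unfold sinKernel; field_simp
  simp only [div_zero, sub_zero] at hftc
  rw [e, ← hftc]
  ring

lemma tendsto_scaled_sum_sinKernel {W : ℝ} (hW : 1 ≤ W) :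
    Tendsto (fun δ => δ ^ 2 / log (1 / δ) ^ 3 *
      ∑ n ∈ Ioc 0 ⌊W ^ 2 / δ ^ 2⌋₊, divisorSq n * sinKernel (δ * √n))
      (𝓝[>] 0) (𝓝 (16 / π ^ 2 * ∫ w in Set.Ioc 0 W, sin (2 * π * w) ^ 2 / w ^ 2)) := by
  have hW0 : 0 < W := by linarith
  obtain ⟨C, hC, hbd⟩ := exists_scaledSum_le
  have hsmall : ∀ᶠ δ : ℝ in 𝓝[>] 0, 0 < δ ∧ δ ≤ exp (-1) := by
    filter_upwards [self_mem_nhdsWithin,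
      (eventually_le_nhds (exp_pos (-1))).filter_mono nhdsWithin_le_nhds] with δ h1 h2
    exact ⟨h1, h2⟩
  have hint : Tendsto (fun δ => ∫ w in Set.Ioc 0 W, sinKernelDeriv w * scaledSum δ w)
      (𝓝[>] 0) (𝓝 (∫ w in Set.Ioc 0 W, sinKernelDeriv w * (8 / π ^ 2 * w ^ 2))) := by
    refine tendsto_integral_filter_of_dominated_convergence
      (fun _ => 20 * π ^ 2 * (C * (3 + 2 * log W) ^ 3)) ?_ ?_ ?_ ?_
    · refine .of_forall fun δ => ?_
      exact ((continuousOn_sinKernelDeriv.mono fun w hw => hw.1).aestronglyMeasurable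
        measurableSet_Ioc).mul (measurable_scaledSum δ).aestronglyMeasurable
    · filter_upwards [hsmall] with δ hδ
      filter_upwards [ae_restrict_mem measurableSet_Ioc] with w hw
      have hw0 : 0 < w := hw.1
      have h1 := scaledSum_nonneg hδ.1 hδ.2 w
      rw [norm_mul, norm_eq_abs, norm_of_nonneg h1]
      calc |sinKernelDeriv w| * scaledSum δ w ≤
            20 * π ^ 2 / w ^ 2 * (C * (w ^ 2 * (3 + 2 * log W) ^ 3)) :=
            mul_le_mul (abs_sinKernelDeriv_le hw0) (hbd δ w W hδ.1 hδ.2 hw0 hw.2 hW) h1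
              (by positivity)
        _ = _ := by field_simp
    · exact integrable_const _
    · filter_upwards [ae_restrict_mem measurableSet_Ioc] with w hw
      exact (tendsto_scaledSum hw.1).const_mul _
  have h2 := ((tendsto_scaledSum hW0).const_mul (sinKernel W)).sub hint
  rw [← integral_sinKernel_by_parts hW0]
  have e : 8 / π ^ 2 * (sinKernel W * W ^ 2 - ∫ w in Set.Ioc 0 W, sinKernelDeriv w * w ^ 2) =
      sinKernel W * (8 / π ^ 2 * W ^ 2) -
        ∫ w in Set.Ioc 0 W, sinKernelDeriv w * (8 / π ^ 2 * w ^ 2) := by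
    have : ∀ w : ℝ, sinKernelDeriv w * (8 / π ^ 2 * w ^ 2) =
      8 / π ^ 2 * (sinKernelDeriv w * w ^ 2) := fun w => by ring
    simp only [this]
    rw [integral_const_mul]
    ring
  rw [e]
  refine h2.congr' ?_
  filter_upwards [hsmall] with δ hδ
  exact (scaled_sum_sinKernel_eq hδ.1 hW0).symm

lemma three_add_two_log_pow_le {w : ℝ} (hw : 1 ≤ w) :
    (3 + 2 * log w) ^ 3 ≤ 3375 * w ^ (1 / 2 : ℝ) := by
  have h0 : 0 < w := by linarith
  have h1 : log w ≤ w ^ (1 / 6 : ℝ) / (1 / 6) := log_le_rpow_div h0.le (by norm_num)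
  have h2 : 1 ≤ w ^ (1 / 6 : ℝ) := one_le_rpow hw (by norm_num)
  have h3 := log_nonneg hw
  calc (3 + 2 * log w) ^ 3 ≤ (15 * w ^ (1 / 6 : ℝ)) ^ 3 := by
        refine pow_le_pow_left₀ (by linarith) ?_ 3
        linarith
    _ = 3375 * (w ^ (1 / 6 : ℝ)) ^ (3 : ℝ) := by rw [mul_pow, rpow_ofNat]; norm_num
    _ = 3375 * w ^ (1 / 2 : ℝ) := by rw [← rpow_mul h0.le]; norm_num

lemma exists_scaled_tail_le : ∃ C, 0 ≤ C ∧ ∀ δ W : ℝ, 0 < δ → δ ≤ exp (-1) → 1 ≤ W → ∀ M : ℕ,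
    δ ^ 2 / log (1 / δ) ^ 3 * ∑ n ∈ Ioc ⌊W ^ 2 / δ ^ 2⌋₊ M, divisorSq n * (1 / (δ * √n) ^ 3) ≤
    C * W ^ (-(1 / 2) : ℝ) := by
  obtain ⟨C, hC, hbd⟩ := exists_scaledSum_le
  refine ⟨3375 * C + 3 * (3375 * C) * 2, by positivity, fun δ W h0 h1 hW M => ?_⟩
  have hL := one_le_log_one_div h0 h1
  have hW0 : 0 < W := by linarith
  set N := ⌊W ^ 2 / δ ^ 2⌋₊ with hN
  rcases le_or_gt M N with hMN | hMN
  · rw [Ioc_eq_empty (by omega)]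
    simp only [sum_empty, mul_zero]
    positivity
  set s := Ioc N M with hs
  set V := δ * √M with hV
  have hlow : ∀ n : ℕ, N < n → W < δ * √n := fun n hn => by
    have h3 : W ^ 2 / δ ^ 2 < n := (Nat.floor_lt (by positivity)).1 hn
    rw [← div_lt_iff₀' h0]
    refine (lt_sqrt (by positivity)).2 ?_
    rwa [div_pow]
  have hWV : W < V := hlow M hMN
  have hV0 : 0 < V := hW0.trans hWV
  have hbd2 : ∀ w : ℝ, 1 ≤ w → scaledSum δ w ≤ 3375 * C * w ^ (5 / 2 : ℝ) := fun w hw => by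
    have hw0 : 0 < w := by linarith
    calc scaledSum δ w ≤ C * (w ^ 2 * (3 + 2 * log w) ^ 3) := hbd δ w w h0 h1 hw0 le_rfl hw
      _ ≤ C * (w ^ 2 * (3375 * w ^ (1 / 2 : ℝ))) := by gcongr; exact three_add_two_log_pow_le hw
      _ = 3375 * C * (w ^ (2 : ℝ) * w ^ (1 / 2 : ℝ)) := by rw [rpow_two]; ring
      _ = 3375 * C * w ^ (5 / 2 : ℝ) := by rw [← rpow_add hw0]; norm_num
  have hv : ∀ n ∈ s, 0 < δ * √n ∧ δ * √n ≤ V := fun n hn => by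
    obtain ⟨k1, k2⟩ := mem_Ioc.1 hn
    exact ⟨hW0.trans (hlow n k1), mul_le_mul_of_nonneg_left (sqrt_le_sqrt (mod_cast k2)) h0.le⟩
  have hpart : ∀ w : ℝ, 0 ≤ w → δ ^ 2 / log (1 / δ) ^ 3 *
      ∑ n ∈ s with (fun n : ℕ => δ * √n) n ≤ w, divisorSq n ≤ scaledSum δ w := fun w hw => by
    unfold scaledSum
    refine mul_le_mul_of_nonneg_left ?_ (by positivity)
    rw [sumUpTo]
    refine sum_le_sum_of_subset_of_nonneg (fun n hn => ?_) fun n _ _ => divisorSq_nonneg n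
    obtain ⟨k1, k2⟩ := mem_filter.1 hn
    obtain ⟨k3, k4⟩ := mem_Ioc.1 k1
    have := filter_mul_sqrt_le h0 hw M
    have h5 : n ∈ (Ioc 0 M).filter (fun n : ℕ => δ * √n ≤ w) :=
      mem_filter.2 ⟨mem_Ioc.2 ⟨by omega, k4⟩, k2⟩
    rw [this] at h5
    exact Ioc_subset_Ioc_right (min_le_right _ _) h5
  have hder : ∀ w : ℝ, 0 < w → HasDerivAt (fun w => 1 / w ^ 3) (-(3 / w ^ 4)) w := fun w hw => by
    refine ((hasDerivAt_const w (1 : ℝ)).fun_div (hasDerivAt_pow 3 w)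
      (by positivity)).congr_deriv ?_
    field_simp
    ring
  have hcont : ContinuousOn (fun w : ℝ => -(3 / w ^ 4)) (Set.Ioi 0) := by
    refine ContinuousOn.neg (ContinuousOn.div (by fun_prop) (by fun_prop) fun w hw => ?_)
    have : 0 < w := hw
    positivity
  have habel := sum_mul_sub_eq_integral hder hcont s (fun n => divisorSq n) (fun n : ℕ => δ * √n) hv
  have hI : δ ^ 2 / log (1 / δ) ^ 3 * -∫ w in Set.Ioc 0 V, -(3 / w ^ 4) *
      ∑ n ∈ s with (fun n : ℕ => δ * √n) n ≤ w, divisorSq n ≤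
      3 * (3375 * C) * 2 * W ^ (-(1 / 2) : ℝ) := by
    rw [← integral_neg, ← integral_const_mul]
    have hgi : IntegrableOn (fun w : ℝ => 3 * (3375 * C) * w ^ (-(3 / 2) : ℝ)) (Set.Ioi W) :=
      (integrableOn_Ioi_rpow_of_lt (by norm_num) hW0).const_mul _
    have hval : ∫ w in Set.Ioi W, 3 * (3375 * C) * w ^ (-(3 / 2) : ℝ) =
        3 * (3375 * C) * 2 * W ^ (-(1 / 2) : ℝ) := by
      rw [integral_const_mul, integral_Ioi_rpow_of_lt (by norm_num) hW0]
      norm_num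
      ring
    rw [← hval, ← integral_indicator measurableSet_Ioi]
    refine (integral_mono_of_nonneg ?_ (hgi.integrable_indicator measurableSet_Ioi).integrableOn
      (μ := volume.restrict (Set.Ioc 0 V)) ?_).trans
      (setIntegral_le_integral (hgi.integrable_indicator measurableSet_Ioi) ?_)
    · filter_upwards [ae_restrict_mem measurableSet_Ioc] with w hw
      have hw0 : 0 < w := hw.1
      have : 0 ≤ ∑ n ∈ s with (fun n : ℕ => δ * √n) n ≤ w, divisorSq n :=
        sum_nonneg fun n _ => divisorSq_nonneg n
      simp only [Pi.zero_apply, neg_mul, neg_neg]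
      positivity
    · filter_upwards [ae_restrict_mem measurableSet_Ioc] with w hw
      have hw0 : 0 < w := hw.1
      by_cases hwW : W < w
      · rw [indicator_of_mem (Set.mem_Ioi.2 hwW)]
        have h3 := (hpart w hw0.le).trans (hbd2 w (by linarith))
        calc _ = 3 / w ^ 4 * (δ ^ 2 / log (1 / δ) ^ 3 *
              ∑ n ∈ s with (fun n : ℕ => δ * √n) n ≤ w, divisorSq n) := by ring
          _ ≤ 3 / w ^ 4 * (3375 * C * w ^ (5 / 2 : ℝ)) := by gcongr
          _ = 3 * (3375 * C) * (w ^ (5 / 2 : ℝ) / w ^ (4 : ℝ)) := by rw [rpow_ofNat]; ring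
          _ = 3 * (3375 * C) * w ^ (-(3 / 2) : ℝ) := by rw [← rpow_sub hw0]; norm_num
      · rw [indicator_of_notMem (fun h => hwW (Set.mem_Ioi.1 h)), filter_false_of_mem]
        · simp
        · intro n hn h
          have := hlow n (mem_Ioc.1 hn).1
          linarith
    · refine .of_forall fun w => Set.indicator_nonneg (fun w hw => ?_) w
      have : 0 < w := hW0.trans hw
      positivity
  have hsum : ∑ n ∈ s, divisorSq n * (1 / (δ * √n) ^ 3) =
      1 / V ^ 3 * (∑ n ∈ s, divisorSq n) + -∫ w in Set.Ioc 0 V, -(3 / w ^ 4) *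
      ∑ n ∈ s with (fun n : ℕ => δ * √n) n ≤ w, divisorSq n := by
    rw [← habel]
    simp only [mul_sub, sum_sub_distrib, ← sum_mul]
    ring
  have hA : δ ^ 2 / log (1 / δ) ^ 3 * (1 / V ^ 3 * (∑ n ∈ s, divisorSq n)) ≤
      3375 * C * W ^ (-(1 / 2) : ℝ) := by
    have h3 := hpart V hV0.le
    rw [filter_true_of_mem fun n hn => (hv n hn).2] at h3
    have h4 := h3.trans (hbd2 V (by linarith))
    calc _ = 1 / V ^ 3 * (δ ^ 2 / log (1 / δ) ^ 3 * ∑ n ∈ s, divisorSq n) := by ring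
      _ ≤ 1 / V ^ 3 * (3375 * C * V ^ (5 / 2 : ℝ)) := by gcongr
      _ = 3375 * C * (V ^ (5 / 2 : ℝ) / V ^ (3 : ℝ)) := by rw [rpow_ofNat]; ring
      _ = 3375 * C * V ^ (-(1 / 2) : ℝ) := by rw [← rpow_sub hV0]; norm_num
      _ ≤ 3375 * C * W ^ (-(1 / 2) : ℝ) := by
          refine mul_le_mul_of_nonneg_left ?_ (by positivity)
          exact rpow_le_rpow_of_nonpos hW0 hWV.le (by norm_num)
  rw [hsum, mul_add]
  linarith

/-- The asymptotic variance. -/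
lemma tendsto_variance : Tendsto (fun δ => δ ^ 2 / log (1 / δ) ^ 3 *
      ∑ n ∈ Ioc 0 ⌊(δ⁻¹) ^ 3⌋₊, divisorSq n * sinKernel (δ * √n))
      (𝓝[>] 0) (𝓝 16) := by
  obtain ⟨C, hC, htail⟩ := exists_scaled_tail_le
  have hWlim : Tendsto (fun W => 16 / π ^ 2 * ∫ w in Set.Ioc 0 W, sin (2 * π * w) ^ 2 / w ^ 2)
      atTop (𝓝 16) := by
    have h1 := intervalIntegral_tendsto_integral_Ioi 0 integral_sin_sq_div_sq.1 tendsto_id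
    rw [integral_sin_sq_div_sq.2] at h1
    have h2 := h1.const_mul (16 / π ^ 2)
    have e : 16 / π ^ 2 * π ^ 2 = 16 := by field_simp
    rw [e] at h2
    refine h2.congr' ?_
    filter_upwards [eventually_ge_atTop 0] with W hW
    rw [integral_of_le (by exact hW)]
    rfl
  have hrp : Tendsto (fun W => C * W ^ (-(1 / 2) : ℝ)) atTop (𝓝 0) := by
    simpa using (tendsto_rpow_neg_atTop (y := 1 / 2) (by norm_num)).const_mul C
  rw [Metric.tendsto_nhds]
  intro ε hε
  have hε3 : 0 < ε / 3 := by positivity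
  obtain ⟨W, hW1, hW2, hW3⟩ := ((eventually_ge_atTop (1 : ℝ)).and
    (((Metric.tendsto_nhds.1 hWlim) _ hε3).and ((Metric.tendsto_nhds.1 hrp) _ hε3))).exists
  have hW0 : 0 < W := by linarith
  filter_upwards [(Metric.tendsto_nhds.1 (tendsto_scaled_sum_sinKernel hW1)) _ hε3,
    self_mem_nhdsWithin,
    (eventually_le_nhds (exp_pos (-1))).filter_mono nhdsWithin_le_nhds,
    (eventually_le_nhds (show (0 : ℝ) < 1 / W ^ 2 by positivity)).filter_mono
      nhdsWithin_le_nhds] with δ h1 h2 h3 h4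
  have h0 : (0 : ℝ) < δ := h2
  have hL := one_le_log_one_div h0 h3
  have hNM : ⌊W ^ 2 / δ ^ 2⌋₊ ≤ ⌊(δ⁻¹) ^ 3⌋₊ := by
    refine Nat.floor_le_floor ?_
    rw [div_le_iff₀ (by positivity), inv_pow]
    rw [le_div_iff₀ (by positivity)] at h4
    have : (δ ^ 3)⁻¹ * δ ^ 2 = δ⁻¹ := by field_simp
    rw [this, ← one_div, le_div_iff₀ h0]
    linarith
  have hsplit := sum_Ioc_consecutive
    (fun n : ℕ => divisorSq n * sinKernel (δ * √n)) (Nat.zero_le ⌊W ^ 2 / δ ^ 2⌋₊) hNM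
  have ht := htail δ W h0 h3 hW1 ⌊(δ⁻¹) ^ 3⌋₊
  set T := δ ^ 2 / log (1 / δ) ^ 3 * ∑ n ∈ Ioc ⌊W ^ 2 / δ ^ 2⌋₊ ⌊(δ⁻¹) ^ 3⌋₊,
    divisorSq n * sinKernel (δ * √n) with hT
  have hpos : ∀ n ∈ Ioc ⌊W ^ 2 / δ ^ 2⌋₊ ⌊(δ⁻¹) ^ 3⌋₊, 0 < δ * √n := fun n hn => by
    have : (0 : ℝ) < n := mod_cast (Nat.zero_le _).trans_lt (mem_Ioc.1 hn).1
    positivity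
  have hT0 : 0 ≤ T := by
    refine mul_nonneg (by positivity) (sum_nonneg fun n hn => ?_)
    exact mul_nonneg (divisorSq_nonneg n) (sinKernel_nonneg (hpos n hn))
  have hT1 : T ≤ C * W ^ (-(1 / 2) : ℝ) := by
    refine le_trans (mul_le_mul_of_nonneg_left (sum_le_sum fun n hn => ?_) (by positivity)) ht
    refine mul_le_mul_of_nonneg_left ?_ (divisorSq_nonneg n)
    have := hpos n hn
    unfold sinKernel
    gcongr
    exact sin_sq_le_one _
  rw [← hsplit, mul_add, ← hT]
  rw [dist_eq] at h1 hW2 hW3 ⊢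
  rw [sub_zero] at hW3
  have h5 := (abs_lt.1 hW3).2
  rw [abs_lt] at h1 hW2 ⊢
  constructor <;> linarith [h1.1, h1.2, hW2.1, hW2.2]

/-- The subfield `K(√r)` of the reals. -/
def adjoinSqrt (K : Subfield ℝ) (r : ℕ) : Subfield ℝ where
  carrier := {x | ∃ α ∈ K, ∃ β ∈ K, x = α + β * √r}
  mul_mem' := by
    rintro _ _ ⟨a, ha, b, hb, rfl⟩ ⟨c, hc, d, hd, rfl⟩
    refine ⟨a * c + b * d * r, add_mem (mul_mem ha hc) (mul_mem (mul_mem hb hd) (natCast_mem K r)),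
      a * d + b * c, add_mem (mul_mem ha hd) (mul_mem hb hc), ?_⟩
    have := mul_self_sqrt (cast_nonneg (α := ℝ) r)
    linear_combination b * d * this
  one_mem' := ⟨1, one_mem K, 0, zero_mem K, by simp⟩
  add_mem' := by
    rintro _ _ ⟨a, ha, b, hb, rfl⟩ ⟨c, hc, d, hd, rfl⟩
    exact ⟨a + c, add_mem ha hc, b + d, add_mem hb hd, by ring⟩
  zero_mem' := ⟨0, zero_mem K, 0, zero_mem K, by simp⟩
  neg_mem' := by
    rintro _ ⟨a, ha, b, hb, rfl⟩
    exact ⟨-a, neg_mem ha, -b, neg_mem hb, by ring⟩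
  inv_mem' := by
    rintro _ ⟨a, ha, b, hb, rfl⟩
    by_cases hr : √r ∈ K
    · exact ⟨(a + b * √r)⁻¹, inv_mem (add_mem ha (mul_mem hb hr)), 0, zero_mem K, by simp⟩
    have hs := mul_self_sqrt (cast_nonneg (α := ℝ) r)
    by_cases hb0 : b = 0
    · subst hb0
      exact ⟨a⁻¹, inv_mem ha, 0, zero_mem K, by simp⟩
    have hne : ∀ c ∈ K, c - b * √r ≠ 0 := fun c hc h => hr (by
      have : √r = c / b := by
        field_simp
        linarith
      rw [this]
      exact div_mem hc hb)
    have h1 := hne a ha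
    have h2 : a + b * √r ≠ 0 := fun h => hne (-a) (neg_mem ha) (by linarith)
    have h3 : a * a - b * b * r ≠ 0 := by
      have : a * a - b * b * r = (a - b * √r) * (a + b * √r) := by linear_combination b * b * hs
      rw [this]
      exact mul_ne_zero h1 h2
    have hd : a * a - b * b * r ∈ K :=
      sub_mem (mul_mem ha ha) (mul_mem (mul_mem hb hb) (natCast_mem K r))
    refine ⟨a / (a * a - b * b * r), div_mem ha hd, -b / (a * a - b * b * r),
      div_mem (neg_mem hb) hd, ?_⟩
    have e : a / (a * a - b * b * r) + -b / (a * a - b * b * r) * √r =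
        (a - b * √r) / (a * a - b * b * r) := by ring
    rw [e, eq_div_iff h3, inv_mul_eq_div, div_eq_iff h2]
    linear_combination b ^ 2 * hs

lemma le_adjoinSqrt (K : Subfield ℝ) (r : ℕ) : K ≤ adjoinSqrt K r :=
  fun x hx => ⟨x, hx, 0, zero_mem K, by simp⟩

lemma sqrt_mem_adjoinSqrt (K : Subfield ℝ) (r : ℕ) : √r ∈ adjoinSqrt K r :=
  ⟨0, zero_mem K, 1, one_mem K, by simp⟩

/-- A subfield of `ℝ` containing the square roots of the primes of `P`, but no square root of a
squarefree number greater than one that is coprime to `P`. -/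
structure IsSqrtField (P : Finset ℕ) (K : Subfield ℝ) : Prop where
  sqrt_mem : ∀ p ∈ P, √p ∈ K
  sqrt_notMem : ∀ m : ℕ, 1 < m → Squarefree m → (∀ p ∈ P, p.Coprime m) → √m ∉ K

lemma isSqrtField_empty : IsSqrtField ∅ ⊥ := by
  refine ⟨by simp, fun m hm hsq _ h => ?_⟩
  have hirr : Irrational √m := by
    rw [irrational_sqrt_natCast_iff]
    rintro ⟨k, rfl⟩
    have := hsq k dvd_rfl
    rw [Nat.isUnit_iff] at this
    subst this
    simp at hm
  have : √m ∈ (algebraMap ℚ ℝ).fieldRange := (bot_le : (⊥ : Subfield ℝ) ≤ _) h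
  obtain ⟨y, hy⟩ := this
  exact hirr ⟨y, by simpa using hy⟩

lemma IsSqrtField.insert {P : Finset ℕ} {K : Subfield ℝ} (h : IsSqrtField P K) {r : ℕ}
    (hr : r.Prime) (hP : ∀ p ∈ P, p.Coprime r) : IsSqrtField (insert r P) (adjoinSqrt K r) := by
  refine ⟨fun p hp => ?_, fun m hm hsq hcop hmem => ?_⟩
  · rcases mem_insert.1 hp with rfl | hp
    · exact sqrt_mem_adjoinSqrt K p
    · exact le_adjoinSqrt K r (h.sqrt_mem p hp)
  · have hcP : ∀ p ∈ P, p.Coprime m := fun p hp => hcop p (mem_insert_of_mem hp)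
    have hcr : r.Coprime m := hcop r (mem_insert_self r P)
    have hrK : √r ∉ K := h.sqrt_notMem r hr.one_lt hr.squarefree hP
    obtain ⟨α, hα, β, hβ, e⟩ := hmem
    have hm2 := mul_self_sqrt (cast_nonneg (α := ℝ) m)
    have hr2 := mul_self_sqrt (cast_nonneg (α := ℝ) r)
    by_cases hβ0 : β = 0
    · subst hβ0
      rw [zero_mul, add_zero] at e
      exact h.sqrt_notMem m hm hsq hcP (e ▸ hα)
    by_cases hα0 : α = 0
    · subst hα0
      rw [zero_add] at e
      refine h.sqrt_notMem (r * m) (by nlinarith [hr.one_lt])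
        ((Nat.squarefree_mul hcr).2 ⟨hr.squarefree, hsq⟩)
        (fun p hp => Nat.Coprime.mul_right (hP p hp) (hcP p hp)) ?_
      have : √((r * m : ℕ) : ℝ) = β * r := by
        rw [Nat.cast_mul, sqrt_mul (cast_nonneg r), e]
        linear_combination β * hr2
      rw [this]
      exact mul_mem hβ (natCast_mem K r)
    · refine hrK ?_
      have : √r = (m - α * α - β * β * r) / (2 * α * β) := by
        rw [eq_div_iff (by positivity)]
        rw [e] at hm2
        linear_combination hm2 - β * β * hr2
      rw [this]
      refine div_mem (sub_mem (sub_mem (natCast_mem K m) (mul_mem hα hα))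
        (mul_mem (mul_mem hβ hβ) (natCast_mem K r))) (mul_mem (mul_mem ?_ hα) hβ)
      exact_mod_cast natCast_mem K 2

lemma exists_isSqrtField (P : Finset ℕ) (hP : ∀ p ∈ P, p.Prime) : ∃ K, IsSqrtField P K := by
  induction P using Finset.induction_on with
  | empty => exact ⟨⊥, isSqrtField_empty⟩
  | insert r P hr ih =>
    obtain ⟨K, hK⟩ := ih fun p hp => hP p (mem_insert_of_mem hp)
    have hr' := hP r (mem_insert_self r P)
    exact ⟨_, hK.insert hr' fun p hp => (Nat.coprime_primes
      (hP p (mem_insert_of_mem hp)) hr').2 fun h => hr (h ▸ hp)⟩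

lemma sqrt_mem_of_primeFactors_subset {P : Finset ℕ} {K : Subfield ℝ} (h : IsSqrtField P K)
    {d : ℕ} (hd : Squarefree d) (hdP : d.primeFactors ⊆ P) : √d ∈ K := by
  have : √d = ∏ p ∈ d.primeFactors, √p := by
    rw [← sqrt_prod _ fun p _ => cast_nonneg p, ← Nat.cast_prod,
      Nat.prod_primeFactors_of_squarefree hd]
  rw [this]
  exact prod_mem fun p hp => h.sqrt_mem p (hdP hp)

lemma sqrt_linearIndependent_aux (P : Finset ℕ) (hP : ∀ p ∈ P, p.Prime) (D : Finset ℕ)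
    (hD : ∀ d ∈ D, Squarefree d ∧ d.primeFactors ⊆ P) (b : ℕ → ℤ)
    (h0 : ∑ d ∈ D, (b d : ℝ) * √d = 0) : ∀ d ∈ D, b d = 0 := by
  induction P using Finset.induction_on generalizing D b with
  | empty =>
    have h1 : ∀ d ∈ D, d = 1 := fun d hd => by
      obtain ⟨k1, k2⟩ := hD d hd
      rw [← Nat.prod_primeFactors_of_squarefree k1, subset_empty.1 k2]
      simp
    intro d hd
    obtain rfl := h1 d hd
    have : D = {1} := eq_singleton_iff_unique_mem.2 ⟨hd, h1⟩
    rw [this] at h0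
    simpa using h0
  | insert r P hr ih =>
    have hr' := hP r (mem_insert_self r P)
    have hP' : ∀ p ∈ P, p.Prime := fun p hp => hP p (mem_insert_of_mem hp)
    obtain ⟨K, hK⟩ := exists_isSqrtField P hP'
    have hrK : √r ∉ K := hK.sqrt_notMem r hr'.one_lt hr'.squarefree fun p hp =>
      (Nat.coprime_primes (hP' p hp) hr').2 fun h => hr (h ▸ hp)
    have hsub1 : ∀ d ∈ D.filter (¬ r ∣ ·), Squarefree d ∧ d.primeFactors ⊆ P := fun d hd => by
      obtain ⟨k1, k2⟩ := mem_filter.1 hd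
      refine ⟨(hD d k1).1, fun p hp => ?_⟩
      rcases mem_insert.1 ((hD d k1).2 hp) with rfl | h
      · exact absurd (Nat.dvd_of_mem_primeFactors hp) k2
      · exact h
    have hinj : Set.InjOn (fun d => d / r) (D.filter (r ∣ ·) : Set ℕ) := by
      intro x hx y hy hxy
      have h1 := (mem_filter.1 (mem_coe.1 hx)).2
      have h2 := (mem_filter.1 (mem_coe.1 hy)).2
      rw [← Nat.div_mul_cancel h1, ← Nat.div_mul_cancel h2]
      exact congrArg (· * r) hxy
    have hsub2 : ∀ d ∈ (D.filter (r ∣ ·)).image (fun d => d / r),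
        Squarefree d ∧ d.primeFactors ⊆ P := fun d hd => by
      obtain ⟨e, he, rfl⟩ := mem_image.1 hd
      obtain ⟨k1, k2⟩ := mem_filter.1 he
      have k3 := (hD e k1).1
      have hsq : Squarefree (r * (e / r)) := by rwa [Nat.mul_div_cancel' k2]
      have hcop := Nat.coprime_of_squarefree_mul hsq
      refine ⟨hsq.of_mul_right, fun p hp => ?_⟩
      have hpe : p ∈ e.primeFactors := Nat.primeFactors_mono (Nat.div_dvd_of_dvd k2) k3.ne_zero hp
      rcases mem_insert.1 ((hD e k1).2 hpe) with rfl | h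
      · exact absurd (Nat.dvd_of_mem_primeFactors hp) ((Nat.Prime.coprime_iff_not_dvd hr').1 hcop)
      · exact h
    have hsum2 : ∑ d ∈ D.filter (r ∣ ·), (b d : ℝ) * √d =
        (∑ d ∈ (D.filter (r ∣ ·)).image (fun d => d / r), (b (r * d) : ℝ) * √d) * √r := by
      rw [sum_image hinj, sum_mul]
      refine sum_congr rfl fun d hd => ?_
      have k2 := (mem_filter.1 hd).2
      nth_rewrite 2 [← Nat.mul_div_cancel' k2]
      rw [Nat.cast_mul, sqrt_mul (cast_nonneg r), Nat.mul_div_cancel' k2]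
      ring
    have hmemK : ∀ (E : Finset ℕ) (g : ℕ → ℤ), (∀ d ∈ E, Squarefree d ∧ d.primeFactors ⊆ P) →
        ∑ d ∈ E, (g d : ℝ) * √d ∈ K := fun E g hE =>
      sum_mem fun d hd => mul_mem (intCast_mem K _)
        (sqrt_mem_of_primeFactors_subset hK (hE d hd).1 (hE d hd).2)
    rw [← sum_filter_add_sum_filter_not D (r ∣ ·), hsum2] at h0
    have hA := hmemK _ b hsub1
    have hB := hmemK _ (fun d => b (r * d)) hsub2
    set A := ∑ d ∈ D.filter (¬ r ∣ ·), (b d : ℝ) * √d with hAdef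
    set B := ∑ d ∈ (D.filter (r ∣ ·)).image (fun d => d / r), (b (r * d) : ℝ) * √d with hBdef
    have hB0 : B = 0 := by
      by_contra hB0
      refine hrK ?_
      have : √r = -A / B := by
        field_simp
        linarith
      rw [this]
      exact div_mem (neg_mem hA) hB
    have hA0 : A = 0 := by
      rw [hB0, zero_mul, zero_add] at h0
      exact h0
    intro d hd
    by_cases hrd : r ∣ d
    · have := ih hP' _ hsub2 (fun d => b (r * d)) hB0 (d / r)
        (mem_image_of_mem _ (mem_filter.2 ⟨hd, hrd⟩))
      rwa [Nat.mul_div_cancel' hrd] at this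
    · exact ih hP' _ hsub1 b hA0 d (mem_filter.2 ⟨hd, hrd⟩)

/-- Square roots of distinct squarefree numbers are linearly independent over the integers. -/
lemma sqrt_linearIndependent (D : Finset ℕ) (hD : ∀ d ∈ D, Squarefree d) (b : ℕ → ℤ)
    (h0 : ∑ d ∈ D, (b d : ℝ) * √d = 0) : ∀ d ∈ D, b d = 0 := by
  refine sqrt_linearIndependent_aux (D.biUnion Nat.primeFactors) ?_ D ?_ b h0
  · intro p hp
    obtain ⟨d, _, h⟩ := mem_biUnion.1 hp
    exact Nat.prime_of_mem_primeFactors h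
  · exact fun d hd => ⟨hD d hd, subset_biUnion_of_mem Nat.primeFactors hd⟩

/-- `IsSqrtComb l B x`: `x` is an integral combination, with coefficients at most `B`, of the
products of the square roots of the members of `l`. -/
def IsSqrtComb : List ℕ → ℝ → ℝ → Prop
  | [], B, x => ∃ z : ℤ, x = z ∧ |(z : ℝ)| ≤ B
  | m :: l, B, x => ∃ α β : ℝ, IsSqrtComb l B α ∧ IsSqrtComb l B β ∧ x = α + β * √m

lemma IsSqrtComb.mono {l : List ℕ} {B B' x : ℝ} (h : IsSqrtComb l B x) (hB : B ≤ B') :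
    IsSqrtComb l B' x := by
  induction l generalizing x with
  | nil => obtain ⟨z, e, hz⟩ := h; exact ⟨z, e, hz.trans hB⟩
  | cons m l ih =>
    obtain ⟨α, β, hα, hβ, e⟩ := h
    exact ⟨α, β, ih hα, ih hβ, e⟩

lemma isSqrtComb_zero (l : List ℕ) {B : ℝ} (hB : 0 ≤ B) : IsSqrtComb l B 0 := by
  induction l with
  | nil => exact ⟨0, by simp, by simpa using hB⟩
  | cons m l ih => exact ⟨0, 0, ih, ih, by simp⟩

lemma isSqrtComb_intCast (l : List ℕ) {B : ℝ} {z : ℤ} (hB : |(z : ℝ)| ≤ B) : IsSqrtComb l B z := by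
  induction l with
  | nil => exact ⟨z, rfl, hB⟩
  | cons m l ih =>
    exact ⟨z, 0, ih, isSqrtComb_zero l ((abs_nonneg _).trans hB), by simp⟩

lemma IsSqrtComb.add {l : List ℕ} {B B' x y : ℝ} (hx : IsSqrtComb l B x)
    (hy : IsSqrtComb l B' y) : IsSqrtComb l (B + B') (x + y) := by
  induction l generalizing x y with
  | nil =>
    obtain ⟨z, e, hz⟩ := hx
    obtain ⟨z', e', hz'⟩ := hy
    refine ⟨z + z', by rw [e, e']; push_cast; rfl, ?_⟩
    push_cast
    exact (abs_add_le _ _).trans (add_le_add hz hz')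
  | cons m l ih =>
    obtain ⟨α, β, hα, hβ, e⟩ := hx
    obtain ⟨α', β', hα', hβ', e'⟩ := hy
    exact ⟨α + α', β + β', ih hα hα', ih hβ hβ', by rw [e, e']; ring⟩

lemma IsSqrtComb.intCast_mul {l : List ℕ} {B x : ℝ} (z : ℤ) (hx : IsSqrtComb l B x) :
    IsSqrtComb l (|(z : ℝ)| * B) (z * x) := by
  induction l generalizing x with
  | nil =>
    obtain ⟨w, e, hw⟩ := hx
    refine ⟨z * w, by rw [e]; push_cast; rfl, ?_⟩
    push_cast
    rw [abs_mul]
    gcongr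
  | cons m l ih =>
    obtain ⟨α, β, hα, hβ, e⟩ := hx
    exact ⟨z * α, z * β, ih hα, ih hβ, by rw [e]; ring⟩

lemma IsSqrtComb.mul {l : List ℕ} {M : ℝ} (hM : 1 ≤ M) (hl : ∀ m ∈ l, (m : ℝ) ≤ M) {B B' x y : ℝ}
    (hB : 0 ≤ B) (hB' : 0 ≤ B') (hx : IsSqrtComb l B x) (hy : IsSqrtComb l B' y) :
    IsSqrtComb l ((2 * M) ^ l.length * (B * B')) (x * y) := by
  induction l generalizing x y with
  | nil =>
    obtain ⟨z, e, hz⟩ := hx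
    obtain ⟨z', e', hz'⟩ := hy
    refine ⟨z * z', by rw [e, e']; push_cast; rfl, ?_⟩
    push_cast
    rw [abs_mul]
    simpa using mul_le_mul hz hz' (abs_nonneg _) hB
  | cons m l ih =>
    obtain ⟨α, β, hα, hβ, e⟩ := hx
    obtain ⟨α', β', hα', hβ', e'⟩ := hy
    have ih := @ih fun m hm => hl m (List.mem_cons_of_mem _ hm)
    have hm := hl m List.mem_cons_self
    set G := (2 * M) ^ l.length * (B * B') with hG
    have hG0 : 0 ≤ G := by positivity
    have e2 : (2 * M) ^ (m :: l).length * (B * B') = 2 * M * G := by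
      rw [List.length_cons, pow_succ, hG]; ring
    rw [e2]
    refine ⟨α * α' + (m : ℤ) * (β * β'), α * β' + β * α', ?_, ?_, ?_⟩
    · refine ((ih hα hα').add ((ih hβ hβ').intCast_mul (m : ℤ))).mono ?_
      rw [Int.cast_natCast, abs_of_nonneg (cast_nonneg _)]
      nlinarith
    · refine ((ih hα hβ').add (ih hβ hα')).mono ?_
      nlinarith
    · rw [e, e']
      have := mul_self_sqrt (cast_nonneg (α := ℝ) m)
      push_cast
      linear_combination β * β' * this

lemma IsSqrtComb.abs_le {l : List ℕ} {M : ℝ} (hM : 1 ≤ M) (hl : ∀ m ∈ l, (m : ℝ) ≤ M) {B x : ℝ}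
    (hB : 0 ≤ B) (hx : IsSqrtComb l B x) : |x| ≤ (2 * M) ^ l.length * B := by
  induction l generalizing x with
  | nil =>
    obtain ⟨z, e, hz⟩ := hx
    rw [e]; simpa using hz
  | cons m l ih =>
    obtain ⟨α, β, hα, hβ, e⟩ := hx
    have ih := @ih fun m hm => hl m (List.mem_cons_of_mem _ hm)
    have hm := hl m List.mem_cons_self
    have hs : √m ≤ M := by
      rw [sqrt_le_left (by linarith)]
      nlinarith
    set G := (2 * M) ^ l.length * B with hG
    have hG0 : 0 ≤ G := by positivity
    have e2 : (2 * M) ^ (m :: l).length * B = 2 * M * G := by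
      rw [List.length_cons, pow_succ, hG]; ring
    rw [e2, e]
    have h1 : |β * √m| ≤ G * M := by
      rw [abs_mul, abs_of_nonneg (sqrt_nonneg _)]
      exact mul_le_mul (ih hβ) hs (sqrt_nonneg _) hG0
    calc |α + β * √m| ≤ G + G * M := (abs_add_le _ _).trans (add_le_add (ih hα) h1)
      _ ≤ 2 * M * G := by nlinarith

/-- A nonzero integral combination of products of square roots cannot be very small. -/
lemma exists_pow_le_of_isSqrtComb (k : ℕ) : ∀ e : ℕ, ∃ A : ℕ, ∀ M : ℝ, 2 ≤ M → ∀ l : List ℕ,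
    l.length = k → (∀ m ∈ l, (m : ℝ) ≤ M) → ∀ x : ℝ, IsSqrtComb l (M ^ e) x → x ≠ 0 →
    1 ≤ |x| * M ^ A := by
  induction k with
  | zero =>
    refine fun e => ⟨0, fun M hM l hl _ x hx hx0 => ?_⟩
    obtain rfl := List.length_eq_zero_iff.1 hl
    obtain ⟨z, rfl, _⟩ := hx
    rw [pow_zero, mul_one]
    have : z ≠ 0 := mod_cast hx0
    exact_mod_cast Int.one_le_abs this
  | succ k ih =>
    intro e
    obtain ⟨A₁, h₁⟩ := ih (2 * k + 2 * e + 2)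
    obtain ⟨A₂, h₂⟩ := ih e
    refine ⟨A₁ + A₂ + (2 * k + e + 2), fun M hM l hl hlM x hx hx0 => ?_⟩
    obtain ⟨m, l, rfl⟩ := List.exists_cons_of_length_eq_add_one hl
    have hlk : l.length = k := by simpa using hl
    have hM1 : 1 ≤ M := by linarith
    have hM0 : 0 < M := by linarith
    have hlM' : ∀ m ∈ l, (m : ℝ) ≤ M := fun m hm => hlM m (List.mem_cons_of_mem _ hm)
    have hm := hlM m List.mem_cons_self
    obtain ⟨α, β, hα, hβ, rfl⟩ := hx
    have hB : (0 : ℝ) ≤ M ^ e := by positivity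
    have hs := mul_self_sqrt (cast_nonneg (α := ℝ) m)
    have h2M : (2 * M) ^ k ≤ M ^ (2 * k) := by
      rw [pow_mul]
      exact pow_le_pow_left₀ (by positivity) (by nlinarith) k
    set y := α - β * √m with hy
    have hN : IsSqrtComb l (M ^ (2 * k + 2 * e + 2)) (α * α + ((-m : ℤ) : ℝ) * (β * β)) := by
      refine ((hα.mul hM1 hlM' hB hB hα).add
        ((hβ.mul hM1 hlM' hB hB hβ).intCast_mul (-m : ℤ))).mono ?_
      rw [hlk]
      push_cast
      rw [abs_neg, abs_of_nonneg (cast_nonneg _)]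
      have h3 : (2 * M) ^ k * (M ^ e * M ^ e) ≤ M ^ (2 * k + 2 * e) := by
        have : M ^ (2 * k + 2 * e) = M ^ (2 * k) * (M ^ e * M ^ e) := by ring
        rw [this]; gcongr
      have h4 : M ^ (2 * k + 2 * e + 2) = M ^ (2 * k + 2 * e) * (M * M) := by ring
      rw [h4]
      have h5 : 0 ≤ M ^ (2 * k + 2 * e) := by positivity
      have h6 : 0 ≤ (2 * M) ^ k * (M ^ e * M ^ e) := by positivity
      calc _ = (1 + m) * ((2 * M) ^ k * (M ^ e * M ^ e)) := by ring
        _ ≤ (M * M) * M ^ (2 * k + 2 * e) := by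
            refine mul_le_mul (by nlinarith) h3 h6 (by positivity)
        _ = _ := by ring
    have hNeq : α * α + ((-m : ℤ) : ℝ) * (β * β) = (α + β * √m) * y := by
      rw [hy]; push_cast; linear_combination β * β * hs
    have hpow : ∀ a b : ℕ, a ≤ b → M ^ a ≤ M ^ b := fun a b h => pow_le_pow_right₀ hM1 h
    by_cases hy0 : y = 0
    · have hαβ : α + β * √m = 2 * α := by linarith
      have hα0 : α ≠ 0 := fun h => hx0 (by rw [hαβ, h, mul_zero])
      have h3 := h₂ M hM l hlk hlM' α hα hα0
      rw [hαβ, abs_mul, abs_of_pos (by norm_num : (0 : ℝ) < 2)]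
      have h4 := hpow A₂ (A₁ + A₂ + (2 * k + e + 2)) (by omega)
      have h5 : |α| * M ^ A₂ ≤ |α| * M ^ (A₁ + A₂ + (2 * k + e + 2)) := by gcongr
      nlinarith [abs_nonneg α]
    · have h3 := h₁ M hM l hlk hlM' _ hN (by rw [hNeq]; exact mul_ne_zero hx0 hy0)
      rw [hNeq, abs_mul] at h3
      have hyB : IsSqrtComb (m :: l) (M ^ e) y :=
        ⟨α, ((-1 : ℤ) : ℝ) * β, hα, by simpa using hβ.intCast_mul (-1), by rw [hy]; push_cast; ring⟩
      have h4 := hyB.abs_le hM1 hlM hB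
      have h5 : |y| ≤ M ^ (2 * k + e + 2) := by
        refine h4.trans ?_
        rw [List.length_cons, hlk, pow_succ]
        have : M ^ (2 * k + e + 2) = M ^ (2 * k) * (M * M) * M ^ e := by ring
        rw [this]
        gcongr
      calc (1 : ℝ) ≤ |α + β * √m| * |y| * M ^ A₁ := h3
        _ ≤ |α + β * √m| * M ^ (2 * k + e + 2) * M ^ (A₁ + A₂) := by
            gcongr
            omega
        _ = _ := by ring

lemma isSqrtComb_sum : ∀ (l : List ℕ) (ε : ℕ → ℤ), (∀ i, |((ε i : ℤ) : ℝ)| ≤ 1) →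
    IsSqrtComb l 1 (∑ i ∈ range l.length, (ε i : ℝ) * √((l.getD i 0 : ℕ) : ℝ))
  | [], ε, _ => by simpa using isSqrtComb_zero [] zero_le_one
  | m :: l, ε, hε => by
    rw [List.length_cons, sum_range_succ']
    exact ⟨_, (ε 0 : ℝ), isSqrtComb_sum l (fun i => ε (i + 1)) fun i => hε (i + 1),
      isSqrtComb_intCast l (hε 0), by simp⟩

/-- A nonzero signed sum of `k` square roots of integers at most `M` is at least a power of `M`,
with an exponent that depends only on `k`. -/
lemma exists_one_le_abs_sum_sqrt (k : ℕ) : ∃ A : ℕ, ∀ M : ℝ, 2 ≤ M → ∀ (n : Fin k → ℕ)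
    (ε : Fin k → ℤ), (∀ i, (n i : ℝ) ≤ M) → (∀ i, |(ε i : ℝ)| ≤ 1) →
    ∑ i, (ε i : ℝ) * √(n i : ℝ) ≠ 0 → 1 ≤ |∑ i, (ε i : ℝ) * √(n i : ℝ)| * M ^ A := by
  obtain ⟨A, hA⟩ := exists_pow_le_of_isSqrtComb k 0
  refine ⟨A, fun M hM n ε hn hε h0 => ?_⟩
  refine hA M hM (List.ofFn n) (by simp) ?_ _ ?_ h0
  · intro m hm
    obtain ⟨i, rfl⟩ := List.mem_ofFn.1 hm
    exact hn i
  · have h := isSqrtComb_sum (List.ofFn n) (fun i => if h : i < k then ε ⟨i, h⟩ else 0) fun i => by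
      by_cases h : i < k
      · simpa [h] using hε ⟨i, h⟩
      · simp [h]
    rw [pow_zero]
    convert h using 1
    rw [List.length_ofFn, sum_range]
    refine sum_congr rfl fun i _ => ?_
    simp [List.getD_eq_getElem?_getD]

section

/-- The uniform probability measure on the unit interval. -/
def unitMeasure : Measure ℝ := volume.restrict (Set.Ioc 0 1)

instance : IsProbabilityMeasure unitMeasure := ⟨by simp [unitMeasure]⟩

lemma intervalIntegral_unitExp {l : ℝ} (hl : l ≠ 0) (a b : ℝ) :
    ∫ x in a..b, unitExp (l * x) = (unitExp (l * b) - unitExp (l * a)) / (2 * π * l * I) := by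
  have hc : (2 * π * l * I : ℂ) ≠ 0 := by simp [hl, pi_ne_zero, Complex.I_ne_zero]
  have h := integral_exp_mul_complex (a := a) (b := b) hc
  have e : ∀ x : ℝ, unitExp (l * x) = cexp (2 * π * l * I * x) := fun x => by
    unfold unitExp
    congr 1
    push_cast
    ring
  simp only [e]
  exact h

lemma norm_intervalIntegral_unitExp_le {l : ℝ} (hl : l ≠ 0) (a b : ℝ) :
    ‖∫ x in a..b, unitExp (l * x)‖ ≤ 1 / (π * |l|) := by
  rw [intervalIntegral_unitExp hl, norm_div]
  have h1 : ‖(2 * π * l * I : ℂ)‖ = 2 * (π * |l|) := by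
    simp [abs_of_pos pi_pos]
    ring
  have h2 : ‖unitExp (l * b) - unitExp (l * a)‖ ≤ 2 := by
    refine (norm_sub_le _ _).trans ?_
    rw [norm_unitExp, norm_unitExp]
    norm_num
  have : 0 < |l| := abs_pos.2 hl
  have := pi_pos
  rw [h1, div_le_div_iff₀ (by positivity) (by positivity)]
  nlinarith [mul_pos pi_pos (abs_pos.2 hl)]

lemma unitExp_intCast (m : ℤ) : unitExp m = 1 := by
  unfold unitExp
  rw [Complex.exp_eq_one_iff]
  exact ⟨m, by push_cast; ring⟩

lemma integral_unitExp_unitMeasure (m : ℤ) :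
    ∫ t, unitExp (m * t) ∂unitMeasure = if m = 0 then 1 else 0 := by
  rw [unitMeasure, ← integral_of_le zero_le_one]
  split_ifs with h
  · subst h
    simp [unitExp_zero]
  · rw [intervalIntegral_unitExp (mod_cast h)]
    rw [mul_one, mul_zero, unitExp_intCast, unitExp_zero, sub_self, zero_div]

lemma unitExp_sum {α : Type*} (s : Finset α) (f : α → ℝ) :
    unitExp (∑ i ∈ s, f i) = ∏ i ∈ s, unitExp (f i) := by
  classical
  induction s using Finset.induction_on with
  | empty => simp [unitExp_zero]
  | insert a s ha ih => rw [sum_insert ha, prod_insert ha, unitExp_add, ih]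

/-- The uniform probability measure on a finite product of unit intervals. -/
def torusMeasure (Q : Type*) [Fintype Q] : Measure (Q → ℝ) :=
  Measure.pi fun _ => unitMeasure

instance (Q : Type*) [Fintype Q] : IsProbabilityMeasure (torusMeasure Q) := by
  unfold torusMeasure; infer_instance

/-- A trigonometric polynomial in one variable with real frequencies `w`. -/
def timeSum {ι : Type*} [Fintype ι] (c : ι → ℂ) (w : ι → ℝ) (x : ℝ) : ℂ :=
  ∑ j, c j * unitExp (w j * x)

/-- The trigonometric polynomial on a torus whose term of index `j` has frequency `a j` in the
variable `q j`. -/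
def torusSum {ι Q : Type*} [Fintype ι] (c : ι → ℂ) (a : ι → ℤ) (q : ι → Q)
    (θ : Q → ℝ) : ℂ :=
  ∑ j, c j * unitExp (a j * θ (q j))

lemma norm_torusSum_le {ι Q : Type*} [Fintype ι] (c : ι → ℂ) (a : ι → ℤ) (q : ι → Q)
    (θ : Q → ℝ) : ‖torusSum c a q θ‖ ≤ ∑ j, ‖c j‖ := by
  refine (norm_sum_le _ _).trans (sum_le_sum fun j _ => ?_)
  rw [norm_mul, norm_unitExp, mul_one]

lemma timeSum_pow {ι : Type*} [Fintype ι] (c : ι → ℂ) (w : ι → ℝ) (x : ℝ) (k : ℕ) :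
    timeSum c w x ^ k = ∑ p : Fin k → ι, (∏ i, c (p i)) * unitExp ((∑ i, w (p i)) * x) := by
  rw [timeSum, Fintype.sum_pow]
  refine sum_congr rfl fun p _ => ?_
  rw [prod_mul_distrib, sum_mul, unitExp_sum]

lemma torusSum_pow {ι Q : Type*} [Fintype ι] [Fintype Q] [DecidableEq Q] (c : ι → ℂ) (a : ι → ℤ)
    (q : ι → Q) (θ : Q → ℝ) (k : ℕ) :
    torusSum c a q θ ^ k = ∑ p : Fin k → ι, (∏ i, c (p i)) *
      ∏ r, unitExp ((∑ i with q (p i) = r, a (p i) : ℤ) * θ r) := by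
  rw [torusSum, Fintype.sum_pow]
  refine sum_congr rfl fun p _ => ?_
  rw [prod_mul_distrib, ← unitExp_sum, ← unitExp_sum]
  congr 2
  rw [← sum_fiberwise univ (fun i => q (p i))]
  refine sum_congr rfl fun r _ => ?_
  push_cast
  rw [sum_mul]
  refine sum_congr rfl fun i hi => ?_
  rw [(mem_filter.1 hi).2]

lemma integral_torusSum_pow {ι Q : Type*} [Fintype ι] [Fintype Q] [DecidableEq Q] (c : ι → ℂ)
    (a : ι → ℤ) (q : ι → Q) (k : ℕ) :
    ∫ θ, torusSum c a q θ ^ k ∂torusMeasure Q = ∑ p : Fin k → ι, (∏ i, c (p i)) *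
      if ∀ r, ∑ i with q (p i) = r, a (p i) = 0 then 1 else 0 := by
  simp only [torusSum_pow]
  rw [integral_finsetSum]
  · refine sum_congr rfl fun p _ => ?_
    rw [integral_const_mul, torusMeasure, integral_fintype_prod_eq_prod
      (f := fun r t => unitExp ((∑ i with q (p i) = r, a (p i) : ℤ) * t))]
    simp only [integral_unitExp_unitMeasure]
    congr 1
    split_ifs with h
    · exact prod_eq_one fun r _ => if_pos (h r)
    · obtain ⟨r, hr⟩ := not_forall.1 h
      exact prod_eq_zero (mem_univ r) (if_neg hr)
  · intro p _
    have := continuous_unitExp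
    refine Integrable.of_bound (Continuous.aestronglyMeasurable (by fun_prop)) (∏ i, ‖c (p i)‖) ?_
    refine .of_forall fun θ => ?_
    rw [norm_mul, norm_prod, norm_prod]
    simp [norm_unitExp]

/-- The average of a complex function over `[X, 2X]`. -/
def timeMean (X : ℝ) (f : ℝ → ℂ) : ℂ := (X : ℂ)⁻¹ * ∫ x in X..2 * X, f x

lemma norm_timeMean_sub_torus_le {ι Q : Type*} [Fintype ι] [Fintype Q] [DecidableEq Q] (c : ι → ℂ)
    (a : ι → ℤ) (q : ι → Q) (w : ι → ℝ) (k : ℕ) {X η : ℝ} (hX : 0 < X) (hη : 0 < η)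
    (hres : ∀ p : Fin k → ι, ((∀ r, ∑ i with q (p i) = r, a (p i) = 0) ∧ ∑ i, w (p i) = 0) ∨
      ((¬ ∀ r, ∑ i with q (p i) = r, a (p i) = 0) ∧ η ≤ |∑ i, w (p i)|)) :
    ‖timeMean X (fun x => timeSum c w x ^ k) - ∫ θ, torusSum c a q θ ^ k ∂torusMeasure Q‖ ≤
      (∑ j, ‖c j‖) ^ k * (X⁻¹ * (1 / (π * η))) := by
  have hXc : (X : ℂ) ≠ 0 := mod_cast hX.ne'
  have hcu := continuous_unitExp
  have h1 : timeMean X (fun x => timeSum c w x ^ k) = ∑ p : Fin k → ι, (∏ i, c (p i)) *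
      timeMean X fun x => unitExp ((∑ i, w (p i)) * x) := by
    unfold timeMean
    simp only [timeSum_pow]
    rw [intervalIntegral.integral_finsetSum, mul_sum]
    · refine sum_congr rfl fun p _ => ?_
      rw [intervalIntegral.integral_const_mul]
      ring
    · intro p _
      exact Continuous.intervalIntegrable (by fun_prop) _ _
  rw [h1, integral_torusSum_pow, ← sum_sub_distrib, Fintype.sum_pow, sum_mul]
  refine (norm_sum_le _ _).trans (sum_le_sum fun p _ => ?_)
  rw [← mul_sub, norm_mul, norm_prod]
  refine mul_le_mul_of_nonneg_left ?_ (prod_nonneg fun i _ => norm_nonneg _)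
  rcases hres p with ⟨h2, h3⟩ | ⟨h2, h3⟩
  · rw [if_pos h2, h3]
    have : timeMean X (fun x => unitExp (0 * x)) = 1 := by
      simp only [timeMean, zero_mul, unitExp_zero, intervalIntegral.integral_const]
      have : 2 * X - X = X := by ring
      rw [this]
      simp [hXc]
    rw [this, sub_self, norm_zero]
    positivity
  · have hne : ∑ i, w (p i) ≠ 0 := abs_pos.1 (hη.trans_le h3)
    rw [if_neg h2, sub_zero, timeMean, norm_mul, norm_inv, norm_real, norm_eq_abs, abs_of_pos hX]
    refine mul_le_mul_of_nonneg_left ?_ (by positivity)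
    refine (norm_intervalIntegral_unitExp_le hne _ _).trans ?_
    gcongr

end

lemma integrable_of_continuous_of_bound {Ω E : Type*} [TopologicalSpace Ω] [MeasurableSpace Ω]
    [OpensMeasurableSpace Ω] [NormedAddCommGroup E] [SecondCountableTopologyEither Ω E]
    {μ : Measure Ω} [IsFiniteMeasure μ] {f : Ω → E} (hf : Continuous f) (C : ℝ)
    (hC : ∀ x, ‖f x‖ ≤ C) : Integrable f μ :=
  Integrable.of_bound hf.aestronglyMeasurable C (.of_forall hC)

section Blocks

variable {Q : Type*} [Fintype Q] {Y : Q → ℝ → ℝ} {b : ℝ}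

lemma integral_exp_block_le {Y : ℝ → ℝ} (hY : Continuous Y) (hb : ∀ t, |Y t| ≤ b)
    (h0 : ∫ t, Y t ∂unitMeasure = 0) {s : ℝ} (hs : |s| * b ≤ 1) :
    ∫ t, rexp (s * Y t) ∂unitMeasure ≤ rexp (s ^ 2 * ∫ t, Y t ^ 2 ∂unitMeasure) := by
  have hsY : ∀ t, |s * Y t| ≤ 1 := fun t => by
    rw [abs_mul]
    exact (mul_le_mul_of_nonneg_left (hb t) (abs_nonneg s)).trans hs
  have i1 : Integrable Y unitMeasure := integrable_of_continuous_of_bound hY b hb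
  have i2 : Integrable (fun t => Y t ^ 2) unitMeasure :=
    integrable_of_continuous_of_bound (by fun_prop) (b ^ 2) fun t => by
      rw [norm_pow, norm_eq_abs]
      exact pow_le_pow_left₀ (abs_nonneg _) (hb t) 2
  have i3 : Integrable (fun t => rexp (s * Y t)) unitMeasure :=
    integrable_of_continuous_of_bound (by fun_prop) (rexp 1) fun t => by
      rw [norm_eq_abs, abs_of_pos (exp_pos _)]
      exact exp_le_exp.2 ((le_abs_self _).trans (hsY t))
  have i4 : Integrable (fun t => 1 + s * Y t) unitMeasure :=
    (integrable_const _).add (i1.const_mul s)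
  calc ∫ t, rexp (s * Y t) ∂unitMeasure
      ≤ ∫ t, (1 + s * Y t) + s ^ 2 * Y t ^ 2 ∂unitMeasure := by
        refine integral_mono i3 (i4.add (i2.const_mul _)) fun t => ?_
        have := abs_exp_sub_one_sub_id_le (hsY t)
        have := (abs_le.1 this).2
        dsimp only
        nlinarith
    _ = s ^ 2 * ∫ t, Y t ^ 2 ∂unitMeasure + 1 := by
        rw [integral_add i4 (i2.const_mul _), integral_add (integrable_const _) (i1.const_mul s),
          integral_const_mul, integral_const_mul, h0]
        simp
        ring
    _ ≤ _ := add_one_le_exp _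

lemma integral_exp_blocks_le (hY : ∀ r, Continuous (Y r)) (hb : ∀ r t, |Y r t| ≤ b)
    (h0 : ∀ r, ∫ t, Y r t ∂unitMeasure = 0) {s : ℝ} (hs : |s| * b ≤ 1) :
    ∫ θ, rexp (s * ∑ r, Y r (θ r)) ∂torusMeasure Q ≤
      rexp (s ^ 2 * ∑ r, ∫ t, Y r t ^ 2 ∂unitMeasure) := by
  have e : ∀ θ : Q → ℝ, rexp (s * ∑ r, Y r (θ r)) = ∏ r, rexp (s * Y r (θ r)) := fun θ => by
    rw [← exp_sum, mul_sum]
  simp only [e]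
  rw [torusMeasure, integral_fintype_prod_eq_prod (f := fun r t => rexp (s * Y r t)),
    mul_sum, exp_sum]
  exact prod_le_prod (fun r _ => integral_nonneg fun t => (exp_pos _).le) fun r _ =>
    integral_exp_block_le (hY r) (hb r) (h0 r) hs

lemma norm_exp_I_sub_taylor_le {y : ℝ} (hy : |y| ≤ 1) :
    ‖cexp (y * I) - (1 + y * I - y ^ 2 / 2)‖ ≤ |y| ^ 3 := by
  have h := Complex.exp_bound (x := (y * I : ℂ)) (by simpa using hy) (n := 3) (by norm_num)
  rw [sum_range_succ, sum_range_succ, sum_range_succ, sum_range_zero] at h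
  have e : (0 + (y * I : ℂ) ^ 0 / (Nat.factorial 0 : ℂ) + (y * I : ℂ) ^ 1 / (Nat.factorial 1 : ℂ) +
      (y * I : ℂ) ^ 2 / (Nat.factorial 2 : ℂ)) = 1 + y * I - y ^ 2 / 2 := by
    simp [Nat.factorial, mul_pow]
    ring
  rw [e] at h
  refine h.trans ?_
  simp only [norm_mul, norm_real, norm_I, mul_one, norm_eq_abs]
  refine mul_le_of_le_one_right (by positivity) ?_
  norm_num [Nat.factorial]

lemma norm_integral_exp_I_block_sub_le {Y : ℝ → ℝ} (hY : Continuous Y) (hb : ∀ t, |Y t| ≤ b)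
    (h0 : ∫ t, Y t ∂unitMeasure = 0) {s : ℝ} (hs : |s| * b ≤ 1) :
    ‖(∫ t, cexp ((s * Y t : ℝ) * I) ∂unitMeasure) -
      cexp (-(s ^ 2 * (∫ t, Y t ^ 2 ∂unitMeasure) / 2 : ℝ))‖ ≤
      (|s| * b + (|s| * b) ^ 2) * (s ^ 2 * ∫ t, Y t ^ 2 ∂unitMeasure) := by
  have hb0 : 0 ≤ b := (abs_nonneg _).trans (hb 0)
  have hsY : ∀ t, |s * Y t| ≤ |s| * b := fun t => by
    rw [abs_mul]
    exact (mul_le_mul_of_nonneg_left (hb t) (abs_nonneg s))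
  have i1 : Integrable Y unitMeasure := integrable_of_continuous_of_bound hY b hb
  have i2 : Integrable (fun t => Y t ^ 2) unitMeasure :=
    integrable_of_continuous_of_bound (by fun_prop) (b ^ 2) fun t => by
      rw [norm_pow, norm_eq_abs]
      exact pow_le_pow_left₀ (abs_nonneg _) (hb t) 2
  set v := ∫ t, Y t ^ 2 ∂unitMeasure with hv
  have hv0 : 0 ≤ v := integral_nonneg fun t => sq_nonneg _
  have hvb : v ≤ b ^ 2 := by
    calc v ≤ ∫ _, b ^ 2 ∂unitMeasure := integral_mono i2 (integrable_const _) fun t => by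
          dsimp only
          rw [← sq_abs]
          exact pow_le_pow_left₀ (abs_nonneg _) (hb t) 2
      _ = b ^ 2 := by simp
  have i3 : Integrable (fun t => cexp ((s * Y t : ℝ) * I)) unitMeasure :=
    integrable_of_continuous_of_bound (by fun_prop) 1 fun t => by rw [norm_exp_ofReal_mul_I]
  have i4 : Integrable (fun t => ((s * Y t : ℝ) : ℂ) * I) unitMeasure :=
    ((i1.const_mul s).ofReal).mul_const _
  have i5 : Integrable (fun t => (((s ^ 2 / 2) * Y t ^ 2 : ℝ) : ℂ)) unitMeasure :=
    (i2.const_mul _).ofReal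
  have i6 : Integrable (fun t => (1 : ℂ) + ((s * Y t : ℝ) : ℂ) * I) unitMeasure :=
    (integrable_const _).add i4
  have i7 : Integrable (fun t => (1 : ℂ) + ((s * Y t : ℝ) : ℂ) * I -
      (((s ^ 2 / 2) * Y t ^ 2 : ℝ) : ℂ)) unitMeasure := i6.sub i5
  have e1 : ∫ t, ((1 : ℂ) + ((s * Y t : ℝ) : ℂ) * I -
      (((s ^ 2 / 2) * Y t ^ 2 : ℝ) : ℂ)) ∂unitMeasure = ((1 - s ^ 2 * v / 2 : ℝ) : ℂ) := by
    rw [integral_sub i6 i5, integral_add (integrable_const _) i4, integral_mul_const,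
      integral_complex_ofReal, integral_complex_ofReal, integral_const_mul, integral_const_mul,
      h0, ← hv]
    simp
    ring
  have h1 : ‖(∫ t, cexp ((s * Y t : ℝ) * I) ∂unitMeasure) -
      ((1 - s ^ 2 * v / 2 : ℝ) : ℂ)‖ ≤ (|s| * b) * (s ^ 2 * v) := by
    rw [← e1, ← integral_sub i3 i7]
    calc _ ≤ ∫ t, (|s| * b) * s ^ 2 * Y t ^ 2 ∂unitMeasure := by
          refine norm_integral_le_of_norm_le (i2.const_mul _) (.of_forall fun t => ?_)
          have h := norm_exp_I_sub_taylor_le ((hsY t).trans hs)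
          have e : (1 : ℂ) + ((s * Y t : ℝ) : ℂ) * I - (((s ^ 2 / 2) * Y t ^ 2 : ℝ) : ℂ) =
              1 + ((s * Y t : ℝ) : ℂ) * I - ((s * Y t : ℝ) : ℂ) ^ 2 / 2 := by
            push_cast
            ring
          rw [e]
          refine h.trans ?_
          calc |s * Y t| ^ 3 = |s * Y t| * |s * Y t| ^ 2 := by ring
            _ = |s * Y t| * (s ^ 2 * Y t ^ 2) := by rw [sq_abs, mul_pow]
            _ ≤ (|s| * b) * (s ^ 2 * Y t ^ 2) := by
                gcongr
                exact hsY t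
            _ = _ := by ring
      _ = _ := by
          rw [integral_const_mul, ← hv]
          ring
  have hsv : s ^ 2 * v ≤ (|s| * b) ^ 2 := by
    rw [mul_pow, sq_abs]
    gcongr
  have hz0 : 0 ≤ s ^ 2 * v := by positivity
  have h2 : ‖((1 - s ^ 2 * v / 2 : ℝ) : ℂ) - cexp (-(s ^ 2 * v / 2 : ℝ))‖ ≤
      (|s| * b) ^ 2 * (s ^ 2 * v) := by
    rw [← ofReal_neg, ← ofReal_exp, ← Complex.ofReal_sub, norm_real, norm_eq_abs, abs_sub_comm]
    have h3 : s ^ 2 * v ≤ 1 := hsv.trans (pow_le_one₀ (by positivity) hs)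
    have := abs_exp_sub_one_sub_id_le (x := -(s ^ 2 * v / 2))
      (by rw [abs_neg, abs_of_nonneg (by positivity)]; linarith)
    rw [show rexp (-(s ^ 2 * v / 2)) - (1 - s ^ 2 * v / 2) =
      rexp (-(s ^ 2 * v / 2)) - 1 - -(s ^ 2 * v / 2) by ring]
    refine this.trans ?_
    nlinarith
  calc _ ≤ _ := norm_sub_le_norm_sub_add_norm_sub _ ((1 - s ^ 2 * v / 2 : ℝ) : ℂ) _
    _ ≤ _ := add_le_add h1 h2
    _ = _ := by ring

lemma norm_prod_sub_prod_le {α : Type*} (s : Finset α) (f g : α → ℂ) (hf : ∀ i, ‖f i‖ ≤ 1)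
    (hg : ∀ i, ‖g i‖ ≤ 1) : ‖∏ i ∈ s, f i - ∏ i ∈ s, g i‖ ≤ ∑ i ∈ s, ‖f i - g i‖ := by
  classical
  induction s using Finset.induction_on with
  | empty => simp
  | insert a s ha ih =>
    rw [prod_insert ha, prod_insert ha, sum_insert ha]
    have h1 : ‖∏ i ∈ s, f i‖ ≤ 1 := by
      rw [norm_prod]
      exact prod_le_one (fun i _ => norm_nonneg _) fun i _ => hf i
    calc _ = ‖(f a - g a) * ∏ i ∈ s, f i + g a * (∏ i ∈ s, f i - ∏ i ∈ s, g i)‖ := by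
          congr 1
          ring
      _ ≤ ‖f a - g a‖ * ‖∏ i ∈ s, f i‖ + ‖g a‖ * ‖∏ i ∈ s, f i - ∏ i ∈ s, g i‖ := by
          rw [← norm_mul, ← norm_mul]
          exact norm_add_le _ _
      _ ≤ ‖f a - g a‖ * 1 + 1 * ∑ i ∈ s, ‖f i - g i‖ := by
          gcongr
          exact hg a
      _ = _ := by ring

lemma norm_integral_exp_I_blocks_sub_le (hY : ∀ r, Continuous (Y r)) (hb : ∀ r t, |Y r t| ≤ b)
    (h0 : ∀ r, ∫ t, Y r t ∂unitMeasure = 0) {s : ℝ} (hs : |s| * b ≤ 1) :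
    ‖(∫ θ, cexp ((s * ∑ r, Y r (θ r) : ℝ) * I) ∂torusMeasure Q) -
      cexp (-(s ^ 2 * (∑ r, ∫ t, Y r t ^ 2 ∂unitMeasure) / 2 : ℝ))‖ ≤
      (|s| * b + (|s| * b) ^ 2) * (s ^ 2 * ∑ r, ∫ t, Y r t ^ 2 ∂unitMeasure) := by
  have e : ∀ θ : Q → ℝ, cexp ((s * ∑ r, Y r (θ r) : ℝ) * I) =
      ∏ r, cexp ((s * Y r (θ r) : ℝ) * I) := fun θ => by
    rw [← Complex.exp_sum, mul_sum, ofReal_sum, sum_mul]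
  have e2 : cexp (-(s ^ 2 * (∑ r, ∫ t, Y r t ^ 2 ∂unitMeasure) / 2 : ℝ)) =
      ∏ r, cexp (-(s ^ 2 * (∫ t, Y r t ^ 2 ∂unitMeasure) / 2 : ℝ)) := by
    rw [← Complex.exp_sum, mul_sum, sum_div, ofReal_sum, sum_neg_distrib]
  simp only [e]
  rw [e2, torusMeasure, integral_fintype_prod_eq_prod (f := fun r t => cexp ((s * Y r t : ℝ) * I))]
  refine (norm_prod_sub_prod_le _ _ _ ?_ ?_).trans ?_
  · intro r
    have := norm_integral_le_of_norm_le_const (μ := unitMeasure)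
      (f := fun t => cexp ((s * Y r t : ℝ) * I)) (C := 1)
      (.of_forall fun t => by rw [norm_exp_ofReal_mul_I])
    simpa using this
  · intro r
    rw [← ofReal_neg, ← ofReal_exp, norm_real, norm_eq_abs, abs_of_pos (exp_pos _), exp_le_one_iff]
    have : 0 ≤ ∫ t, Y r t ^ 2 ∂unitMeasure := integral_nonneg fun t => sq_nonneg _
    have : 0 ≤ s ^ 2 * ∫ t, Y r t ^ 2 ∂unitMeasure := by positivity
    linarith
  · rw [mul_sum, mul_sum]
    exact sum_le_sum fun r _ => norm_integral_exp_I_block_sub_le (hY r) (hb r) (h0 r) hs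

end Blocks

lemma even_pow_div_factorial_le (y : ℝ) {K : ℕ} (hK : Even K) :
    y ^ K / K.factorial ≤ rexp y + rexp (-y) := by
  rw [← hK.pow_abs]
  refine (pow_div_factorial_le_exp _ (abs_nonneg y) K).trans ?_
  rcases abs_choice y with h | h <;> rw [h] <;> linarith [exp_pos y, exp_pos (-y)]

lemma norm_exp_mul_sub_sum_range_le {z : ℂ} (hz : z.re = 0) (hz1 : ‖z‖ = 1) (K : ℕ) :
    ∀ y : ℝ, 0 ≤ y → ‖cexp (y * z) - ∑ k ∈ range K, (y * z) ^ k / k.factorial‖ ≤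
        y ^ K / K.factorial := by
  induction K with
  | zero =>
    intro y _
    simp [Complex.norm_exp, hz]
  | succ K ih =>
    intro y hy
    have hd : ∀ x : ℝ, HasDerivAt (fun x : ℝ => cexp (x * z) -
        ∑ k ∈ range (K + 1), (x * z) ^ k / k.factorial)
        (z * (cexp (x * z) - ∑ k ∈ range K, (x * z) ^ k / k.factorial)) x := by
      intro x
      have hl : HasDerivAt (fun x : ℝ => (x * z : ℂ)) z x := by
        simpa using (Complex.ofRealCLM.hasDerivAt (x := x)).mul_const z
      have h1 := hl.cexp
      have h2 : HasDerivAt (fun x : ℝ => ∑ k ∈ range (K + 1), (x * z) ^ k / k.factorial)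
          (∑ k ∈ range (K + 1), (k : ℂ) * (x * z) ^ (k - 1) * z / k.factorial) x :=
        HasDerivAt.fun_sum fun k _ => (hl.fun_pow k).div_const _
      refine (h1.sub h2).congr_deriv ?_
      rw [sum_range_succ', mul_sub, mul_sum]
      simp only [Nat.cast_zero, zero_mul, zero_div, add_zero, Nat.add_sub_cancel]
      congr 1
      · ring
      · refine sum_congr rfl fun k _ => ?_
        have : ((k : ℂ) + 1) ≠ 0 := mod_cast k.succ_ne_zero
        have : (k.factorial : ℂ) ≠ 0 := mod_cast k.factorial_ne_zero
        rw [Nat.factorial_succ]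
        push_cast
        field_simp
    have hB : ∀ x : ℝ, HasDerivAt (fun x : ℝ => x ^ (K + 1) / (K + 1).factorial)
        (x ^ K / K.factorial) x := by
      intro x
      refine ((hasDerivAt_pow (K + 1) x).div_const _).congr_deriv ?_
      have h1 : (K + 1 : ℝ) ≠ 0 := by positivity
      have : (K.factorial : ℝ) ≠ 0 := mod_cast K.factorial_ne_zero
      rw [Nat.factorial_succ, Nat.add_sub_cancel]
      push_cast
      field_simp
    have := image_norm_le_of_norm_deriv_right_le_deriv_boundary (a := 0) (b := y)
      (f := fun x => cexp (x * z) - ∑ k ∈ range (K + 1), (x * z) ^ k / k.factorial)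
      (f' := fun x : ℝ => z * (cexp (x * z) - ∑ k ∈ range K, (x * z) ^ k / k.factorial))
      (B := fun x : ℝ => x ^ (K + 1) / (K + 1).factorial)
      (B' := fun x : ℝ => x ^ K / K.factorial)
      (fun x _ => (hd x).continuousAt.continuousWithinAt) (fun x _ => (hd x).hasDerivWithinAt)
      (by simp [sum_range_succ']) hB
      (fun x hx => by
        rw [norm_mul, hz1, one_mul]
        exact ih x hx.1)
    exact this (Set.right_mem_Icc.2 hy)

lemma norm_exp_I_sub_sum_range_le (y : ℝ) (K : ℕ) :
    ‖cexp (y * I) - ∑ k ∈ range K, (y * I) ^ k / k.factorial‖ ≤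
      |y| ^ K / K.factorial := by
  rcases le_total 0 y with h | h
  · rw [abs_of_nonneg h]
    exact norm_exp_mul_sub_sum_range_le (by simp) (by simp) K y h
  · have := norm_exp_mul_sub_sum_range_le (z := -I) (by simp) (by simp) K (-y) (by linarith)
    rw [abs_of_nonpos h]
    simpa using this

lemma norm_integral_exp_I_sub_sum_moments_le {Ω : Type*} [MeasurableSpace Ω] {ρ : Measure Ω}
    [IsProbabilityMeasure ρ] {f : Ω → ℝ} (hf : AEStronglyMeasurable f ρ) {B : ℝ}
    (hfB : ∀ x, |f x| ≤ B) {K : ℕ} (hK : Even K) (t : ℝ) :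
    ‖(∫ x, cexp ((t * f x : ℝ) * I) ∂ρ) -
      ∑ k ∈ range K, ((t * I) ^ k / k.factorial) * (∫ x, f x ^ k ∂ρ : ℝ)‖ ≤
      |t| ^ K / K.factorial * ∫ x, f x ^ K ∂ρ := by
  have ik : ∀ k : ℕ, Integrable (fun x => f x ^ k) ρ := fun k =>
    Integrable.of_bound (hf.pow k) (B ^ k) (.of_forall fun x => by
      rw [norm_pow, norm_eq_abs]
      exact pow_le_pow_left₀ (abs_nonneg _) (hfB x) k)
  have ie : Integrable (fun x => cexp ((t * f x : ℝ) * I)) ρ := by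
    refine Integrable.of_bound ?_ 1 (.of_forall fun x => by rw [norm_exp_ofReal_mul_I])
    have hc : Continuous fun y => cexp ((t * y : ℝ) * I) := by fun_prop
    exact hc.comp_aestronglyMeasurable hf
  have is : ∀ k ∈ range K, Integrable (fun x => ((t * I) ^ k / k.factorial) *
      ((f x ^ k : ℝ) : ℂ)) ρ := fun k _ => (ik k).ofReal.const_mul _
  have e : ∑ k ∈ range K, ((t * I) ^ k / k.factorial) * (∫ x, f x ^ k ∂ρ : ℝ) =
      ∫ x, ∑ k ∈ range K, ((t * I) ^ k / k.factorial) * ((f x ^ k : ℝ) : ℂ) ∂ρ := by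
    rw [integral_finsetSum _ is]
    refine sum_congr rfl fun k _ => ?_
    rw [integral_const_mul, integral_complex_ofReal]
  rw [e, ← integral_sub ie (integrable_finsetSum _ is), ← integral_const_mul]
  refine norm_integral_le_of_norm_le ((ik K).const_mul _) (.of_forall fun x => ?_)
  have h := norm_exp_I_sub_sum_range_le (t * f x) K
  rw [abs_mul, mul_pow, hK.pow_abs (f x)] at h
  have e2 : ∑ k ∈ range K, (((t * f x : ℝ) : ℂ) * I) ^ k / k.factorial =
      ∑ k ∈ range K, ((t * I) ^ k / k.factorial) * ((f x ^ k : ℝ) : ℂ) := by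
    refine sum_congr rfl fun k _ => ?_
    push_cast
    ring
  rw [e2] at h
  calc _ ≤ _ := h
    _ = _ := by ring

/-- Comparison of characteristic functions of two bounded random variables through their moments. -/
lemma norm_integral_exp_I_sub_le_of_moments {Ω₁ Ω₂ : Type*} [MeasurableSpace Ω₁]
    [MeasurableSpace Ω₂] {μ : Measure Ω₁} {ν : Measure Ω₂} [IsProbabilityMeasure μ]
    [IsProbabilityMeasure ν] {S : Ω₁ → ℝ} {T : Ω₂ → ℝ} (hS : AEStronglyMeasurable S μ)
    (hT : AEStronglyMeasurable T ν) {B : ℝ} (hSB : ∀ x, |S x| ≤ B) (hTB : ∀ x, |T x| ≤ B)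
    {K : ℕ} (hK : Even K) {d t : ℝ}
    (hd : ∀ k ≤ K, |(∫ x, S x ^ k ∂μ) - ∫ x, T x ^ k ∂ν| ≤ d) :
    ‖(∫ x, cexp ((t * S x : ℝ) * I) ∂μ) - ∫ x, cexp ((t * T x : ℝ) * I) ∂ν‖ ≤
      d * rexp |t| + 2 * (|t| ^ K / K.factorial * ∫ x, T x ^ K ∂ν) := by
  have h1 := norm_integral_exp_I_sub_sum_moments_le hS hSB hK t
  have h2 := norm_integral_exp_I_sub_sum_moments_le hT hTB hK t
  have h3 : ‖(∑ k ∈ range K, ((t * I) ^ k / k.factorial) *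
      ((∫ x, S x ^ k ∂μ : ℝ) : ℂ)) - ∑ k ∈ range K, ((t * I) ^ k / k.factorial) *
      ((∫ x, T x ^ k ∂ν : ℝ) : ℂ)‖ ≤ d * ∑ k ∈ range K, |t| ^ k / k.factorial := by
    rw [← sum_sub_distrib, mul_sum]
    refine (norm_sum_le _ _).trans (sum_le_sum fun k hk => ?_)
    rw [← mul_sub, norm_mul, ← Complex.ofReal_sub, norm_real, norm_eq_abs, norm_div,
      norm_pow, norm_mul, norm_I, mul_one, norm_real, norm_eq_abs,
      Complex.norm_natCast, mul_comm]
    gcongr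
    exact hd k (mem_range.1 hk).le
  have hd0 : 0 ≤ d := (abs_nonneg _).trans (hd 0 K.zero_le)
  have h4 : |t| ^ K / K.factorial * ∫ x, S x ^ K ∂μ ≤
      |t| ^ K / K.factorial * (∫ x, T x ^ K ∂ν) + d * (|t| ^ K / K.factorial) := by
    have := (abs_le.1 (hd K le_rfl)).2
    have h5 : 0 ≤ |t| ^ K / K.factorial := by positivity
    nlinarith
  have h5 : ∑ k ∈ range K, |t| ^ k / k.factorial + |t| ^ K / K.factorial ≤ rexp |t| := by
    rw [← sum_range_succ (fun k => |t| ^ k / (k.factorial : ℝ))]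
    exact sum_le_exp_of_nonneg (abs_nonneg t) (K + 1)
  have h6 := mul_le_mul_of_nonneg_left h5 hd0
  rw [norm_sub_rev] at h2
  have := norm_sub_le_norm_sub_add_norm_sub (∫ x, cexp ((t * S x : ℝ) * I) ∂μ)
    (∑ k ∈ range K, ((t * I) ^ k / k.factorial) * ((∫ x, S x ^ k ∂μ : ℝ) : ℂ))
    (∫ x, cexp ((t * T x : ℝ) * I) ∂ν)
  have := norm_sub_le_norm_sub_add_norm_sub
    (∑ k ∈ range K, ((t * I) ^ k / k.factorial) * ((∫ x, S x ^ k ∂μ : ℝ) : ℂ))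
    (∑ k ∈ range K, ((t * I) ^ k / k.factorial) * ((∫ x, T x ^ k ∂ν : ℝ) : ℂ))
    (∫ x, cexp ((t * T x : ℝ) * I) ∂ν)
  linarith

/-- The uniform measure on `[X, 2X]`. -/
def timeMeasure (X : ℝ) : Measure ℝ :=
  ENNReal.ofReal X⁻¹ • volume.restrict (Set.Ioc X (2 * X))

lemma isProbabilityMeasure_timeMeasure {X : ℝ} (hX : 0 < X) :
    IsProbabilityMeasure (timeMeasure X) := ⟨by
  have h : 2 * X - X = X := by ring
  simp only [timeMeasure, Measure.smul_apply, Measure.restrict_apply_univ, volume_Ioc, h,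
    smul_eq_mul]
  rw [← ENNReal.ofReal_mul (by positivity), inv_mul_cancel₀ hX.ne', ENNReal.ofReal_one]⟩

lemma integral_timeMeasure {X : ℝ} (hX : 0 < X) (f : ℝ → ℂ) :
    ∫ x, f x ∂timeMeasure X = timeMean X f := by
  rw [timeMeasure, integral_smul_measure, timeMean,
    integral_of_le (by linarith), ENNReal.toReal_ofReal (by positivity)]
  simp

/-- The squarefree part of `n`. -/
def squarefreePart (n : ℕ) : ℕ := (Nat.sq_mul_squarefree n).choose

/-- The positive integer whose square is the cofactor of the squarefree part of `n`. -/
def squarePart (n : ℕ) : ℕ := (Nat.sq_mul_squarefree n).choose_spec.choose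

lemma squarePart_sq_mul (n : ℕ) : squarePart n ^ 2 * squarefreePart n = n :=
  (Nat.sq_mul_squarefree n).choose_spec.choose_spec.1

lemma squarefree_squarefreePart (n : ℕ) : Squarefree (squarefreePart n) :=
  (Nat.sq_mul_squarefree n).choose_spec.choose_spec.2

lemma squarePart_pos {n : ℕ} (hn : 1 ≤ n) : 0 < squarePart n := by
  rcases Nat.eq_zero_or_pos (squarePart n) with h | h
  · have := squarePart_sq_mul n
    rw [h] at this
    simp at this
    omega
  · exact h

lemma sqrt_eq_squarePart_mul (n : ℕ) : √n = squarePart n * √(squarefreePart n : ℝ) := by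
  conv_lhs => rw [← squarePart_sq_mul n]
  push_cast
  rw [sqrt_mul (by positivity), sqrt_sq (by positivity)]

/-- The real trigonometric polynomial with frequencies `2√n` and coefficients `c n`. -/
def rootSum (N : Finset ℕ) (c : ℕ → ℂ) (x : ℝ) : ℝ :=
  ∑ n ∈ N, 2 * (c n * unitExp (-(x * (2 * √n)))).re

/-- The real trigonometric polynomial with frequencies `squarePart n`. -/
def blockSum (N : Finset ℕ) (c : ℕ → ℂ) (t : ℝ) : ℝ :=
  ∑ n ∈ N, 2 * (c n * unitExp ((-(squarePart n : ℤ) : ℤ) * t)).re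

lemma continuous_rootSum (N : Finset ℕ) (c : ℕ → ℂ) : Continuous (rootSum N c) := by
  have := continuous_unitExp
  unfold rootSum
  fun_prop

lemma continuous_blockSum (N : Finset ℕ) (c : ℕ → ℂ) : Continuous (blockSum N c) := by
  have := continuous_unitExp
  unfold blockSum
  fun_prop

lemma abs_two_mul_re_le (z : ℂ) (s : ℝ) : |2 * (z * unitExp s).re| ≤ 2 * ‖z‖ := by
  rw [abs_mul, abs_two]
  refine mul_le_mul_of_nonneg_left ?_ zero_le_two
  refine (abs_re_le_norm _).trans ?_
  rw [norm_mul, norm_unitExp, mul_one]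

lemma abs_rootSum_le (N : Finset ℕ) (c : ℕ → ℂ) (x : ℝ) :
    |rootSum N c x| ≤ ∑ n ∈ N, 2 * ‖c n‖ :=
  (abs_sum_le_sum_abs _ _).trans (sum_le_sum fun _ _ => abs_two_mul_re_le _ _)

lemma abs_blockSum_le (N : Finset ℕ) (c : ℕ → ℂ) (x : ℝ) :
    |blockSum N c x| ≤ ∑ n ∈ N, 2 * ‖c n‖ :=
  (abs_sum_le_sum_abs _ _).trans (sum_le_sum fun _ _ => abs_two_mul_re_le _ _)

lemma integral_two_mul_re_unitExp (z : ℂ) (m : ℤ) :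
    ∫ t, 2 * (z * unitExp (m * t)).re ∂unitMeasure = if m = 0 then 2 * z.re else 0 := by
  have hi : Integrable (fun t => z * unitExp (m * t)) unitMeasure := by
    have := continuous_unitExp
    refine integrable_of_continuous_of_bound (by fun_prop) ‖z‖ fun t => ?_
    rw [norm_mul, norm_unitExp, mul_one]
  have h : ∫ t, (z * unitExp (m * t)).re ∂unitMeasure =
      (∫ t, z * unitExp (m * t) ∂unitMeasure).re := integral_re hi
  rw [integral_const_mul, h, integral_const_mul, integral_unitExp_unitMeasure]
  split_ifs <;> simp

lemma integrable_two_mul_re_unitExp (z : ℂ) (m : ℤ) :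
    Integrable (fun t => 2 * (z * unitExp (m * t)).re) unitMeasure := by
  have := continuous_unitExp
  exact integrable_of_continuous_of_bound (by fun_prop) (2 * ‖z‖) fun t => abs_two_mul_re_le _ _

lemma integral_blockSum {N : Finset ℕ} (hN : ∀ n ∈ N, 1 ≤ n) (c : ℕ → ℂ) :
    ∫ t, blockSum N c t ∂unitMeasure = 0 := by
  unfold blockSum
  rw [integral_finsetSum _ fun n _ => integrable_two_mul_re_unitExp _ _]
  refine sum_eq_zero fun n hn => ?_
  rw [integral_two_mul_re_unitExp, if_neg]
  have := squarePart_pos (hN n hn)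
  omega

lemma integral_blockSum_sq {N : Finset ℕ} (hN : ∀ n ∈ N, 1 ≤ n) (c : ℕ → ℂ) {r : ℕ}
    (hr : ∀ n ∈ N, squarefreePart n = r) :
    ∫ t, blockSum N c t ^ 2 ∂unitMeasure = ∑ n ∈ N, 2 * ‖c n‖ ^ 2 := by
  have e : ∀ t : ℝ, blockSum N c t ^ 2 = ∑ n ∈ N, ∑ m ∈ N,
      (2 * (c n * c m * unitExp ((-(squarePart n : ℤ) - squarePart m : ℤ) * t)).re +
      2 * (c n * conj (c m) * unitExp ((-(squarePart n : ℤ) + squarePart m : ℤ) * t)).re) := by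
    intro t
    rw [blockSum, sq, sum_mul_sum]
    refine sum_congr rfl fun n _ => sum_congr rfl fun m _ => ?_
    set u := unitExp ((-(squarePart n : ℤ) : ℤ) * t) with hu
    set v := unitExp ((-(squarePart m : ℤ) : ℤ) * t) with hv
    have e1 : unitExp ((-(squarePart n : ℤ) - squarePart m : ℤ) * t) = u * v := by
      rw [hu, hv, ← unitExp_add]
      congr 1
      push_cast
      ring
    have e2 : unitExp ((-(squarePart n : ℤ) + squarePart m : ℤ) * t) = u * conj v := by
      rw [hu, hv, ← unitExp_neg, ← unitExp_add]
      congr 1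
      push_cast
      ring
    rw [e1, e2]
    simp only [Complex.mul_re, Complex.mul_im, Complex.conj_re, Complex.conj_im]
    ring
  simp only [e]
  have hi : ∀ n m : ℕ, Integrable (fun t =>
      2 * (c n * c m * unitExp ((-(squarePart n : ℤ) - squarePart m : ℤ) * t)).re +
      2 * (c n * conj (c m) *
        unitExp ((-(squarePart n : ℤ) + squarePart m : ℤ) * t)).re) unitMeasure := fun n m =>
    (integrable_two_mul_re_unitExp _ _).add (integrable_two_mul_re_unitExp _ _)
  rw [integral_finsetSum _ fun n _ => integrable_finsetSum _ fun m _ => hi n m]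
  refine sum_congr rfl fun n hn => ?_
  rw [integral_finsetSum _ fun m _ => hi n m, sum_eq_single_of_mem n hn]
  · rw [integral_add (integrable_two_mul_re_unitExp _ _) (integrable_two_mul_re_unitExp _ _),
      integral_two_mul_re_unitExp, integral_two_mul_re_unitExp, if_neg, if_pos (by ring),
      Complex.mul_conj, ofReal_re, Complex.normSq_eq_norm_sq, zero_add]
    have := squarePart_pos (hN n hn)
    omega
  · intro m hm hmn
    rw [integral_add (integrable_two_mul_re_unitExp _ _) (integrable_two_mul_re_unitExp _ _),
      integral_two_mul_re_unitExp, integral_two_mul_re_unitExp, if_neg, if_neg, zero_add]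
    · intro h
      apply hmn
      rw [← squarePart_sq_mul n, ← squarePart_sq_mul m, hr n hn, hr m hm]
      congr 2
      omega
    · have := squarePart_pos (hN n hn)
      omega

section Model

variable (N : Finset ℕ) (c : ℕ → ℂ)

/-- The sign attached to a boolean: `-1` for `true` and `1` for `false`. -/
def boolSign : Bool → ℤ
  | true => -1
  | false => 1

/-- Coefficients of `rootSum` as a complex trigonometric polynomial. -/
def modelCoeff (j : N × Bool) : ℂ := if j.2 then c j.1 else conj (c j.1)

/-- The squarefree part of an index, as an element of the set of squarefree parts of `N`. -/
def modelRoot (j : N × Bool) : N.image squarefreePart :=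
  ⟨squarefreePart j.1, mem_image_of_mem _ j.1.2⟩

lemma timeSum_modelCoeff (x : ℝ) :
    timeSum (modelCoeff N c) (fun j => boolSign j.2 * (2 * √((j.1 : ℕ) : ℝ))) x =
      (rootSum N c x : ℂ) := by
  rw [timeSum, Fintype.sum_prod_type, rootSum, ofReal_sum, ← sum_coe_sort N]
  refine sum_congr rfl fun n _ => ?_
  rw [Fintype.sum_bool]
  have e1 : unitExp (((boolSign true : ℤ) : ℝ) * (2 * √((n : ℕ) : ℝ)) * x) =
      unitExp (-(x * (2 * √((n : ℕ) : ℝ)))) := by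
    congr 1
    simp [boolSign]
    ring
  have e2 : unitExp (((boolSign false : ℤ) : ℝ) * (2 * √((n : ℕ) : ℝ)) * x) =
      conj (unitExp (-(x * (2 * √((n : ℕ) : ℝ))))) := by
    rw [← unitExp_neg]
    congr 1
    simp [boolSign]
    ring
  simp only [modelCoeff, e1, e2, if_true, Bool.false_eq_true, if_false]
  rw [← map_mul, Complex.add_conj]

lemma torusSum_modelCoeff (θ : N.image squarefreePart → ℝ) :
    torusSum (modelCoeff N c) (fun j => boolSign j.2 * squarePart j.1) (modelRoot N) θ =
      ((∑ r : N.image squarefreePart,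
        blockSum {n ∈ N | squarefreePart n = (r : ℕ)} c (θ r) : ℝ) : ℂ) := by
  have h1 : torusSum (modelCoeff N c) (fun j => boolSign j.2 * squarePart j.1) (modelRoot N) θ =
      ∑ n : N, ((2 * (c n * unitExp ((-(squarePart n : ℤ) : ℤ) * θ (modelRoot N (n, true)))).re : ℝ)
        : ℂ) := by
    rw [torusSum, Fintype.sum_prod_type]
    refine sum_congr rfl fun n _ => ?_
    rw [Fintype.sum_bool]
    have e0 : modelRoot N (n, false) = modelRoot N (n, true) := rfl
    rw [e0]
    set s := θ (modelRoot N (n, true))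
    have e1 : unitExp (((boolSign true * squarePart n : ℤ) : ℝ) * s) =
        unitExp ((-(squarePart n : ℤ) : ℤ) * s) := by
      congr 1
      simp [boolSign]
    have e2 : unitExp (((boolSign false * squarePart n : ℤ) : ℝ) * s) =
        conj (unitExp ((-(squarePart n : ℤ) : ℤ) * s)) := by
      rw [← unitExp_neg]
      congr 1
      simp [boolSign]
    simp only [modelCoeff, e1, e2, if_true, Bool.false_eq_true, if_false]
    rw [← map_mul, Complex.add_conj]
  rw [h1, ← ofReal_sum]
  congr 1
  rw [← sum_fiberwise univ (fun n : N => modelRoot N (n, true))]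
  refine sum_congr rfl fun r _ => ?_
  rw [blockSum, sum_filter, sum_filter, ← sum_coe_sort N]
  refine sum_congr rfl fun n _ => ?_
  have : modelRoot N (n, true) = r ↔ squarefreePart n = (r : ℕ) := by
    rw [modelRoot, Subtype.ext_iff]
  by_cases h : modelRoot N (n, true) = r
  · rw [if_pos h, if_pos (this.1 h), h]
  · rw [if_neg h, if_neg fun h' => h (this.2 h')]

lemma sum_norm_modelCoeff : ∑ j, ‖modelCoeff N c j‖ = ∑ n ∈ N, 2 * ‖c n‖ := by
  rw [Fintype.sum_prod_type, ← sum_coe_sort N]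
  refine sum_congr rfl fun n _ => ?_
  rw [Fintype.sum_bool]
  simp [modelCoeff, two_mul]

lemma exists_modelRoot_nonresonant (k : ℕ) : ∃ A : ℕ, ∀ (M : ℝ) (N : Finset ℕ), 2 ≤ M →
    (∀ n ∈ N, 4 * (n : ℝ) ≤ M) → ∀ p : Fin k → N × Bool,
      ((∀ r, ∑ i with modelRoot N (p i) = r, boolSign (p i).2 * (squarePart (p i).1 : ℤ) = 0) ∧
        ∑ i, (boolSign (p i).2 : ℝ) * (2 * √(((p i).1 : ℕ) : ℝ)) = 0) ∨
      ((¬ ∀ r, ∑ i with modelRoot N (p i) = r, boolSign (p i).2 * (squarePart (p i).1 : ℤ) = 0) ∧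
        (M ^ A)⁻¹ ≤ |∑ i, (boolSign (p i).2 : ℝ) * (2 * √(((p i).1 : ℕ) : ℝ))|) := by
  obtain ⟨A, hA⟩ := exists_one_le_abs_sum_sqrt k
  refine ⟨A, fun M N hM hN p => ?_⟩
  set s : N.image squarefreePart → ℤ := fun r =>
    ∑ i with modelRoot N (p i) = r, boolSign (p i).2 * (squarePart (p i).1 : ℤ) with hs
  have hsum : ∑ i, (boolSign (p i).2 : ℝ) * (2 * √(((p i).1 : ℕ) : ℝ)) =
      2 * ∑ r, (s r : ℝ) * √((r : ℕ) : ℝ) := by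
    rw [← sum_fiberwise univ (fun i => modelRoot N (p i)), mul_sum]
    refine sum_congr rfl fun r _ => ?_
    rw [hs]
    push_cast
    rw [sum_mul, mul_sum]
    refine sum_congr rfl fun i hi => ?_
    have : (r : ℕ) = squarefreePart (p i).1 := by rw [← (mem_filter.1 hi).2, modelRoot]
    rw [this, sqrt_eq_squarePart_mul]
    ring
  by_cases h : ∀ r, s r = 0
  · refine Or.inl ⟨h, ?_⟩
    rw [hsum]
    simp [h]
  · refine Or.inr ⟨h, ?_⟩
    have hne : ∑ i, (boolSign (p i).2 : ℝ) * (2 * √(((p i).1 : ℕ) : ℝ)) ≠ 0 := by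
      intro h0
      rw [hsum] at h0
      have h1 : ∑ r, (s r : ℝ) * √((r : ℕ) : ℝ) = 0 := by linarith
      apply h
      have h2 := sqrt_linearIndependent (N.image squarefreePart) (fun d hd => by
          obtain ⟨n, -, rfl⟩ := mem_image.1 hd
          exact squarefree_squarefreePart n)
        (fun d => if hd : d ∈ N.image squarefreePart then s ⟨d, hd⟩ else 0)
        (by
          rw [← h1, ← sum_coe_sort (N.image squarefreePart)]
          refine sum_congr rfl fun r _ => ?_
          rw [dif_pos r.2])
      intro r
      have := h2 r r.2
      rwa [dif_pos r.2] at this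
    have e : ∑ i, (boolSign (p i).2 : ℝ) * (2 * √(((p i).1 : ℕ) : ℝ)) =
        ∑ i, (boolSign (p i).2 : ℝ) * √((4 * ((p i).1 : ℕ) : ℕ) : ℝ) := by
      refine sum_congr rfl fun i _ => ?_
      push_cast
      rw [sqrt_mul (by norm_num), show (4 : ℝ) = 2 ^ 2 by norm_num, sqrt_sq (by norm_num)]
    have h3 := hA M hM (fun i => 4 * ((p i).1 : ℕ)) (fun i => boolSign (p i).2) (fun i => by
        push_cast
        exact hN _ (p i).1.2)
      (fun i => by cases (p i).2 <;> simp [boolSign]) (by rw [← e]; exact hne)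
    rw [← e] at h3
    rw [inv_le_iff_one_le_mul₀ (by positivity)]
    exact h3

end Model

lemma exists_norm_charFun_rootSum_sub_le {K : ℕ} (hK : Even K) :
    ∃ A : ℕ, ∀ (X M : ℝ) (N : Finset ℕ) (c : ℕ → ℂ) (b t : ℝ), 0 < X → 2 ≤ M →
      (∀ n ∈ N, 1 ≤ n ∧ 4 * (n : ℝ) ≤ M) →
      (∀ r : ℕ, ∑ n ∈ N with squarefreePart n = r, 2 * ‖c n‖ ≤ b) → 2 * |t| * b ≤ 1 →
      ‖(∫ x, cexp ((t * rootSum N c x : ℝ) * I) ∂timeMeasure X) -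
        cexp (-(t ^ 2 * (∑ n ∈ N, 2 * ‖c n‖ ^ 2) / 2 : ℝ))‖ ≤
        (1 + ∑ n ∈ N, 2 * ‖c n‖) ^ K * M ^ A / X * rexp |t| +
          4 * (2⁻¹ ^ K * rexp (4 * t ^ 2 * ∑ n ∈ N, 2 * ‖c n‖ ^ 2)) +
          (|t| * b + (|t| * b) ^ 2) * (t ^ 2 * ∑ n ∈ N, 2 * ‖c n‖ ^ 2) := by
  choose A hA using exists_modelRoot_nonresonant
  refine ⟨∑ k ∈ range (K + 1), A k, fun X M N c b t hX hM hN hb ht => ?_⟩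
  have := isProbabilityMeasure_timeMeasure hX
  set B := ∑ n ∈ N, 2 * ‖c n‖ with hB
  have hB0 : 0 ≤ B := sum_nonneg fun n _ => by positivity
  set A' := ∑ k ∈ range (K + 1), A k with hA'
  set V := ∑ n ∈ N, 2 * ‖c n‖ ^ 2 with hV
  set Y : N.image squarefreePart → ℝ → ℝ := fun r =>
    blockSum {n ∈ N | squarefreePart n = (r : ℕ)} c with hY
  have hYc : ∀ r, Continuous (Y r) := fun r => continuous_blockSum _ _
  have hYb : ∀ r s, |Y r s| ≤ b := fun r s => (abs_blockSum_le _ _ _).trans (hb r)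
  have hY0 : ∀ r, ∫ s, Y r s ∂unitMeasure = 0 := fun r =>
    integral_blockSum (fun n hn => (hN n (mem_filter.1 hn).1).1) c
  have hYV : ∑ r, ∫ s, Y r s ^ 2 ∂unitMeasure = V := by
    have : ∀ r, ∫ s, Y r s ^ 2 ∂unitMeasure =
        ∑ n ∈ N with squarefreePart n = (r : ℕ), 2 * ‖c n‖ ^ 2 := fun r =>
      integral_blockSum_sq (fun n hn => (hN n (mem_filter.1 hn).1).1) c (r := r)
        fun n hn => (mem_filter.1 hn).2
    simp only [this]
    rw [sum_coe_sort (N.image squarefreePart)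
      (fun r => ∑ n ∈ N with squarefreePart n = r, 2 * ‖c n‖ ^ 2), hV]
    exact sum_fiberwise_of_maps_to (fun n hn => mem_image_of_mem _ hn) _
  set T : (N.image squarefreePart → ℝ) → ℝ := fun θ => ∑ r, Y r (θ r) with hT
  have hTc : Continuous T := by
    rw [hT]
    fun_prop
  have hTtorus : ∀ θ, (T θ : ℂ) = torusSum (modelCoeff N c)
      (fun j => boolSign j.2 * squarePart j.1) (modelRoot N) θ := fun θ =>
    (torusSum_modelCoeff N c θ).symm
  have hTB : ∀ θ, |T θ| ≤ B := fun θ => by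
    rw [← norm_eq_abs, ← norm_real, hTtorus, hB, ← sum_norm_modelCoeff]
    exact norm_torusSum_le _ _ _ _
  have hd : ∀ k ≤ K, |(∫ x, rootSum N c x ^ k ∂timeMeasure X) - ∫ θ, T θ ^ k ∂torusMeasure _| ≤
      (1 + B) ^ K * M ^ A' / X := by
    intro k hk
    have hMA : M ^ A k ≤ M ^ A' := by
      refine pow_le_pow_right₀ (by linarith) ?_
      exact single_le_sum (f := A) (fun _ _ => Nat.zero_le _) (mem_range.2 (Nat.lt_succ_of_le hk))
    have hM0 : 0 < M ^ A k := by positivity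
    have h := norm_timeMean_sub_torus_le (modelCoeff N c) (fun j => boolSign j.2 * squarePart j.1)
      (modelRoot N) (fun j => boolSign j.2 * (2 * √((j.1 : ℕ) : ℝ))) k hX (inv_pos.2 hM0)
      (fun p => hA k M N hM (fun n hn => (hN n hn).2) p)
    rw [sum_norm_modelCoeff, ← integral_timeMeasure hX] at h
    simp only [timeSum_modelCoeff, ← hTtorus, ← ofReal_pow] at h
    rw [integral_complex_ofReal, integral_complex_ofReal, ← Complex.ofReal_sub, norm_real,
      norm_eq_abs] at h
    refine h.trans ?_
    have e1 : B ^ k ≤ (1 + B) ^ K :=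
      (pow_le_pow_left₀ hB0 (by linarith) k).trans (pow_le_pow_right₀ (by linarith) hk)
    have e2 : 1 / (π * (M ^ A k)⁻¹) ≤ M ^ A' := by
      rw [one_div, mul_inv, inv_inv]
      refine (mul_le_of_le_one_left hM0.le ?_).trans hMA
      exact inv_le_one_of_one_le₀ (by linarith [pi_gt_three])
    calc _ ≤ (1 + B) ^ K * (X⁻¹ * M ^ A') := by gcongr
      _ = _ := by ring
  have h1 := norm_integral_exp_I_sub_le_of_moments (μ := timeMeasure X)
    (ν := torusMeasure (N.image squarefreePart)) (S := rootSum N c) (T := T)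
    (continuous_rootSum N c).aestronglyMeasurable hTc.aestronglyMeasurable
    (abs_rootSum_le N c) hTB hK (t := t) hd
  have hb0 : 0 ≤ b := (sum_nonneg fun n _ => by positivity).trans (hb 0)
  have htb : |t| * b ≤ 1 := by
    have : 0 ≤ |t| * b := by positivity
    linarith
  have h2 := norm_integral_exp_I_blocks_sub_le hYc hYb hY0 htb
  rw [hYV] at h2
  have h3 : |t| ^ K / K.factorial * ∫ θ, T θ ^ K ∂torusMeasure (N.image squarefreePart) ≤
      2 * (2⁻¹ ^ K * rexp (4 * t ^ 2 * V)) := by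
    have i0 : ∀ s : ℝ, Integrable (fun θ => rexp (s * T θ))
        (torusMeasure (N.image squarefreePart)) := fun s =>
      integrable_of_continuous_of_bound (by fun_prop) (rexp (|s| * B)) fun θ => by
        rw [norm_eq_abs, abs_of_pos (exp_pos _)]
        refine exp_le_exp.2 ((le_abs_self _).trans ?_)
        rw [abs_mul]
        exact mul_le_mul_of_nonneg_left (hTB θ) (abs_nonneg s)
    have h4 : ∀ s : ℝ, |s| = 2 * |t| → ∫ θ, rexp (s * T θ) ∂torusMeasure _ ≤
        rexp (4 * t ^ 2 * V) := by
      intro s hs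
      have := integral_exp_blocks_le hYc hYb hY0 (s := s) (by rw [hs]; exact ht)
      rw [hYV] at this
      refine this.trans (le_of_eq ?_)
      rw [← sq_abs s, hs, mul_pow, sq_abs]
      norm_num
    have h5 : ∫ θ, (2 * |t|) ^ K / K.factorial * T θ ^ K ∂torusMeasure (N.image squarefreePart) ≤
        ∫ θ, rexp (2 * |t| * T θ) + rexp (-(2 * |t|) * T θ) ∂torusMeasure _ := by
      refine integral_mono ?_ ((i0 _).add (i0 _)) fun θ => ?_
      · refine Integrable.const_mul ?_ _
        exact integrable_of_continuous_of_bound (by fun_prop) (B ^ K) fun θ => by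
          rw [norm_pow, norm_eq_abs]
          exact pow_le_pow_left₀ (abs_nonneg _) (hTB θ) K
      · have := even_pow_div_factorial_le (2 * |t| * T θ) hK
        rw [mul_pow] at this
        dsimp only
        rw [neg_mul]
        calc _ = _ := by ring
          _ ≤ _ := this
    rw [integral_const_mul, integral_add (i0 _) (i0 _)] at h5
    have h6 := h4 (2 * |t|) (by rw [abs_mul, abs_two, abs_abs])
    have h7 := h4 (-(2 * |t|)) (by rw [abs_neg, abs_mul, abs_two, abs_abs])
    have h8 : |t| ^ K / K.factorial * ∫ θ, T θ ^ K ∂torusMeasure (N.image squarefreePart) =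
        2⁻¹ ^ K * ((2 * |t|) ^ K / K.factorial *
          ∫ θ, T θ ^ K ∂torusMeasure (N.image squarefreePart)) := by
      rw [mul_pow, inv_pow]
      field_simp
    rw [h8]
    calc _ ≤ 2⁻¹ ^ K * (rexp (4 * t ^ 2 * V) + rexp (4 * t ^ 2 * V)) := by
          gcongr
          linarith
      _ = _ := by ring
  have := norm_sub_le_norm_sub_add_norm_sub (∫ x, cexp ((t * rootSum N c x : ℝ) * I) ∂timeMeasure X)
    (∫ θ, cexp ((t * T θ : ℝ) * I) ∂torusMeasure _)
    (cexp (-(t ^ 2 * V / 2 : ℝ)))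
  linarith

/-- The standard deviation appearing in the limit law. -/
def deviation (δ : ℝ) : ℝ := √((16 / π ^ 2) * δ * (log (1 / δ)) ^ 3)

/-- The indices of the terms that make up the limit law. -/
def mainIndices (δ : ℝ) : Finset ℕ :=
  {n ∈ Ioc 0 ⌊(δ⁻¹) ^ 3⌋₊ | (squarePart n : ℝ) ≤ δ ^ (-1 / 4 : ℝ)}

lemma exists_norm_voronoiCoeff_sq_le : ∃ C, 0 ≤ C ∧ ∀ (δ : ℝ) (n : ℕ), 0 < δ → 1 ≤ n →
    ‖voronoiCoeff δ n‖ ^ 2 ≤ C * (n : ℝ) ^ (-47 / 32 : ℝ) * min 1 (δ ^ 2 * n) := by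
  obtain ⟨C, hC, h⟩ := exists_card_divisors_le (ε := 1 / 64) (by norm_num)
  refine ⟨2 * C ^ 2, by positivity, fun δ n hδ hn => ?_⟩
  have hn0 : (0 : ℝ) < n := mod_cast hn
  rw [norm_voronoiCoeff δ hn]
  have h1 : τ n ^ 2 * (n : ℝ) ^ (-3 / 2 : ℝ) ≤ C ^ 2 * (n : ℝ) ^ (-47 / 32 : ℝ) := by
    calc τ n ^ 2 * (n : ℝ) ^ (-3 / 2 : ℝ)
        ≤ (C * (n : ℝ) ^ (1 / 64 : ℝ)) ^ 2 * (n : ℝ) ^ (-3 / 2 : ℝ) := by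
          gcongr
          exact h n hn
      _ = C ^ 2 * (n : ℝ) ^ (-47 / 32 : ℝ) := by
          rw [mul_pow, ← rpow_natCast ((n : ℝ) ^ (1 / 64 : ℝ)), ← rpow_mul hn0.le,
            mul_assoc, ← rpow_add hn0]
          norm_num
  have h2 : sin (2 * π * √n * δ) ^ 2 / (2 * π ^ 2) ≤ 2 * min 1 (δ ^ 2 * n) := by
    rw [div_le_iff₀ (by positivity)]
    have hp := pi_gt_three
    have hp2 : 1 ≤ π ^ 2 := one_le_pow₀ (by linarith)
    rcases min_choice (1 : ℝ) (δ ^ 2 * n) with h3 | h3 <;> rw [h3]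
    · nlinarith [sin_sq_le_one (2 * π * √n * δ)]
    · have h4 := abs_sin_le_two_pi_mul (w := √n * δ) (by positivity)
      rw [← mul_assoc] at h4
      have h5 := pow_le_pow_left₀ (abs_nonneg _) h4 2
      rw [sq_abs, mul_pow, mul_pow, mul_pow, sq_sqrt hn0.le] at h5
      calc _ ≤ _ := h5
        _ = _ := by ring
  calc _ = τ n ^ 2 * (n : ℝ) ^ (-3 / 2 : ℝ) *
        (sin (2 * π * √n * δ) ^ 2 / (2 * π ^ 2)) := by ring
    _ ≤ C ^ 2 * (n : ℝ) ^ (-47 / 32 : ℝ) * (2 * min 1 (δ ^ 2 * n)) := by gcongr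
    _ = _ := by ring

lemma exists_sum_rpow_le {p : ℝ} (hp : p < -1) : ∃ Z, 0 ≤ Z ∧ ∀ S : Finset ℕ,
    ∑ n ∈ S, (n : ℝ) ^ p ≤ Z :=
  ⟨∑' n : ℕ, (n : ℝ) ^ p, tsum_nonneg fun n => by positivity, fun S =>
    (summable_nat_rpow.2 hp).sum_le_tsum S fun n _ => by positivity⟩

lemma exists_sum_squarePart_gt_le : ∃ Z, 0 ≤ Z ∧ ∀ (F : ℝ) (S : Finset ℕ), 0 < F →
    (∀ n ∈ S, 1 ≤ n ∧ F < squarePart n) → ∑ n ∈ S, (n : ℝ) ^ (-33 / 32 : ℝ) ≤ Z * F⁻¹ := by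
  obtain ⟨Z₁, hZ₁, h1⟩ := exists_sum_rpow_le (p := -17 / 16) (by norm_num)
  obtain ⟨Z₂, hZ₂, h2⟩ := exists_sum_rpow_le (p := -33 / 32) (by norm_num)
  refine ⟨Z₁ * Z₂, by positivity, fun F S hF hS => ?_⟩
  have hinj : Set.InjOn (fun n => (squarePart n, squarefreePart n)) S := by
    intro m _ n _ h
    simp only [Prod.mk.injEq] at h
    rw [← squarePart_sq_mul m, ← squarePart_sq_mul n, h.1, h.2]
  calc ∑ n ∈ S, (n : ℝ) ^ (-33 / 32 : ℝ)
      ≤ ∑ n ∈ S, F⁻¹ * ((squarePart n : ℝ) ^ (-17 / 16 : ℝ) *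
          (squarefreePart n : ℝ) ^ (-33 / 32 : ℝ)) := by
        refine sum_le_sum fun n hn => ?_
        obtain ⟨hn1, hnF⟩ := hS n hn
        have hp : (0 : ℝ) < squarePart n := mod_cast squarePart_pos hn1
        have e : (n : ℝ) = (squarePart n : ℝ) ^ 2 * squarefreePart n := by
          exact_mod_cast (squarePart_sq_mul n).symm
        rw [e, mul_rpow (by positivity) (by positivity), ← mul_assoc]
        gcongr
        rw [← rpow_natCast, ← rpow_mul hp.le]
        have : (squarePart n : ℝ) ^ (((2 : ℕ) : ℝ) * (-33 / 32)) =
            (squarePart n : ℝ)⁻¹ * (squarePart n : ℝ) ^ (-17 / 16 : ℝ) := by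
          rw [← rpow_neg_one, ← rpow_add hp]
          norm_num
        rw [this]
        gcongr
    _ = F⁻¹ * ∑ p ∈ S.image fun n => (squarePart n, squarefreePart n),
          (p.1 : ℝ) ^ (-17 / 16 : ℝ) * (p.2 : ℝ) ^ (-33 / 32 : ℝ) := by
        rw [sum_image hinj, mul_sum]
    _ ≤ F⁻¹ * ∑ p ∈ S.image squarePart ×ˢ S.image squarefreePart,
          (p.1 : ℝ) ^ (-17 / 16 : ℝ) * (p.2 : ℝ) ^ (-33 / 32 : ℝ) := by
        gcongr
        intro p hp
        obtain ⟨n, hn, rfl⟩ := mem_image.1 hp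
        exact mem_product.2 ⟨mem_image_of_mem _ hn, mem_image_of_mem _ hn⟩
    _ = F⁻¹ * ((∑ f ∈ S.image squarePart, (f : ℝ) ^ (-17 / 16 : ℝ)) *
          ∑ q ∈ S.image squarefreePart, (q : ℝ) ^ (-33 / 32 : ℝ)) := by
        rw [sum_product, sum_mul_sum]
    _ ≤ F⁻¹ * (Z₁ * Z₂) := by
        gcongr
        · exact h1 _
        · exact h2 _
    _ = _ := by ring

lemma mem_mainIndices {δ : ℝ} {n : ℕ} : n ∈ mainIndices δ ↔
    1 ≤ n ∧ (n : ℝ) ≤ (δ⁻¹) ^ 3 ∧ (squarePart n : ℝ) ≤ δ ^ (-1 / 4 : ℝ) := by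
  rw [mainIndices, mem_filter, mem_Ioc, and_assoc]
  constructor
  · rintro ⟨h1, h2, h3⟩
    exact ⟨h1, (Nat.le_floor_iff' (by omega)).1 h2, h3⟩
  · rintro ⟨h1, h2, h3⟩
    exact ⟨h1, (Nat.le_floor_iff' (by omega)).2 h2, h3⟩

lemma exists_sum_norm_sq_off_mainIndices_le : ∃ C, 0 ≤ C ∧ ∀ (δ : ℝ) (S : Finset ℕ), 0 < δ →
    δ ≤ 1 → (∀ n ∈ S, 1 ≤ n ∧ n ∉ mainIndices δ) →
    ∑ n ∈ S, ‖voronoiCoeff δ n‖ ^ 2 ≤ C * δ ^ (9 / 8 : ℝ) := by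
  obtain ⟨C, hC, hc⟩ := exists_norm_voronoiCoeff_sq_le
  obtain ⟨Z₁, hZ₁, h1⟩ := exists_sum_squarePart_gt_le
  obtain ⟨Z₂, hZ₂, h2⟩ := exists_sum_rpow_le (p := -33 / 32) (by norm_num)
  refine ⟨C * Z₁ + C * Z₂, by positivity, fun δ S hδ hδ1 hS => ?_⟩
  rw [← sum_filter_add_sum_filter_not S (fun n => δ ^ (-1 / 4 : ℝ) < (squarePart n : ℝ)), add_mul]
  refine add_le_add ?_ ?_
  · calc _ ≤ ∑ n ∈ S with δ ^ (-1 / 4 : ℝ) < (squarePart n : ℝ),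
          C * δ ^ (7 / 8 : ℝ) * (n : ℝ) ^ (-33 / 32 : ℝ) := by
          refine sum_le_sum fun n hn => ?_
          have hn1 := (hS n (mem_filter.1 hn).1).1
          have hn0 : (0 : ℝ) < n := mod_cast hn1
          have h3 : min 1 (δ ^ 2 * n) ≤ (δ ^ 2 * n) ^ (7 / 16 : ℝ) := by
            rcases le_total (δ ^ 2 * n) 1 with h | h
            · refine (min_le_right _ _).trans ?_
              exact self_le_rpow_of_le_one (by positivity) h (by norm_num)
            · exact (min_le_left _ _).trans (one_le_rpow h (by norm_num))
          calc _ ≤ _ := hc δ n hδ hn1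
            _ ≤ C * (n : ℝ) ^ (-47 / 32 : ℝ) * (δ ^ 2 * n) ^ (7 / 16 : ℝ) := by gcongr
            _ = C * δ ^ (7 / 8 : ℝ) * ((n : ℝ) ^ (-47 / 32 : ℝ) * (n : ℝ) ^ (7 / 16 : ℝ)) := by
                rw [mul_rpow (by positivity) hn0.le, ← rpow_natCast, ← rpow_mul hδ.le]
                norm_num
                ring
            _ = _ := by
                rw [← rpow_add hn0]
                norm_num
      _ ≤ C * δ ^ (7 / 8 : ℝ) * (Z₁ * (δ ^ (-1 / 4 : ℝ))⁻¹) := by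
          rw [← mul_sum]
          gcongr
          refine h1 _ _ (by positivity) fun n hn => ?_
          exact ⟨(hS n (mem_filter.1 hn).1).1, (mem_filter.1 hn).2⟩
      _ = C * Z₁ * (δ ^ (7 / 8 : ℝ) * (δ ^ (-1 / 4 : ℝ))⁻¹) := by ring
      _ = _ := by
          rw [← rpow_neg hδ.le, ← rpow_add hδ]
          norm_num
  · calc _ ≤ ∑ n ∈ S with ¬ δ ^ (-1 / 4 : ℝ) < (squarePart n : ℝ),
          C * δ ^ (9 / 8 : ℝ) * (n : ℝ) ^ (-33 / 32 : ℝ) := by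
          refine sum_le_sum fun n hn => ?_
          obtain ⟨hnS, hnq⟩ := mem_filter.1 hn
          obtain ⟨hn1, hn2⟩ := hS n hnS
          have hn0 : (0 : ℝ) < n := mod_cast hn1
          have h3 : (δ⁻¹) ^ 3 ≤ (n : ℝ) := by
            by_contra! h
            exact hn2 (mem_mainIndices.2 ⟨hn1, h.le, not_lt.1 hnq⟩)
          have h4 : (n : ℝ) ^ (-14 / 32 : ℝ) ≤ δ ^ (9 / 8 : ℝ) := by
            calc (n : ℝ) ^ (-14 / 32 : ℝ) ≤ ((δ⁻¹) ^ 3) ^ (-14 / 32 : ℝ) :=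
                  rpow_le_rpow_of_nonpos (by positivity) h3 (by norm_num)
              _ = δ ^ (42 / 32 : ℝ) := by
                  rw [← rpow_natCast, ← rpow_mul (by positivity), inv_rpow hδ.le, ← rpow_neg hδ.le]
                  norm_num
              _ ≤ _ := rpow_le_rpow_of_exponent_ge hδ hδ1 (by norm_num)
          calc _ ≤ _ := hc δ n hδ hn1
            _ ≤ C * (n : ℝ) ^ (-47 / 32 : ℝ) * 1 := by
                gcongr
                exact min_le_left _ _
            _ = C * ((n : ℝ) ^ (-14 / 32 : ℝ) * (n : ℝ) ^ (-33 / 32 : ℝ)) := by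
                rw [← rpow_add hn0]
                norm_num
            _ ≤ C * (δ ^ (9 / 8 : ℝ) * (n : ℝ) ^ (-33 / 32 : ℝ)) := by gcongr
            _ = _ := by ring
      _ ≤ C * δ ^ (9 / 8 : ℝ) * Z₂ := by
          rw [← mul_sum]
          gcongr
          exact h2 _
      _ = _ := by ring

lemma exists_norm_voronoiCoeff_le : ∃ C, 0 ≤ C ∧ ∀ (δ : ℝ) (n : ℕ), 0 < δ → 1 ≤ n →
    ‖voronoiCoeff δ n‖ ≤ C * δ := by
  obtain ⟨C, hC, hc⟩ := exists_norm_voronoiCoeff_sq_le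
  refine ⟨√C, by positivity, fun δ n hδ hn => ?_⟩
  have hn0 : (1 : ℝ) ≤ n := mod_cast hn
  refine abs_le_of_sq_le_sq' ?_ (by positivity) |>.2
  rw [mul_pow, sq_sqrt hC]
  calc _ ≤ _ := hc δ n hδ hn
    _ ≤ C * (n : ℝ) ^ (-1 : ℝ) * (δ ^ 2 * n) := by
        gcongr C * ?_ * ?_
        · exact rpow_le_rpow_of_exponent_le hn0 (by norm_num)
        · exact min_le_right _ _
    _ = _ := by
        rw [rpow_neg_one]
        field_simp

lemma exists_sum_norm_block_le : ∃ C, 0 ≤ C ∧ ∀ (δ : ℝ) (r : ℕ), 0 < δ →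
    ∑ n ∈ mainIndices δ with squarefreePart n = r, ‖voronoiCoeff δ n‖ ≤ C * δ ^ (3 / 4 : ℝ) := by
  obtain ⟨C, hC, hc⟩ := exists_norm_voronoiCoeff_le
  refine ⟨C, hC, fun δ r hδ => ?_⟩
  have hcard : ((card {n ∈ mainIndices δ | squarefreePart n = r} : ℕ) : ℝ) ≤ δ ^ (-1 / 4 : ℝ) := by
    have : card {n ∈ mainIndices δ | squarefreePart n = r} ≤ (Icc 1 ⌊δ ^ (-1 / 4 : ℝ)⌋₊).card := by
      refine card_le_card_of_injOn squarePart ?_ ?_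
      · intro n hn
        obtain ⟨h1, -, h3⟩ := mem_mainIndices.1 (mem_filter.1 hn).1
        exact mem_coe.2 (mem_Icc.2 ⟨squarePart_pos h1, le_floor h3⟩)
      · intro m hm n hn h
        rw [← squarePart_sq_mul m, ← squarePart_sq_mul n, h, (mem_filter.1 hm).2,
          (mem_filter.1 hn).2]
    rw [Nat.card_Icc, Nat.add_sub_cancel] at this
    exact (Nat.cast_le.2 this).trans (floor_le (by positivity))
  calc _ ≤ ∑ n ∈ mainIndices δ with squarefreePart n = r, C * δ :=
        sum_le_sum fun n hn => hc δ n hδ (mem_mainIndices.1 (mem_filter.1 hn).1).1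
    _ ≤ δ ^ (-1 / 4 : ℝ) * (C * δ ^ (1 : ℝ)) := by
        rw [sum_const, nsmul_eq_mul, rpow_one]
        gcongr
    _ = C * (δ ^ (-1 / 4 : ℝ) * δ ^ (1 : ℝ)) := by ring
    _ = _ := by
        rw [← rpow_add hδ]
        norm_num

lemma exists_sum_norm_mainIndices_le : ∃ C, 0 ≤ C ∧ ∀ δ : ℝ, 0 < δ →
    ∑ n ∈ mainIndices δ, ‖voronoiCoeff δ n‖ ≤ C * (δ⁻¹) ^ 2 := by
  obtain ⟨C, hC, hc⟩ := exists_norm_voronoiCoeff_le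
  refine ⟨C, hC, fun δ hδ => ?_⟩
  have hcard : ((mainIndices δ).card : ℝ) ≤ (δ⁻¹) ^ 3 := by
    have : (mainIndices δ).card ≤ (Ioc 0 ⌊(δ⁻¹) ^ 3⌋₊).card := card_le_card (filter_subset _ _)
    rw [Nat.card_Ioc, Nat.sub_zero] at this
    exact (Nat.cast_le.2 this).trans (floor_le (by positivity))
  calc _ ≤ ∑ n ∈ mainIndices δ, C * δ :=
        sum_le_sum fun n hn => hc δ n hδ (mem_mainIndices.1 hn).1
    _ ≤ (δ⁻¹) ^ 3 * (C * δ) := by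
        rw [sum_const, nsmul_eq_mul]
        gcongr
    _ = _ := by field_simp

lemma deviation_sq {δ : ℝ} (hδ : 0 < δ) (hδ1 : δ ≤ rexp (-1)) :
    deviation δ ^ 2 = (16 / π ^ 2) * δ * (log (1 / δ)) ^ 3 := by
  have := one_le_log_one_div hδ hδ1
  exact sq_sqrt (by positivity)

lemma le_deviation_sq {δ : ℝ} (hδ : 0 < δ) (hδ1 : δ ≤ rexp (-1)) : δ ≤ deviation δ ^ 2 := by
  rw [deviation_sq hδ hδ1]
  have h1 : 1 ≤ log (1 / δ) ^ 3 := one_le_pow₀ (one_le_log_one_div hδ hδ1)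
  have h2 : 1 ≤ 16 / π ^ 2 := by
    rw [le_div_iff₀ (by positivity)]
    nlinarith [pi_lt_four, pi_pos]
  nlinarith [mul_le_mul h2 h1 zero_le_one (by positivity)]

lemma deviation_pos {δ : ℝ} (hδ : 0 < δ) (hδ1 : δ ≤ rexp (-1)) : 0 < deviation δ := by
  have := le_deviation_sq hδ hδ1
  have h0 : 0 ≤ deviation δ := sqrt_nonneg _
  rcases h0.eq_or_lt with h | h
  · rw [← h] at this
    norm_num at this
    linarith
  · exact h

lemma eventually_le_exp_neg_one : ∀ᶠ δ : ℝ in 𝓝[>] 0, 0 < δ ∧ δ ≤ rexp (-1) :=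
  (eventually_mem_nhdsWithin).and (nhdsWithin_le_nhds (Iic_mem_nhds (exp_pos _)))

lemma tendsto_variance_mainIndices :
    Tendsto (fun δ => ∑ n ∈ mainIndices δ, 2 * (‖voronoiCoeff δ n‖ / deviation δ) ^ 2)
      (𝓝[>] 0) (𝓝 1) := by
  obtain ⟨C, hC, hoff⟩ := exists_sum_norm_sq_off_mainIndices_le
  have h1 : Tendsto (fun δ => δ ^ 2 / log (1 / δ) ^ 3 *
      ∑ n ∈ Ioc 0 ⌊(δ⁻¹) ^ 3⌋₊, divisorSq n * sinKernel (δ * √n) / 16)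
      (𝓝[>] 0) (𝓝 1) := by
    have := tendsto_variance.div_const 16
    simp only [← sum_div, ← mul_div_assoc]
    convert this using 1
    norm_num
  have hz : Tendsto (fun δ => 2 * (C * δ ^ (1 / 8 : ℝ))) (𝓝[>] 0) (𝓝 0) := by
    have : ContinuousAt (fun δ => 2 * (C * δ ^ (1 / 8 : ℝ))) 0 := by
      refine continuousAt_const.mul (continuousAt_const.mul ?_)
      exact continuousAt_rpow_const _ _ (Or.inr (by norm_num))
    have h := this.tendsto
    simp only [zero_rpow (show (1 / 8 : ℝ) ≠ 0 by norm_num), mul_zero] at h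
    exact h.mono_left nhdsWithin_le_nhds
  have h2 : Tendsto (fun δ => (∑ n ∈ Ioc 0 ⌊(δ⁻¹) ^ 3⌋₊ with
      ¬ (squarePart n : ℝ) ≤ δ ^ (-1 / 4 : ℝ), 2 * (‖voronoiCoeff δ n‖ / deviation δ) ^ 2))
      (𝓝[>] 0) (𝓝 0) := by
    refine squeeze_zero' (.of_forall fun δ => sum_nonneg fun n _ => by positivity) ?_ hz
    filter_upwards [eventually_le_exp_neg_one] with δ ⟨hδ, hδ1⟩
    have hd := le_deviation_sq hδ hδ1
    have h3 := hoff δ {n ∈ Ioc 0 ⌊(δ⁻¹) ^ 3⌋₊ | ¬ (squarePart n : ℝ) ≤ δ ^ (-1 / 4 : ℝ)} hδ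
      (hδ1.trans (exp_le_one_iff.2 (by norm_num))) (fun n hn => by
        obtain ⟨h4, h5⟩ := mem_filter.1 hn
        exact ⟨(mem_Ioc.1 h4).1, fun h6 => h5 (mem_mainIndices.1 h6).2.2⟩)
    simp only [div_pow, ← mul_sum, ← sum_div]
    gcongr
    rw [div_le_iff₀ (hδ.trans_le hd)]
    refine h3.trans ?_
    calc C * δ ^ (9 / 8 : ℝ) = C * δ ^ (1 / 8 : ℝ) * δ := by
          rw [mul_assoc, ← rpow_add_one hδ.ne']
          norm_num
      _ ≤ _ := by gcongr
  have h3 := h1.sub h2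
  rw [sub_zero] at h3
  refine h3.congr' ?_
  filter_upwards [eventually_le_exp_neg_one] with δ ⟨hδ, hδ1⟩
  have hL := one_le_log_one_div hδ hδ1
  have e : δ ^ 2 / log (1 / δ) ^ 3 *
      ∑ n ∈ Ioc 0 ⌊(δ⁻¹) ^ 3⌋₊, divisorSq n * sinKernel (δ * √n) / 16 =
      ∑ n ∈ Ioc 0 ⌊(δ⁻¹) ^ 3⌋₊, 2 * (‖voronoiCoeff δ n‖ / deviation δ) ^ 2 := by
    rw [mul_sum]
    refine sum_congr rfl fun n hn => ?_
    have hn1 : 1 ≤ n := (mem_Ioc.1 hn).1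
    have hn0 : (0 : ℝ) < n := mod_cast hn1
    rw [div_pow, deviation_sq hδ hδ1, norm_voronoiCoeff δ hn1, divisorSq_apply, sinKernel]
    have e1 : (n : ℝ) ^ (-3 / 2 : ℝ) = (√n ^ 3)⁻¹ := by
      rw [sqrt_eq_rpow, ← rpow_natCast, ← rpow_mul hn0.le, ← rpow_neg hn0.le]
      norm_num
    rw [e1, show 2 * π * (δ * √n) = 2 * π * √n * δ by ring]
    have : 0 < √n := by positivity
    field_simp
  rw [e, mainIndices, ← sum_filter_add_sum_filter_not (Ioc 0 ⌊(δ⁻¹) ^ 3⌋₊)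
    (fun n => (squarePart n : ℝ) ≤ δ ^ (-1 / 4 : ℝ)), add_sub_cancel_right]

lemma sum_inv_nat_le {N : ℕ} : ∑ j ∈ Icc 1 N, (j : ℝ)⁻¹ ≤ 1 + log N := by
  have := harmonic_le_one_add_log N
  rw [harmonic_eq_sum_Icc] at this
  push_cast at this
  exact this

lemma sum_inv_abs_sub_le {N m : ℕ} (hm : m ≤ N) :
    ∑ n ∈ Icc 1 N with n ≠ m, |(m : ℝ) - n|⁻¹ ≤ 2 * (1 + log N) := by
  have h1 : ∑ n ∈ Icc 1 N with n < m, |(m : ℝ) - n|⁻¹ ≤ 1 + log N := by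
    calc ∑ n ∈ Icc 1 N with n < m, |(m : ℝ) - n|⁻¹
        = ∑ n ∈ Icc 1 N with n < m, (((m - n : ℕ) : ℝ))⁻¹ := by
          refine sum_congr rfl fun n hn => ?_
          have h1 := (mem_filter.1 hn).2
          have h2 : (n : ℝ) < m := mod_cast h1
          rw [abs_of_pos (by linarith), Nat.cast_sub h1.le]
      _ = ∑ j ∈ ({n ∈ Icc 1 N | n < m} : Finset ℕ).image fun n => m - n, (j : ℝ)⁻¹ := by
          refine (sum_image (f := fun j : ℕ => (j : ℝ)⁻¹) (g := fun n : ℕ => m - n) ?_).symm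
          intro a ha b hb h
          have h1 := (mem_filter.1 ha).2
          have h2 := (mem_filter.1 hb).2
          dsimp only at h
          omega
      _ ≤ ∑ j ∈ Icc 1 N, (j : ℝ)⁻¹ := by
          refine sum_le_sum_of_subset_of_nonneg ?_ fun j _ _ => by positivity
          intro j hj
          obtain ⟨n, hn, rfl⟩ := mem_image.1 hj
          have := (mem_filter.1 hn).2
          exact mem_Icc.2 ⟨by omega, by omega⟩
      _ ≤ _ := sum_inv_nat_le
  have h2 : ∑ n ∈ Icc 1 N with m < n, |(m : ℝ) - n|⁻¹ ≤ 1 + log N := by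
    calc ∑ n ∈ Icc 1 N with m < n, |(m : ℝ) - n|⁻¹
        = ∑ n ∈ Icc 1 N with m < n, (((n - m : ℕ) : ℝ))⁻¹ := by
          refine sum_congr rfl fun n hn => ?_
          have h1 := (mem_filter.1 hn).2
          have h2 : (m : ℝ) < n := mod_cast h1
          rw [abs_of_neg (by linarith), Nat.cast_sub h1.le]
          ring_nf
      _ = ∑ j ∈ ({n ∈ Icc 1 N | m < n} : Finset ℕ).image fun n => n - m, (j : ℝ)⁻¹ := by
          refine (sum_image (f := fun j : ℕ => (j : ℝ)⁻¹) (g := fun n : ℕ => n - m) ?_).symm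
          intro a ha b hb h
          have h1 := (mem_filter.1 ha).2
          have h2 := (mem_filter.1 hb).2
          dsimp only at h
          omega
      _ ≤ ∑ j ∈ Icc 1 N, (j : ℝ)⁻¹ := by
          refine sum_le_sum_of_subset_of_nonneg ?_ fun j _ _ => by positivity
          intro j hj
          obtain ⟨n, hn, rfl⟩ := mem_image.1 hj
          have := (mem_filter.1 hn).2
          have := mem_Icc.1 (mem_filter.1 hn).1
          exact mem_Icc.2 ⟨by omega, by omega⟩
      _ ≤ _ := sum_inv_nat_le
  have e : ({n ∈ Icc 1 N | n ≠ m} : Finset ℕ) = {n ∈ Icc 1 N | n < m} ∪ {n ∈ Icc 1 N | m < n} := by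
    ext n
    simp only [mem_filter, mem_union, ← and_or_left]
    simp only [lt_or_lt_iff_ne]
  rw [e, sum_union]
  · linarith
  · refine disjoint_filter.2 fun n _ h3 h4 => ?_
    omega

lemma timeMean_one {X : ℝ} (hX : 0 < X) : timeMean X (fun _ => 1) = 1 := by
  have hXc : (X : ℂ) ≠ 0 := mod_cast hX.ne'
  have h : 2 * X - X = X := by ring
  simp only [timeMean, intervalIntegral.integral_const, h]
  simp [hXc]

lemma norm_timeMean_unitExp_root_le {X : ℝ} (hX : 0 < X) {m n N : ℕ} (hm : m ≤ N) (hn : n ≤ N)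
    (hmn : n ≠ m) :
    ‖timeMean X fun x => unitExp ((2 * √n - 2 * √m) * x)‖ ≤ √N / X * |(m : ℝ) - n|⁻¹ := by
  have hne : (n : ℝ) ≠ m := mod_cast hmn
  have hs : √n ≠ √m := fun h => hne ((sqrt_inj (by positivity) (by positivity)).1 h)
  have hl : 2 * √n - 2 * √m ≠ 0 := fun h => hs (by linarith)
  rw [timeMean, norm_mul, norm_inv, norm_real, norm_eq_abs, abs_of_pos hX]
  have h1 := norm_intervalIntegral_unitExp_le hl X (2 * X)
  have h2 : |(m : ℝ) - n| ≤ |2 * √n - 2 * √m| * √N := by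
    have e : (m : ℝ) - n = -((√n - √m) * (√n + √m)) := by
      have := mul_self_sqrt (show (0 : ℝ) ≤ n by positivity)
      have := mul_self_sqrt (show (0 : ℝ) ≤ m by positivity)
      linarith
    have h3 : √n ≤ √N := sqrt_le_sqrt (mod_cast hn)
    have h4 : √m ≤ √N := sqrt_le_sqrt (mod_cast hm)
    rw [e, abs_neg, abs_mul, ← mul_sub, abs_mul, abs_two,
      abs_of_nonneg (by positivity : 0 ≤ √n + √m)]
    nlinarith [abs_nonneg (√n - √m)]
  have h5 : 0 < |(m : ℝ) - n| := abs_pos.2 (sub_ne_zero.2 hne.symm)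
  have h6 : 0 < |2 * √n - 2 * √m| := abs_pos.2 hl
  have h7 : 1 / (π * |2 * √n - 2 * √m|) ≤ √N * |(m : ℝ) - n|⁻¹ := by
    rw [← div_eq_mul_inv, div_le_div_iff₀ (by positivity) h5, one_mul]
    refine h2.trans ?_
    have := pi_gt_three
    have h8 : 0 ≤ √N * |2 * √n - 2 * √m| := by positivity
    nlinarith
  calc _ ≤ X⁻¹ * (√N * |(m : ℝ) - n|⁻¹) := by
        gcongr
        exact h1.trans h7
    _ = _ := by ring

lemma integral_norm_sq_rootSum_le {X : ℝ} (hX : 0 < X) (N : ℕ) (r : ℕ → ℂ) :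
    ∫ x, ‖∑ n ∈ Icc 1 N, r n * unitExp (-(x * (2 * √n)))‖ ^ 2 ∂timeMeasure X ≤
      (1 + √N / X * (2 * (1 + log N))) * ∑ n ∈ Icc 1 N, ‖r n‖ ^ 2 := by
  have hcu := continuous_unitExp
  have h0 : ((∫ x, ‖∑ n ∈ Icc 1 N, r n * unitExp (-(x * (2 * √n)))‖ ^ 2
      ∂timeMeasure X : ℝ) : ℂ) = ∑ m ∈ Icc 1 N, ∑ n ∈ Icc 1 N,
      r m * conj (r n) * timeMean X fun x => unitExp ((2 * √n - 2 * √m) * x) := by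
    rw [← integral_complex_ofReal, integral_timeMeasure hX]
    have e : ∀ x : ℝ, ((‖∑ n ∈ Icc 1 N, r n * unitExp (-(x * (2 * √n)))‖ ^ 2 : ℝ) : ℂ)
        = ∑ m ∈ Icc 1 N, ∑ n ∈ Icc 1 N, r m * conj (r n) * unitExp ((2 * √n - 2 * √m) * x) := by
      intro x
      rw [ofReal_pow, ← Complex.mul_conj', map_sum, sum_mul_sum]
      refine sum_congr rfl fun m _ => sum_congr rfl fun n _ => ?_
      rw [map_mul, ← unitExp_neg, show (2 * √n - 2 * √m) * x =
        -(x * (2 * √m)) + - -(x * (2 * √n)) by ring, unitExp_add]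
      ring
    simp only [e]
    unfold timeMean
    rw [intervalIntegral.integral_finsetSum, mul_sum]
    · refine sum_congr rfl fun m _ => ?_
      rw [intervalIntegral.integral_finsetSum, mul_sum]
      · refine sum_congr rfl fun n _ => ?_
        rw [intervalIntegral.integral_const_mul]
        ring
      · intro n _
        exact Continuous.intervalIntegrable (by fun_prop) _ _
    · intro m _
      exact Continuous.intervalIntegrable (by fun_prop) _ _
  set κ : ℕ → ℕ → ℝ := fun m n => if n = m then 1 else √N / X * |(m : ℝ) - n|⁻¹ with hκ
  have hκ0 : ∀ m n, 0 ≤ κ m n := fun m n => by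
    simp only [hκ]
    split_ifs <;> positivity
  have hκs : ∀ m n, κ m n = κ n m := fun m n => by
    simp only [hκ, abs_sub_comm (m : ℝ) n, eq_comm (a := m)]
  have hκsum : ∀ m ∈ Icc 1 N, ∑ n ∈ Icc 1 N, κ m n ≤ 1 + √N / X * (2 * (1 + log N)) := by
    intro m hm
    rw [← sum_filter_add_sum_filter_not _ (fun n => n = m)]
    refine add_le_add ?_ ?_
    · rw [filter_eq', if_pos hm, sum_singleton]
      simp [hκ]
    · have : ∑ n ∈ Icc 1 N with ¬ n = m, κ m n =
          √N / X * ∑ n ∈ Icc 1 N with n ≠ m, |(m : ℝ) - n|⁻¹ := by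
        rw [mul_sum]
        refine sum_congr rfl fun n hn => ?_
        simp only [hκ]
        rw [if_neg (mem_filter.1 hn).2]
      rw [this]
      gcongr
      exact sum_inv_abs_sub_le (mem_Icc.1 hm).2
  have h1 : ∀ m ∈ Icc 1 N, ∀ n ∈ Icc 1 N,
      ‖timeMean X fun x => unitExp ((2 * √n - 2 * √m) * x)‖ ≤ κ m n := by
    intro m hm n hn
    simp only [hκ]
    split_ifs with h
    · subst h
      simp only [sub_self, zero_mul, unitExp_zero, timeMean_one hX]
      simp
    · exact norm_timeMean_unitExp_root_le hX (mem_Icc.1 hm).2 (mem_Icc.1 hn).2 h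
  have h2 : ∫ x, ‖∑ n ∈ Icc 1 N, r n * unitExp (-(x * (2 * √n)))‖ ^ 2 ∂timeMeasure X ≤
      ∑ m ∈ Icc 1 N, ∑ n ∈ Icc 1 N, (‖r m‖ ^ 2 / 2 * κ m n + ‖r n‖ ^ 2 / 2 * κ m n) := by
    calc _ ≤ ‖((∫ x, ‖∑ n ∈ Icc 1 N, r n * unitExp (-(x * (2 * √n)))‖ ^ 2
          ∂timeMeasure X : ℝ) : ℂ)‖ := by
          rw [norm_real]
          exact le_norm_self _
      _ ≤ _ := by
          rw [h0]
          refine (norm_sum_le _ _).trans (sum_le_sum fun m hm => ?_)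
          refine (norm_sum_le _ _).trans (sum_le_sum fun n hn => ?_)
          rw [norm_mul, norm_mul, RCLike.norm_conj]
          have h3 := h1 m hm n hn
          have h4 := hκ0 m n
          calc _ ≤ ‖r m‖ * ‖r n‖ * κ m n := by gcongr
            _ ≤ (‖r m‖ ^ 2 / 2 + ‖r n‖ ^ 2 / 2) * κ m n := by
                gcongr
                nlinarith [sq_nonneg (‖r m‖ - ‖r n‖)]
            _ = _ := by ring
  refine h2.trans ?_
  simp only [sum_add_distrib]
  have h3 : ∑ m ∈ Icc 1 N, ∑ n ∈ Icc 1 N, ‖r n‖ ^ 2 / 2 * κ m n =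
      ∑ m ∈ Icc 1 N, ∑ n ∈ Icc 1 N, ‖r m‖ ^ 2 / 2 * κ m n := by
    rw [sum_comm]
    simp only [hκs]
  rw [h3, ← two_mul, mul_sum, mul_sum]
  refine sum_le_sum fun m hm => ?_
  rw [← mul_sum]
  have := mul_le_mul_of_nonneg_left (hκsum m hm) (sq_nonneg ‖r m‖)
  linarith

lemma exists_integral_norm_sq_le : ∃ C, 0 ≤ C ∧ ∀ (X : ℝ) (r : ℕ → ℂ), 1 ≤ X →
    ∫ x, ‖∑ n ∈ Icc 1 ⌊X ^ (7 / 4 : ℝ)⌋₊, r n * unitExp (-(x * (2 * √n)))‖ ^ 2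
      ∂timeMeasure X ≤ C * ∑ n ∈ Icc 1 ⌊X ^ (7 / 4 : ℝ)⌋₊, ‖r n‖ ^ 2 := by
  refine ⟨31, by norm_num, fun X r hX => ?_⟩
  have hX0 : 0 < X := by linarith
  refine (integral_norm_sq_rootSum_le hX0 _ r).trans ?_
  gcongr
  set N := ⌊X ^ (7 / 4 : ℝ)⌋₊ with hN
  have hN1 : (N : ℝ) ≤ X ^ (7 / 4 : ℝ) := floor_le (by positivity)
  have hN0 : (1 : ℝ) ≤ N := by
    have : 1 ≤ N := le_floor (by
      push_cast
      exact one_le_rpow hX (by norm_num))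
    exact_mod_cast this
  have h1 : √N ≤ X ^ (7 / 8 : ℝ) := by
    refine (sqrt_le_sqrt hN1).trans (le_of_eq ?_)
    rw [sqrt_eq_rpow, ← rpow_mul hX0.le]
    norm_num
  have h2 : log N ≤ 14 * X ^ (1 / 8 : ℝ) := by
    calc log N ≤ log (X ^ (7 / 4 : ℝ)) := log_le_log (by linarith) hN1
      _ = 7 / 4 * log X := log_rpow hX0 _
      _ ≤ 7 / 4 * (X ^ (1 / 8 : ℝ) / (1 / 8)) := by
          gcongr
          exact log_le_rpow_div hX0.le (by norm_num)
      _ = _ := by ring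
  have h3 : 1 ≤ X ^ (1 / 8 : ℝ) := one_le_rpow hX (by norm_num)
  have h4 : X ^ (7 / 8 : ℝ) * X ^ (1 / 8 : ℝ) = X := by
    rw [← rpow_add hX0]
    norm_num
  have h5 : 0 ≤ log N := log_nonneg hN0
  calc 1 + √N / X * (2 * (1 + log N))
      ≤ 1 + X ^ (7 / 8 : ℝ) / X * (2 * (X ^ (1 / 8 : ℝ) + 14 * X ^ (1 / 8 : ℝ))) := by gcongr
    _ = 1 + 30 * (X ^ (7 / 8 : ℝ) * X ^ (1 / 8 : ℝ)) / X := by ring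
    _ = 31 := by
        rw [h4]
        field_simp
        norm_num

/-- The mean square of the difference between the truncated dual sum and its main part. -/
lemma exists_integral_sq_dualSum_sub_le : ∃ C, 0 ≤ C ∧ ∀ X δ : ℝ, 1 ≤ X → 0 < δ → δ ≤ 1 →
    (δ⁻¹) ^ 3 ≤ X ^ (7 / 4 : ℝ) →
    ∫ x, (∑ n ∈ Icc 1 ⌊X ^ (7 / 4 : ℝ)⌋₊, dualSummand (X ^ (-9 / 16 : ℝ)) δ x n -
        rootSum (mainIndices δ) (voronoiCoeff δ) x) ^ 2 ∂timeMeasure X ≤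
      C * (δ ^ (9 / 8 : ℝ) +
        X ^ (-9 / 8 : ℝ) * (δ⁻¹) ^ 3 * ∑ n ∈ mainIndices δ, ‖voronoiCoeff δ n‖ ^ 2) := by
  obtain ⟨C₁, hC₁, h1⟩ := exists_integral_norm_sq_le
  obtain ⟨C₂, hC₂, h2⟩ := exists_sum_norm_sq_off_mainIndices_le
  refine ⟨4 * (C₁ * (C₂ + (4 * π) ^ 2)), by positivity, fun X δ hX hδ hδ1 hXδ => ?_⟩
  have hX0 : 0 < X := by linarith
  have := isProbabilityMeasure_timeMeasure hX0
  have hcu := continuous_unitExp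
  set u := X ^ (-9 / 16 : ℝ) with hu
  set I := Icc 1 ⌊X ^ (7 / 4 : ℝ)⌋₊ with hI
  have hsub : mainIndices δ ⊆ I := by
    intro n hn
    obtain ⟨h3, h4, -⟩ := mem_mainIndices.1 hn
    exact mem_Icc.2 ⟨h3, le_floor (h4.trans hXδ)⟩
  set r : ℕ → ℂ := fun n => voronoiCoeff δ n *
    (mollifierHat (u * (2 * √n)) - if n ∈ mainIndices δ then 1 else 0) with hr
  have e : ∀ x, ∑ n ∈ I, dualSummand u δ x n - rootSum (mainIndices δ) (voronoiCoeff δ) x =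
      2 * (∑ n ∈ I, r n * unitExp (-(x * (2 * √n)))).re := by
    intro x
    have e1 : rootSum (mainIndices δ) (voronoiCoeff δ) x = ∑ n ∈ I, if n ∈ mainIndices δ then
        2 * (voronoiCoeff δ n * unitExp (-(x * (2 * √n)))).re else 0 := by
      rw [sum_ite_mem, inter_eq_right.2 hsub, rootSum]
    rw [e1, Complex.re_sum, mul_sum, ← sum_sub_distrib]
    refine sum_congr rfl fun n _ => ?_
    simp only [dualSummand, hr]
    split_ifs
    · rw [← mul_sub, ← Complex.sub_re]
      congr 2
      ring
    · rw [sub_zero, sub_zero]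
  simp only [e]
  have hcont : Continuous fun x => ∑ n ∈ I, r n * unitExp (-(x * (2 * √n))) := by fun_prop
  have hbound : ∀ x : ℝ, ‖∑ n ∈ I, r n * unitExp (-(x * (2 * √n)))‖ ≤ ∑ n ∈ I, ‖r n‖ := by
    intro x
    refine (norm_sum_le _ _).trans (sum_le_sum fun n _ => ?_)
    rw [norm_mul, norm_unitExp, mul_one]
  have hint : Integrable (fun x =>
      4 * ‖∑ n ∈ I, r n * unitExp (-(x * (2 * √n)))‖ ^ 2) (timeMeasure X) := by
    refine integrable_of_continuous_of_bound (by fun_prop) (4 * (∑ n ∈ I, ‖r n‖) ^ 2) fun x => ?_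
    rw [norm_eq_abs, abs_of_nonneg (by positivity)]
    gcongr
    exact hbound x
  have hoff : ∑ n ∈ I with n ∉ mainIndices δ, ‖r n‖ ^ 2 ≤ C₂ * δ ^ (9 / 8 : ℝ) := by
    refine le_trans (sum_le_sum fun n hn => ?_)
      (h2 δ {n ∈ I | n ∉ mainIndices δ} hδ hδ1 fun n hn => ?_)
    · simp only [hr]
      rw [if_neg (mem_filter.1 hn).2, sub_zero, norm_mul]
      gcongr
      exact mul_le_of_le_one_right (norm_nonneg _) (norm_mollifierHat_le_one _)
    · exact ⟨(mem_Icc.1 (mem_filter.1 hn).1).1, (mem_filter.1 hn).2⟩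
  have hon : ∑ n ∈ I with n ∈ mainIndices δ, ‖r n‖ ^ 2 ≤ (4 * π) ^ 2 *
      (X ^ (-9 / 8 : ℝ) * (δ⁻¹) ^ 3 * ∑ n ∈ mainIndices δ, ‖voronoiCoeff δ n‖ ^ 2) := by
    rw [filter_mem_eq_inter, inter_eq_right.2 hsub, mul_sum, mul_sum]
    refine sum_le_sum fun n hn => ?_
    simp only [hr]
    rw [if_pos hn, norm_mul, mul_pow]
    have h3 := norm_mollifierHat_sub_one_le (u * (2 * √n))
    have hu0 : 0 < u := by positivity
    rw [abs_of_nonneg (by positivity)] at h3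
    have h4 : (2 * π * (u * (2 * √n))) ^ 2 ≤ (4 * π) ^ 2 * (X ^ (-9 / 8 : ℝ) * (δ⁻¹) ^ 3) := by
      have e2 : u ^ 2 = X ^ (-9 / 8 : ℝ) := by
        rw [hu, ← rpow_natCast, ← rpow_mul hX0.le]
        norm_num
      calc (2 * π * (u * (2 * √n))) ^ 2 = (4 * π) ^ 2 * (u ^ 2 * √n ^ 2) := by ring
        _ ≤ _ := by
            rw [e2, sq_sqrt (by positivity)]
            gcongr
            exact (mem_mainIndices.1 hn).2.1
    have h5 := pow_le_pow_left₀ (norm_nonneg _) h3 2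
    calc _ ≤ ‖voronoiCoeff δ n‖ ^ 2 * ((4 * π) ^ 2 * (X ^ (-9 / 8 : ℝ) * (δ⁻¹) ^ 3)) := by
          gcongr
          exact h5.trans h4
      _ = _ := by ring
  have hsum : ∑ n ∈ I, ‖r n‖ ^ 2 ≤ (C₂ + (4 * π) ^ 2) * (δ ^ (9 / 8 : ℝ) +
        X ^ (-9 / 8 : ℝ) * (δ⁻¹) ^ 3 * ∑ n ∈ mainIndices δ, ‖voronoiCoeff δ n‖ ^ 2) := by
    rw [← sum_filter_add_sum_filter_not I (fun n => n ∈ mainIndices δ)]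
    have hp : 0 ≤ X ^ (-9 / 8 : ℝ) * (δ⁻¹) ^ 3 * ∑ n ∈ mainIndices δ, ‖voronoiCoeff δ n‖ ^ 2 := by
      positivity
    have hp2 : 0 ≤ δ ^ (9 / 8 : ℝ) := by positivity
    have hp3 : 0 ≤ (4 * π) ^ 2 := by positivity
    nlinarith [mul_nonneg hC₂ hp, mul_nonneg hp3 hp2]
  calc _ ≤ ∫ x, 4 * ‖∑ n ∈ I, r n * unitExp (-(x * (2 * √n)))‖ ^ 2 ∂timeMeasure X := by
        refine integral_mono_of_nonneg (.of_forall fun x => sq_nonneg _) hint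
          (.of_forall fun x => ?_)
        set z := ∑ n ∈ I, r n * unitExp (-(x * (2 * √n)))
        calc (2 * z.re) ^ 2 = 4 * |z.re| ^ 2 := by
              rw [sq_abs]
              ring
          _ ≤ 4 * ‖z‖ ^ 2 := by
              gcongr
              exact abs_re_le_norm z
    _ ≤ 4 * (C₁ * ∑ n ∈ I, ‖r n‖ ^ 2) := by
        rw [integral_const_mul]
        gcongr
        exact h1 X r hX
    _ ≤ 4 * (C₁ * ((C₂ + (4 * π) ^ 2) * (δ ^ (9 / 8 : ℝ) +
        X ^ (-9 / 8 : ℝ) * (δ⁻¹) ^ 3 * ∑ n ∈ mainIndices δ, ‖voronoiCoeff δ n‖ ^ 2))) := by gcongr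
    _ = _ := by ring

section

open ProbabilityTheory

lemma gaussianReal_Ioc {α β : ℝ} (h : α ≤ β) : (gaussianReal 0 1 (Set.Ioc α β)).toReal =
    (1 / √(2 * π)) * ∫ t in α..β, rexp (-t ^ 2 / 2) := by
  rw [gaussianReal_apply_eq_integral 0 one_ne_zero, ENNReal.toReal_ofReal
    (integral_nonneg fun x => gaussianPDFReal_nonneg _ _ _), integral_of_le h,
    ← integral_const_mul]
  congr with x
  simp [gaussianPDFReal]

/-- Lévy's continuity theorem with a standard Gaussian limit, for intervals. -/
lemma tendsto_measure_Ioc_of_tendsto_charFun {P : ℕ → ProbabilityMeasure ℝ}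
    (hP : ∀ t : ℝ, Tendsto (fun n => charFun (P n : Measure ℝ) t) atTop
      (𝓝 (cexp (-(t ^ 2 / 2) : ℝ)))) {α β : ℝ} (h : α < β) :
    Tendsto (fun n => ((P n : Measure ℝ) (Set.Ioc α β)).toReal) atTop
      (𝓝 ((1 / √(2 * π)) * ∫ t in α..β, rexp (-t ^ 2 / 2))) := by
  let G : ProbabilityMeasure ℝ := ⟨gaussianReal 0 1, inferInstance⟩
  have hlim : Tendsto P atTop (𝓝 G) := by
    rw [ProbabilityMeasure.tendsto_iff_tendsto_charFun]
    intro t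
    have e : charFun (G : Measure ℝ) t = cexp (-(t ^ 2 / 2) : ℝ) := by
      change charFun (gaussianReal 0 1) t = _
      rw [charFun_gaussianReal]
      congr 1
      push_cast
      ring
    rw [e]
    exact hP t
  have hfr : (G : Measure ℝ) (frontier (Set.Ioc α β)) = 0 := by
    rw [frontier_Ioc h]
    have : NullSingletonClass (gaussianReal 0 1) := nullSingletonClass_gaussianReal one_ne_zero
    exact (Set.toFinite {α, β}).measure_zero (gaussianReal 0 1)
  have := ProbabilityMeasure.tendsto_measure_of_null_frontier_of_tendsto' hlim hfr
  rw [← gaussianReal_Ioc h.le]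
  exact (ENNReal.tendsto_toReal (measure_ne_top _ _)).comp this

lemma integral_abs_le_sqrt {Ω : Type*} [MeasurableSpace Ω] {μ : Measure Ω}
    [IsProbabilityMeasure μ] {g : Ω → ℝ} (hg : Integrable g μ)
    (hg2 : Integrable (fun x => g x ^ 2) μ) {Q : ℝ} (hQ : ∫ x, g x ^ 2 ∂μ ≤ Q) :
    ∫ x, |g x| ∂μ ≤ √Q := by
  set m := ∫ x, |g x| ∂μ with hm
  have h1 : Integrable (fun x => 2 * m * |g x|) μ := hg.abs.const_mul _
  have h2 : 0 ≤ ∫ x, (|g x| - m) ^ 2 ∂μ := integral_nonneg fun x => sq_nonneg _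
  have h3 : ∫ x, (|g x| - m) ^ 2 ∂μ = (∫ x, g x ^ 2 ∂μ) - m ^ 2 := by
    have e : (fun x => (|g x| - m) ^ 2) = fun x => (g x ^ 2 - 2 * m * |g x|) + m ^ 2 := by
      funext x
      rw [← sq_abs (g x)]
      ring
    have h4 : Integrable (fun x => g x ^ 2 - 2 * m * |g x|) μ := hg2.sub h1
    rw [e, integral_add h4 (integrable_const _), integral_sub hg2 h1, integral_const_mul, ← hm]
    simp
    ring
  exact le_sqrt_of_sq_le (by linarith)

lemma measurable_divisorError : Measurable divisorError := by
  have h : Measurable fun y : ℝ => ∑ n ∈ Icc 1 ⌊y⌋₊, τ n :=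
    (measurable_from_nat (f := fun k : ℕ => ∑ n ∈ Icc 1 k, τ n)).comp Nat.measurable_floor
  unfold divisorError
  exact (h.sub (measurable_id.mul measurable_log)).sub (measurable_id.const_mul _)

lemma measurable_divisorError_sub (δ : ℝ) :
    Measurable fun x => divisorError ((x + δ) ^ 2) - divisorError (x ^ 2) :=
  (measurable_divisorError.comp (g := divisorError) (by fun_prop)).sub
    (measurable_divisorError.comp (by fun_prop))

lemma rootSum_div (N : Finset ℕ) (c : ℕ → ℂ) (s x : ℝ) :
    rootSum N (fun n => c n / s) x = rootSum N c x / s := by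
  rw [rootSum, rootSum, sum_div]
  refine sum_congr rfl fun n _ => ?_
  rw [div_mul_eq_mul_div, Complex.div_ofReal_re]
  ring

section

variable {δ : ℝ → ℝ}

lemma tendsto_inv_pow_mul_rpow (hδpos : ∀ X, 0 < δ X)
    (hδX : Tendsto (fun X : ℝ => log (1 / δ X) / log X) atTop (𝓝 0)) (k : ℕ) {s : ℝ}
    (hs : 0 < s) : Tendsto (fun X => (δ X)⁻¹ ^ k * X ^ (-s)) atTop (𝓝 0) := by
  have h0 : Tendsto (fun X : ℝ => X ^ (-(s / 2))) atTop (𝓝 0) :=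
    tendsto_rpow_neg_atTop (by positivity)
  refine squeeze_zero' ?_ ?_ h0
  · filter_upwards [eventually_gt_atTop 0] with X hX
    have := hδpos X
    positivity
  · filter_upwards [eventually_gt_atTop 1, hδX.eventually_le_const
      (show (0 : ℝ) < s / (2 * (k + 1)) by positivity)] with X hX h
    have hX0 : 0 < X := by linarith
    have hl := log_pos hX
    rw [div_le_iff₀ hl, one_div] at h
    have hd := inv_pos.2 (hδpos X)
    have h1 : (δ X)⁻¹ ^ k ≤ X ^ (s / 2) := by
      rw [← exp_log hd, ← exp_nat_mul, rpow_def_of_pos hX0]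
      refine exp_le_exp.2 ?_
      calc (k : ℝ) * log (δ X)⁻¹ ≤ k * (s / (2 * (k + 1)) * log X) := by gcongr
        _ = (k / (k + 1)) * (log X * (s / 2)) := by field_simp
        _ ≤ 1 * (log X * (s / 2)) := by
            gcongr
            rw [div_le_one (by positivity)]
            linarith
        _ = _ := one_mul _
    calc (δ X)⁻¹ ^ k * X ^ (-s) ≤ X ^ (s / 2) * X ^ (-s) := by gcongr
      _ = X ^ (-(s / 2)) := by
          rw [← rpow_add hX0]
          ring_nf

lemma tendsto_rpow_comp_zero (hδ : Tendsto δ atTop (𝓝 0)) {s : ℝ} (hs : 0 < s) :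
    Tendsto (fun X => δ X ^ s) atTop (𝓝 0) := by
  have := hδ.rpow_const (p := s) (Or.inr hs.le)
  rwa [zero_rpow hs.ne'] at this

end

lemma sqrt_le_deviation {δ : ℝ} (hδ : 0 < δ) (hδ1 : δ ≤ rexp (-1)) : √δ ≤ deviation δ := by
  rw [← sqrt_sq (deviation_pos hδ hδ1).le]
  exact sqrt_le_sqrt (le_deviation_sq hδ hδ1)

lemma exists_norm_charFun_mainIndices_sub_le {K : ℕ} (hK : Even K) :
    ∃ (A : ℕ) (C : ℝ), 0 ≤ C ∧ ∀ X δ t v : ℝ,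
      v = ∑ n ∈ mainIndices δ, 2 * (‖voronoiCoeff δ n‖ / deviation δ) ^ 2 →
      0 < X → 0 < δ → δ ≤ rexp (-1) → 2 * |t| * (C * δ ^ (1 / 4 : ℝ)) ≤ 1 →
      ‖(∫ x, cexp ((t * (rootSum (mainIndices δ) (voronoiCoeff δ) x / deviation δ) : ℝ) *
          I) ∂timeMeasure X) - cexp (-(t ^ 2 * v / 2 : ℝ))‖ ≤
        C * (δ⁻¹ ^ A / X) * rexp |t| + 4 * (2⁻¹ ^ K * rexp (4 * t ^ 2 * v)) +
          (|t| * (C * δ ^ (1 / 4 : ℝ)) + (|t| * (C * δ ^ (1 / 4 : ℝ))) ^ 2) * (t ^ 2 * v) := by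
  obtain ⟨A, hA⟩ := exists_norm_charFun_rootSum_sub_le hK
  obtain ⟨C₁, hC₁, h1⟩ := exists_sum_norm_block_le
  obtain ⟨C₂, hC₂, h2⟩ := exists_sum_norm_mainIndices_le
  set C := 2 * C₁ + (1 + 2 * C₂) ^ K * 4 ^ A with hC
  refine ⟨3 * K + 3 * A, C, by positivity, fun X δ t v hv hX hδ hδ1 ht => ?_⟩
  subst hv
  have hσ := deviation_pos hδ hδ1
  have hδ2 : δ ≤ 1 := hδ1.trans (exp_le_one_iff.2 (by norm_num))
  have hδ' : 1 ≤ δ⁻¹ := (one_le_inv₀ hδ).2 hδ2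
  have hn : ∀ n, ‖voronoiCoeff δ n / (deviation δ : ℂ)‖ = ‖voronoiCoeff δ n‖ / deviation δ := by
    intro n
    rw [norm_div, norm_real, norm_eq_abs, abs_of_pos hσ]
  have hinv : (deviation δ)⁻¹ ≤ δ ^ (-1 / 2 : ℝ) := by
    have := inv_anti₀ (sqrt_pos.2 hδ) (sqrt_le_deviation hδ hδ1)
    rwa [sqrt_eq_rpow, ← rpow_neg hδ.le, ← neg_div] at this
  have key := hA X (4 * δ⁻¹ ^ 3) (mainIndices δ) (fun n => voronoiCoeff δ n / (deviation δ : ℂ))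
    (C * δ ^ (1 / 4 : ℝ)) t hX ?_ ?_ ?_ ht
  · simp only [rootSum_div, hn] at key
    refine key.trans ?_
    gcongr
    have hB : 1 + ∑ n ∈ mainIndices δ, 2 * (‖voronoiCoeff δ n‖ / deviation δ) ≤
        (1 + 2 * C₂) * δ⁻¹ ^ 3 := by
      have h3 : ∑ n ∈ mainIndices δ, 2 * (‖voronoiCoeff δ n‖ / deviation δ) ≤ 2 * C₂ * δ⁻¹ ^ 3 := by
        calc ∑ n ∈ mainIndices δ, 2 * (‖voronoiCoeff δ n‖ / deviation δ)
            = 2 * ((∑ n ∈ mainIndices δ, ‖voronoiCoeff δ n‖) * (deviation δ)⁻¹) := by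
              rw [sum_mul, mul_sum]
              rfl
          _ ≤ 2 * ((C₂ * δ⁻¹ ^ 2) * δ⁻¹) := by
              gcongr
              · exact h2 δ hδ
              · exact (le_sqrt_of_sq_le (by nlinarith)).trans (sqrt_le_deviation hδ hδ1)
          _ = _ := by ring
      have : 1 ≤ δ⁻¹ ^ 3 := one_le_pow₀ hδ'
      linarith
    calc (1 + ∑ n ∈ mainIndices δ, 2 * (‖voronoiCoeff δ n‖ / deviation δ)) ^ K *
          (4 * δ⁻¹ ^ 3) ^ A / X
        ≤ ((1 + 2 * C₂) * δ⁻¹ ^ 3) ^ K * (4 * δ⁻¹ ^ 3) ^ A / X := by gcongr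
      _ = ((1 + 2 * C₂) ^ K * 4 ^ A) * (δ⁻¹ ^ (3 * K + 3 * A) / X) := by
          rw [mul_pow, mul_pow, ← pow_mul, ← pow_mul, pow_add]
          ring
      _ ≤ C * (δ⁻¹ ^ (3 * K + 3 * A) / X) := by
          gcongr
          linarith
  · have : 1 ≤ δ⁻¹ ^ 3 := one_le_pow₀ hδ'
    linarith
  · intro n hn
    have := mem_mainIndices.1 hn
    exact ⟨this.1, by linarith [this.2.1]⟩
  · intro r
    simp only [hn]
    calc ∑ n ∈ mainIndices δ with squarefreePart n = r, 2 * (‖voronoiCoeff δ n‖ / deviation δ)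
        = 2 * ((∑ n ∈ mainIndices δ with squarefreePart n = r, ‖voronoiCoeff δ n‖) *
            (deviation δ)⁻¹) := by
          rw [sum_mul, mul_sum]
          rfl
      _ ≤ 2 * ((C₁ * δ ^ (3 / 4 : ℝ)) * δ ^ (-1 / 2 : ℝ)) := by
          gcongr
          exact h1 δ r hδ
      _ = 2 * C₁ * δ ^ (1 / 4 : ℝ) := by
          rw [mul_assoc, ← rpow_add hδ]
          norm_num
          ring
      _ ≤ C * δ ^ (1 / 4 : ℝ) := by
          gcongr
          have : 0 ≤ (1 + 2 * C₂) ^ K * 4 ^ A := by positivity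
          linarith

lemma exists_integral_abs_sub_le : ∃ C, 0 ≤ C ∧ ∀ X δ : ℝ, 1 ≤ X → 0 < δ → δ ≤ 1 →
    δ⁻¹ ^ 3 ≤ X ^ (7 / 4 : ℝ) → X ^ (-9 / 16 : ℝ) ≤ δ → ∀ t s : ℝ, 0 < s →
    ‖(∫ x, cexp ((t * ((divisorError ((x + δ) ^ 2) - divisorError (x ^ 2)) / √x / s) : ℝ) *
        I) ∂timeMeasure X) -
      ∫ x, cexp ((t * (rootSum (mainIndices δ) (voronoiCoeff δ) x / s) : ℝ) * I) ∂timeMeasure X‖ ≤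
      |t| / s * (C * X ^ (-1 / 32 : ℝ) + √(C * (δ ^ (9 / 8 : ℝ) +
        X ^ (-9 / 8 : ℝ) * δ⁻¹ ^ 3 * ∑ n ∈ mainIndices δ, ‖voronoiCoeff δ n‖ ^ 2))) := by
  obtain ⟨C₁, hC₁, h1⟩ := exists_abs_divisorError_sub_le
  obtain ⟨C₂, hC₂, h2⟩ := exists_integral_sq_dualSum_sub_le
  refine ⟨max C₁ C₂, le_max_of_le_left hC₁, fun X δ hX hδ hδ1 hXδ hXδ' t s hs => ?_⟩
  have hX0 : 0 < X := by linarith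
  have := isProbabilityMeasure_timeMeasure hX0
  set N := Icc 1 ⌊X ^ (7 / 4 : ℝ)⌋₊
  set u := X ^ (-9 / 16 : ℝ)
  set F : ℝ → ℝ := fun x => (divisorError ((x + δ) ^ 2) - divisorError (x ^ 2)) / √x with hF
  set S : ℝ → ℝ := rootSum (mainIndices δ) (voronoiCoeff δ) with hS
  set D : ℝ → ℝ := rootSum N (fun n => voronoiCoeff δ n * mollifierHat (u * (2 * √n))) with hD
  have hDc : Continuous D := continuous_rootSum _ _
  have hSc : Continuous S := continuous_rootSum _ _
  obtain ⟨BD, hBD⟩ : ∃ B, ∀ x, |D x| ≤ B := ⟨_, abs_rootSum_le _ _⟩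
  obtain ⟨BS, hBS⟩ : ∃ B, ∀ x, |S x| ≤ B := ⟨_, abs_rootSum_le _ _⟩
  have hDS : ∀ x, |D x - S x| ≤ BD + BS := fun x => (abs_sub _ _).trans (add_le_add (hBD x) (hBS x))
  have hi : Integrable (fun x => D x - S x) (timeMeasure X) :=
    integrable_of_continuous_of_bound (by fun_prop) (BD + BS) hDS
  have hi2 : Integrable (fun x => (D x - S x) ^ 2) (timeMeasure X) := by
    refine integrable_of_continuous_of_bound (by fun_prop) ((BD + BS) ^ 2) fun x => ?_
    rw [norm_eq_abs, abs_pow]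
    exact pow_le_pow_left₀ (abs_nonneg _) (hDS x) 2
  have hFm : Measurable F := (measurable_divisorError_sub δ).div (by fun_prop)
  have hexp : ∀ f : ℝ → ℝ, Measurable f →
      Integrable (fun x => cexp ((t * (f x / s) : ℝ) * I)) (timeMeasure X) := by
    intro f hf
    refine Integrable.of_bound (C := 1) (Measurable.aestronglyMeasurable (by fun_prop))
      (.of_forall fun x => ?_)
    rw [norm_exp_ofReal_mul_I]
  have hae : ∀ᵐ x ∂timeMeasure X, x ∈ Set.Ioc X (2 * X) :=
    Measure.ae_smul_measure (ae_restrict_mem measurableSet_Ioc) _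
  have hlip : ∀ a b : ℝ, ‖cexp ((a : ℂ) * I) - cexp ((b : ℂ) * I)‖ ≤
      |a - b| := by
    intro a b
    have e : cexp ((a : ℂ) * I) - cexp ((b : ℂ) * I) =
        cexp ((b : ℂ) * I) * (cexp (I * ((a - b : ℝ) : ℂ)) - 1) := by
      rw [mul_sub, mul_one, ← Complex.exp_add]
      push_cast
      ring_nf
    rw [e, norm_mul, norm_exp_ofReal_mul_I, one_mul]
    exact norm_exp_I_mul_ofReal_sub_one_le
  rw [← integral_sub (hexp F hFm) (hexp S hSc.measurable)]
  have hgi : Integrable (fun x => |t| / s * (C₁ * X ^ (-1 / 32 : ℝ) + |D x - S x|))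
      (timeMeasure X) := by
    have : Integrable (fun x => C₁ * X ^ (-1 / 32 : ℝ) + |D x - S x|) (timeMeasure X) :=
      (integrable_const _).add hi.abs
    exact this.const_mul _
  refine (norm_integral_le_of_norm_le hgi ?_).trans ?_
  · filter_upwards [hae] with x hx
    refine (hlip _ _).trans ?_
    have h3 := h1 X δ x hX hXδ' hδ1 ⟨hx.1.le, hx.2⟩
    have e : t * (F x / s) - t * (S x / s) = t / s * (F x - S x) := by ring
    rw [e, abs_mul, abs_div, abs_of_pos hs]
    gcongr
    exact (abs_sub_le _ (D x) _).trans (by gcongr; exact h3)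
  · rw [integral_const_mul, integral_add (integrable_const _) hi.abs]
    simp only [integral_const, probReal_univ, one_smul]
    gcongr
    · exact le_max_left _ _
    · refine integral_abs_le_sqrt hi hi2 ((h2 X δ hX hδ hδ1 hXδ).trans ?_)
      gcongr
      exact le_max_right _ _

section

variable {δ : ℝ → ℝ}

lemma tendsto_integral_cexp_rootSum (hδpos : ∀ X, 0 < δ X) (hδ : Tendsto δ atTop (𝓝 0))
    (hδX : Tendsto (fun X => log (1 / δ X) / log X) atTop (𝓝 0)) (t : ℝ) :
    Tendsto (fun X => ∫ x, cexp ((t * (rootSum (mainIndices (δ X)) (voronoiCoeff (δ X)) x /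
      deviation (δ X)) : ℝ) * I) ∂timeMeasure X) atTop
      (𝓝 (cexp (-(t ^ 2 / 2) : ℝ))) := by
  have hδ0 : Tendsto δ atTop (𝓝[>] 0) := tendsto_nhdsWithin_iff.2 ⟨hδ, .of_forall hδpos⟩
  set V : ℝ → ℝ := fun X =>
    ∑ n ∈ mainIndices (δ X), 2 * (‖voronoiCoeff (δ X) n‖ / deviation (δ X)) ^ 2 with hV
  have hV1 : Tendsto V atTop (𝓝 1) := tendsto_variance_mainIndices.comp hδ0
  have hg : Tendsto (fun X => cexp (-(t ^ 2 * V X / 2) : ℝ)) atTop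
      (𝓝 (cexp (-(t ^ 2 / 2) : ℝ))) := by
    have hc : Continuous fun v => cexp (-(t ^ 2 * v / 2) : ℝ) := by fun_prop
    have := (hc.tendsto 1).comp hV1
    rwa [mul_one] at this
  refine (tendsto_iff_of_dist ?_).2 hg
  rw [Metric.tendsto_nhds]
  intro ε hε
  obtain ⟨K, hK, hKε⟩ : ∃ K : ℕ, Even K ∧ 4 * ((2 : ℝ)⁻¹ ^ K * rexp (4 * t ^ 2 * 1)) < ε := by
    have h1 : Tendsto (fun k : ℕ => 4 * ((2 : ℝ)⁻¹ ^ (2 * k) * rexp (4 * t ^ 2 * 1))) atTop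
        (𝓝 (4 * (0 * rexp (4 * t ^ 2 * 1)))) := by
      have h2 : Tendsto (fun k : ℕ => (2 : ℝ)⁻¹ ^ (2 * k)) atTop (𝓝 0) :=
        (tendsto_pow_atTop_nhds_zero_of_lt_one (by norm_num) (by norm_num)).comp
          (tendsto_id.const_mul_atTop' two_pos)
      exact (h2.mul_const _).const_mul _
    rw [zero_mul, mul_zero] at h1
    obtain ⟨k, hk⟩ := (h1.eventually_lt_const hε).exists
    exact ⟨2 * k, even_two_mul k, hk⟩
  obtain ⟨A, C, hC, h⟩ := exists_norm_charFun_mainIndices_sub_le hK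
  have ha : Tendsto (fun X => C * δ X ^ (1 / 4 : ℝ)) atTop (𝓝 0) := by
    simpa using (tendsto_rpow_comp_zero hδ (s := 1 / 4) (by norm_num)).const_mul C
  have hb : Tendsto (fun X => (δ X)⁻¹ ^ A / X) atTop (𝓝 0) := by
    refine (tendsto_inv_pow_mul_rpow hδpos hδX A one_pos).congr fun X => ?_
    rw [rpow_neg_one, div_eq_mul_inv]
  have hbound : Tendsto (fun X => C * ((δ X)⁻¹ ^ A / X) * rexp |t| +
      4 * (2⁻¹ ^ K * rexp (4 * t ^ 2 * V X)) +
      (|t| * (C * δ X ^ (1 / 4 : ℝ)) + (|t| * (C * δ X ^ (1 / 4 : ℝ))) ^ 2) * (t ^ 2 * V X)) atTop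
      (𝓝 (C * 0 * rexp |t| + 4 * (2⁻¹ ^ K * rexp (4 * t ^ 2 * 1)) +
        (|t| * 0 + (|t| * 0) ^ 2) * (t ^ 2 * 1))) := by
    refine (((hb.const_mul C).mul_const _).add ?_).add
      (((ha.const_mul _).add ((ha.const_mul _).pow 2)).mul (hV1.const_mul _))
    exact (((continuous_exp.tendsto _).comp (hV1.const_mul _)).const_mul _).const_mul _
  have hlt := hbound.eventually_lt_const (u := ε) (by simpa using hKε)
  have hsmall := (ha.const_mul (2 * |t|)).eventually_le_const (u := 1) (by simp)
  filter_upwards [hlt, hsmall, hδ0.eventually eventually_le_exp_neg_one, eventually_gt_atTop 0]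
    with X h1 h2 h3 hX
  rw [dist_eq, sub_zero, abs_of_nonneg dist_nonneg, dist_eq_norm, ofReal_neg]
  exact (h X (δ X) t _ rfl hX h3.1 h3.2 h2).trans_lt h1

lemma tendsto_integral_cexp_divisorError (hδpos : ∀ X, 0 < δ X) (hδ : Tendsto δ atTop (𝓝 0))
    (hδX : Tendsto (fun X => log (1 / δ X) / log X) atTop (𝓝 0)) (t : ℝ) :
    Tendsto (fun X => ∫ x, cexp ((t * ((divisorError ((x + δ X) ^ 2) -
      divisorError (x ^ 2)) / √x / deviation (δ X)) : ℝ) * I) ∂timeMeasure X) atTop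
      (𝓝 (cexp (-(t ^ 2 / 2) : ℝ))) := by
  have hδ0 : Tendsto δ atTop (𝓝[>] 0) := tendsto_nhdsWithin_iff.2 ⟨hδ, .of_forall hδpos⟩
  set V : ℝ → ℝ := fun X =>
    ∑ n ∈ mainIndices (δ X), 2 * (‖voronoiCoeff (δ X) n‖ / deviation (δ X)) ^ 2 with hV
  have hV1 : Tendsto V atTop (𝓝 1) := tendsto_variance_mainIndices.comp hδ0
  refine (tendsto_iff_of_dist ?_).2 (tendsto_integral_cexp_rootSum hδpos hδ hδX t)
  obtain ⟨C, hC, h⟩ := exists_integral_abs_sub_le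
  have hb : Tendsto (fun X => |t| * (C * ((δ X)⁻¹ ^ 1 * X ^ (-(1 / 32) : ℝ)) +
      √(C * (δ X ^ (1 / 8 : ℝ) + (δ X)⁻¹ ^ 3 * X ^ (-(9 / 8) : ℝ) * (V X / 2))))) atTop
      (𝓝 (|t| * (C * 0 + √(C * (0 + 0 * (1 / 2)))))) := by
    have h1 := tendsto_inv_pow_mul_rpow hδpos hδX 1 (s := 1 / 32) (by norm_num)
    have h2 := tendsto_inv_pow_mul_rpow hδpos hδX 3 (s := 9 / 8) (by norm_num)
    have h3 := tendsto_rpow_comp_zero hδ (s := 1 / 8) (by norm_num)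
    exact ((h1.const_mul C).add ((h3.add (h2.mul (hV1.div_const 2))).const_mul C).sqrt).const_mul _
  simp only [mul_zero, zero_mul, add_zero, sqrt_zero] at hb
  have e1 := (tendsto_inv_pow_mul_rpow hδpos hδX 3 (s := 7 / 4) (by norm_num)).eventually_le_const
    one_pos
  have e2 := (tendsto_inv_pow_mul_rpow hδpos hδX 1 (s := 9 / 16) (by norm_num)).eventually_le_const
    one_pos
  refine squeeze_zero' (.of_forall fun _ => dist_nonneg) ?_ hb
  filter_upwards [e1, e2, hδ0.eventually eventually_le_exp_neg_one, eventually_ge_atTop 1]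
    with X h1 h2 h3 hX
  have hX0 : 0 < X := by linarith
  obtain ⟨hd, hd1⟩ := h3
  have hσ := deviation_pos hd hd1
  have hd2 : δ X ≤ 1 := hd1.trans (exp_le_one_iff.2 (by norm_num))
  have h1' : (δ X)⁻¹ ^ 3 ≤ X ^ (7 / 4 : ℝ) := by
    rwa [rpow_neg hX0.le, ← div_eq_mul_inv, div_le_one (by positivity)] at h1
  have h2' : X ^ (-9 / 16 : ℝ) ≤ δ X := by
    rwa [pow_one, mul_comm, ← div_eq_mul_inv, div_le_one hd, ← neg_div] at h2
  have key := h X (δ X) hX hd hd2 h1' h2' t (deviation (δ X)) hσ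
  rw [dist_eq_norm]
  refine key.trans ?_
  have hq : √(C * (δ X ^ (9 / 8 : ℝ) + X ^ (-9 / 8 : ℝ) * (δ X)⁻¹ ^ 3 *
      ∑ n ∈ mainIndices (δ X), ‖voronoiCoeff (δ X) n‖ ^ 2)) / deviation (δ X) ≤
      √(C * (δ X ^ (1 / 8 : ℝ) + (δ X)⁻¹ ^ 3 * X ^ (-(9 / 8) : ℝ) * (V X / 2))) := by
    nth_rewrite 1 [← sqrt_sq hσ.le]
    rw [← sqrt_div (by positivity)]
    refine sqrt_le_sqrt ?_
    have eV : V X / 2 = (∑ n ∈ mainIndices (δ X), ‖voronoiCoeff (δ X) n‖ ^ 2) /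
        deviation (δ X) ^ 2 := by
      simp only [hV, div_pow, sum_div]
      exact sum_congr rfl fun n _ => by ring
    have e3 : δ X ^ (9 / 8 : ℝ) / deviation (δ X) ^ 2 ≤ δ X ^ (1 / 8 : ℝ) := by
      rw [div_le_iff₀ (by positivity)]
      calc δ X ^ (9 / 8 : ℝ) = δ X ^ (1 / 8 : ℝ) * δ X := by
            rw [← rpow_add_one hd.ne']
            norm_num
        _ ≤ _ := by
            gcongr
            exact le_deviation_sq hd hd1
    rw [eV, mul_div_assoc, add_div, neg_div]
    gcongr
    apply le_of_eq
    ring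
  have hp : C * X ^ (-1 / 32 : ℝ) / deviation (δ X) ≤ C * ((δ X)⁻¹ ^ 1 * X ^ (-(1 / 32) : ℝ)) := by
    have : (deviation (δ X))⁻¹ ≤ (δ X)⁻¹ :=
      inv_anti₀ hd ((le_sqrt_of_sq_le (by nlinarith)).trans (sqrt_le_deviation hd hd1))
    rw [div_eq_mul_inv, pow_one, mul_assoc, neg_div, mul_comm (δ X)⁻¹]
    gcongr
  rw [div_mul_eq_mul_div, mul_div_assoc, add_div]
  gcongr

end

lemma toReal_timeMeasure_preimage {X : ℝ} (hX : 0 < X) (p : ℝ → Prop) :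
    (timeMeasure X {x | p x}).toReal = (volume {x | x ∈ Set.Icc X (2 * X) ∧ p x}).toReal / X := by
  have h : (volume.restrict (Set.Ioc X (2 * X))) {x | p x} =
      volume {x | x ∈ Set.Icc X (2 * X) ∧ p x} := by
    rw [restrict_Ioc_eq_restrict_Icc, Measure.restrict_apply' measurableSet_Icc, Set.inter_comm]
    rfl
  rw [timeMeasure, Measure.smul_apply, h, smul_eq_mul, ENNReal.toReal_mul,
    ENNReal.toReal_ofReal (by positivity)]
  ring

theorem tendsto_toReal_volume_div {δ : ℝ → ℝ} (hδpos : ∀ X, 0 < δ X) (hδ : Tendsto δ atTop (𝓝 0))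
    (hδX : Tendsto (fun X => log (1 / δ X) / log X) atTop (𝓝 0)) {α β : ℝ}
    (h : α < β) :
    Tendsto (fun X => (volume {x : ℝ | x ∈ Set.Icc X (2 * X) ∧
        (divisorError ((x + δ X) ^ 2) - divisorError (x ^ 2)) / (√x * deviation (δ X)) ∈
          Set.Ioc α β}).toReal / X) atTop
      (𝓝 ((1 / √(2 * π)) * ∫ t in α..β, rexp (-t ^ 2 / 2))) := by
  refine tendsto_of_seq_tendsto fun u hu => ?_
  set G : ℝ → ℝ → ℝ := fun X x =>
    (divisorError ((x + δ X) ^ 2) - divisorError (x ^ 2)) / √x / deviation (δ X) with hG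
  have hGm : ∀ X, Measurable (G X) := fun X =>
    ((measurable_divisorError_sub (δ X)).div (by fun_prop)).div_const _
  let w : ℕ → ℝ := fun n => max (u n) 1
  have hw0 : ∀ n, 0 < w n := fun n => zero_lt_one.trans_le (le_max_right _ _)
  have hw : w =ᶠ[atTop] u := by
    filter_upwards [hu.eventually_ge_atTop 1] with n hn
    exact max_eq_left hn
  have hwt : Tendsto w atTop atTop := hu.congr' hw.symm
  let P : ℕ → ProbabilityMeasure ℝ := fun n => ⟨(timeMeasure (w n)).map (G (w n)),
    have := isProbabilityMeasure_timeMeasure (hw0 n)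
    Measure.isProbabilityMeasure_map (hGm _).aemeasurable⟩
  have hP : ∀ t : ℝ, Tendsto (fun n => charFun (P n : Measure ℝ) t) atTop
      (𝓝 (cexp (-(t ^ 2 / 2) : ℝ))) := by
    intro t
    refine ((tendsto_integral_cexp_divisorError hδpos hδ hδX t).comp hwt).congr fun n => ?_
    change _ = charFun ((timeMeasure (w n)).map (G (w n))) t
    rw [charFun_apply_real, integral_map (hGm _).aemeasurable
      (Measurable.aestronglyMeasurable (by fun_prop))]
    simp only [Function.comp_apply, hG]
    push_cast
    rfl
  refine (tendsto_measure_Ioc_of_tendsto_charFun hP h).congr' ?_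
  filter_upwards [hw] with n hn
  change ((timeMeasure (w n)).map (G (w n)) (Set.Ioc α β)).toReal = _
  rw [Measure.map_apply (hGm _) measurableSet_Ioc, Function.comp_apply, ← hn]
  simp only [← div_div]
  exact toReal_timeMeasure_preimage (hw0 n) fun x => G (w n) x ∈ Set.Ioc α β

end

end

end DivisorCLT

/-- Central limit theorem for the divisor function in short intervals
(`m = 2` unconditional case of the main theorem, `λ(n) = τ(n)`). -/
theorem divisor_clt_short_intervals
    (δ : ℝ → ℝ) (hδpos : ∀ X, 0 < δ X)
    (hδ : Tendsto δ atTop (𝓝 0))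
    (hδX : Tendsto (fun X : ℝ => Real.log (1 / δ X) / Real.log X) atTop (𝓝 0)) :
    ∀ α β : ℝ, α < β →
      Tendsto
        (fun X : ℝ =>
          (volume {x : ℝ | x ∈ Set.Icc X (2 * X) ∧
              (divisorError ((x + δ X) ^ 2) - divisorError (x ^ 2)) /
                (Real.sqrt x *
                  Real.sqrt ((16 / π ^ 2) * δ X * (Real.log (1 / δ X)) ^ 3))
                ∈ Set.Ioc α β}).toReal / X)
        atTop
        (𝓝 ((1 / Real.sqrt (2 * π)) * ∫ t in α..β, Real.exp (-t ^ 2 / 2))) := by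
  intro α β hαβ
  exact DivisorCLT.tendsto_toReal_volume_div hδpos hδ hδX hαβ
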